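/- (Proposition 2) Let p∈(1,+∞], let I⊆{1,…,d} be nonempty, and suppose Assumptions (N1)-(N2) hold for the noise density q. For each r ≥ 1 there exist constants γ_{p,I}(r) > 0 and c_p(r) > 0, not depending on the sample size n, such that for every integer n ≥ 3: { E sup_{h_I∈H_{p,I}} [ ‖ξ_{h_I}‖_p − γ_{p,I}(r)·U_p(h_I) ]_+^r }^{1/r} ≤ c_p(r)·n^{-1/2}, where ξ_{h_I}(x_I) := f̃_{h_I}(x_I) − E{f̃_{h_I}(x_I)} is the stochastic error of the kernel deconvolution estimator. -/

import Mathlib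

open MeasureTheory ENNReal Filter Finset
open scoped ENNReal Topology

noncomputable section

namespace Deconv

/-- Euclidean inner product on a finite coordinate space. -/
def dotp {ι : Type} [Fintype ι] (t x : ι → ℝ) : ℝ := ∑ j, t j * x j

/-- Fourier transform `ĝ(t) = ∫ e^{i⟨t,x⟩} g(x) dx` of a real function. -/
def ftI {ι : Type} [Fintype ι] (g : (ι → ℝ) → ℝ) (t : ι → ℝ) : ℂ :=
  ∫ x : ι → ℝ, Complex.exp (Complex.I * (dotp t x : ℝ)) * (g x : ℂ)

/-- Glue coordinates indexed by `I` with coordinates indexed by `Iᶜ`. -/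
def glue {d : ℕ} (I : Finset (Fin d)) (xI : I → ℝ) (y : ↥(Iᶜ) → ℝ) : Fin d → ℝ :=
  fun i => if h : i ∈ I then xI ⟨i, h⟩ else y ⟨i, Finset.mem_compl.mpr h⟩

/-- Marginal density on the coordinates indexed by `I`. -/
def marginal {d : ℕ} (I : Finset (Fin d)) (g : (Fin d → ℝ) → ℝ) (xI : I → ℝ) : ℝ :=
  ∫ y : ↥(Iᶜ) → ℝ, g (glue I xI y)

/-- A probability density. -/
def IsDensity {ι : Type} [Fintype ι] (g : (ι → ℝ) → ℝ) : Prop :=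
  (∀ x, 0 ≤ g x) ∧ (∫ x, g x) = 1

/-- Product kernel `K_I`. -/
def KI {d : ℕ} (I : Finset (Fin d)) (K : ℝ → ℝ) (xI : I → ℝ) : ℝ := ∏ j : I, K (xI j)

/-- Rescaled product kernel `K_{h_I}`. -/
def Kh {d : ℕ} (I : Finset (Fin d)) (K : ℝ → ℝ) (h : Fin d → ℝ) (xI : I → ℝ) : ℝ :=
  (∏ j ∈ I, h j)⁻¹ * ∏ j : I, K (xI j / h ↑j)

/-- The deconvolution kernel `L_{(h_I)}`. -/
def Lh {d : ℕ} (I : Finset (Fin d)) (K : ℝ → ℝ) (q : (Fin d → ℝ) → ℝ) (h : Fin d → ℝ)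
    (xI : I → ℝ) : ℂ :=
  (((2 * Real.pi) ^ (-(I.card : ℝ)) : ℝ) : ℂ) *
    ∫ t : I → ℝ, Complex.exp (-(Complex.I * (dotp t xI : ℝ))) *
      (ftI (Kh I K h) t / ftI (marginal I q) t)

/-- Convolution of two densities on `ℝ^d`. -/
def conv {d : ℕ} (f g : (Fin d → ℝ) → ℝ) (x : Fin d → ℝ) : ℝ := ∫ y, f (x - y) * g y

/-- Law of the observation vector `Y^{(n)} = (Y_1,…,Y_n)`, `Y_k = X_k + ε_k`:
the `n`-fold product of the measure with density `f ⋆ q`. -/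
def obsMeasure (d n : ℕ) (f q : (Fin d → ℝ) → ℝ) : Measure (Fin n → Fin d → ℝ) :=
  Measure.pi fun _ => volume.withDensity fun x => ENNReal.ofReal (conv f q x)

/-- Kernel deconvolution estimator `f̃_{h_I}` built from the sample `y`. -/
def fHat {d : ℕ} (I : Finset (Fin d)) (K : ℝ → ℝ) (q : (Fin d → ℝ) → ℝ) (h : Fin d → ℝ)
    {n : ℕ} (y : Fin n → Fin d → ℝ) (xI : I → ℝ) : ℂ :=
  (n : ℂ)⁻¹ * ∑ k, Lh I K q h (fun j => xI j - y k ↑j)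

/-- Expectation `E_f f̃_{h_I}(x_I)`. -/
def fHatMean {d : ℕ} (I : Finset (Fin d)) (K : ℝ → ℝ) (f q : (Fin d → ℝ) → ℝ)
    (h : Fin d → ℝ) (xI : I → ℝ) : ℂ :=
  ∫ y : Fin d → ℝ, Lh I K q h (fun j => xI j - y ↑j)
    ∂(volume.withDensity fun x => ENNReal.ofReal (conv f q x))

/-- Stochastic error `ξ_{h_I} = f̃_{h_I} - E_f f̃_{h_I}`. -/
def xiProc {d : ℕ} (I : Finset (Fin d)) (K : ℝ → ℝ) (f q : (Fin d → ℝ) → ℝ) (h : Fin d → ℝ)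
    {n : ℕ} (y : Fin n → Fin d → ℝ) (xI : I → ℝ) : ℂ :=
  fHat I K q h y xI - fHatMean I K f q h xI

/-- `λ_max = max_j λ_j`. -/
def lamMax {d : ℕ} (lam : Fin d → ℝ) : ℝ := sSup (Set.range lam)

/-- `b_p = (1/2) ∧ (1 - 1/p)`  (with the convention `p.toReal = 0` for `p = ∞`). -/
def bp (p : ℝ≥0∞) : ℝ := min (1 / 2) (1 - 1 / p.toReal)

/-- The constant `c_p` of the bandwidth grid. -/
def cpGrid {d : ℕ} (lam : Fin d → ℝ) (p : ℝ≥0∞) : ℝ :=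
  min 1 ((p.toReal / Real.exp 1 * (1 + lamMax lam * max 2 (p.toReal / (p.toReal - 1))))
    ^ (-(p.toReal * (bp p + lamMax lam))))

/-- Minimal bandwidth `h_min^{(p)}`. -/
def hminG (p : ℝ≥0∞) (n : ℕ) (m : ℕ) : ℝ :=
  if p = ⊤ then (n : ℝ)⁻¹ else (n : ℝ) ^ (-(max 1 (p.toReal / m)))

/-- Maximal bandwidth `h_max^{(p)}`. -/
def hmaxG (p : ℝ≥0∞) (n : ℕ) (m : ℕ) : ℝ :=
  if p = ⊤ then 1 else (Real.log n) ^ (-(p.toReal / m))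

/-- Membership in the dyadic bandwidth set `H_{p,I}` (only the coordinates in `I` matter). -/
def memGrid {d : ℕ} (lam : Fin d → ℝ) (p : ℝ≥0∞) (n : ℕ) (I : Finset (Fin d))
    (h : Fin d → ℝ) : Prop :=
  (∀ j ∈ I, ∃ k : ℕ, 1 ≤ k ∧ h j = 2 ^ (-(k : ℝ))) ∧
  (∀ j ∈ I, hminG p n I.card ≤ h j ∧ h j ≤ hmaxG p n I.card) ∧
  ((if p = ⊤ then Real.sqrt (Real.log n) else cpGrid lam p) ≤
    ((n : ℝ) * ∏ j ∈ I, h j) ^ bp p * ∏ j ∈ I, h j ^ lam j)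

/-- The majorant `U_p(h_I)`. -/
def Up {d : ℕ} (K : ℝ → ℝ) (q : (Fin d → ℝ) → ℝ) (lam : Fin d → ℝ) (p : ℝ≥0∞) (n : ℕ)
    (I : Finset (Fin d)) (h : Fin d → ℝ) : ℝ≥0∞ :=
  if p = ⊤ then
    ENNReal.ofReal ((n : ℝ) ^ (-(1 : ℝ) / 2) * Real.sqrt (Real.log n) *
      ∏ j ∈ I, h j ^ (-lam j - 1 / 2))
  else if p = 2 then
    ENNReal.ofReal ((n : ℝ) ^ (-(1 : ℝ) / 2) * ∏ j ∈ I, h j ^ (-lam j - 1 / 2))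
  else if p.toReal < 2 then
    ENNReal.ofReal ((n : ℝ) ^ (1 / p.toReal - 1)) * eLpNorm (Lh I K q h) p volume
  else
    ENNReal.ofReal ((n : ℝ) ^ (-(1 : ℝ) / 2)) *
      (ENNReal.ofReal (∏ j ∈ I, h j ^ (-lam j - 1 / 2)) +
        ENNReal.ofReal (Real.sqrt (Real.log n)) *
          eLpNorm (Lh I K q h) (ENNReal.ofReal (2 * p.toReal / (p.toReal + 2))) volume)

/-- First-order partial derivative in direction `j` of a complex-valued function. -/
def cpd {ι : Type} [Fintype ι] [DecidableEq ι] (j : ι) (φ : (ι → ℝ) → ℂ) (t : ι → ℝ) : ℂ :=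
  fderiv ℝ φ t (Pi.single j 1)

/-- Iterated mixed partial derivative `D^α φ`. -/
def multiPD {ι : Type} [Fintype ι] [DecidableEq ι] (α : ι → ℕ) (φ : (ι → ℝ) → ℂ) :
    (ι → ℝ) → ℂ :=
  (Finset.univ (α := ι)).toList.foldr (fun j ψ => (cpd j)^[α j] ψ) φ

/-- Assumption (N2), case `p = 2`: lower bound on `|q̂_I|`. -/
def N2two {d : ℕ} (I : Finset (Fin d)) (q : (Fin d → ℝ) → ℝ) (A : ℝ) (lam : Fin d → ℝ) :
    Prop :=
  ∀ t : I → ℝ, A⁻¹ * ∏ j : I, (1 + t j ^ 2) ^ (-lam ↑j / 2) ≤ ‖ftI (marginal I q) t‖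

/-- Assumption (N2), case `p ∈ (1,∞) \ {2}`. -/
def N2mid {d : ℕ} (I : Finset (Fin d)) (q : (Fin d → ℝ) → ℝ) (A : ℝ) (lam : Fin d → ℝ) :
    Prop :=
  (∀ t : I → ℝ, ftI (marginal I q) t ≠ 0) ∧
  ContDiff ℝ I.card (fun t : I → ℝ => (ftI (marginal I q) t)⁻¹) ∧
  ∀ α : I → ℕ, (∑ j, α j) ≤ I.card → ∀ t : I → ℝ,
    ‖multiPD α (fun u => (ftI (marginal I q) u)⁻¹) t * ∏ j, (t j : ℂ) ^ α j‖ ≤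
      A * ∏ j : I, (1 + t j ^ 2) ^ (lam ↑j / 2)

/-- Assumption (N2), case `p = ∞`. -/
def N2inf {d : ℕ} (I : Finset (Fin d)) (q : (Fin d → ℝ) → ℝ) (A : ℝ) (lam : Fin d → ℝ) :
    Prop :=
  (∀ t : I → ℝ, ftI (marginal I q) t ≠ 0) ∧
  ContDiff ℝ 1 (fun t : I → ℝ => (ftI (marginal I q) t)⁻¹) ∧
  ∀ k : I, ∀ a : ℕ, a ≤ 1 → ∀ t : I → ℝ,
    ‖(cpd k)^[a] (fun u => (ftI (marginal I q) u)⁻¹) t‖ ≤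
      A * ∏ j : I, (1 + t j ^ 2) ^ (lam ↑j / 2)

/-- Assumptions (N1)-(N2) of the paper, for a given `p` and a given block `I`. -/
def N1N2 {d : ℕ} (p : ℝ≥0∞) (I : Finset (Fin d)) (q : (Fin d → ℝ) → ℝ) (A : ℝ)
    (lam : Fin d → ℝ) : Prop :=
  0 < A ∧ (∀ j, 0 < lam j) ∧
  (p = 2 → Integrable (ftI (marginal I q)) ∧ N2two I q A lam) ∧
  (2 < p → eLpNorm (marginal I q) ⊤ volume < ⊤) ∧
  (p ≠ 2 → p ≠ ⊤ → N2mid I q A lam) ∧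
  (p = ⊤ → N2inf I q A lam)

/-- `K` is a symmetric Schwartz kernel integrating to one. -/
def IsKernel (K : ℝ → ℝ) : Prop :=
  (∃ KS : SchwartzMap ℝ ℝ, ⇑KS = K) ∧ (∀ z, K (-z) = K z) ∧ (∫ z, K z) = 1

/-- `⌊a⌋`, the largest integer strictly smaller than `a` (for `a > 0`). -/
def flr (a : ℝ) : ℕ := ⌈a⌉₊ - 1

/-- Partial derivative in direction `j` of a real function on `ℝ^ι`. -/
def rpd {ι : Type} [Fintype ι] [DecidableEq ι] (j : ι) (g : (ι → ℝ) → ℝ) (x : ι → ℝ) : ℝ :=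
  fderiv ℝ g x (Pi.single j 1)

/-- The anisotropic Nikolskii class `N_{r,s}(β,L)` of probability densities. -/
def Nikolskii {ι : Type} [Fintype ι] [DecidableEq ι] (r : ι → ℝ≥0∞) (β L : ι → ℝ) :
    Set ((ι → ℝ) → ℝ) :=
  {g | IsDensity g ∧
    (∀ j, ∀ k ≤ flr (β j), eLpNorm ((rpd j)^[k] g) (r j) volume ≤ ENNReal.ofReal (L j)) ∧
    (∀ j, ∀ z : ℝ,
      eLpNorm (fun x => (rpd j)^[flr (β j)] g (x + z • (Pi.single j 1 : ι → ℝ)) -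
        (rpd j)^[flr (β j)] g x) (r j) volume ≤
          ENNReal.ofReal (L j * |z| ^ (β j - flr (β j))))}

/-- Partitions of `{1,…,d}`. -/
abbrev Part (d : ℕ) := Finpartition (Finset.univ : Finset (Fin d))

/-- The operation `P ⋄ P'` on partitions. -/
def diamond {d : ℕ} (P P' : Part d) : Finset (Finset (Fin d)) :=
  ((P.parts ×ˢ P'.parts).image fun z => z.1 ∩ z.2).filter fun I => I.Nonempty

/-- The class `N_{r,d}(β,L,P)` taking smoothness and independence structure into account. -/
def NikolskiiP {d : ℕ} (𝔓 : Set (Part d)) (r : Fin d → ℝ≥0∞) (β L : Fin d → ℝ) (P : Part d) :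
    Set ((Fin d → ℝ) → ℝ) :=
  {g | IsDensity g ∧ (∀ x, g x = ∏ I ∈ P.parts, marginal I g fun j => x ↑j) ∧
    ∀ P' ∈ 𝔓, ∀ P'' ∈ 𝔓, ∀ I ∈ diamond P' P'',
      marginal I g ∈
        Nikolskii (fun j : I => r ↑j) (fun j : I => β ↑j) (fun j : I => L ↑j)}

/-- The set of partitions encoding an independence structure of `f`. -/
def structSet {d : ℕ} (𝔓 : Set (Part d)) (f : (Fin d → ℝ) → ℝ) : Set (Part d) :=
  {P ∈ 𝔓 | ∀ x, f x = ∏ I ∈ P.parts, marginal I f fun j => x ↑j}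

/-- The set `H_p[𝔓]` of admissible pairs `(h,P)`. -/
def HpSet {d : ℕ} (lam : Fin d → ℝ) (p : ℝ≥0∞) (n : ℕ) (𝔓 : Set (Part d)) :
    Set ((Fin d → ℝ) × Part d) :=
  {hP | hP.2 ∈ 𝔓 ∧ ∀ I ∈ hP.2.parts, memGrid lam p n I hP.1}

/-- The product estimator `f̃_{(h,P)}`. -/
def fHatProd {d : ℕ} (K : ℝ → ℝ) (q : (Fin d → ℝ) → ℝ) {n : ℕ}
    (hP : (Fin d → ℝ) × Part d) (y : Fin n → Fin d → ℝ) (x : Fin d → ℝ) : ℂ :=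
  ∏ I ∈ hP.2.parts, fHat I K q hP.1 y fun j => x ↑j

/-- Smoothed estimator `f̃_{h_I,η_I} = K_{η_I} ⋆ f̃_{h_I}`. -/
def fHatConv {d : ℕ} (K : ℝ → ℝ) (q : (Fin d → ℝ) → ℝ) (I : Finset (Fin d))
    (h η : Fin d → ℝ) {n : ℕ} (y : Fin n → Fin d → ℝ) (xI : I → ℝ) : ℂ :=
  ∫ u : I → ℝ, ((Kh I K η u : ℝ) : ℂ) * fHat I K q h y fun j => xI j - u j

/-- Auxiliary estimator `f̃_{(h,P),(η,P')}`. -/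
def fHatProdAux {d : ℕ} (K : ℝ → ℝ) (q : (Fin d → ℝ) → ℝ) {n : ℕ}
    (hP ηP' : (Fin d → ℝ) × Part d) (y : Fin n → Fin d → ℝ) (x : Fin d → ℝ) : ℂ :=
  ∏ I ∈ diamond hP.2 ηP'.2, fHatConv K q I hP.1 ηP'.1 y fun j => x ↑j

/-- `𝔡 = sup_{P ∈ 𝔓} |P|`. -/
def Dd {d : ℕ} (𝔓 : Set (Part d)) : ℕ := sSup ((fun P : Part d => P.parts.card) '' 𝔓)

/-- The random quantity `Ḡ_p`. -/
def Gbar {d : ℕ} (K : ℝ → ℝ) (q : (Fin d → ℝ) → ℝ) (lam : Fin d → ℝ) (p : ℝ≥0∞)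
    (𝔓 : Set (Part d)) {n : ℕ} (y : Fin n → Fin d → ℝ) : ℝ≥0∞ :=
  max 1 (ENNReal.ofReal ((∫ z, |K z|) ^ d) *
    ⨆ hP ∈ HpSet lam p n 𝔓, ⨆ P' ∈ 𝔓, ⨆ I ∈ diamond hP.2 P',
      eLpNorm (fHat I K q hP.1 y) p volume)

/-- The random threshold `Λ_p = 𝔡 γ_p Ḡ_p^{𝔡(𝔡-1)}`. -/
def LamThr {d : ℕ} (K : ℝ → ℝ) (q : (Fin d → ℝ) → ℝ) (lam : Fin d → ℝ) (p : ℝ≥0∞)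
    (𝔓 : Set (Part d)) (γp : ℝ≥0∞) {n : ℕ} (y : Fin n → Fin d → ℝ) : ℝ≥0∞ :=
  (Dd 𝔓 : ℝ≥0∞) * γp * Gbar K q lam p 𝔓 y ^ (Dd 𝔓 * (Dd 𝔓 - 1))

/-- `U_p(h,P) = sup_{I ∈ P} U_p(h_I)`. -/
def UpPart {d : ℕ} (K : ℝ → ℝ) (q : (Fin d → ℝ) → ℝ) (lam : Fin d → ℝ) (p : ℝ≥0∞) (n : ℕ)
    (hP : (Fin d → ℝ) × Part d) : ℝ≥0∞ :=
  ⨆ I ∈ hP.2.parts, Up K q lam p n I hP.1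

/-- The quantity `Δ̃_p(h,P)` of the selection rule. -/
def DeltaT {d : ℕ} (K : ℝ → ℝ) (q : (Fin d → ℝ) → ℝ) (lam : Fin d → ℝ) (p : ℝ≥0∞)
    (𝔓 : Set (Part d)) (γp : ℝ≥0∞) {n : ℕ} (y : Fin n → Fin d → ℝ)
    (hP : (Fin d → ℝ) × Part d) : ℝ≥0∞ :=
  ⨆ ηP' ∈ HpSet lam p n 𝔓,
    (eLpNorm (fun x => fHatProdAux K q hP ηP' y x - fHatProd K q ηP' y x) p volume -
      LamThr K q lam p 𝔓 γp y * UpPart K q lam p n ηP')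

/-- The selection criterion. -/
def crit {d : ℕ} (K : ℝ → ℝ) (q : (Fin d → ℝ) → ℝ) (lam : Fin d → ℝ) (p : ℝ≥0∞)
    (𝔓 : Set (Part d)) (γp : ℝ≥0∞) {n : ℕ} (y : Fin n → Fin d → ℝ)
    (hP : (Fin d → ℝ) × Part d) : ℝ≥0∞ :=
  DeltaT K q lam p 𝔓 γp y hP + LamThr K q lam p 𝔓 γp y * UpPart K q lam p n hP

/-- `(h̃,P̃)` obeys the data-driven selection rule. -/
def IsSelection {d : ℕ} (K : ℝ → ℝ) (q : (Fin d → ℝ) → ℝ) (lam : Fin d → ℝ) (p : ℝ≥0∞)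
    (𝔓 : Set (Part d)) (γp : ℝ≥0∞) {n : ℕ}
    (sel : (Fin n → Fin d → ℝ) → (Fin d → ℝ) × Part d) : Prop :=
  ∀ y, sel y ∈ HpSet lam p n 𝔓 ∧
    crit K q lam p 𝔓 γp y (sel y) = ⨅ hP ∈ HpSet lam p n 𝔓, crit K q lam p 𝔓 γp y hP

/-- `L_p`-risk of the selected estimator `f̃ = f̃_{(h̃,P̃)}` (`E_f ‖f̃ - f‖_∞` for `p = ∞`). -/
def riskSel {d : ℕ} (K : ℝ → ℝ) (q : (Fin d → ℝ) → ℝ) (p : ℝ≥0∞) {n : ℕ}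
    (sel : (Fin n → Fin d → ℝ) → (Fin d → ℝ) × Part d) (f : (Fin d → ℝ) → ℝ) : ℝ≥0∞ :=
  if p = ⊤ then
    ∫⁻ y, eLpNorm (fun x => fHatProd K q (sel y) y x - (f x : ℂ)) ⊤ volume
      ∂obsMeasure d n f q
  else
    (∫⁻ y, eLpNorm (fun x => fHatProd K q (sel y) y x - (f x : ℂ)) p volume ^ p.toReal
      ∂obsMeasure d n f q) ^ (1 / p.toReal)

/-- The oracle risk `R_p[(h,P),f]`. -/
def riskOracle {d : ℕ} (K : ℝ → ℝ) (q : (Fin d → ℝ) → ℝ) (p : ℝ≥0∞) (𝔓 : Set (Part d))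
    (n : ℕ) (hP : (Fin d → ℝ) × Part d) (f : (Fin d → ℝ) → ℝ) : ℝ≥0∞ :=
  if p = ⊤ then
    ∫⁻ y, (⨆ P' ∈ 𝔓, ⨆ I ∈ diamond hP.2 P',
      eLpNorm (fun xI => fHat I K q hP.1 y xI - (marginal I f xI : ℂ)) ⊤ volume)
      ∂obsMeasure d n f q
  else
    (∫⁻ y, (⨆ P' ∈ 𝔓, ⨆ I ∈ diamond hP.2 P',
      eLpNorm (fun xI => fHat I K q hP.1 y xI - (marginal I f xI : ℂ)) p volume) ^ p.toReal
      ∂obsMeasure d n f q) ^ (1 / p.toReal)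

/-- `f_p = 1 ∨ sup_{P,P' ∈ 𝔓} sup_{I ∈ P⋄P'} ‖f_I‖_p` (as an extended real). -/
def fpE {d : ℕ} (p : ℝ≥0∞) (𝔓 : Set (Part d)) (f : (Fin d → ℝ) → ℝ) : ℝ≥0∞ :=
  max 1 (⨆ P ∈ 𝔓, ⨆ P' ∈ 𝔓, ⨆ I ∈ diamond P P', eLpNorm (marginal I f) p volume)

local notation:max "cE" t:max x:max => Complex.exp (-(Complex.I * (dotp t x : ℝ)))
abbrev eFT (κ : SchwartzMap ℝ ℂ) (K : ℝ → ℝ) : Prop := ∀ s : ℝ, κ s = ∫ x, Complex.exp (Complex.I * ((s * x : ℝ) : ℂ)) * (K x : ℂ)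
local notation "oR" => ENNReal.ofReal
local notation "pP" => (by positivity)
local notation "pL" => (by linarith)
local notation "pN" => (by norm_num)
local notation "pS" => (by simp)
local notation "pF" => (by fun_prop)
local notation:max "Vd" d:max => (Fin d → ℝ)

section

theorem lemA {𝒴 : Type} [MeasurableSpace 𝒴] (P : Measure 𝒴) [IsProbabilityMeasure P] (n : ℕ)
    (b : ℝ) (hb : 0 ≤ b)
    (Ψ : ∀ m : ℕ, (Fin m → 𝒴) → ℝ) (F : ∀ m : ℕ, (Fin m → 𝒴) → 𝒴 → ℝ)
    (hFm : ∀ m, Measurable (fun z : (Fin m → 𝒴) × 𝒴 => F m z.1 z.2))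
    (hFb : ∀ m, ∃ C, ∀ y y0, |F m y y0| ≤ C)
    (hsum : ∀ m y, Ψ m y = ∑ i, F m y (y i))
    (hmean : ∀ m y, ∫ y0, F m y y0 ∂P = 0)
    (hΔ : ∀ m < n, ∀ y : Fin m → 𝒴, ∀ i : Fin (m + 1),
      ∫ y0, |F (m + 1) (i.insertNth y0 y) y0 - F m y y0| ∂P ≤ (b + Ψ m y) / (2 * n)) :
    ∀ m ≤ n, ∫ y, Ψ m y ∂(Measure.pi fun _ : Fin m => P) ≤ b := by
  have hΨm : ∀ m, Measurable (Ψ m) := by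
    intro m
    have : Ψ m = fun y => ∑ i, F m y (y i) := funext (hsum m)
    rw [this]
    refine Finset.measurable_sum _ fun i _ => ?_
    exact (hFm m).comp (measurable_id.prodMk (measurable_pi_apply i))
  have hΨb : ∀ m, ∃ C, ∀ y, |Ψ m y| ≤ C := by
    intro m
    obtain ⟨C, hC⟩ := hFb m
    refine ⟨∑ i : Fin m, C, fun y => ?_⟩
    rw [hsum]
    exact (Finset.abs_sum_le_sum_abs _ _).trans (Finset.sum_le_sum fun i _ => hC _ _)
  have hΨi : ∀ m, Integrable (Ψ m) (Measure.pi fun _ : Fin m => P) := by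
    intro m
    obtain ⟨C, hC⟩ := hΨb m
    exact Integrable.of_bound (hΨm m).aestronglyMeasurable C (ae_of_all _ fun y => hC y)
  intro m
  induction m with
  | zero =>
    intro _
    have : Ψ 0 = fun _ => 0 := by funext y; rw [hsum]; simp
    rw [this]; simpa using hb
  | succ m ih =>
    intro hm
    have ih' := ih (by omega)
    have hn : (0 : ℝ) < n := by exact_mod_cast (by omega : 0 < n)
    have hterm : ∀ i : Fin (m + 1), ∫ y, F (m + 1) y (y i) ∂(Measure.pi fun _ : Fin (m+1) => P)
        ≤ b / n := by
      intro i
      have mp := (measurePreserving_piFinSuccAbove (fun _ : Fin (m+1) => P) i).symm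
      rw [← mp.integral_comp (MeasurableEquiv.measurableEmbedding _)]
      have hm1 : Measurable (fun z : 𝒴 × (Fin m → 𝒴) =>
          F (m+1) ((MeasurableEquiv.piFinSuccAbove (fun _ => 𝒴) i).symm z) z.1) :=
        (hFm (m+1)).comp ((MeasurableEquiv.measurable _).prodMk measurable_fst)
      have hm2 : Measurable (fun z : 𝒴 × (Fin m → 𝒴) => F m z.2 z.1) :=
        (hFm m).comp measurable_swap
      obtain ⟨C1, hC1⟩ := hFb (m+1)
      obtain ⟨C2, hC2⟩ := hFb m
      have hi1 : Integrable (fun z : 𝒴 × (Fin m → 𝒴) =>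
          F (m+1) ((MeasurableEquiv.piFinSuccAbove (fun _ => 𝒴) i).symm z) z.1)
          (P.prod (Measure.pi fun _ : Fin m => P)) :=
        Integrable.of_bound hm1.aestronglyMeasurable C1 (ae_of_all _ fun y => hC1 _ _)
      have hi2 : Integrable (fun z : 𝒴 × (Fin m → 𝒴) => F m z.2 z.1)
          (P.prod (Measure.pi fun _ : Fin m => P)) :=
        Integrable.of_bound hm2.aestronglyMeasurable C2 (ae_of_all _ fun y => hC2 _ _)
      have e0 : ∫ z, F m z.2 z.1 ∂(P.prod (Measure.pi fun _ : Fin m => P)) = 0 := by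
        rw [integral_prod_symm _ hi2]
        simp [hmean]
      have e2 : ∀ z : 𝒴 × (Fin m → 𝒴),
          ((MeasurableEquiv.piFinSuccAbove (fun _ => 𝒴) i).symm z) = i.insertNth z.1 z.2 := by
        intro z
        rfl
      have e1 : ∀ z : 𝒴 × (Fin m → 𝒴),
          ((MeasurableEquiv.piFinSuccAbove (fun _ => 𝒴) i).symm z) i = z.1 := by
        intro z
        rw [e2]; simp
      simp_rw [e1]
      calc ∫ z, F (m+1) ((MeasurableEquiv.piFinSuccAbove (fun _ => 𝒴) i).symm z) z.1
              ∂(P.prod (Measure.pi fun _ : Fin m => P))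
          = ∫ z, (F (m+1) ((MeasurableEquiv.piFinSuccAbove (fun _ => 𝒴) i).symm z) z.1
              - F m z.2 z.1) ∂(P.prod (Measure.pi fun _ : Fin m => P)) := by
            rw [integral_sub hi1 hi2, e0, sub_zero]
        _ ≤ ∫ z, |F (m+1) ((MeasurableEquiv.piFinSuccAbove (fun _ => 𝒴) i).symm z) z.1
              - F m z.2 z.1| ∂(P.prod (Measure.pi fun _ : Fin m => P)) :=
            integral_mono (hi1.sub hi2) (hi1.sub hi2).abs fun z => le_abs_self _
        _ = ∫ y, ∫ y0, |F (m+1) (i.insertNth y0 y) y0 - F m y y0| ∂P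
              ∂(Measure.pi fun _ : Fin m => P) := by
            refine (integral_prod_symm _ (hi1.sub hi2).abs).trans ?_
            simp only [Pi.sub_apply, e2]
        _ ≤ ∫ y, (b + Ψ m y) / (2 * n) ∂(Measure.pi fun _ : Fin m => P) := by
            refine integral_mono_of_nonneg (ae_of_all _ fun y => integral_nonneg fun _ => abs_nonneg _) ?_
              (ae_of_all _ fun y => hΔ m (by omega) y i)
            exact ((integrable_const b).add (hΨi m)).div_const _
        _ ≤ b / n := by
            rw [integral_div, integral_add (integrable_const b) (hΨi m)]
            simp only [integral_const, probReal_univ, smul_eq_mul, one_mul]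
            rw [div_le_div_iff₀ pP hn]
            nlinarith
    have : ∫ y, Ψ (m+1) y ∂(Measure.pi fun _ : Fin (m+1) => P) =
        ∑ i : Fin (m+1), ∫ y, F (m + 1) y (y i) ∂(Measure.pi fun _ : Fin (m+1) => P) := by
      rw [← integral_finset_sum]
      · simp_rw [hsum]
      · intro i _
        obtain ⟨C, hC⟩ := hFb (m+1)
        refine Integrable.of_bound ?_ C (ae_of_all _ fun y => hC _ _)
        exact ((hFm (m+1)).comp (measurable_id.prodMk (measurable_pi_apply i))).aestronglyMeasurable
    rw [this]
    calc _ ≤ ∑ i : Fin (m+1), b / n := Finset.sum_le_sum fun i _ => hterm i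
      _ = (m + 1) * (b / n) := by simp
      _ ≤ n * (b / n) := by
        refine mul_le_mul_of_nonneg_right ?_ pP
        exact_mod_cast hm
      _ = b := by field_simp

end
section

def Jp (p a : ℝ) : ℝ := |a| ^ (p - 2) * a

theorem Jp_abs {p : ℝ} (hp : 1 < p) (a : ℝ) : |Jp p a| = |a| ^ (p - 1) := by
  unfold Jp
  rw [abs_mul, abs_of_nonneg (Real.rpow_nonneg (abs_nonneg a) _)]
  rcases eq_or_ne a 0 with h | h
  · subst h
    simp [Real.zero_rpow (by linarith : p - 1 ≠ 0)]
  · have : 0 < |a| := abs_pos.mpr h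
    rw [← Real.rpow_add_one this.ne']
    congr 1; ring

theorem Jp_mul {p : ℝ} (hp : 1 < p) (a : ℝ) : Jp p a * a = |a| ^ p := by
  unfold Jp
  rcases eq_or_ne a 0 with h | h
  · subst h
    simp [Real.zero_rpow (by linarith : p ≠ 0)]
  · have : 0 < |a| := abs_pos.mpr h
    rw [mul_assoc, ← abs_mul_abs_self a, ← mul_assoc, ← Real.rpow_add_one this.ne',
      ← Real.rpow_add_one this.ne']
    congr 1; ring

theorem Jp_meas (p : ℝ) : Measurable (Jp p) := by
  unfold Jp; fun_prop

def LpOK {X : Type} [MeasurableSpace X] (ν : Measure X) (p : ℝ) (T : X → ℝ) : Prop :=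
  Measurable T ∧ Integrable (fun x => |T x| ^ p) ν

def Nf {X : Type} [MeasurableSpace X] (ν : Measure X) (p : ℝ) (T : X → ℝ) : ℝ :=
  ∫ x, |T x| ^ p ∂ν

def Zf {X : Type} [MeasurableSpace X] (ν : Measure X) (p : ℝ) (T : X → ℝ) : ℝ :=
  (Nf ν p T) ^ (1 / p)

section
variable {X : Type} [MeasurableSpace X] {ν : Measure X} {p : ℝ}

theorem LpOK.memLp (hp : 1 < p) {T : X → ℝ} (h : LpOK ν p T) :
    MemLp T (oR p) ν := by
  refine (integrable_norm_rpow_iff h.1.aestronglyMeasurable ?_ ENNReal.ofReal_ne_top).1 ?_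
  · simp; linarith
  · rw [ENNReal.toReal_ofReal pL]
    exact h.2

theorem LpOK.of_memLp (hp : 1 < p) {T : X → ℝ} (hT : Measurable T)
    (h : MemLp T (oR p) ν) : LpOK ν p T := by
  refine ⟨hT, ?_⟩
  have := (integrable_norm_rpow_iff hT.aestronglyMeasurable (p := oR p)
    (by simp; linarith) ENNReal.ofReal_ne_top).2 h
  rwa [ENNReal.toReal_ofReal pL] at this

theorem Nf_nonneg (T : X → ℝ) : 0 ≤ Nf ν p T :=
  integral_nonneg fun _ => Real.rpow_nonneg (abs_nonneg _) _

theorem Zf_nonneg (T : X → ℝ) : 0 ≤ Zf ν p T := Real.rpow_nonneg (Nf_nonneg _) _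

theorem Zf_pow (hp : 1 < p) (T : X → ℝ) : Zf ν p T ^ p = Nf ν p T := by
  unfold Zf
  rw [← Real.rpow_mul (Nf_nonneg _), one_div_mul_cancel pL, Real.rpow_one]

theorem Zf_eq (hp : 1 < p) {T : X → ℝ} (h : LpOK ν p T) :
    eLpNorm T (oR p) ν = oR (Zf ν p T) := by
  rw [MemLp.eLpNorm_eq_integral_rpow_norm (by simp; linarith) ENNReal.ofReal_ne_top (h.memLp hp),
    ENNReal.toReal_ofReal pL]
  simp [Zf, Nf]

theorem LpOK.add (hp : 1 < p) {T S : X → ℝ} (hT : LpOK ν p T) (hS : LpOK ν p S) :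
    LpOK ν p (fun x => T x + S x) :=
  LpOK.of_memLp hp (hT.1.add hS.1) ((hT.memLp hp).add (hS.memLp hp))

theorem Zf_add (hp : 1 < p) {T S : X → ℝ} (hT : LpOK ν p T) (hS : LpOK ν p S) :
    Zf ν p (fun x => T x + S x) ≤ Zf ν p T + Zf ν p S := by
  have := eLpNorm_add_le (p := oR p) (hT.memLp hp).1 (hS.memLp hp).1
    (by rw [ENNReal.one_le_ofReal]; linarith)
  rw [Zf_eq hp hT, Zf_eq hp hS, ← ENNReal.ofReal_add (Zf_nonneg _) (Zf_nonneg _)] at this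
  have h2 := Zf_eq hp (hT.add hp hS)
  have h3 : eLpNorm (T + S) (oR p) ν = oR (Zf ν p (fun x => T x + S x)) := h2
  rw [h3] at this
  exact (ENNReal.ofReal_le_ofReal_iff (add_nonneg (Zf_nonneg _) (Zf_nonneg _))).1 this

theorem LpOK.zero (hp : 1 < p) : LpOK ν p (fun _ => 0) := by
  refine ⟨measurable_const, ?_⟩
  simp [Real.zero_rpow (by linarith : p ≠ 0)]

theorem Zf_zero (hp : 1 < p) : Zf ν p (fun _ => 0) = 0 := by
  have : p ≠ 0 := by linarith
  simp [Zf, Nf, Real.zero_rpow this, Real.zero_rpow (inv_ne_zero this)]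

theorem LpOK.sum (hp : 1 < p) {ι : Type} (s : Finset ι) {T : ι → X → ℝ}
    (h : ∀ i ∈ s, LpOK ν p (T i)) : LpOK ν p (fun x => ∑ i ∈ s, T i x) := by
  classical
  induction s using Finset.induction_on with
  | empty => simpa using LpOK.zero hp
  | insert a s ha ih =>
    simp_rw [Finset.sum_insert ha]
    exact (h a pS).add hp (ih fun i hi => h i (by simp [hi]))

theorem Zf_sum (hp : 1 < p) {ι : Type} (s : Finset ι) {T : ι → X → ℝ}
    (h : ∀ i ∈ s, LpOK ν p (T i)) :
    Zf ν p (fun x => ∑ i ∈ s, T i x) ≤ ∑ i ∈ s, Zf ν p (T i) := by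
  classical
  induction s using Finset.induction_on with
  | empty => simp [Zf_zero hp]
  | insert a s ha ih =>
    simp_rw [Finset.sum_insert ha]
    refine (Zf_add hp (h a pS) (LpOK.sum hp s fun i hi => h i (by simp [hi]))).trans ?_
    gcongr
    exact ih fun i hi => h i (by simp [hi])

theorem holderJ (hp : 1 < p) {T S : X → ℝ} (hT : LpOK ν p T) (hS : LpOK ν p S) :
    Integrable (fun x => |T x| ^ (p - 1) * |S x|) ν ∧
    ∫ x, |T x| ^ (p - 1) * |S x| ∂ν ≤ Zf ν p T ^ (p - 1) * Zf ν p S := by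
  have hc := (Real.HolderConjugate.conjExponent hp).symm
  set q := p.conjExponent with hq
  have hq1 : 1 < q := hc.lt
  have hpow : ∀ x, |(|T x| ^ (p - 1))| ^ q = |T x| ^ p := by
    intro x
    rw [abs_of_nonneg (Real.rpow_nonneg (abs_nonneg _) _), ← Real.rpow_mul (abs_nonneg _),
      hc.symm.sub_one_mul_conj]
  have hT' : LpOK ν q (fun x => |T x| ^ (p - 1)) := by
    have := hT.1
    refine ⟨by fun_prop, ?_⟩
    simp_rw [hpow]; exact hT.2
  have hS' : LpOK ν p (fun x => |S x|) := ⟨by have := hS.1; fun_prop, by simpa using hS.2⟩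
  have hcE : ENNReal.HolderConjugate (oR q) (oR p) := hc.ennrealOfReal
  refine ⟨(hT'.memLp hq1).integrable_mul (hS'.memLp hp), ?_⟩
  have h := integral_mul_norm_le_Lp_mul_Lq hc (hT'.memLp hq1) (hS'.memLp hp)
  simp only [Real.norm_eq_abs, abs_abs, hpow] at h
  have e : ∀ x, |(|T x| ^ (p - 1))| = |T x| ^ (p-1) := fun x =>
    abs_of_nonneg (Real.rpow_nonneg (abs_nonneg _) _)
  simp only [e] at h
  refine h.trans (le_of_eq ?_)
  unfold Zf
  congr 1
  rw [← Real.rpow_mul (Nf_nonneg _)]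
  unfold Nf
  congr 1
  have := hc.symm.sub_one_mul_conj
  field_simp
  linarith

def Df (ν : Measure X) (p : ℝ) (T S : X → ℝ) : ℝ := ∫ x, Jp p (T x) * S x ∂ν

theorem Df_integrable (hp : 1 < p) {T S : X → ℝ} (hT : LpOK ν p T) (hS : LpOK ν p S) :
    Integrable (fun x => Jp p (T x) * S x) ν := by
  refine (holderJ hp hT hS).1.mono' ?_ (ae_of_all _ fun x => ?_)
  · exact (((Jp_meas p).comp hT.1).mul hS.1).aestronglyMeasurable
  · rw [Real.norm_eq_abs, abs_mul, Jp_abs hp]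

theorem Df_abs (hp : 1 < p) {T S : X → ℝ} (hT : LpOK ν p T) (hS : LpOK ν p S) :
    |Df ν p T S| ≤ ∫ x, |T x| ^ (p - 1) * |S x| ∂ν := by
  unfold Df
  refine (abs_integral_le_integral_abs).trans (le_of_eq ?_)
  simp_rw [abs_mul, Jp_abs hp]

theorem Df_le (hp : 1 < p) {T S : X → ℝ} (hT : LpOK ν p T) (hS : LpOK ν p S) :
    |Df ν p T S| ≤ Zf ν p T ^ (p - 1) * Zf ν p S :=
  (Df_abs hp hT hS).trans (holderJ hp hT hS).2

theorem Nf_eq_sum (hp : 1 < p) {ι : Type} [Fintype ι] {T : ι → X → ℝ}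
    (h : ∀ i, LpOK ν p (T i)) :
    Nf ν p (fun x => ∑ i, T i x) = ∑ i, Df ν p (fun x => ∑ i, T i x) (T i) := by
  unfold Df
  rw [← integral_finsetSum _ fun i _ => Df_integrable hp (LpOK.sum hp _ fun i _ => h i) (h i)]
  unfold Nf
  congr 1; funext x
  rw [← Jp_mul hp, Finset.mul_sum]

end

end
section

theorem powC {Z M B R : ℝ} (hZ : 0 ≤ Z) (hM : 0 < M) (hR : 1 ≤ R) (hB : 2 * R * M ≤ B) :
    (Z + M) ^ R ≤ 3 * Z ^ R + B ^ R := by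
  have hB0 : 0 ≤ B := le_trans pP hB
  rcases le_total (R * M) Z with h | h
  · have h1 : Z + M ≤ Z * (1 + 1 / R) := by
      have : M ≤ Z * (1 / R) := by
        rw [mul_one_div, le_div_iff₀ pL]; linarith
      linarith
    have h2 : (1 + 1 / R) ^ R ≤ 3 := by
      have h3 : 1 + 1 / R ≤ Real.exp (1 / R) := by linarith [Real.add_one_le_exp (1 / R)]
      calc (1 + 1 / R) ^ R ≤ (Real.exp (1 / R)) ^ R :=
            Real.rpow_le_rpow pP h3 pL
        _ = Real.exp 1 := by
            rw [← Real.exp_mul, one_div_mul_cancel pL]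
        _ ≤ 3 := by linarith [Real.exp_one_lt_d9]
    calc (Z + M) ^ R ≤ (Z * (1 + 1 / R)) ^ R :=
          Real.rpow_le_rpow pP h1 pL
      _ = Z ^ R * (1 + 1 / R) ^ R := Real.mul_rpow hZ pP
      _ ≤ Z ^ R * 3 := by gcongr
      _ ≤ _ := by have := Real.rpow_nonneg hB0 R; linarith
  · have : Z + M ≤ B := by nlinarith
    have h3 := Real.rpow_le_rpow pP this (by linarith : 0 ≤ R)
    have := Real.rpow_nonneg hZ R
    linarith

theorem algC {p W B n a1 a2 b1 b2 : ℝ} {j : ℕ} (hp : 1 < p) (hW : 0 < W) (hB : 0 < B)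
    (h1 : 24 * n * a1 ≤ B ^ 2) (h2 : 24 * n * a2 ≤ B ^ p)
    (h3 : 24 * n * (j + 2) * b1 ≤ B ^ 2) (h4 : 24 * n * (j + 2) * b2 ≤ (B ^ p) ^ 2) :
    n * ((W ^ p) ^ (j + 1) * (a1 * W ^ (p - 2) + a2) +
      (j + 2) * (W ^ p) ^ j * (b1 * W ^ (2 * p - 2) + b2)) ≤
      ((W ^ p) ^ (j + 2) + (B ^ p) ^ (j + 2)) / 6 := by
  have e1 : W ^ (p - 2) = W ^ p / W ^ 2 := by
    rw [Real.rpow_sub hW]; norm_num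
  have e2 : W ^ (2 * p - 2) = (W ^ p) ^ 2 / W ^ 2 := by
    rw [Real.rpow_sub hW, two_mul, Real.rpow_add hW]; norm_num; ring
  rw [e1, e2]
  have hq : W ≤ B → W ^ p * B ≤ B ^ p * W := by
    intro h
    have e3 : W ^ p = W ^ (p - 1) * W := by
      rw [← Real.rpow_add_one hW.ne']; congr 1; ring
    have e4 : B ^ p = B ^ (p - 1) * B := by
      rw [← Real.rpow_add_one hB.ne']; congr 1; ring
    have := Real.rpow_le_rpow hW.le h (by linarith : 0 ≤ p - 1)
    rw [e3, e4]
    have := mul_le_mul_of_nonneg_right this (mul_pos hW hB).le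
    linarith
  have hm : W ≤ B → W ^ p ≤ B ^ p := fun h => Real.rpow_le_rpow hW.le h pL
  have hm' : B ≤ W → B ^ p ≤ W ^ p := fun h => Real.rpow_le_rpow hB.le h pL
  have hQ : 0 < W ^ p := Real.rpow_pos_of_pos hW _
  have hβ : 0 < B ^ p := Real.rpow_pos_of_pos hB _
  set Q := W ^ p
  set β := B ^ p
  have hs : (0:ℝ) ≤ Q ^ j := by positivity
  have hs' : (0:ℝ) ≤ β ^ j := by positivity
  have key : ∀ c, 0 ≤ c → (W ≤ B → c ≤ β ^ 2) → (B ≤ W → c ≤ Q ^ 2) →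
      Q ^ j * c ≤ Q ^ (j + 2) + β ^ (j + 2) := by
    intro c hc ha hb
    rcases le_total W B with h | h
    · have h5 : Q ^ j ≤ β ^ j := pow_le_pow_left₀ hQ.le (hm h) j
      have := mul_le_mul h5 (ha h) hc hs'
      have h6 : 0 ≤ Q ^ (j+2) := by positivity
      rw [pow_add β]; linarith
    · have := mul_le_mul_of_nonneg_left (hb h) hs
      have h6 : 0 ≤ β ^ (j+2) := by positivity
      rw [pow_add Q]; linarith
  have k1 := key (Q ^ 2 * B ^ 2 / W ^ 2) pP
    (by intro h; rw [div_le_iff₀ pP]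
        have := pow_le_pow_left₀ pP (hq h) 2
        nlinarith)
    (by intro h; rw [div_le_iff₀ pP]
        have := pow_le_pow_left₀ pP h 2
        gcongr)
  have k2 := key (Q * β) pP
    (by intro h; nlinarith [hm h]) (by intro h; nlinarith [hm' h])
  have k3 := key (β ^ 2) pP
    (by intro h; exact le_rfl)
    (by intro h; exact pow_le_pow_left₀ hβ.le (hm' h) 2)
  have i1 : 24 * n * a1 * (Q ^ j * Q ^ 2 / W ^ 2) ≤ B ^ 2 * (Q ^ j * Q ^ 2 / W ^ 2) :=
    mul_le_mul_of_nonneg_right h1 pP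
  have i2 : 24 * n * a2 * (Q ^ j * Q) ≤ β * (Q ^ j * Q) :=
    mul_le_mul_of_nonneg_right h2 pP
  have i3 : 24 * n * (j + 2) * b1 * (Q ^ j * Q ^ 2 / W ^ 2) ≤ B ^ 2 * (Q ^ j * Q ^ 2 / W ^ 2) :=
    mul_le_mul_of_nonneg_right h3 pP
  have i4 : 24 * n * (j + 2) * b2 * Q ^ j ≤ β ^ 2 * Q ^ j :=
    mul_le_mul_of_nonneg_right h4 pP
  have e : n * (Q ^ (j + 1) * (a1 * (Q / W ^ 2) + a2) +
      (j + 2) * Q ^ j * (b1 * (Q ^ 2 / W ^ 2) + b2)) =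
      (24 * n * a1 * (Q ^ j * Q ^ 2 / W ^ 2) + 24 * n * a2 * (Q ^ j * Q) +
      24 * n * (j + 2) * b1 * (Q ^ j * Q ^ 2 / W ^ 2) + 24 * n * (j + 2) * b2 * Q ^ j) / 24 := by
    ring
  rw [e]
  have e' : Q ^ j * (Q ^ 2 * B ^ 2 / W ^ 2) = B ^ 2 * (Q ^ j * Q ^ 2 / W ^ 2) := by ring
  rw [e'] at k1
  linarith

end
section

section
variable {X 𝒴 : Type} [MeasurableSpace X] [MeasurableSpace 𝒴] {ν : Measure X} [SFinite ν] {p : ℝ}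

theorem meas_integral_snd {Z : Type} [MeasurableSpace Z] {g : Z → X → ℝ}
    (hg : Measurable (fun z : Z × X => g z.1 z.2)) : Measurable (fun z => ∫ x, g z x ∂ν) :=
  (StronglyMeasurable.integral_prod_right' (ν := ν) (f := fun z : Z × X => g z.1 z.2)
    hg.stronglyMeasurable).measurable

theorem meas_Nf {Z : Type} [MeasurableSpace Z] {g : Z → X → ℝ}
    (hg : Measurable (fun z : Z × X => g z.1 z.2)) : Measurable (fun z => Nf ν p (g z)) := by
  unfold Nf
  refine meas_integral_snd (g := fun z x => |g z x| ^ p) ?_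
  fun_prop

theorem meas_Df {Z : Type} [MeasurableSpace Z] {g g' : Z → X → ℝ}
    (hg : Measurable (fun z : Z × X => g z.1 z.2))
    (hg' : Measurable (fun z : Z × X => g' z.1 z.2)) :
    Measurable (fun z => Df ν p (g z) (g' z)) := by
  unfold Df
  refine meas_integral_snd (g := fun z x => Jp p (g z x) * g' z x) ?_
  exact ((Jp_meas p).comp hg).mul hg'

theorem int_bdd (P : Measure 𝒴) [IsProbabilityMeasure P] {g : 𝒴 → ℝ} (hg : Measurable g) (C : ℝ)
    (h : ∀ y, |g y| ≤ C) : Integrable g P :=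
  Integrable.of_bound hg.aestronglyMeasurable C (ae_of_all _ h)

theorem Df_mean (P : Measure 𝒴) [IsProbabilityMeasure P] (hp : 1 < p) {ℓ : X → 𝒴 → ℝ}
    (hℓ : Measurable (fun z : X × 𝒴 => ℓ z.1 z.2)) {M : ℝ}
    (hL : ∀ y, LpOK ν p (fun x => ℓ x y)) (hM : ∀ y, Zf ν p (fun x => ℓ x y) ≤ M)
    (h0 : ∀ x, ∫ y, ℓ x y ∂P = 0) {T : X → ℝ} (hT : LpOK ν p T) :
    ∫ y, Df ν p T (fun x => ℓ x y) ∂P = 0 := by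
  unfold Df
  rw [integral_integral_swap]
  · simp_rw [integral_const_mul, h0]; simp
  · have hm : Measurable (fun z : 𝒴 × X => Jp p (T z.2) * ℓ z.2 z.1) :=
      ((Jp_meas p).comp (hT.1.comp measurable_snd)).mul (hℓ.comp measurable_swap)
    have hm2 := hm.aestronglyMeasurable (μ := P.prod ν)
    refine (integrable_prod_iff hm2).2 ⟨ae_of_all _ fun y => Df_integrable hp hT (hL y), ?_⟩
    refine int_bdd P (meas_integral_snd (g := fun y x => ‖Jp p (T x) * ℓ x y‖) hm.norm)
      (Zf ν p T ^ (p - 1) * M) fun y => ?_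
    rw [abs_of_nonneg (integral_nonneg fun _ => norm_nonneg _)]
    have h1 := (holderJ hp hT (hL y)).2
    simp only [Real.norm_eq_abs, abs_mul, Jp_abs hp]
    refine h1.trans (mul_le_mul_of_nonneg_left (hM y) (Real.rpow_nonneg (Zf_nonneg _) _))

theorem thmC (P : Measure 𝒴) [IsProbabilityMeasure P] (hp : 1 < p) {ℓ : X → 𝒴 → ℝ}
    (hℓ : Measurable (fun z : X × 𝒴 => ℓ z.1 z.2)) {M : ℝ} (hM0 : 0 < M)
    (hL : ∀ y, LpOK ν p (fun x => ℓ x y)) (hM : ∀ y, Zf ν p (fun x => ℓ x y) ≤ M)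
    (h0 : ∀ x, ∫ y, ℓ x y ∂P = 0) {n : ℕ} (hn : 0 < n) {j : ℕ} {B a1 a2 b1 b2 : ℝ} (hB : 0 < B)
    (H1 : ∀ T, LpOK ν p T → ∫ y, |Df ν p (fun x => T x + ℓ x y) (fun x => ℓ x y) -
      Df ν p T (fun x => ℓ x y)| ∂P ≤ a1 * (Zf ν p T + M) ^ (p - 2) + a2)
    (H2 : ∀ T, LpOK ν p T → ∫ y, |Nf ν p (fun x => T x + ℓ x y) - Nf ν p T| *
      |Df ν p T (fun x => ℓ x y)| ∂P ≤ b1 * (Zf ν p T + M) ^ (2 * p - 2) + b2)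
    (h1 : 24 * n * a1 ≤ B ^ 2) (h2 : 24 * n * a2 ≤ B ^ p)
    (h3 : 24 * n * (j + 2) * b1 ≤ B ^ 2) (h4 : 24 * n * (j + 2) * b2 ≤ (B ^ p) ^ 2)
    (h5 : 2 * (p * (j + 2)) * M ≤ B) :
    ∫⁻ y, oR (Zf ν p (fun x => ∑ i, ℓ x (y i)) ^ (p * (j + 2)))
      ∂(Measure.pi fun _ : Fin n => P) ≤ oR (B ^ (p * (j + 2))) := by
  have hS : ∀ m (y : Fin m → 𝒴), LpOK ν p (fun x => ∑ i, ℓ x (y i)) := fun m y =>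
    LpOK.sum hp _ fun i _ => hL (y i)
  have hmS : ∀ m, Measurable (fun z : (Fin m → 𝒴) × X => ∑ i, ℓ z.2 (z.1 i)) := by
    intro m
    refine Finset.measurable_sum _ fun i _ => ?_
    exact hℓ.comp (measurable_snd.prodMk ((measurable_pi_apply i).comp measurable_fst))
  have hZS : ∀ m (y : Fin m → 𝒴), Zf ν p (fun x => ∑ i, ℓ x (y i)) ≤ m * M := by
    intro m y
    refine (Zf_sum hp _ fun i _ => hL (y i)).trans ?_
    refine (Finset.sum_le_sum fun i _ => hM (y i)).trans ?_
    simp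
  have hNS : ∀ m (y : Fin m → 𝒴), Nf ν p (fun x => ∑ i, ℓ x (y i)) ≤ (m * M) ^ p := by
    intro m y
    rw [← Zf_pow hp]
    exact Real.rpow_le_rpow (Zf_nonneg _) (hZS m y) pL
  have hDb : ∀ T, LpOK ν p T → ∀ y, |Df ν p T (fun x => ℓ x y)| ≤ Zf ν p T ^ (p - 1) * M := by
    intro T hT y
    exact (Df_le hp hT (hL y)).trans
      (mul_le_mul_of_nonneg_left (hM y) (Real.rpow_nonneg (Zf_nonneg _) _))
  have hmℓ : Measurable (fun z : 𝒴 × X => ℓ z.2 z.1) := hℓ.comp measurable_swap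
  have main := lemA P n ((B ^ p) ^ (j + 2)) pP
    (fun m y => Nf ν p (fun x => ∑ i, ℓ x (y i)) ^ (j + 2))
    (fun m y y0 => Nf ν p (fun x => ∑ i, ℓ x (y i)) ^ (j + 1) *
      Df ν p (fun x => ∑ i, ℓ x (y i)) (fun x => ℓ x y0)) ?_ ?_ ?_ ?_ ?_ n le_rfl
  · have hmeas : Measurable (fun y : Fin n → 𝒴 => Nf ν p (fun x => ∑ i, ℓ x (y i))) :=
      meas_Nf (g := fun (y : Fin n → 𝒴) x => ∑ i, ℓ x (y i)) (hmS n)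
    have e : ∀ y : Fin n → 𝒴, Zf ν p (fun x => ∑ i, ℓ x (y i)) ^ (p * (j + 2)) =
        Nf ν p (fun x => ∑ i, ℓ x (y i)) ^ (j + 2) := by
      intro y
      rw [Real.rpow_mul (Zf_nonneg _), Zf_pow hp]
      exact_mod_cast Real.rpow_natCast _ (j + 2)
    simp_rw [e]
    rw [← ofReal_integral_eq_lintegral_ofReal]
    · refine ENNReal.ofReal_le_ofReal (main.trans (le_of_eq ?_))
      rw [Real.rpow_mul hB.le]
      exact_mod_cast (Real.rpow_natCast _ (j + 2)).symm
    · refine int_bdd _ (hmeas.pow_const _) (((n * M) ^ p) ^ (j + 2)) fun y => ?_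
      rw [abs_of_nonneg (pow_nonneg (Nf_nonneg _) _)]
      exact pow_le_pow_left₀ (Nf_nonneg _) (hNS n y) _
    · exact ae_of_all _ fun y => pow_nonneg (Nf_nonneg _) _
  · intro m
    refine Measurable.mul (((meas_Nf (g := fun (y : Fin m → 𝒴) x => ∑ i, ℓ x (y i))
      (hmS m)).comp measurable_fst).pow_const _) ?_
    refine meas_Df (g := fun (z : (Fin m → 𝒴) × 𝒴) x => ∑ i, ℓ x (z.1 i))
      (g' := fun (z : (Fin m → 𝒴) × 𝒴) x => ℓ x z.2) ?_ ?_
    · exact (hmS m).comp ((measurable_fst.comp measurable_fst).prodMk measurable_snd)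
    · exact hmℓ.comp ((measurable_snd.comp measurable_fst).prodMk measurable_snd)
  · intro m
    refine ⟨((m * M) ^ p) ^ (j + 1) * ((m * M) ^ (p - 1) * M), fun y y0 => ?_⟩
    rw [abs_mul, abs_of_nonneg (pow_nonneg (Nf_nonneg _) _)]
    refine mul_le_mul (pow_le_pow_left₀ (Nf_nonneg _) (hNS m y) _) ?_ (abs_nonneg _)
      pP
    refine (hDb _ (hS m y) y0).trans ?_
    gcongr
    · exact Zf_nonneg _
    · exact hZS m y
  · intro m y
    rw [← Finset.mul_sum, ← Nf_eq_sum hp fun i => hL (y i), ← pow_succ]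
  · intro m y
    rw [integral_const_mul, Df_mean P hp hℓ hL hM h0 (hS m y), mul_zero]
  · intro m hm y i
    have hn' : (0 : ℝ) < n := by exact_mod_cast hn
    set T : X → ℝ := fun x => ∑ i, ℓ x (y i) with hTdef
    have hT : LpOK ν p T := hS m y
    have eS : ∀ y0, (fun x => ∑ l, ℓ x ((i.insertNth y0 y : Fin (m + 1) → 𝒴) l)) =
        fun x => T x + ℓ x y0 := by
      intro y0; funext x
      rw [Fin.sum_univ_succAbove _ i]
      simp [hTdef, add_comm]
    simp_rw [eS]
    set W := Zf ν p T + M with hW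
    have hW0 : 0 < W := by have := Zf_nonneg (ν := ν) (p := p) T; linarith
    have hQt : Nf ν p T ≤ W ^ p := by
      rw [← Zf_pow hp]
      exact Real.rpow_le_rpow (Zf_nonneg _) pL pL
    have hQs : ∀ y0, Nf ν p (fun x => T x + ℓ x y0) ≤ W ^ p := by
      intro y0
      rw [← Zf_pow hp]
      refine Real.rpow_le_rpow (Zf_nonneg _) ?_ pL
      exact (Zf_add hp hT (hL y0)).trans (by linarith [hM y0])
    have hW0' : 0 ≤ W ^ p := by positivity
    have hpt : ∀ y0, |Nf ν p (fun x => T x + ℓ x y0) ^ (j + 1) *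
        Df ν p (fun x => T x + ℓ x y0) (fun x => ℓ x y0) -
        Nf ν p T ^ (j + 1) * Df ν p T (fun x => ℓ x y0)| ≤
        (W ^ p) ^ (j + 1) * |Df ν p (fun x => T x + ℓ x y0) (fun x => ℓ x y0) -
          Df ν p T (fun x => ℓ x y0)| + (j + 2) * (W ^ p) ^ j *
          (|Nf ν p (fun x => T x + ℓ x y0) - Nf ν p T| * |Df ν p T (fun x => ℓ x y0)|) := by
      intro y0
      set a := Nf ν p (fun x => T x + ℓ x y0)
      set b := Nf ν p T
      set u := Df ν p (fun x => T x + ℓ x y0) (fun x => ℓ x y0)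
      set v := Df ν p T (fun x => ℓ x y0)
      have ha0 : 0 ≤ a := Nf_nonneg _
      have hb0 : 0 ≤ b := Nf_nonneg _
      have e : a ^ (j + 1) * u - b ^ (j + 1) * v = a ^ (j + 1) * (u - v) +
        (a ^ (j + 1) - b ^ (j + 1)) * v := by ring
      rw [e]
      refine (abs_add_le _ _).trans ?_
      rw [abs_mul, abs_mul, abs_of_nonneg (pow_nonneg ha0 _)]
      have t1 : a ^ (j + 1) ≤ (W ^ p) ^ (j + 1) := pow_le_pow_left₀ ha0 (hQs y0) _
      have t2 : |a ^ (j + 1) - b ^ (j + 1)| ≤ (j + 2) * (W ^ p) ^ j * |a - b| := by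
        have := abs_pow_sub_pow_le a b (j + 1)
        have h6 : max |a| |b| ^ (j + 1 - 1) ≤ (W ^ p) ^ j := by
          rw [Nat.add_sub_cancel]
          refine pow_le_pow_left₀ pP ?_ _
          rw [abs_of_nonneg ha0, abs_of_nonneg hb0]
          exact max_le (hQs y0) hQt
        calc _ ≤ _ := this
          _ ≤ |a - b| * (j + 2) * (W ^ p) ^ j := by
            refine mul_le_mul ?_ h6 pP pP
            push_cast
            refine mul_le_mul_of_nonneg_left ?_ (abs_nonneg _)
            linarith
          _ = _ := by ring
      calc _ ≤ (W ^ p) ^ (j + 1) * |u - v| + (j + 2) * (W ^ p) ^ j * |a - b| * |v| := by gcongr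
        _ = _ := by ring
    have mℓ1 : Measurable (fun z : 𝒴 × X => T z.2 + ℓ z.2 z.1) :=
      (hT.1.comp measurable_snd).add hmℓ
    have mD1 : Measurable (fun y0 => Df ν p (fun x => T x + ℓ x y0) (fun x => ℓ x y0)) :=
      meas_Df (g := fun y0 x => T x + ℓ x y0) (g' := fun y0 x => ℓ x y0) mℓ1 hmℓ
    have mD2 : Measurable (fun y0 => Df ν p T (fun x => ℓ x y0)) :=
      meas_Df (g := fun _ x => T x) (g' := fun y0 x => ℓ x y0) (hT.1.comp measurable_snd) hmℓ
    have mN1 : Measurable (fun y0 => Nf ν p (fun x => T x + ℓ x y0)) :=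
      meas_Nf (g := fun y0 x => T x + ℓ x y0) mℓ1
    have bD1 : ∀ y0, |Df ν p (fun x => T x + ℓ x y0) (fun x => ℓ x y0)| ≤ W ^ (p - 1) * M := by
      intro y0
      refine (hDb _ (hT.add hp (hL y0)) y0).trans ?_
      refine mul_le_mul_of_nonneg_right (Real.rpow_le_rpow (Zf_nonneg _) ?_ pL) hM0.le
      exact (Zf_add hp hT (hL y0)).trans (by linarith [hM y0])
    have bD2 : ∀ y0, |Df ν p T (fun x => ℓ x y0)| ≤ W ^ (p - 1) * M := by
      intro y0
      refine (hDb _ hT y0).trans ?_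
      exact mul_le_mul_of_nonneg_right (Real.rpow_le_rpow (Zf_nonneg _) pL
        pL) hM0.le
    have i1 : Integrable (fun y0 => |Df ν p (fun x => T x + ℓ x y0) (fun x => ℓ x y0) -
          Df ν p T (fun x => ℓ x y0)|) P := by
      refine ((int_bdd P mD1 _ bD1).sub (int_bdd P mD2 _ bD2)).abs
    have i2 : Integrable (fun y0 => |Nf ν p (fun x => T x + ℓ x y0) - Nf ν p T| *
        |Df ν p T (fun x => ℓ x y0)|) P := by
      refine int_bdd P ((mN1.sub_const _).abs.mul mD2.abs) (W ^ p * (W ^ (p - 1) * M)) fun y0 => ?_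
      rw [abs_mul, abs_abs, abs_abs]
      refine mul_le_mul ?_ (bD2 y0) (abs_nonneg _) hW0'
      rw [abs_le]
      have t1 := hQs y0
      have t2 := Nf_nonneg (ν := ν) (p := p) (fun x => T x + ℓ x y0)
      have t3 := Nf_nonneg (ν := ν) (p := p) T
      constructor <;> linarith
    have hlast := algC (j := j) hp hW0 hB h1 h2 h3 h4
    have hpow := powC (R := p * (j + 2)) (Zf_nonneg (ν := ν) (p := p) T) hM0
      (by have : (0:ℝ) ≤ j := by positivity
          nlinarith) h5
    have c1 : ∀ a : ℝ, 0 ≤ a → a ^ (p * (j + 2)) = (a ^ p) ^ (j + 2) := by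
      intro a ha
      rw [Real.rpow_mul ha]
      exact_mod_cast Real.rpow_natCast _ (j + 2)
    rw [c1 _ hW0.le, c1 _ (Zf_nonneg _), c1 _ hB.le, Zf_pow hp] at hpow
    have hint : ∫ y0, |Nf ν p (fun x => T x + ℓ x y0) ^ (j + 1) *
        Df ν p (fun x => T x + ℓ x y0) (fun x => ℓ x y0) -
        Nf ν p T ^ (j + 1) * Df ν p T (fun x => ℓ x y0)| ∂P ≤
        (W ^ p) ^ (j + 1) * (a1 * W ^ (p - 2) + a2) + (j + 2) * (W ^ p) ^ j *
        (b1 * W ^ (2 * p - 2) + b2) := by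
      refine (integral_mono_of_nonneg (ae_of_all _ fun _ => abs_nonneg _)
        ((i1.const_mul _).add (i2.const_mul _)) (ae_of_all _ hpt)).trans ?_
      refine (integral_add (i1.const_mul _) (i2.const_mul _)).le.trans ?_
      rw [integral_const_mul, integral_const_mul]
      have := H1 T hT
      have := H2 T hT
      gcongr
    rw [le_div_iff₀ pP]
    have := mul_le_mul_of_nonneg_left hint hn'.le
    have h7 : 0 ≤ (B ^ p) ^ (j + 2) := by positivity
    nlinarith

end

end
section

theorem glue_meas {d : ℕ} (I : Finset (Fin d)) :
    Measurable (fun z : (I → ℝ) × (↥(Iᶜ) → ℝ) => glue I z.1 z.2) := by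
  refine measurable_pi_lambda _ fun i => ?_
  unfold glue
  by_cases h : i ∈ I
  · simp only [h, dite_true]; fun_prop
  · simp only [h, dite_false]; fun_prop

theorem glue_mp {d : ℕ} (I : Finset (Fin d)) :
    MeasurePreserving (fun z : (I → ℝ) × (↥(Iᶜ) → ℝ) => glue I z.1 z.2) := by
  refine ⟨glue_meas I, ?_⟩
  symm
  refine Measure.pi_eq fun s hs => ?_
  rw [Measure.map_apply (glue_meas I) (MeasurableSet.univ_pi hs)]
  have : (fun z : (I → ℝ) × (↥(Iᶜ) → ℝ) => glue I z.1 z.2) ⁻¹' (Set.univ.pi s) =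
      (Set.univ.pi fun i : I => s i) ×ˢ (Set.univ.pi fun i : ↥(Iᶜ) => s i) := by
    ext z
    simp only [Set.mem_preimage, Set.mem_pi, Set.mem_univ, true_implies, Set.mem_prod, glue]
    constructor
    · intro h
      refine ⟨fun i => ?_, fun i => ?_⟩
      · simpa using h i
      · have h1 := h i
        have h2 : (i : Fin d) ∉ I := Finset.mem_compl.1 i.2
        simpa [h2] using h1
    · intro h i
      by_cases hi : i ∈ I
      · simpa [hi] using h.1 ⟨i, hi⟩
      · simpa [hi] using h.2 ⟨i, Finset.mem_compl.2 hi⟩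
  rw [this, Measure.volume_eq_prod, Measure.prod_prod, volume_pi_pi, volume_pi_pi,
    Finset.prod_coe_sort I (fun i => volume (s i)), Finset.prod_coe_sort Iᶜ (fun i => volume (s i)),
    Finset.prod_mul_prod_compl]

theorem glue_left {d : ℕ} (I : Finset (Fin d)) (x : I → ℝ) (y : ↥(Iᶜ) → ℝ) :
    (fun j : I => glue I x y j) = x := by
  funext j; simp [glue]

def dm {d : ℕ} (g : Vd d → ℝ) : Measure Vd d :=
  volume.withDensity fun x => oR (g x)

theorem IsDensity.int {ι : Type} [Fintype ι] {g : (ι → ℝ) → ℝ} (h : IsDensity g) :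
    Integrable g := by
  by_contra hh
  have := integral_undef hh
  rw [h.2] at this
  norm_num at this

theorem dm_prob {d : ℕ} {g : Vd d → ℝ} (h : IsDensity g) :
    IsProbabilityMeasure (dm g) := by
  refine ⟨?_⟩
  unfold dm
  rw [withDensity_apply _ MeasurableSet.univ, Measure.restrict_univ,
    ← ofReal_integral_eq_lintegral_ofReal h.int (ae_of_all _ h.1), h.2, ENNReal.ofReal_one]

theorem conv_ae {d : ℕ} {f f' g g' : Vd d → ℝ} (hf : f =ᵐ[volume] f')
    (hg : g =ᵐ[volume] g') : conv f g = conv f' g' := by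
  funext x
  unfold conv
  refine integral_congr_ae ?_
  have := (Measure.measurePreserving_sub_left (volume : Measure Vd d) x).quasiMeasurePreserving.ae_eq_comp hf
  filter_upwards [this, hg] with y h1 h2
  have h1' : f (x - y) = f' (x - y) := h1
  rw [h1', h2]

theorem conv_law {d : ℕ} {f q : Vd d → ℝ} (hf : IsDensity f) (hq : IsDensity q) :
    dm (conv f q) = ((dm f).prod (dm q)).map (fun z => z.1 + z.2) := by
  obtain ⟨f', hf'm, hf'⟩ := hf.int.1.aemeasurable
  obtain ⟨q', hq'm, hq'⟩ := hq.int.1.aemeasurable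
  have hm1 : dm f = volume.withDensity fun x => oR (f' x) :=
    withDensity_congr_ae (by filter_upwards [hf'] with x hx; rw [hx])
  have hm2 : dm q = volume.withDensity fun x => oR (q' x) :=
    withDensity_congr_ae (by filter_upwards [hq'] with x hx; rw [hx])
  have if' : Integrable f' := hf.int.congr hf'
  have iq' : Integrable q' := hq.int.congr hq'
  have hf0 : ∀ᵐ x, 0 ≤ f' x := by filter_upwards [hf'] with x hx; rw [← hx]; exact hf.1 x
  have hq0 : ∀ᵐ x, 0 ≤ q' x := by filter_upwards [hq'] with x hx; rw [← hx]; exact hq.1 x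
  have := dm_prob hf
  have := dm_prob hq
  have hconv : ∀ᵐ x, oR (conv f q x) =
      ∫⁻ y, oR (f' (x - y)) * oR (q' y) := by
    have hi : Integrable (fun z : Vd d × Vd d => q' z.2 * f' (z.1 - z.2))
      (volume.prod volume) := iq'.convolution_integrand (ContinuousLinearMap.mul ℝ ℝ) if'
    filter_upwards [hi.prod_right_ae] with x hx
    rw [conv_ae hf' hq']
    unfold conv
    have hff := (Measure.measurePreserving_sub_left (volume : Measure Vd d) x).quasiMeasurePreserving.ae hf0
    rw [ofReal_integral_eq_lintegral_ofReal]
    · refine lintegral_congr_ae ?_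
      filter_upwards [hff] with y h1
      rw [ENNReal.ofReal_mul h1]
    · simpa [mul_comm] using hx
    · filter_upwards [hff, hq0] with y h1 h2
      exact mul_nonneg h1 h2
  refine Measure.ext_of_lintegral _ fun H hH => ?_
  rw [lintegral_map hH pF, lintegral_prod _ pF]
  unfold dm at hm1 hm2 ⊢
  rw [withDensity_congr_ae hconv, hm1, hm2]
  have hmf : Measurable fun x => oR (f' x) := by fun_prop
  have hmq : Measurable fun x => oR (q' x) := by fun_prop
  have hmm : Measurable fun z : Vd d × Vd d =>
    oR (f' (z.1 - z.2)) * oR (q' z.2) := by fun_prop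
  rw [lintegral_withDensity_eq_lintegral_mul _ hmm.lintegral_prod_right' hH]
  have hmH : Measurable fun x => ∫⁻ y, H (x + y) ∂(volume.withDensity fun x => oR (q' x)) :=
    Measurable.lintegral_prod_right' (f := fun z : Vd d × Vd d => H (z.1 + z.2)) pF
  rw [lintegral_withDensity_eq_lintegral_mul _ hmf hmH]
  simp only [Pi.mul_apply]
  have e1 : ∀ x, ∫⁻ y, H (x + y) ∂(volume.withDensity fun x => oR (q' x)) =
      ∫⁻ y, oR (q' y) * H (x + y) := by
    intro x
    rw [lintegral_withDensity_eq_lintegral_mul _ hmq pF]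
    rfl
  simp_rw [e1]
  have e2 : ∀ x, (∫⁻ y, oR (f' (x - y)) * oR (q' y)) * H x =
      ∫⁻ y, oR (f' (x - y)) * oR (q' y) * H x := by
    intro x
    rw [lintegral_mul_const _ pF]
  have e3 : ∀ x, oR (f' x) * (∫⁻ y, oR (q' y) * H (x + y)) =
      ∫⁻ y, oR (f' x) * (oR (q' y) * H (x + y)) := by
    intro x
    rw [lintegral_const_mul _ pF]
  simp_rw [e2, e3]
  rw [lintegral_lintegral_swap pF]
  conv_rhs => rw [lintegral_lintegral_swap pF]
  refine lintegral_congr fun y => ?_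
  rw [← lintegral_add_right_eq_self _ y]
  refine lintegral_congr fun x => ?_
  rw [add_sub_cancel_right]; ring

end
section

section
variable {d : ℕ} {I : Finset (Fin d)} {f q : Vd d → ℝ}

def rI (I : Finset (Fin d)) (y : Vd d) : I → ℝ := fun j => y j

theorem rI_meas : Measurable (rI I) := by
  unfold rI; fun_prop

theorem rI_glue (x : I → ℝ) (y : ↥(Iᶜ) → ℝ) : rI I (glue I x y) = x := glue_left I x y

theorem marg_lint (hq : IsDensity q) {G : (I → ℝ) → ℝ≥0∞} (hG : Measurable G) :
    ∫⁻ y, G (rI I y) ∂(dm q) = ∫⁻ x, G x * oR (marginal I q x) := by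
  obtain ⟨q', hq'm, hq'⟩ := hq.int.1.aemeasurable
  have hm2 : dm q = volume.withDensity fun x => oR (q' x) :=
    withDensity_congr_ae (by filter_upwards [hq'] with x hx; rw [hx])
  have hq0 : ∀ᵐ x, 0 ≤ q' x := by filter_upwards [hq'] with x hx; rw [← hx]; exact hq.1 x
  have iq' : Integrable q' := hq.int.congr hq'
  have hGr : Measurable (fun y => G (rI I y)) := hG.comp rI_meas
  rw [hm2, lintegral_withDensity_eq_lintegral_mul _ pF hGr]
  have hmm : Measurable ((fun x => oR (q' x)) * fun y => G (rI I y)) :=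
    (by fun_prop : Measurable (fun x => oR (q' x))).mul (hG.comp rI_meas)
  rw [← (glue_mp I).lintegral_comp hmm]
  have hg := glue_meas I
  have hmg : Measurable (fun z : (I → ℝ) × (↥(Iᶜ) → ℝ) =>
    ((fun x => oR (q' x)) * fun y => G (rI I y)) (glue I z.1 z.2)) := hmm.comp hg
  rw [Measure.volume_eq_prod, lintegral_prod _ hmg.aemeasurable]
  refine lintegral_congr_ae ?_
  have a1 : ∀ᵐ z : (I → ℝ) × (↥(Iᶜ) → ℝ), q (glue I z.1 z.2) = q' (glue I z.1 z.2) :=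
    (glue_mp I).quasiMeasurePreserving.ae hq'
  have a2 : ∀ᵐ z : (I → ℝ) × (↥(Iᶜ) → ℝ), 0 ≤ q' (glue I z.1 z.2) :=
    (glue_mp I).quasiMeasurePreserving.ae hq0
  have a3 : Integrable (fun z : (I → ℝ) × (↥(Iᶜ) → ℝ) => q' (glue I z.1 z.2)) volume :=
    (glue_mp I).integrable_comp_of_integrable iq'
  rw [Measure.volume_eq_prod] at a1 a2 a3
  filter_upwards [Measure.ae_ae_of_ae_prod a1, Measure.ae_ae_of_ae_prod a2, a3.prod_right_ae] with x h1 h2 h3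
  simp only [Pi.mul_apply, rI_glue]
  rw [lintegral_mul_const _ pF, mul_comm]
  congr 1
  unfold marginal
  rw [integral_congr_ae h1, ofReal_integral_eq_lintegral_ofReal h3 h2]

theorem dm_lint_le {G : (I → ℝ) → ℝ≥0∞} (hq : IsDensity q) (hG : Measurable G) :
    ∫⁻ y, G (rI I y) ∂(dm q) ≤ eLpNorm (marginal I q) ⊤ volume * ∫⁻ x, G x := by
  rw [marg_lint hq hG, ← lintegral_const_mul _ hG]
  refine lintegral_mono_ae ?_
  rw [eLpNorm_exponent_top]
  filter_upwards [enorm_ae_le_eLpNormEssSup (marginal I q) volume] with x hx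
  rw [mul_comm]
  gcongr
  refine le_trans ?_ hx
  rw [← ofReal_norm]
  exact ENNReal.ofReal_le_ofReal (le_abs_self _)

theorem law_prob (hf : IsDensity f) (hq : IsDensity q) : IsProbabilityMeasure (dm (conv f q)) := by
  have := dm_prob hf
  have := dm_prob hq
  rw [conv_law hf hq]
  exact Measure.isProbabilityMeasure_map pF

theorem law_lint_le (hf : IsDensity f) (hq : IsDensity q) {G : (I → ℝ) → ℝ≥0∞}
    (hG : Measurable G) :
    ∫⁻ y, G (rI I y) ∂(dm (conv f q)) ≤ eLpNorm (marginal I q) ⊤ volume * ∫⁻ x, G x := by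
  have := dm_prob hf
  have := dm_prob hq
  have hGr : Measurable (fun y => G (rI I y)) := hG.comp rI_meas
  have hGr2 : Measurable (fun z : Vd d × Vd d => G (rI I (z.1 + z.2))) :=
    hGr.comp pF
  rw [conv_law hf hq, lintegral_map hGr pF, lintegral_prod _ hGr2.aemeasurable]
  have h1 : ∀ x : Vd d, ∫⁻ y, G (rI I (x + y)) ∂(dm q) ≤
      eLpNorm (marginal I q) ⊤ volume * ∫⁻ x, G x := by
    intro x
    have := dm_lint_le (I := I) (G := fun u => G (rI I x + u)) hq (hG.comp pF)
    rw [lintegral_add_left_eq_self] at this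
    exact this
  refine (lintegral_mono h1).trans ?_
  simp

theorem marg_int (hq : IsDensity q) {φ : (I → ℝ) → ℂ} (hφ : Measurable φ) (hb : ∀ x, ‖φ x‖ ≤ 1) :
    ∫ y, φ (rI I y) ∂(dm q) = ∫ x, φ x * (marginal I q x : ℂ) := by
  have hm : AEMeasurable (fun x => (q x).toNNReal) volume := hq.int.1.aemeasurable.real_toNNReal
  have e : dm q = volume.withDensity (fun x => ((q x).toNNReal : ℝ≥0∞)) := rfl
  rw [e, integral_withDensity_eq_integral_smul₀ hm]
  have e2 : (fun y => (q y).toNNReal • φ (rI I y)) = fun y => φ (rI I y) * (q y : ℂ) := by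
    funext y
    rw [NNReal.smul_def, Real.coe_toNNReal _ (hq.1 y), Complex.real_smul, mul_comm]
  rw [e2]
  have hi : Integrable (fun y => φ (rI I y) * (q y : ℂ)) := by
    refine hq.int.norm.mono' ((hφ.comp rI_meas).aestronglyMeasurable.mul
      (Complex.continuous_ofReal.comp_aestronglyMeasurable hq.int.1)) (ae_of_all _ fun y => ?_)
    rw [norm_mul, Complex.norm_real]
    have := mul_le_mul_of_nonneg_right (hb (rI I y)) (norm_nonneg (q y))
    linarith
  have h3 := (glue_mp I).map_eq
  rw [← h3, integral_map (glue_meas I).aemeasurable (by rw [h3]; exact hi.1)]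
  have hi2 : Integrable (fun z : (I → ℝ) × (↥(Iᶜ) → ℝ) => φ (rI I (glue I z.1 z.2)) *
      (q (glue I z.1 z.2) : ℂ)) volume := (glue_mp I).integrable_comp_of_integrable hi
  rw [Measure.volume_eq_prod] at hi2 ⊢
  rw [integral_prod _ hi2]
  congr 1; funext x
  simp_rw [rI_glue]
  rw [integral_const_mul]
  unfold marginal
  rw [integral_complex_ofReal]

theorem dotp_add (t x y : I → ℝ) : dotp t (x + y) = dotp t x + dotp t y := by
  simp [dotp, mul_add, Finset.sum_add_distrib]

def ech {ι : Type} [Fintype ι] (t x : ι → ℝ) : ℂ := Complex.exp (Complex.I * (dotp t x : ℝ))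

theorem ech_norm {ι : Type} [Fintype ι] (t x : ι → ℝ) : ‖ech t x‖ = 1 := by
  unfold ech; rw [mul_comm]; exact Complex.norm_exp_ofReal_mul_I _

theorem ech_cont {ι : Type} [Fintype ι] : Continuous (fun z : (ι → ℝ) × (ι → ℝ) => ech z.1 z.2) := by
  unfold ech dotp; fun_prop

theorem ech_add (t x y : I → ℝ) : ech t (x + y) = ech t x * ech t y := by
  unfold ech; rw [dotp_add, ← Complex.exp_add]; congr 1; push_cast; ring

theorem law_char (hf : IsDensity f) (hq : IsDensity q) (t : I → ℝ) :
    ‖∫ y, ech t (rI I y) ∂(dm (conv f q))‖ ≤ ‖ftI (marginal I q) t‖ := by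
  have := dm_prob hf
  have := dm_prob hq
  have hc : Measurable (fun x : I → ℝ => ech t x) :=
    (ech_cont.comp (by fun_prop : Continuous fun x : I → ℝ => (t, x))).measurable
  have hcr : Measurable (fun y : Vd d => ech t (rI I y)) := hc.comp rI_meas
  rw [conv_law hf hq, integral_map pF hcr.aestronglyMeasurable,
    integral_prod]
  · have e : ∀ x y : Vd d, ech t (rI I (x + y)) = ech t (rI I x) * ech t (rI I y) := by
      intro x y
      exact ech_add t _ _
    simp_rw [e, integral_const_mul]
    rw [integral_mul_const, norm_mul, marg_int hq hc (fun x => (ech_norm t x).le)]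
    have h1 : ‖∫ x, ech t (rI I x) ∂(dm f)‖ ≤ 1 := by
      refine (norm_integral_le_of_norm_le_const (C := 1) (ae_of_all _ fun x => (ech_norm t _).le)).trans ?_
      simp
    have e3 : ∫ x, ech t x * (marginal I q x : ℂ) = ftI (marginal I q) t := rfl
    rw [e3]
    have := mul_le_mul_of_nonneg_right h1 (norm_nonneg (ftI (marginal I q) t))
    linarith
  · refine Integrable.of_bound (C := 1) ?_ (ae_of_all _ fun z => (ech_norm t _).le)
    exact ((hc.comp rI_meas).comp pF).aestronglyMeasurable
end

end
section

section
variable {ι : Type} [Fintype ι]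

theorem schur {a k : (ι → ℝ) → ℝ≥0∞} (ha : Measurable a) (hk : Measurable k) :
    ∫⁻ z : (ι → ℝ) × (ι → ℝ), a z.1 * a z.2 * k (z.1 - z.2) ≤
      2 * ((∫⁻ t, a t ^ 2) * ∫⁻ u, k u) := by
  have h1 : ∀ z : (ι → ℝ) × (ι → ℝ), a z.1 * a z.2 * k (z.1 - z.2) ≤
      a z.1 ^ 2 * k (z.1 - z.2) + a z.2 ^ 2 * k (z.1 - z.2) := by
    intro z
    rw [← add_mul]
    gcongr
    rcases le_total (a z.1) (a z.2) with h | h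
    · exact le_add_left (by rw [sq]; gcongr)
    · exact le_add_right (by rw [sq]; gcongr)
  refine (lintegral_mono h1).trans ?_
  rw [lintegral_add_left pF, Measure.volume_eq_prod,
    lintegral_prod _ pF, lintegral_prod_symm _ pF, two_mul]
  refine add_le_add (le_of_eq ?_) (le_of_eq ?_)
  · rw [← lintegral_mul_const _ pF]
    refine lintegral_congr fun x => ?_
    dsimp only
    rw [lintegral_const_mul _ pF]
    congr 1
    exact lintegral_sub_left_eq_self k x
  · rw [← lintegral_mul_const _ pF]
    refine lintegral_congr fun x => ?_
    dsimp only
    rw [lintegral_const_mul _ pF]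
    congr 1
    exact lintegral_sub_right_eq_self k x

theorem ech_sub (t s x : ι → ℝ) : ech t x * (starRingEnd ℂ) (ech s x) = ech (t - s) x := by
  unfold ech
  rw [← Complex.exp_conj, ← Complex.exp_add]
  congr 1
  simp [dotp, sub_mul, Finset.sum_sub_distrib]
  ring

theorem ech_neg (t x : ι → ℝ) : cE t x = (starRingEnd ℂ) (ech t x) := by
  unfold ech
  rw [← Complex.exp_conj]
  congr 1
  simp

theorem quadQ (μ : Measure (ι → ℝ)) [IsFiniteMeasure μ] {a : (ι → ℝ) → ℂ} (ham : Measurable a)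
    (ha : Integrable a) :
    ∫⁻ x, ‖∫ t, a t * ech t x‖ₑ ^ 2 ∂μ ≤
      2 * ((∫⁻ t, ‖a t‖ₑ ^ 2) * ∫⁻ u, ‖∫ x, ech u x ∂μ‖ₑ) := by
  have hmA : StronglyMeasurable (fun x => ∫ t, a t * ech t x) := by
    refine StronglyMeasurable.integral_prod_right'
      (f := fun z : (ι → ℝ) × (ι → ℝ) => a z.2 * ech z.2 z.1) ?_
    exact ((ham.comp measurable_snd).mul (ech_cont.measurable.comp measurable_swap)).stronglyMeasurable
  have hbA : ∀ x, ‖∫ t, a t * ech t x‖ ≤ ∫ t, ‖a t‖ := by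
    intro x
    refine (norm_integral_le_integral_norm _).trans (le_of_eq ?_)
    simp [ech_norm]
  have e1 : ∫⁻ x, ‖∫ t, a t * ech t x‖ₑ ^ 2 ∂μ = oR (∫ x, ‖∫ t, a t * ech t x‖ ^ 2 ∂μ) := by
    rw [ofReal_integral_eq_lintegral_ofReal]
    · refine lintegral_congr fun x => ?_
      rw [ENNReal.ofReal_pow (norm_nonneg _), ofReal_norm]
    · refine Integrable.of_bound (C := (∫ t, ‖a t‖) ^ 2) (hmA.norm.measurable.pow_const 2).aestronglyMeasurable
        (ae_of_all _ fun x => ?_)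
      rw [norm_pow, norm_norm]
      exact pow_le_pow_left₀ (norm_nonneg _) (hbA x) 2
    · exact ae_of_all _ fun x => by positivity
  set g : (ι → ℝ) × (ι → ℝ) → ℂ := fun z => a z.1 * (starRingEnd ℂ) (a z.2) with hg
  have hgm : Measurable g := (ham.comp measurable_fst).mul
    (Complex.continuous_conj.measurable.comp (ham.comp measurable_snd))
  have hca : Integrable (fun s => (starRingEnd ℂ) (a s)) := by
    refine ha.norm.mono' (Complex.continuous_conj.measurable.comp ham).aestronglyMeasurable
      (ae_of_all _ fun x => by simp)
  have hgi : Integrable g (volume.prod volume) := ha.mul_prod hca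
  have e2 : ∀ x, ((‖∫ t, a t * ech t x‖ ^ 2 : ℝ) : ℂ) =
      ∫ z, g z * ech (z.1 - z.2) x ∂(volume.prod volume) := by
    intro x
    have e3 : ∀ z : (ι → ℝ) × (ι → ℝ), g z * ech (z.1 - z.2) x =
        (a z.1 * ech z.1 x) * ((starRingEnd ℂ) (a z.2 * ech z.2 x)) := by
      intro z; rw [← ech_sub, map_mul]; ring
    simp_rw [e3]
    rw [integral_prod_mul (fun t => a t * ech t x) (fun s => (starRingEnd ℂ) (a s * ech s x)),
      integral_conj, Complex.mul_conj, Complex.normSq_eq_norm_sq]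
  have hjm : Measurable (fun w : (ι → ℝ) × ((ι → ℝ) × (ι → ℝ)) => ech (w.2.1 - w.2.2) w.1) :=
    (ech_cont.comp (by fun_prop : Continuous fun w : (ι → ℝ) × ((ι → ℝ) × (ι → ℝ)) =>
      (w.2.1 - w.2.2, w.1))).measurable
  have e4 : ((∫ x, ‖∫ t, a t * ech t x‖ ^ 2 ∂μ : ℝ) : ℂ) =
      ∫ z, g z * ∫ x, ech (z.1 - z.2) x ∂μ ∂(volume.prod volume) := by
    rw [← integral_complex_ofReal]
    simp_rw [e2]
    rw [integral_integral_swap]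
    · simp_rw [integral_const_mul]
    · have := hgi.comp_snd μ
      refine Integrable.mul_bdd (c := 1) this hjm.aestronglyMeasurable
        (ae_of_all _ fun w => (ech_norm _ _).le)
  have hχm : Measurable (fun u : ι → ℝ => ‖∫ x, ech u x ∂μ‖ₑ) := by
    refine Measurable.enorm (StronglyMeasurable.measurable ?_)
    exact StronglyMeasurable.integral_prod_right'
      (f := fun z : (ι → ℝ) × (ι → ℝ) => ech z.1 z.2) ech_cont.measurable.stronglyMeasurable
  have e5 : oR (∫ x, ‖∫ t, a t * ech t x‖ ^ 2 ∂μ) =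
      ‖∫ z, g z * ∫ x, ech (z.1 - z.2) x ∂μ ∂(volume.prod volume)‖ₑ := by
    rw [← e4, ← ofReal_norm, Complex.norm_real, Real.norm_of_nonneg]
    exact integral_nonneg fun _ => by positivity
  rw [e1, e5]
  refine (enorm_integral_le_lintegral_enorm _).trans ?_
  refine le_trans (le_of_eq ?_) (schur (a := fun t => ‖a t‖ₑ) ham.enorm hχm)
  rw [Measure.volume_eq_prod]
  refine lintegral_congr fun z => ?_
  rw [enorm_mul, hg, enorm_mul]
  congr 2
  rw [← ofReal_norm, ← ofReal_norm, RCLike.norm_conj]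

end

end
section

section
variable {ι : Type} [Fintype ι]

theorem gauss_char {ε : ℝ} (hε : 0 < ε) (u : ι → ℝ) :
    ∫ x, ech u x ∂(volume.withDensity fun x : ι → ℝ => oR (Real.exp (-ε * ∑ i, x i ^ 2)))
      = (((Real.sqrt (Real.pi / ε)) ^ (Fintype.card ι) * Real.exp (-(4 * ε)⁻¹ * ∑ i, u i ^ 2) : ℝ) : ℂ) := by
  have e : (volume.withDensity fun x : ι → ℝ => oR (Real.exp (-ε * ∑ i, x i ^ 2))) =
    volume.withDensity (fun x => ((Real.exp (-ε * ∑ i, x i ^ 2)).toNNReal : ℝ≥0∞)) := rfl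
  rw [e, integral_withDensity_eq_integral_smul pF]
  have := GaussianFourier.integral_cexp_neg_mul_sum_add (ι := ι) (b := ε) (by simpa using hε) (fun i => Complex.I * u i)
  have e2 : ∀ x : ι → ℝ, (Real.exp (-ε * ∑ i, x i ^ 2)).toNNReal • ech u x =
      Complex.exp (-ε * ∑ i, (x i : ℂ) ^ 2 + ∑ i, (Complex.I * u i) * x i) := by
    intro x
    rw [NNReal.smul_def, Real.coe_toNNReal _ (Real.exp_pos _).le, Complex.real_smul, Complex.exp_add]
    unfold ech dotp
    push_cast
    congr 2
    rw [Finset.mul_sum]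
    refine Finset.sum_congr rfl fun i _ => by ring
  simp_rw [e2]
  rw [this]
  push_cast
  congr 1
  · rw [show ((Real.pi : ℂ) / ε) = ((Real.pi / ε : ℝ) : ℂ) by push_cast; rfl,
      show ((Fintype.card ι : ℂ) / 2) = (((Fintype.card ι : ℝ) / 2 : ℝ) : ℂ) by push_cast; rfl,
      ← Complex.ofReal_cpow pP]
    rw [← Complex.ofReal_pow]
    congr 1
    rw [Real.sqrt_eq_rpow, ← Real.rpow_natCast, ← Real.rpow_mul pP]
    congr 1; ring
  · congr 1
    simp_rw [mul_pow, Complex.I_sq]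
    rw [← Finset.mul_sum]
    field_simp

theorem planch0 {ε : ℝ} (hε : 0 < ε) {a : (ι → ℝ) → ℂ} (ham : Measurable a) (ha : Integrable a) :
    ∫⁻ x : ι → ℝ, oR (Real.exp (-ε * ∑ i, x i ^ 2)) * ‖∫ t, a t * ech t x‖ₑ ^ 2 ≤
      2 * oR ((2 * Real.pi) ^ Fintype.card ι) * ∫⁻ t, ‖a t‖ₑ ^ 2 := by
  have hG : ∀ δ : ℝ, 0 < δ → Integrable (fun x : ι → ℝ => Real.exp (-δ * ∑ i, x i ^ 2)) ∧
      ∫ x : ι → ℝ, Real.exp (-δ * ∑ i, x i ^ 2) = Real.sqrt (Real.pi / δ) ^ Fintype.card ι := by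
    intro δ hδ
    simp_rw [Finset.mul_sum, Real.exp_sum]
    constructor
    · exact Integrable.fintype_prod (f := fun (_ : ι) (v : ℝ) => Real.exp (-δ * v ^ 2)) fun _ =>
        integrable_exp_neg_mul_sq hδ
    · rw [integral_fintype_prod_volume_eq_pow (fun v : ℝ => Real.exp (-δ * v ^ 2)), integral_gaussian]
  have hfin : IsFiniteMeasure (volume.withDensity fun x : ι → ℝ =>
      oR (Real.exp (-ε * ∑ i, x i ^ 2))) :=
    isFiniteMeasure_withDensity_ofReal (hG ε hε).1.2
  have h := quadQ (volume.withDensity fun x : ι → ℝ =>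
      oR (Real.exp (-ε * ∑ i, x i ^ 2))) ham ha
  have hmA : StronglyMeasurable (fun x => ∫ t, a t * ech t x) := by
    refine StronglyMeasurable.integral_prod_right'
      (f := fun z : (ι → ℝ) × (ι → ℝ) => a z.2 * ech z.2 z.1) ?_
    exact ((ham.comp measurable_snd).mul (ech_cont.measurable.comp measurable_swap)).stronglyMeasurable
  rw [lintegral_withDensity_eq_lintegral_mul _ pF (hmA.measurable.enorm.pow_const 2)] at h
  refine h.trans (le_of_eq ?_)
  rw [mul_assoc]
  congr 1
  rw [mul_comm]
  congr 1
  simp_rw [gauss_char hε, ← ofReal_norm, Complex.norm_real]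
  rw [← ofReal_integral_eq_lintegral_ofReal]
  · congr 1
    have hp : ∀ u : ι → ℝ, ‖Real.sqrt (Real.pi / ε) ^ Fintype.card ι *
        Real.exp (-(4 * ε)⁻¹ * ∑ i, u i ^ 2)‖ = Real.sqrt (Real.pi / ε) ^ Fintype.card ι *
        Real.exp (-(4 * ε)⁻¹ * ∑ i, u i ^ 2) := fun u => Real.norm_of_nonneg pP
    simp_rw [hp]
    rw [integral_const_mul, (hG (4 * ε)⁻¹ pP).2, ← mul_pow, ← Real.sqrt_mul pP]
    congr 1
    rw [show Real.pi / ε * (Real.pi / (4 * ε)⁻¹) = (2 * Real.pi) ^ 2 by field_simp; ring]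
    exact Real.sqrt_sq pP
  · exact ((hG (4 * ε)⁻¹ pP).1.const_mul _).norm
  · exact ae_of_all _ fun x => norm_nonneg _

theorem planch1 {a : (ι → ℝ) → ℂ} (ham : Measurable a) (ha : Integrable a) :
    ∫⁻ x : ι → ℝ, ‖∫ t, a t * ech t x‖ₑ ^ 2 ≤
      2 * oR ((2 * Real.pi) ^ Fintype.card ι) * ∫⁻ t, ‖a t‖ₑ ^ 2 := by
  have hmA : StronglyMeasurable (fun x => ∫ t, a t * ech t x) := by
    refine StronglyMeasurable.integral_prod_right'
      (f := fun z : (ι → ℝ) × (ι → ℝ) => a z.2 * ech z.2 z.1) ?_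
    exact ((ham.comp measurable_snd).mul (ech_cont.measurable.comp measurable_swap)).stronglyMeasurable
  have hlim : ∀ x : ι → ℝ, Tendsto (fun N : ℕ => oR (Real.exp (-(1 / ((N : ℝ) + 1)) * ∑ i, x i ^ 2)) *
      ‖∫ t, a t * ech t x‖ₑ ^ 2) atTop (𝓝 (‖∫ t, a t * ech t x‖ₑ ^ 2)) := by
    intro x
    have h1 : Tendsto (fun N : ℕ => Real.exp (-(1 / ((N : ℝ) + 1)) * ∑ i, x i ^ 2)) atTop (𝓝 1) := by
      have := ((tendsto_one_div_add_atTop_nhds_zero_nat (𝕜 := ℝ)).neg.mul_const (∑ i, x i ^ 2)).rexp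
      simpa using this
    have h2 := ENNReal.tendsto_ofReal h1
    rw [ENNReal.ofReal_one] at h2
    have h3 := ENNReal.Tendsto.mul_const (b := ‖∫ t, a t * ech t x‖ₑ ^ 2) h2 (Or.inl one_ne_zero)
    rwa [one_mul] at h3
  have e : ∀ x : ι → ℝ, ‖∫ t, a t * ech t x‖ₑ ^ 2 = liminf (fun N : ℕ =>
      oR (Real.exp (-(1 / ((N : ℝ) + 1)) * ∑ i, x i ^ 2)) *
      ‖∫ t, a t * ech t x‖ₑ ^ 2) atTop := fun x => (hlim x).liminf_eq.symm
  rw [lintegral_congr e]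
  refine (lintegral_liminf_le fun N => ?_).trans ?_
  · exact (by fun_prop : Measurable fun x : ι → ℝ => oR (Real.exp (-(1 / ((N : ℝ) + 1)) * ∑ i, x i ^ 2))).mul
      (hmA.measurable.enorm.pow_const 2)
  · refine liminf_le_of_le (by isBoundedDefault) fun b hb => ?_
    obtain ⟨N, hN⟩ := hb.exists
    exact hN.trans (planch0 pP ham ha)

theorem planch {a : (ι → ℝ) → ℂ} (ham : Measurable a) (ha : Integrable a) :
    ∫⁻ x : ι → ℝ, ‖∫ t, cE t x * a t‖ₑ ^ 2 ≤
      2 * oR ((2 * Real.pi) ^ Fintype.card ι) * ∫⁻ t, ‖a t‖ₑ ^ 2 := by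
  have hca : Integrable (fun s => (starRingEnd ℂ) (a s)) := by
    refine ha.norm.mono' (Complex.continuous_conj.measurable.comp ham).aestronglyMeasurable
      (ae_of_all _ fun x => by simp)
  have := planch1 (Complex.continuous_conj.measurable.comp ham) hca
  have e : ∀ x : ι → ℝ, ‖∫ t, cE t x * a t‖ₑ =
      ‖∫ t, (starRingEnd ℂ) (a t) * ech t x‖ₑ := by
    intro x
    have : ∀ t, (starRingEnd ℂ) (a t) * ech t x =
      (starRingEnd ℂ) (cE t x * a t) := by
      intro t; rw [map_mul, ech_neg, Complex.conj_conj, mul_comm]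
    simp_rw [this]
    rw [integral_conj, ← ofReal_norm, ← ofReal_norm, RCLike.norm_conj]
  simp_rw [e]
  refine this.trans (le_of_eq ?_)
  congr 1
  refine lintegral_congr fun t => ?_
  simp only [Function.comp]
  rw [← ofReal_norm, ← ofReal_norm, RCLike.norm_conj]

end

end
section

theorem kap_exists {K : ℝ → ℝ} (hK : IsKernel K) : ∃ κ : SchwartzMap ℝ ℂ, ∀ s : ℝ,
    κ s = ∫ x, Complex.exp (Complex.I * ((s * x : ℝ) : ℂ)) * (K x : ℂ) := by
  obtain ⟨KS, rfl⟩ := hK.1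
  set KC : SchwartzMap ℝ ℂ := KS.postcompCLM Complex.ofRealCLM
  have hne : (-(2 * Real.pi)⁻¹) ≠ 0 := by
    have := Real.pi_pos
    simp
  refine ⟨SchwartzMap.compCLMOfContinuousLinearEquiv ℂ
    (ContinuousLinearEquiv.smulLeft (R₁ := ℝ) (M₁ := ℝ) (Units.mk0 (-(2 * Real.pi)⁻¹) hne))
    (FourierTransform.fourier KC), fun s => ?_⟩
  simp only [SchwartzMap.compCLMOfContinuousLinearEquiv_apply, Function.comp_apply]
  rw [SchwartzMap.fourier_coe, Real.fourier_real_eq_integral_exp_smul]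
  congr 1; funext x
  rw [smul_eq_mul]
  congr 1
  · congr 1
    simp [Units.smul_def]
    have : (Real.pi : ℂ) ≠ 0 := by simp [Real.pi_ne_zero]
    field_simp

theorem schwartz_decay (κ : SchwartzMap ℝ ℂ) (n : ℕ) (s : ℝ) : ∃ C : ℝ, 0 < C ∧ ∀ x : ℝ,
    ‖iteratedDeriv n κ x‖ ≤ C * (1 + x ^ 2) ^ (-s) := by
  set k := ⌈2 * s⌉₊
  obtain ⟨C, hC⟩ : ∃ C : ℝ, ∀ x : ℝ, (1 + ‖x‖) ^ k * ‖iteratedFDeriv ℝ n κ x‖ ≤ C :=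
    ⟨_, fun x => SchwartzMap.one_add_le_sup_seminorm_apply (𝕜 := ℝ) (m := (k, n)) le_rfl le_rfl κ x⟩
  refine ⟨max C 1, by positivity, fun x => ?_⟩
  have hx : 0 < 1 + x ^ 2 := by positivity
  rw [Real.rpow_neg hx.le, ← div_eq_mul_inv, le_div_iff₀ pP]
  rw [← norm_iteratedFDeriv_eq_norm_iteratedDeriv]
  refine le_trans ?_ ((hC x).trans (le_max_left _ _))
  rw [mul_comm]
  refine mul_le_mul_of_nonneg_right ?_ (norm_nonneg _)
  have h1 : 1 + x ^ 2 ≤ (1 + |x|) ^ (2:ℝ) := by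
    rw [Real.rpow_two]; nlinarith [sq_abs x, abs_nonneg x]
  have hone : (1:ℝ) ≤ 1 + |x| := by linarith [abs_nonneg x]
  rcases le_or_gt 0 s with hs | hs
  · calc (1 + x ^ 2) ^ s ≤ ((1 + |x|) ^ (2:ℝ)) ^ s := Real.rpow_le_rpow hx.le h1 hs
      _ = (1 + |x|) ^ (2 * s) := (Real.rpow_mul pL _ _).symm
      _ ≤ (1 + |x|) ^ (k : ℝ) := Real.rpow_le_rpow_of_exponent_le hone (Nat.le_ceil _)
      _ = _ := by rw [Real.rpow_natCast]; rfl
  · calc (1 + x ^ 2) ^ s ≤ 1 := Real.rpow_le_one_of_one_le_of_nonpos (by nlinarith) hs.le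
      _ ≤ _ := one_le_pow₀ hone

section
variable {d : ℕ} {I : Finset (Fin d)} {K : ℝ → ℝ} {h : Vd d}

theorem ft_Kh (κ : SchwartzMap ℝ ℂ)
    (hκ : eFT κ K)
    (hh : ∀ j ∈ I, 0 < h j) (t : I → ℝ) :
    ftI (Kh I K h) t = ∏ j : I, κ (h j * t j) := by
  have e : ∀ x : I → ℝ, Complex.exp (Complex.I * (dotp t x : ℝ)) * (Kh I K h x : ℂ) =
      ∏ j : I, (Complex.exp (Complex.I * ((t j * x j : ℝ) : ℂ)) * (((h j)⁻¹ : ℝ) * (K (x j / h j) : ℂ))) := by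
    intro x
    unfold Kh dotp
    rw [Finset.prod_mul_distrib, ← Complex.exp_sum, Finset.prod_mul_distrib]
    push_cast
    rw [Finset.mul_sum, ← Finset.prod_coe_sort I (fun j => (h j : ℂ)), Finset.prod_inv_distrib]
  unfold ftI
  simp_rw [e]
  rw [integral_fintype_prod_volume_eq_prod (f := fun (j : I) (x : ℝ) =>
    (Complex.exp (Complex.I * ((t j * x : ℝ) : ℂ)) * (((h j)⁻¹ : ℝ) * (K (x / h j) : ℂ))))]
  refine Finset.prod_congr rfl fun j _ => ?_
  have hj := hh j j.2
  rw [hκ]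
  have e2 : ∀ x : ℝ, Complex.exp (Complex.I * ((t j * x : ℝ) : ℂ)) * (((h j)⁻¹ : ℝ) * (K (x / h j) : ℂ))
      = ((h j)⁻¹ : ℝ) • (fun u : ℝ => Complex.exp (Complex.I * ((h j * t j * u : ℝ) : ℂ)) * (K u : ℂ)) (x / h j) := by
    intro x
    rw [Complex.real_smul]
    dsimp only
    rw [show h j * t j * (x / h j) = t j * x by field_simp]
    ring
  simp_rw [e2]
  rw [integral_smul, Measure.integral_comp_div (g := fun u : ℝ => Complex.exp (Complex.I * ((h j * t j * u : ℝ) : ℂ)) * (K u : ℂ)),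
    abs_of_pos hj, smul_smul, inv_mul_cancel₀ hj.ne', one_smul]

theorem ftmarg_meas {q : Vd d → ℝ} (hq : IsDensity q) : Measurable (ftI (marginal I q)) := by
  have := dm_prob hq
  have e : ftI (marginal I q) = fun t => ∫ y, ech t (rI I y) ∂(dm q) := by
    funext t
    rw [marg_int hq]
    · rfl
    · exact (ech_cont.comp (by fun_prop : Continuous fun x : I → ℝ => (t, x))).measurable
    · exact fun x => (ech_norm t x).le
  rw [e]
  refine (StronglyMeasurable.integral_prod_right' (f := fun z : (I → ℝ) × Vd d => ech z.1 (rI I z.2)) ?_).measurable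
  exact (ech_cont.measurable.comp (measurable_fst.prodMk (rI_meas.comp measurable_snd))).stronglyMeasurable

def GB (I : Finset (Fin d)) (q : Vd d → ℝ) (A : ℝ) (lam : Vd d) : Prop :=
  0 < A ∧ (∀ j, 0 < lam j) ∧
  ∀ t : I → ℝ, ‖(ftI (marginal I q) t)⁻¹‖ ≤ A * ∏ j : I, (1 + t j ^ 2) ^ (lam j / 2)

theorem N1N2.gb {q : Vd d → ℝ} {A : ℝ} {lam : Vd d} {p : ℝ≥0∞} (hI : I.Nonempty) (hN : N1N2 p I q A lam) :
    GB I q A lam := by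
  refine ⟨hN.1, hN.2.1, fun t => ?_⟩
  have hA := hN.1
  by_cases h2 : p = 2
  · have h := (hN.2.2.1 h2).2 t
    have hpos : 0 < A⁻¹ * ∏ j : I, (1 + t j ^ 2) ^ (-lam ↑j / 2) :=
      mul_pos (inv_pos.2 hA) (Finset.prod_pos fun j _ => by positivity)
    rw [norm_inv]
    refine (inv_anti₀ hpos h).trans (le_of_eq ?_)
    rw [mul_inv, inv_inv, ← Finset.prod_inv_distrib]
    congr 1
    refine Finset.prod_congr rfl fun j _ => ?_
    rw [neg_div, Real.rpow_neg pP, inv_inv]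
  · by_cases ht : p = ⊤
    · obtain ⟨k, hk⟩ := hI
      exact (hN.2.2.2.2.2 ht).2.2 ⟨k, hk⟩ 0 pN t
    · have := (hN.2.2.2.2.1 h2 ht).2.2 (fun _ => 0) pS t
      have e : multiPD (fun _ : I => 0) (fun u => (ftI (marginal I q) u)⁻¹) = fun u => (ftI (marginal I q) u)⁻¹ := by
        unfold multiPD
        generalize (Finset.univ (α := I)).toList = l
        induction l with
        | nil => rfl
        | cons a l ih => simpa using ih
      rw [e] at this
      simpa using this
end

end
section

section
variable {d : ℕ} {I : Finset (Fin d)} {K : ℝ → ℝ} {h : Vd d}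

def mul (I : Finset (Fin d)) (κ : SchwartzMap ℝ ℂ) (q : Vd d → ℝ) (h : Vd d) (t : I → ℝ) : ℂ :=
  (∏ j : I, κ (h j * t j)) * (ftI (marginal I q) t)⁻¹

theorem mul_meas (κ : SchwartzMap ℝ ℂ) {q : Vd d → ℝ} (hq : IsDensity q) :
    Measurable (mul I κ q h) := by
  unfold mul
  refine Measurable.mul ?_ (ftmarg_meas hq).inv
  exact Finset.measurable_prod _ fun j _ =>
    κ.continuous.measurable.comp ((measurable_pi_apply j).const_mul _)

theorem one_d {lam h t : ℝ} (hl : 0 < lam) (h0 : 0 < h) (h1 : h ≤ 1) :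
    (1 + t ^ 2) ^ (lam / 2) ≤ h ^ (-lam) * (1 + (h * t) ^ 2) ^ (lam / 2) := by
  have : h ^ (-lam) = ((h ^ 2)⁻¹) ^ (lam / 2) := by
    rw [Real.inv_rpow pP, ← Real.rpow_natCast, ← Real.rpow_mul h0.le, ← Real.rpow_neg h0.le]
    congr 1; push_cast; ring
  rw [this, ← Real.mul_rpow pP pP]
  refine Real.rpow_le_rpow pP ?_ pP
  rw [inv_mul_eq_div, le_div_iff₀ pP]
  nlinarith [mul_pos h0 h0]

theorem mulB (κ : SchwartzMap ℝ ℂ) {q : Vd d → ℝ} {A : ℝ} {lam : Vd d} (hG : GB I q A lam) :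
    ∃ C : ℝ, 0 < C ∧ ∀ h : Vd d, (∀ j ∈ I, 0 < h j ∧ h j ≤ 1) → ∀ t : I → ℝ,
      ‖mul I κ q h t‖ ≤ C * (∏ j : I, h j ^ (-lam j)) * ∏ j : I, ((1 + (h j * t j) ^ 2)⁻¹) ^ 2 := by
  obtain ⟨hA, hl, hg⟩ := hG
  choose c hc0 hc using fun j : I => schwartz_decay κ 0 (lam j / 2 + 2)
  refine ⟨(∏ j, c j) * A, mul_pos (Finset.prod_pos fun j _ => hc0 j) hA, fun h hh t => ?_⟩
  unfold mul
  rw [norm_mul, norm_prod]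
  calc (∏ j : I, ‖κ (h j * t j)‖) * ‖(ftI (marginal I q) t)⁻¹‖
      ≤ (∏ j : I, ‖κ (h j * t j)‖) * (A * ∏ j : I, (1 + t j ^ 2) ^ (lam j / 2)) := by
        exact mul_le_mul_of_nonneg_left (hg t) (Finset.prod_nonneg fun j _ => norm_nonneg (κ (h j * t j)))
    _ = A * ∏ j : I, (‖κ (h j * t j)‖ * (1 + t j ^ 2) ^ (lam j / 2)) := by
        rw [Finset.prod_mul_distrib]; ring
    _ ≤ A * ∏ j : I, (c j * h j ^ (-lam j) * ((1 + (h j * t j) ^ 2)⁻¹) ^ 2) := by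
        refine mul_le_mul_of_nonneg_left (Finset.prod_le_prod (fun j _ => by positivity) fun j _ => ?_) hA.le
        have hj := hh j j.2
        have e1 := hc j (h j * t j)
        rw [iteratedDeriv_zero] at e1
        have e2 := one_d (t := t j) (hl j) hj.1 hj.2
        have hp : 0 < 1 + (h j * t j) ^ 2 := by positivity
        calc _ ≤ (c j * (1 + (h j * t j) ^ 2) ^ (-(lam j / 2 + 2))) *
              (h j ^ (-lam j) * (1 + (h j * t j) ^ 2) ^ (lam j / 2)) := by
              exact mul_le_mul e1 e2 pP ((norm_nonneg _).trans e1)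
          _ = c j * h j ^ (-lam j) * ((1 + (h j * t j) ^ 2) ^ (-(lam j / 2 + 2)) * (1 + (h j * t j) ^ 2) ^ (lam j / 2)) := by ring
          _ = _ := by
            rw [← Real.rpow_add hp, inv_pow, ← Real.rpow_natCast (1 + (h j * t j) ^ 2) 2, ← Real.rpow_neg hp.le]
            congr 2; push_cast; ring
    _ = _ := by
        rw [Finset.prod_mul_distrib, Finset.prod_mul_distrib]; ring

theorem E1_int (hh : ∀ j ∈ I, 0 < h j) :
    Integrable (fun t : I → ℝ => ∏ j : I, (1 + (h j * t j) ^ 2)⁻¹) ∧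
    ∫ t : I → ℝ, ∏ j : I, (1 + (h j * t j) ^ 2)⁻¹ = ∏ j : I, (Real.pi * (h j)⁻¹) := by
  have hi : ∀ j : I, Integrable (fun s : ℝ => (1 + (h j * s) ^ 2)⁻¹) := fun j =>
    (integrable_inv_one_add_sq.comp_mul_left' (hh j j.2).ne')
  refine ⟨Integrable.fintype_prod (f := fun (j : I) (s : ℝ) => (1 + (h j * s) ^ 2)⁻¹) hi, ?_⟩
  rw [integral_fintype_prod_volume_eq_prod (f := fun (j : I) (s : ℝ) => (1 + (h j * s) ^ 2)⁻¹)]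
  refine Finset.prod_congr rfl fun j _ => ?_
  rw [Measure.integral_comp_mul_left (g := fun s : ℝ => (1 + s ^ 2)⁻¹), integral_univ_inv_one_add_sq,
    abs_of_pos (inv_pos.2 (hh j j.2)), smul_eq_mul, mul_comm]

def PW (I : Finset (Fin d)) (h : Vd d) (e : Vd d) : ℝ := ∏ j : I, h j ^ e j

theorem PW_pos (hh : ∀ j ∈ I, 0 < h j) (e : Vd d) : 0 < PW I h e :=
  Finset.prod_pos fun j _ => Real.rpow_pos_of_pos (hh j j.2) _
theorem PW_mul (hh : ∀ j ∈ I, 0 < h j) (e e' : Vd d) : PW I h e * PW I h e' = PW I h (fun j => e j + e' j) := by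
  unfold PW
  rw [← Finset.prod_mul_distrib]
  exact Finset.prod_congr rfl fun j _ => (Real.rpow_add (hh j j.2) _ _).symm
theorem PW_rpow (hh : ∀ j ∈ I, 0 < h j) (e : Vd d) (s : ℝ) : PW I h e ^ s = PW I h (fun j => e j * s) := by
  unfold PW
  rw [← Real.finsetProd_rpow _ (fun j : I => h j ^ e j) fun j _ => (Real.rpow_pos_of_pos (hh j j.2) _).le]
  exact Finset.prod_congr rfl fun j _ => (Real.rpow_mul (hh j j.2).le _ _).symm
theorem PW_eq (e : Vd d) : ∏ j ∈ I, h j ^ e j = PW I h e :=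
  (Finset.prod_coe_sort I (fun j => h j ^ e j)).symm
theorem E1_val (hh : ∀ j ∈ I, 0 < h j) :
   ∫ t : I → ℝ, ∏ j : I, (1 + (h j * t j) ^ 2)⁻¹ = Real.pi ^ I.card * PW I h (fun _ => -1) := by
  rw [(E1_int hh).2, Finset.prod_mul_distrib]
  simp [PW, Real.rpow_neg_one]

theorem E1_le (t : I → ℝ) : ∏ j : I, (1 + (h j * t j) ^ 2)⁻¹ ≤ 1 :=
  Finset.prod_le_one (fun j _ => by positivity) fun j _ => inv_le_one_of_one_le₀ (by nlinarith [sq_nonneg (h j * t j)])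
theorem E1_nn (t : I → ℝ) : 0 ≤ ∏ j : I, (1 + (h j * t j) ^ 2)⁻¹ :=
  Finset.prod_nonneg (fun j _ => by positivity)

end

end
section

section
variable {d : ℕ} {I : Finset (Fin d)} {K : ℝ → ℝ}

def HU (I : Finset (Fin d)) (h : Vd d) : Prop := ∀ j ∈ I, 0 < h j ∧ h j ≤ 1

theorem HU.pos {h : Vd d} (H : HU I h) : ∀ j ∈ I, 0 < h j := fun j hj => (H j hj).1

theorem PW_anti {h : Vd d} (H : HU I h) {e e' : Vd d} (hle : ∀ j, e j ≤ e' j) :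
    PW I h e' ≤ PW I h e :=
  Finset.prod_le_prod (fun j _ => (Real.rpow_pos_of_pos (H j j.2).1 _).le) fun j _ =>
    Real.rpow_le_rpow_of_exponent_ge (H j j.2).1 (H j j.2).2 (hle j)

theorem inv_le_PW {h : Vd d} (H : HU I h) (j : I) : (h j)⁻¹ ≤ PW I h (fun _ => -1) := by
  unfold PW
  rw [← Finset.mul_prod_erase _ _ (Finset.mem_univ j), Real.rpow_neg_one]
  refine le_mul_of_one_le_right (inv_pos.2 (H j j.2).1).le ?_
  refine Finset.prod_induction (fun i : I => h i ^ (-1 : ℝ)) (fun x => 1 ≤ x) (fun a b => one_le_mul_of_one_le_of_one_le) le_rfl fun i _ => ?_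
  rw [Real.rpow_neg_one]
  exact (one_le_inv₀ (H i i.2).1).2 (H i i.2).2

theorem Lh_eq (κ : SchwartzMap ℝ ℂ)
    (hκ : eFT κ K)
    (q : Vd d → ℝ) {h : Vd d} (H : HU I h) (x : I → ℝ) :
    Lh I K q h x = (((2 * Real.pi) ^ (-(I.card : ℝ)) : ℝ) : ℂ) *
      ∫ t : I → ℝ, cE t x * mul I κ q h t := by
  unfold Lh mul
  simp_rw [ft_Kh κ hκ H.pos, div_eq_mul_inv]

theorem two_pi_le (m : ℕ) : (2 * Real.pi) ^ (-(m : ℝ)) ≤ 1 :=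
  Real.rpow_le_one_of_one_le_of_nonpos (by linarith [Real.pi_gt_three]) pS
theorem two_pi_nn (m : ℕ) : 0 < (2 * Real.pi) ^ (-(m : ℝ)) := by positivity

theorem mulBds (κ : SchwartzMap ℝ ℂ) {q : Vd d → ℝ} (hq : IsDensity q) {A : ℝ} {lam : Vd d} (hG : GB I q A lam) :
    ∃ C : ℝ, 0 < C ∧ ∀ h : Vd d, HU I h →
      Integrable (mul I κ q h) ∧ (∫ t, ‖mul I κ q h t‖ ≤ C * PW I h (fun j => -lam j - 1)) ∧
      (∫⁻ t, ‖mul I κ q h t‖ₑ ^ 2 ≤ oR (C * PW I h (fun j => -2 * lam j - 1))) ∧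
      (∀ t, ‖mul I κ q h t‖ ≤ C * PW I h (fun j => -lam j)) ∧
      (Integrable (fun t => (∑ j, |t j|) * ‖mul I κ q h t‖)) ∧
      (∫ t, (∑ j, |t j|) * ‖mul I κ q h t‖ ≤ C * PW I h (fun j => -lam j - 2)) := by
  obtain ⟨C, hC, hb⟩ := mulB κ hG
  set D := 1 + C + C ^ 2 with hD
  set c1 := D * Real.pi ^ I.card with hc1
  have hpi : 1 ≤ Real.pi ^ I.card := one_le_pow₀ (by linarith [Real.pi_gt_three])
  have hDp : 0 < D := by positivity
  have hc1p : 0 < c1 := by positivity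
  set c2 := c1 * (1 + I.card) with hc2
  have c1D : D ≤ c1 := le_mul_of_one_le_right hDp.le hpi
  have c21 : c1 ≤ c2 := le_mul_of_one_le_right hc1p.le pS
  have CD : C ≤ D := by nlinarith
  refine ⟨c2, by positivity, fun h H => ?_⟩
  obtain ⟨E, hE⟩ : ∃ E : (I → ℝ) → ℝ, E = fun t : I → ℝ => ∏ j : I, (1 + (h j * t j) ^ 2)⁻¹ := ⟨_, rfl⟩
  have hEi : Integrable E := by rw [hE]; exact (E1_int H.pos).1
  have hEv : ∫ t, E t = Real.pi ^ I.card * PW I h (fun _ => -1) := by rw [hE]; exact E1_val H.pos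
  have hE1 : ∀ t, E t ≤ 1 := by rw [hE]; exact E1_le
  have hE0 : ∀ t, 0 ≤ E t := by rw [hE]; exact E1_nn
  set P0 := PW I h (fun j => -lam j) with hP0
  have hP0p : 0 < P0 := PW_pos H.pos _
  have hP1p : 0 < PW I h (fun _ => -1) := PW_pos H.pos _
  have hb' : ∀ t, ‖mul I κ q h t‖ ≤ C * P0 * (E t) ^ 2 := by
    intro t
    refine (hb h H t).trans (le_of_eq ?_)
    rw [hE, Finset.prod_pow]; rfl
  have hb1 : ∀ t, ‖mul I κ q h t‖ ≤ C * P0 * (E t) := by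
    intro t
    refine (hb' t).trans ?_
    have : E t ^ 2 ≤ E t := by nlinarith [hE0 t, hE1 t]
    gcongr
  have hb0 : ∀ t, ‖mul I κ q h t‖ ≤ C * P0 := by
    intro t
    refine (hb1 t).trans ?_
    have := hE1 t
    nlinarith [mul_pos hC hP0p]
  have hm := mul_meas (I := I) (h := h) κ hq
  have hi : Integrable (mul I κ q h) :=
    (hEi.const_mul (C * P0)).mono' hm.aestronglyMeasurable (ae_of_all _ hb1)
  have pp : P0 * PW I h (fun _ => -1) = PW I h (fun j => -lam j - 1) := by
    rw [hP0, PW_mul H.pos]; rfl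
  have pp2 : P0 * P0 * PW I h (fun _ => -1) = PW I h (fun j => -2 * lam j - 1) := by
    rw [hP0, PW_mul H.pos, PW_mul H.pos]; congr 1; funext j; ring
  have pp3 : P0 * PW I h (fun _ => -1) * PW I h (fun _ => -1) = PW I h (fun j => -lam j - 2) := by
    rw [hP0, PW_mul H.pos, PW_mul H.pos]; congr 1; funext j; ring
  have hsum : ∀ t : I → ℝ, (∑ j, |t j|) * ‖mul I κ q h t‖ ≤ I.card * PW I h (fun _ => -1) * (C * P0) * E t := by
    intro t
    have h1 : ∀ j : I, |t j| * E t ≤ PW I h (fun _ => -1) := by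
      intro j
      refine le_trans ?_ (inv_le_PW H j)
      have hj := (H j j.2).1
      have : E t ≤ (1 + (h j * t j) ^ 2)⁻¹ := by
        rw [hE]; dsimp only
        rw [← Finset.mul_prod_erase _ _ (Finset.mem_univ j)]
        exact mul_le_of_le_one_right pP (Finset.prod_le_one (fun j _ => by positivity) fun j _ => inv_le_one_of_one_le₀ (by nlinarith [sq_nonneg (h j * t j)]))
      refine (mul_le_mul_of_nonneg_left this (abs_nonneg _)).trans ?_
      rw [← div_eq_mul_inv, inv_eq_one_div, div_le_div_iff₀ pP hj]
      have : |h j * t j| = |t j| * h j := by rw [abs_mul, abs_of_pos hj, mul_comm]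
      rw [← this]
      nlinarith [sq_abs (h j * t j), sq_nonneg (|h j * t j| - 1)]
    calc _ ≤ (∑ j, |t j|) * (C * P0 * (E t) ^ 2) := by
          exact mul_le_mul_of_nonneg_left (hb' t) (Finset.sum_nonneg fun _ _ => abs_nonneg _)
      _ = (∑ j, |t j| * E t) * (C * P0 * E t) := by rw [← Finset.sum_mul]; ring
      _ ≤ (∑ j : I, PW I h (fun _ => -1)) * (C * P0 * E t) :=
          mul_le_mul_of_nonneg_right (Finset.sum_le_sum fun j _ => h1 j) (mul_nonneg pP (hE0 t))
      _ = _ := by simp; ring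
  have hi2 : Integrable (fun t => (∑ j, |t j|) * ‖mul I κ q h t‖) := by
    refine (hEi.const_mul (I.card * PW I h (fun _ => -1) * (C * P0))).mono' ?_ (ae_of_all _ fun t => ?_)
    · exact ((Finset.measurable_sum _ fun j _ => (measurable_pi_apply j).abs).mul hm.norm).aestronglyMeasurable
    · rw [Real.norm_of_nonneg (mul_nonneg (Finset.sum_nonneg fun _ _ => abs_nonneg _) (norm_nonneg _))]
      exact hsum t
  refine ⟨hi, ?_, ?_, ?_, hi2, ?_⟩
  · calc _ ≤ ∫ t, C * P0 * E t := integral_mono hi.norm (hEi.const_mul _) hb1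
      _ = C * Real.pi ^ I.card * PW I h (fun j => -lam j - 1) := by
        rw [integral_const_mul, hEv, ← pp]; ring
      _ ≤ _ := by
        have := (PW_pos H.pos (fun j => -lam j - 1)).le
        gcongr
        exact (mul_le_mul_of_nonneg_right CD pP).trans c21
  · calc _ ≤ ∫⁻ t, oR (C ^ 2 * (P0 * P0) * E t) := by
          refine lintegral_mono fun t => ?_
          rw [← ofReal_norm, ← ENNReal.ofReal_pow (norm_nonneg _)]
          refine ENNReal.ofReal_le_ofReal ?_
          have h1 := hb0 t; have h2 := hb1 t
          calc ‖mul I κ q h t‖ ^ 2 = ‖mul I κ q h t‖ * ‖mul I κ q h t‖ := by ring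
            _ ≤ (C * P0) * (C * P0 * E t) := mul_le_mul h1 h2 (norm_nonneg _) pP
            _ = _ := by ring
      _ = oR (C ^ 2 * Real.pi ^ I.card * PW I h (fun j => -2 * lam j - 1)) := by
        rw [← ofReal_integral_eq_lintegral_ofReal (hEi.const_mul _) (ae_of_all _ fun t => mul_nonneg pP (hE0 t)),
          integral_const_mul, hEv, ← pp2]
        congr 1; ring
      _ ≤ _ := by
        refine ENNReal.ofReal_le_ofReal ?_
        have := (PW_pos H.pos (fun j => -2 * lam j - 1)).le
        gcongr
        refine (mul_le_mul_of_nonneg_right ?_ pP).trans c21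
        nlinarith
  · intro t
    refine (hb0 t).trans ?_
    gcongr
    linarith
  · calc _ ≤ ∫ t, I.card * PW I h (fun _ => -1) * (C * P0) * E t := integral_mono hi2 (hEi.const_mul _) hsum
      _ = (C * Real.pi ^ I.card) * I.card * PW I h (fun j => -lam j - 2) := by
        rw [integral_const_mul, hEv, ← pp3]; ring
      _ ≤ _ := by
        have := (PW_pos H.pos (fun j => -lam j - 2)).le
        gcongr
        rw [hc2]
        gcongr
        · exact mul_le_mul_of_nonneg_right CD pP
        · linarith

theorem dotp_sub_le (t x x' : I → ℝ) : |dotp t x - dotp t x'| ≤ (∑ j, |t j|) * ‖x - x'‖ := by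
  unfold dotp
  rw [← Finset.sum_sub_distrib, Finset.sum_mul]
  refine (Finset.abs_sum_le_sum_abs _ _).trans (Finset.sum_le_sum fun j _ => ?_)
  rw [← mul_sub, abs_mul]
  exact mul_le_mul_of_nonneg_left (norm_le_pi_norm (x - x') j) (abs_nonneg _)

theorem LBds (κ : SchwartzMap ℝ ℂ)
    (hκ : eFT κ K)
    {q : Vd d → ℝ} (hq : IsDensity q) {A : ℝ} {lam : Vd d} (hG : GB I q A lam) :
    ∃ C : ℝ, 0 < C ∧ ∀ h : Vd d, HU I h →
      Continuous (Lh I K q h) ∧ (∀ x, ‖Lh I K q h x‖ ≤ C * PW I h (fun j => -lam j - 1)) ∧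
      (∫⁻ x, ‖Lh I K q h x‖ₑ ^ 2 ≤ oR (C * PW I h (fun j => -2 * lam j - 1))) ∧
      (∀ x x', ‖Lh I K q h x - Lh I K q h x'‖ ≤ C * PW I h (fun j => -lam j - 2) * ‖x - x'‖) := by
  obtain ⟨C, hC, hb⟩ := mulBds κ hq hG
  set c2 := 2 * (2 * Real.pi) ^ I.card * C with hc2
  have hpi : 1 ≤ (2 * Real.pi) ^ I.card := one_le_pow₀ (by linarith [Real.pi_gt_three])
  have hCc : C ≤ c2 := by rw [hc2]; nlinarith
  refine ⟨c2, by positivity, fun h H => ?_⟩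
  obtain ⟨hi, h1, h2, -, hi3, h3⟩ := hb h H
  have hm := mul_meas (I := I) (h := h) κ hq
  have nrm : ∀ (t x : I → ℝ), ‖cE t x‖ = 1 := fun t x => by
    rw [ech_neg, RCLike.norm_conj, ech_norm]
  have hc : ∀ x : I → ℝ, Measurable fun t : I → ℝ => cE t x := by
    intro x
    unfold dotp
    fun_prop
  have hii : ∀ x : I → ℝ, Integrable fun t => cE t x * mul I κ q h t := by
    intro x
    refine hi.norm.mono' ((hc x).mul hm).aestronglyMeasurable (ae_of_all _ fun t => ?_)
    rw [norm_mul, nrm, one_mul]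
  have hw := two_pi_le I.card
  have hw0 := two_pi_nn I.card
  have hnw : ‖(((2 * Real.pi) ^ (-(I.card : ℝ)) : ℝ) : ℂ)‖ ≤ 1 := by
    rw [Complex.norm_real, Real.norm_of_nonneg hw0.le]; exact hw
  have hlip : ∀ x x', ‖Lh I K q h x - Lh I K q h x'‖ ≤ c2 * PW I h (fun j => -lam j - 2) * ‖x - x'‖ := by
    intro x x'
    rw [Lh_eq κ hκ q H, Lh_eq κ hκ q H, ← mul_sub, ← integral_sub (hii x) (hii x'), norm_mul]
    refine (mul_le_of_le_one_left (norm_nonneg _) hnw).trans ?_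
    calc _ ≤ ∫ t, ((∑ j, |t j|) * ‖mul I κ q h t‖) * ‖x - x'‖ := by
          refine norm_integral_le_of_norm_le (hi3.mul_const _) (ae_of_all _ fun t => ?_)
          rw [← sub_mul, norm_mul]
          have : ‖cE t x - Complex.exp (-(Complex.I * (dotp t x' : ℝ)))‖ ≤ (∑ j, |t j|) * ‖x - x'‖ := by
            refine le_trans ?_ (dotp_sub_le t x x')
            have e : cE t x - Complex.exp (-(Complex.I * (dotp t x' : ℝ)))
              = Complex.exp (-(Complex.I * (dotp t x' : ℝ))) * (Complex.exp (Complex.I * ((dotp t x' - dotp t x : ℝ) : ℂ)) - 1) := by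
              rw [mul_sub, mul_one, ← Complex.exp_add]; congr 2; push_cast; ring
            rw [e, norm_mul, nrm, one_mul, abs_sub_comm]
            exact Real.norm_exp_I_mul_ofReal_sub_one_le
          nlinarith [norm_nonneg (mul I κ q h t)]
      _ = (∫ t, ((∑ j, |t j|) * ‖mul I κ q h t‖)) * ‖x - x'‖ := integral_mul_const _ _
      _ ≤ _ := by
          have := (PW_pos H.pos (fun j => -lam j - 2)).le
          gcongr
          exact h3.trans (by gcongr)
  refine ⟨?_, ?_, ?_, hlip⟩
  · have := PW_pos H.pos (fun j => -lam j - 2)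
    exact (LipschitzWith.of_dist_le_mul (K := (c2 * PW I h (fun j => -lam j - 2)).toNNReal) fun x y => by
      rw [dist_eq_norm, dist_eq_norm, Real.coe_toNNReal _ pP]; exact hlip x y).continuous
  · intro x
    rw [Lh_eq κ hκ q H, norm_mul]
    refine (mul_le_of_le_one_left (norm_nonneg _) hnw).trans ((norm_integral_le_integral_norm _).trans ?_)
    simp_rw [norm_mul, nrm, one_mul]
    have := (PW_pos H.pos (fun j => -lam j - 1)).le
    exact h1.trans (by gcongr)
  · calc _ ≤ ∫⁻ x : I → ℝ, ‖∫ t : I → ℝ, cE t x * mul I κ q h t‖ₑ ^ 2 := by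
          refine lintegral_mono fun x => ?_
          dsimp only
          rw [Lh_eq κ hκ q H, enorm_mul]
          gcongr
          refine mul_le_of_le_one_left zero_le ?_
          rw [← ofReal_norm]; exact ENNReal.ofReal_le_one.2 hnw
      _ ≤ 2 * oR ((2 * Real.pi) ^ Fintype.card I) * ∫⁻ t, ‖mul I κ q h t‖ₑ ^ 2 := planch hm hi
      _ ≤ 2 * oR ((2 * Real.pi) ^ Fintype.card I) * oR (C * PW I h (fun j => -2 * lam j - 1)) := by gcongr
      _ = _ := by
          have := (PW_pos H.pos (fun j => -2 * lam j - 1)).le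
          rw [hc2, show (2 : ℝ≥0∞) = oR 2 by simp, ← ENNReal.ofReal_mul pP, ← ENNReal.ofReal_mul pP, Fintype.card_coe]
          congr 1; ring
end

end
section

section
variable {d : ℕ} {I : Finset (Fin d)} {K : ℝ → ℝ}

theorem Lh_congr (q : Vd d → ℝ) {h h' : Vd d} (e : ∀ j ∈ I, h j = h' j) :
    Lh I K q h = Lh I K q h' := by
  have : Kh I K h = Kh I K h' := by
    funext x
    unfold Kh
    rw [Finset.prod_congr rfl e]
    congr 1
    exact Finset.prod_congr rfl fun j _ => by rw [e j j.2]
  unfold Lh; rw [this]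
theorem xi_congr (f q : Vd d → ℝ) {h h' : Vd d} (e : ∀ j ∈ I, h j = h' j) {n : ℕ} (y : Fin n → Vd d) :
    xiProc I K f q h y = xiProc I K f q h' y := by
  unfold xiProc fHat fHatMean; rw [Lh_congr q e]
theorem Up_congr (q : Vd d → ℝ) (lam : Vd d) (p : ℝ≥0∞) (n : ℕ) {h h' : Vd d} (e : ∀ j ∈ I, h j = h' j) :
    Up K q lam p n I h = Up K q lam p n I h' := by
  unfold Up
  rw [Lh_congr q e, Finset.prod_congr rfl fun j hj => show h j ^ (-lam j - 1 / 2) = h' j ^ (-lam j - 1 / 2) by rw [e j hj]]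
theorem memGrid_congr (lam : Vd d) (p : ℝ≥0∞) (n : ℕ) {h h' : Vd d} (e : ∀ j ∈ I, h j = h' j)
    (H : memGrid lam p n I h) : memGrid lam p n I h' := by
  obtain ⟨h1, h2, h3⟩ := H
  refine ⟨fun j hj => e j hj ▸ h1 j hj, fun j hj => e j hj ▸ h2 j hj, ?_⟩
  rwa [Finset.prod_congr rfl e, Finset.prod_congr rfl fun j hj => show h j ^ lam j = h' j ^ lam j by rw [e j hj]] at h3

def hk (I : Finset (Fin d)) {N : ℕ} (k : I → Fin N) (j : Fin d) : ℝ :=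
  if hj : j ∈ I then 2 ^ (-((k ⟨j, hj⟩ : ℕ) : ℝ)) else 1

theorem grid_rep (I : Finset (Fin d)) (lam : Vd d) (p : ℝ≥0∞) : ∃ c : ℝ, 0 < c ∧ ∀ n : ℕ, 3 ≤ n → ∃ N : ℕ,
    (N : ℝ) ≤ c * n ∧ ∀ h, memGrid lam p n I h → ∃ k : I → Fin N, ∀ j ∈ I, h j = hk I k j := by
  set e := max 1 (p.toReal / I.card) with he
  have he1 : 1 ≤ e := le_max_left _ _
  refine ⟨2 * e + 2, by positivity, fun n hn => ?_⟩
  have hn0 : (3:ℝ) ≤ n := by exact_mod_cast hn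
  refine ⟨⌊2 * e * n⌋₊ + 1, ?_, fun h H => ?_⟩
  · push_cast
    have := Nat.floor_le (show 0 ≤ 2 * e * n by positivity)
    nlinarith
  · choose k hk1 hk2 using H.1
    have hb : ∀ j (hj : j ∈ I), k j hj < ⌊2 * e * n⌋₊ + 1 := by
      intro j hj
      rw [Nat.lt_succ_iff]
      refine Nat.le_floor ?_
      have h1 := (H.2.1 j hj).1
      rw [hk2 j hj] at h1
      have h2 : (n : ℝ) ^ (-e) ≤ 2 ^ (-(k j hj : ℝ)) := by
        refine le_trans ?_ h1
        unfold hminG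
        split_ifs
        · rw [← Real.rpow_neg_one]
          exact Real.rpow_le_rpow_of_exponent_le pL pL
        · exact le_rfl
      have h3 := Real.log_le_log pP h2
      rw [Real.log_rpow pL, Real.log_rpow pN] at h3
      have h4 := Real.log_two_gt_d9
      have h5 : Real.log n ≤ n := (Real.log_le_sub_one_of_pos pL).trans pL
      have h6 : (k j hj : ℝ) * (1/2) ≤ k j hj * Real.log 2 := by gcongr; linarith
      nlinarith
    refine ⟨fun j => ⟨k j j.2, hb j j.2⟩, fun j hj => ?_⟩
    rw [hk2 j hj]
    simp [hk, hj]

def Core (I : Finset (Fin d)) (K : ℝ → ℝ) (q : Vd d → ℝ) (lam : Vd d) (p : ℝ≥0∞) (r : ℝ) : Prop :=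
  ∃ C1 b c0 : ℝ, 0 < C1 ∧ 0 ≤ b ∧ 1 ≤ c0 ∧ ∀ n : ℕ, 3 ≤ n → ∀ f : Vd d → ℝ, IsDensity f →
    ∀ h, memGrid lam p n I h → Up K q lam p n I h = ⊤ ∨
      (Up K q lam p n I h ≤ oR (C1 * (n : ℝ) ^ b) ∧ ∃ R : ℝ, r + Real.log n ≤ R ∧
        ∃ g : (Fin n → Vd d) → ℝ≥0∞, Measurable g ∧ (∀ y, eLpNorm (xiProc I K f q h y) p volume ≤ g y) ∧
        ∫⁻ y, g y ^ R ∂obsMeasure d n f q ≤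
          (oR c0 * (Up K q lam p n I h + oR ((n : ℝ) ^ (-(1 : ℝ) / 2)))) ^ R)

theorem tailW {Ω : Type} [MeasurableSpace Ω] {P : Measure Ω} {r L R a c0 : ℝ} (hr : 1 ≤ r) (hL : 0 ≤ L) (hR : r + L ≤ R) (ha : 0 ≤ a)
    (hc0 : 1 ≤ c0) {U : ℝ≥0∞} (hU0 : U ≠ 0) (hUt : U ≠ ⊤) {g : Ω → ℝ≥0∞}
    (hb : ∫⁻ y, g y ^ R ∂P ≤ (oR c0 * U) ^ R) :
    ∫⁻ y, (g y - oR (c0 * Real.exp a) * U) ^ r ∂P ≤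
      (oR (c0 * Real.exp a) * U) ^ r * oR (Real.exp (-a * L)) := by
  set v := oR (c0 * Real.exp a) * U with hv
  have hv0 : v ≠ 0 := mul_ne_zero (by simp; positivity) hU0
  have hvt : v ≠ ⊤ := ENNReal.mul_ne_top ENNReal.ofReal_ne_top hUt
  have hpt : ∀ y, (g y - v) ^ r ≤ g y ^ R * v ^ (r - R) := by
    intro y
    rcases le_or_gt (g y) v with hle | hgt
    · rw [tsub_eq_zero_of_le hle, ENNReal.zero_rpow_of_pos pL]; exact zero_le
    · calc (g y - v) ^ r ≤ g y ^ r := ENNReal.rpow_le_rpow tsub_le_self pL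
        _ ≤ g y ^ R * v ^ (r - R) := by
          rcases eq_or_ne (g y) ⊤ with ht | ht
          · rw [ht, ENNReal.top_rpow_of_pos pL, ENNReal.top_rpow_of_pos pL, ENNReal.top_mul]
            exact (ENNReal.rpow_pos (pos_iff_ne_zero.2 hv0) hvt).ne'
          have hg0 : g y ≠ 0 := (pos_of_gt hgt).ne'
          have : g y ^ r = g y ^ R * g y ^ (r - R) := by
            rw [← ENNReal.rpow_add _ _ hg0 ht]; congr 1; ring
          rw [this]
          gcongr 1
          rw [show r - R = -(R - r) by ring, ENNReal.rpow_neg, ENNReal.rpow_neg]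
          exact ENNReal.inv_le_inv.2 (ENNReal.rpow_le_rpow hgt.le pL)
  calc _ ≤ ∫⁻ y, g y ^ R * v ^ (r - R) ∂P := lintegral_mono hpt
    _ = (∫⁻ y, g y ^ R ∂P) * v ^ (r - R) := lintegral_mul_const' _ _ (ENNReal.rpow_ne_top_of_ne_zero hv0 hvt)
    _ ≤ (oR c0 * U) ^ R * v ^ (r - R) := by gcongr
    _ = v ^ r * oR (Real.exp (-a * R)) := by
      have e1 : oR c0 * U = v * oR (Real.exp (-a)) := by
        rw [hv, mul_right_comm, ← ENNReal.ofReal_mul pP, mul_assoc, ← Real.exp_add]; simp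
      rw [e1, ENNReal.mul_rpow_of_nonneg _ _ pL, mul_right_comm, ← ENNReal.rpow_add _ _ hv0 hvt,
        ENNReal.ofReal_rpow_of_pos (Real.exp_pos _), ← Real.exp_mul]
      congr 2; ring
    _ ≤ _ := by gcongr v ^ r * oR (Real.exp ?_); nlinarith
end

end
section

theorem ofReal_npow {n : ℕ} (hn : 3 ≤ n) (s : ℝ) : oR ((n : ℝ) ^ s) = (n : ℝ≥0∞) ^ s := by
  rw [← ENNReal.ofReal_rpow_of_pos pP, ENNReal.ofReal_natCast]

theorem assemble {d : ℕ} {I : Finset (Fin d)} {K : ℝ → ℝ} {q : Vd d → ℝ} (hq : IsDensity q)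
    {lam : Vd d} {p : ℝ≥0∞} {r : ℝ} (hr : 1 ≤ r) (hC : Core I K q lam p r) :
    ∃ γ c : ℝ≥0∞, 0 < γ ∧ γ ≠ ⊤ ∧ 0 < c ∧ c ≠ ⊤ ∧
      ∀ n : ℕ, 3 ≤ n → ∀ f : Vd d → ℝ, IsDensity f →
        (∫⁻ y, (⨆ h ∈ {h : Vd d | memGrid lam p n I h},
            (eLpNorm (xiProc I K f q h y) p volume - γ * Up K q lam p n I h)) ^ r
          ∂obsMeasure d n f q) ^ (1 / r) ≤
        c * oR ((n : ℝ) ^ (-(1 : ℝ) / 2)) := by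
  obtain ⟨C1, b, c0, hC1, hb, hc0, hcore⟩ := hC
  obtain ⟨cg, hcg, hgrid⟩ := grid_rep I lam p
  set m := I.card with hm
  set a : ℝ := m + b * r + r / 2 with ha
  have ha0 : 0 ≤ a := by positivity
  set γ : ℝ≥0∞ := oR (c0 * Real.exp a) with hγ
  have hγ0 : 0 < γ := by rw [hγ, ENNReal.ofReal_pos]; positivity
  have hγt : γ ≠ ⊤ := ENNReal.ofReal_ne_top
  set Q : ℝ≥0∞ := 2 ^ (r - 1) * (γ ^ r + oR cg ^ m * (γ * oR (C1 + 1)) ^ r) with hQ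
  have hQt : Q ≠ ⊤ := by
    refine ENNReal.mul_ne_top (ENNReal.rpow_ne_top_of_nonneg pL pS) (ENNReal.add_ne_top.2 ⟨ENNReal.rpow_ne_top_of_nonneg pL hγt, ENNReal.mul_ne_top pS (ENNReal.rpow_ne_top_of_nonneg pL (ENNReal.mul_ne_top hγt pS))⟩)
  refine ⟨γ, Q ^ (1 / r) + 1, hγ0, hγt, by positivity, ENNReal.add_ne_top.2 ⟨ENNReal.rpow_ne_top_of_nonneg pP hQt, by simp⟩, fun n hn f hf => ?_⟩
  have hP := law_prob hf hq
  have hP' : IsProbabilityMeasure (obsMeasure d n f q) := by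
    unfold obsMeasure; unfold dm at hP; infer_instance
  have hn1 : (1:ℝ) ≤ n := by exact_mod_cast (by omega : 1 ≤ n)
  have hn0 : (n : ℝ≥0∞) ≠ 0 := by simp; omega
  have hnt : (n : ℝ≥0∞) ≠ ⊤ := by simp
  have hlog : 0 ≤ Real.log n := Real.log_nonneg hn1
  obtain ⟨N, hN, hrep⟩ := hgrid n hn
  set w := oR ((n : ℝ) ^ (-(1 : ℝ) / 2)) with hw
  have hw' : w = (n : ℝ≥0∞) ^ (-(1 : ℝ) / 2) := ofReal_npow hn _
  have hw0 : w ≠ 0 := by rw [hw]; simp; positivity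
  have hwt : w ≠ ⊤ := ENNReal.ofReal_ne_top
  have key : ∀ k : I → Fin N, ∃ W : (Fin n → Vd d) → ℝ≥0∞, Measurable W ∧
      (∀ y, memGrid lam p n I (hk I k) → eLpNorm (xiProc I K f q (hk I k) y) p volume - γ * Up K q lam p n I (hk I k) ≤ γ * w + W y) ∧
      ∫⁻ y, W y ^ r ∂obsMeasure d n f q ≤ (γ * oR (C1 + 1) * (n : ℝ≥0∞) ^ b) ^ r * (n : ℝ≥0∞) ^ (-a) := by
    intro k
    by_cases hg : memGrid lam p n I (hk I k)
    swap
    · refine ⟨fun _ => 0, measurable_const, fun y h => absurd h hg, ?_⟩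
      simp [ENNReal.zero_rpow_of_pos (show 0 < r by linarith)]
    rcases hcore n hn f hf _ hg with htop | ⟨hU, R, hR, g, hgm, hgb, hgi⟩
    · refine ⟨fun _ => 0, measurable_const, fun y _ => ?_, ?_⟩
      · rw [htop, ENNReal.mul_top hγ0.ne']; simp
      · simp [ENNReal.zero_rpow_of_pos (show 0 < r by linarith)]
    set U := Up K q lam p n I (hk I k)
    have hUt : U ≠ ⊤ := (hU.trans_lt ENNReal.ofReal_lt_top).ne
    refine ⟨fun y => g y - γ * (U + w), hgm.sub_const _, fun y _ => ?_, ?_⟩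
    · rw [tsub_le_iff_right]
      refine (hgb y).trans ?_
      refine (le_tsub_add (a := γ * (U + w))).trans (le_of_eq ?_)
      rw [mul_add]; ring
    · refine (tailW hr hlog hR ha0 hc0 (by simp [hw0]) (ENNReal.add_ne_top.2 ⟨hUt, hwt⟩) hgi).trans ?_
      have e1 : oR (Real.exp (-a * Real.log n)) = (n : ℝ≥0∞) ^ (-a) := by
        rw [← ofReal_npow hn, Real.rpow_def_of_pos pP]; congr 2; ring
      rw [e1, mul_assoc γ]
      have e2 : U + w ≤ oR (C1 + 1) * (n : ℝ≥0∞) ^ b := by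
        rw [← ofReal_npow hn, ← ENNReal.ofReal_mul pP, add_mul, ENNReal.ofReal_add pP pP]
        refine add_le_add hU (ENNReal.ofReal_le_ofReal ?_)
        rw [one_mul]
        exact Real.rpow_le_rpow_of_exponent_le hn1 pL
      gcongr
  choose W hWm hWb hWi using key
  have hsup : ∀ y, (⨆ h ∈ {h : Vd d | memGrid lam p n I h},
            (eLpNorm (xiProc I K f q h y) p volume - γ * Up K q lam p n I h)) ^ r ≤
      2 ^ (r - 1) * ((γ * w) ^ r + ∑ k : I → Fin N, W k y ^ r) := by
    intro y
    have h1 : (⨆ h ∈ {h : Vd d | memGrid lam p n I h},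
            (eLpNorm (xiProc I K f q h y) p volume - γ * Up K q lam p n I h)) ≤ γ * w + ⨆ k : I → Fin N, W k y := by
      refine iSup₂_le fun h hh => ?_
      obtain ⟨k, hkk⟩ := hrep h hh
      rw [xi_congr f q hkk y, Up_congr q lam p n hkk]
      refine (hWb k y (memGrid_congr lam p n hkk hh)).trans ?_
      gcongr
      exact le_iSup (fun k => W k y) k
    refine (ENNReal.rpow_le_rpow h1 pL).trans ((ENNReal.rpow_add_le_mul_rpow_add_rpow _ _ hr).trans ?_)
    gcongr
    rw [(ENNReal.monotone_rpow_of_nonneg (show 0 ≤ r by linarith)).map_iSup_of_continuousAt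
      (ENNReal.continuous_rpow_const).continuousAt (by simp [ENNReal.zero_rpow_of_pos (show 0 < r by linarith)])]
    exact iSup_le fun k => Finset.single_le_sum (f := fun k => W k y ^ r) (fun _ _ => zero_le) (Finset.mem_univ k)
  have hint : ∫⁻ y, (⨆ h ∈ {h : Vd d | memGrid lam p n I h},
            (eLpNorm (xiProc I K f q h y) p volume - γ * Up K q lam p n I h)) ^ r ∂obsMeasure d n f q ≤ Q * w ^ r := by
    refine (lintegral_mono hsup).trans ?_
    rw [lintegral_const_mul' _ _ (ENNReal.rpow_ne_top_of_nonneg pL pS),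
      lintegral_add_left measurable_const, lintegral_const, measure_univ, mul_one,
      lintegral_finsetSum _ fun k _ => (hWm k).pow_const r, hQ, mul_assoc]
    gcongr
    rw [add_mul]
    refine add_le_add (by rw [ENNReal.mul_rpow_of_nonneg _ _ pL]) ?_
    refine (Finset.sum_le_sum fun k _ => hWi k).trans ?_
    rw [Finset.sum_const, nsmul_eq_mul, Finset.card_univ, Fintype.card_fun, Fintype.card_fin, Fintype.card_coe, ← hm]
    have hN' : ((N ^ m : ℕ) : ℝ≥0∞) ≤ oR cg ^ m * (n : ℝ≥0∞) ^ (m : ℝ) := by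
      push_cast
      rw [ENNReal.rpow_natCast, ← mul_pow]
      gcongr
      rw [← ENNReal.ofReal_natCast N, ← ENNReal.ofReal_natCast n, ← ENNReal.ofReal_mul hcg.le]
      exact ENNReal.ofReal_le_ofReal hN
    calc _ ≤ (oR cg ^ m * (n : ℝ≥0∞) ^ (m : ℝ)) * ((γ * oR (C1 + 1) * (n : ℝ≥0∞) ^ b) ^ r * (n : ℝ≥0∞) ^ (-a)) := by gcongr
      _ = oR cg ^ m * (γ * oR (C1 + 1)) ^ r * ((n : ℝ≥0∞) ^ (m : ℝ) * (n : ℝ≥0∞) ^ (b * r) * (n : ℝ≥0∞) ^ (-a)) := by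
        rw [ENNReal.mul_rpow_of_nonneg _ ((n : ℝ≥0∞) ^ b) pL, ← ENNReal.rpow_mul]; ring
      _ = _ := by
        rw [← ENNReal.rpow_add _ _ hn0 hnt, ← ENNReal.rpow_add _ _ hn0 hnt, hw', ← ENNReal.rpow_mul]
        congr 2; rw [ha]; ring
  calc _ ≤ (Q * w ^ r) ^ (1 / r) := ENNReal.rpow_le_rpow hint pP
    _ = Q ^ (1 / r) * w := by
      rw [ENNReal.mul_rpow_of_nonneg _ _ pP, ← ENNReal.rpow_mul, mul_one_div_cancel pL, ENNReal.rpow_one]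
    _ ≤ _ := by gcongr; exact le_self_add

end
section

section
variable {d : ℕ} {I : Finset (Fin d)}

def cen (P : Measure Vd d) (L : (I → ℝ) → ℂ) (x : I → ℝ) (y : Vd d) : ℂ :=
  L (x - rI I y) - ∫ y', L (x - rI I y') ∂P

variable {P : Measure Vd d} [IsProbabilityMeasure P] {L : (I → ℝ) → ℂ}

theorem Lsub_meas (hL : Measurable L) : Measurable (fun z : (I → ℝ) × Vd d => L (z.1 - rI I z.2)) :=
  hL.comp (measurable_fst.sub (rI_meas.comp measurable_snd))
theorem Lsub_meas2 (hL : Measurable L) (x : I → ℝ) : Measurable (fun y : Vd d => L (x - rI I y)) :=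
  hL.comp (measurable_const.sub rI_meas)
theorem Lsub_int (hL : Measurable L) {C : ℝ} (hC : ∀ x, ‖L x‖ ≤ C) (x : I → ℝ) : Integrable (fun y : Vd d => L (x - rI I y)) P :=
  Integrable.of_bound (Lsub_meas2 hL x).aestronglyMeasurable C (ae_of_all _ fun _ => hC _)
theorem Lmean_meas (hL : Measurable L) : Measurable (fun x : I → ℝ => ∫ y', L (x - rI I y') ∂P) :=
  (StronglyMeasurable.integral_prod_right' (f := fun z : (I → ℝ) × Vd d => L (z.1 - rI I z.2)) (Lsub_meas hL).stronglyMeasurable).measurable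
theorem cen_meas (hL : Measurable L) : Measurable (fun z : (I → ℝ) × Vd d => cen P L z.1 z.2) :=
  (Lsub_meas hL).sub ((Lmean_meas hL).comp measurable_fst)
theorem cen_int (hL : Measurable L) {C : ℝ} (hC : ∀ x, ‖L x‖ ≤ C) (x : I → ℝ) : Integrable (cen P L x) P :=
  (Lsub_int hL hC x).sub (integrable_const _)
theorem cen_mean (hL : Measurable L) {C : ℝ} (hC : ∀ x, ‖L x‖ ≤ C) (x : I → ℝ) : ∫ y, cen P L x y ∂P = 0 := by
  unfold cen
  rw [integral_sub (Lsub_int hL hC x) (integrable_const _)]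
  simp

theorem jensenE {Ω : Type} [MeasurableSpace Ω] {P : Measure Ω} [IsProbabilityMeasure P] {g : Ω → ℝ≥0∞} (hg : Measurable g) {s : ℝ} (hs : 1 ≤ s) :
    (∫⁻ y, g y ∂P) ^ s ≤ ∫⁻ y, g y ^ s ∂P := by
  rcases eq_or_lt_of_le hs with rfl | h1
  · simp
  have hc := Real.HolderConjugate.conjExponent h1
  have := ENNReal.lintegral_mul_le_Lp_mul_Lq P hc (f := g) (g := fun _ => 1) hg.aemeasurable aemeasurable_const
  simp only [Pi.mul_apply, mul_one, ENNReal.one_rpow, lintegral_one, measure_univ] at this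
  calc (∫⁻ y, g y ∂P) ^ s ≤ ((∫⁻ y, g y ^ s ∂P) ^ (1 / s)) ^ s := ENNReal.rpow_le_rpow this pL
    _ = _ := by rw [← ENNReal.rpow_mul, one_div_mul_cancel pL, ENNReal.rpow_one]

theorem Lmean_lint (hL : Measurable L) {s : ℝ} (hs : 1 ≤ s) :
    ∫⁻ x : I → ℝ, ‖∫ y', L (x - rI I y') ∂P‖ₑ ^ s ≤ ∫⁻ x, ‖L x‖ₑ ^ s := by
  have hm := (Lsub_meas hL).enorm.pow_const s
  calc _ ≤ ∫⁻ x : I → ℝ, (∫⁻ y, ‖L (x - rI I y)‖ₑ ^ s ∂P) := by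
        refine lintegral_mono fun x => ?_
        refine (ENNReal.rpow_le_rpow (enorm_integral_le_lintegral_enorm _) pL).trans ?_
        exact jensenE (Lsub_meas2 hL x).enorm hs
    _ = ∫⁻ y, (∫⁻ x : I → ℝ, ‖L (x - rI I y)‖ₑ ^ s) ∂P := lintegral_lintegral_swap hm.aemeasurable
    _ = ∫⁻ y, (∫⁻ x : I → ℝ, ‖L x‖ₑ ^ s) ∂P := by
        congr 1; funext y
        exact lintegral_sub_right_eq_self (fun x => ‖L x‖ₑ ^ s) (rI I y)
    _ = _ := by simp

theorem eLp_eq {X E : Type} [MeasurableSpace X] [NormedAddCommGroup E] {ν : Measure X} (g : X → E) {s : ℝ} (hs : 1 ≤ s) :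
    eLpNorm g (oR s) ν = (∫⁻ x, ‖g x‖ₑ ^ s ∂ν) ^ (1 / s) := by
  rw [eLpNorm_eq_lintegral_rpow_enorm_toReal (by simp; linarith) ENNReal.ofReal_ne_top, ENNReal.toReal_ofReal pL]

theorem cen_eLp (hL : Measurable L) {s : ℝ} (hs : 1 ≤ s) (y : Vd d) :
    eLpNorm (fun x => cen P L x y) (oR s) volume ≤ 2 * eLpNorm L (oR s) volume := by
  have h1 : eLpNorm (fun x : I → ℝ => L (x - rI I y)) (oR s) volume = eLpNorm L (oR s) volume := by
    rw [eLp_eq _ hs, eLp_eq _ hs, lintegral_sub_right_eq_self (fun x => ‖L x‖ₑ ^ s) (rI I y)]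
  have h2 : eLpNorm (fun x : I → ℝ => ∫ y', L (x - rI I y') ∂P) (oR s) volume ≤ eLpNorm L (oR s) volume := by
    rw [eLp_eq _ hs, eLp_eq _ hs]
    exact ENNReal.rpow_le_rpow (Lmean_lint hL hs) pP
  have := eLpNorm_sub_le (μ := volume) (p := oR s) (f := fun x : I → ℝ => L (x - rI I y)) (g := fun x : I → ℝ => ∫ y', L (x - rI I y') ∂P)
    (hL.comp (measurable_id.sub_const _)).aestronglyMeasurable (Lmean_meas hL).aestronglyMeasurable (by simpa using hs)
  refine this.trans ?_
  rw [h1, two_mul]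
  gcongr

def RF (ρ : ℂ →L[ℝ] ℝ) : Prop := ∀ z, |ρ z| ≤ ‖z‖
theorem RF_re : RF Complex.reCLM := fun z => Complex.abs_re_le_norm z
theorem RF_im : RF Complex.imCLM := fun z => Complex.abs_im_le_norm z

variable {ρ : ℂ →L[ℝ] ℝ}

theorem rcen_meas (hL : Measurable L) : Measurable (fun z : (I → ℝ) × Vd d => ρ (cen P L z.1 z.2)) :=
  ρ.continuous.measurable.comp (cen_meas hL)
theorem rcen_mean (hL : Measurable L) {C : ℝ} (hC : ∀ x, ‖L x‖ ≤ C) (x : I → ℝ) : ∫ y, ρ (cen P L x y) ∂P = 0 := by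
  rw [ρ.integral_comp_comm (cen_int hL hC x), cen_mean hL hC, map_zero]

theorem rcen_ok (hρ : RF ρ) (hL : Measurable L) {s M : ℝ} (hs : 1 < s) (hM : eLpNorm L (oR s) volume ≤ oR M) (y : Vd d) :
    LpOK volume s (fun x => ρ (cen P L x y)) ∧ (0 ≤ M → Zf volume s (fun x => ρ (cen P L x y)) ≤ 2 * M) := by
  have hm : Measurable (fun x => ρ (cen P L x y)) := (rcen_meas (P := P) (ρ := ρ) hL).comp (measurable_id.prodMk measurable_const)
  have hle : eLpNorm (fun x => ρ (cen P L x y)) (oR s) volume ≤ 2 * oR M := by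
    refine (eLpNorm_mono fun x => ?_).trans ((cen_eLp (P := P) hL hs.le y).trans (by gcongr))
    exact hρ _
  have hok : LpOK volume s (fun x => ρ (cen P L x y)) := by
    refine LpOK.of_memLp hs hm ⟨hm.aestronglyMeasurable, hle.trans_lt (ENNReal.mul_lt_top pS pS)⟩
  refine ⟨hok, fun hM0 => ?_⟩
  rw [Zf_eq hs hok, show (2 : ℝ≥0∞) = oR 2 by simp, ← ENNReal.ofReal_mul pN] at hle
  exact (ENNReal.ofReal_le_ofReal_iff pP).1 hle
end

theorem combine {Ω : Type} [MeasurableSpace Ω] {P : Measure Ω} {Z1 Z2 : Ω → ℝ} (h1 : Measurable Z1) (h2 : Measurable Z2)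
    (p1 : ∀ y, 0 ≤ Z1 y) (p2 : ∀ y, 0 ≤ Z2 y) {R B s : ℝ} (hR : 1 ≤ R) (hB : 0 ≤ B) (hs : 0 ≤ s)
    (i1 : ∫⁻ y, oR (Z1 y ^ R) ∂P ≤ oR (B ^ R)) (i2 : ∫⁻ y, oR (Z2 y ^ R) ∂P ≤ oR (B ^ R)) :
    ∫⁻ y, (oR s * (oR (Z1 y) + oR (Z2 y))) ^ R ∂P ≤ oR (2 * s * B) ^ R := by
  calc _ ≤ ∫⁻ y, oR s ^ R * (2 ^ (R - 1) * (oR (Z1 y ^ R) + oR (Z2 y ^ R))) ∂P := by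
        refine lintegral_mono fun y => ?_
        dsimp only
        rw [ENNReal.mul_rpow_of_nonneg _ _ pL, ← ENNReal.ofReal_rpow_of_nonneg (p1 y) pL, ← ENNReal.ofReal_rpow_of_nonneg (p2 y) pL]
        gcongr
        exact ENNReal.rpow_add_le_mul_rpow_add_rpow _ _ hR
    _ = oR s ^ R * (2 ^ (R - 1) * (∫⁻ y, oR (Z1 y ^ R) ∂P + ∫⁻ y, oR (Z2 y ^ R) ∂P)) := by
        rw [lintegral_const_mul' _ _ (ENNReal.rpow_ne_top_of_nonneg pL pS), lintegral_const_mul' _ _ (ENNReal.rpow_ne_top_of_nonneg pL pS),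
          lintegral_add_left pF]
    _ ≤ oR s ^ R * (2 ^ (R - 1) * (oR (B ^ R) + oR (B ^ R))) := by gcongr
    _ = _ := by
        rw [← two_mul, ← ENNReal.ofReal_rpow_of_nonneg hB pL, ← mul_assoc (2 ^ (R - 1))]
        have : (2 : ℝ≥0∞) ^ (R - 1) * 2 = 2 ^ R := by
          nth_rw 2 [← ENNReal.rpow_one 2]
          rw [← ENNReal.rpow_add _ _ pS pS]; congr 1; ring
        rw [this, ← ENNReal.mul_rpow_of_nonneg _ _ pL, ← ENNReal.mul_rpow_of_nonneg _ _ pL]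
        congr 1
        rw [ENNReal.ofReal_mul pP, ENNReal.ofReal_mul pP]
        simp; ring

section
variable {d : ℕ} {I : Finset (Fin d)} {K : ℝ → ℝ}
theorem xi_eq (f q : Vd d → ℝ) (h : Vd d) {n : ℕ} (hn : 3 ≤ n) (y : Fin n → Vd d) (x : I → ℝ) :
    xiProc I K f q h y x = (n : ℂ)⁻¹ * ∑ k, cen (dm (conv f q)) (Lh I K q h) x (y k) := by
  have hn0 : (n : ℂ) ≠ 0 := by simp; omega
  unfold cen
  rw [Finset.sum_sub_distrib, Finset.sum_const, mul_sub, Finset.card_univ, Fintype.card_fin, nsmul_eq_mul, inv_mul_cancel_left₀ hn0]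
  rfl

theorem xi_split (f q : Vd d → ℝ) (h : Vd d) {n : ℕ} (hn : 3 ≤ n) (y : Fin n → Vd d) {p : ℝ} (hp : 1 < p)
    (h1 : LpOK volume p (fun x : I → ℝ => ∑ k, Complex.reCLM (cen (dm (conv f q)) (Lh I K q h) x (y k))))
    (h2 : LpOK volume p (fun x : I → ℝ => ∑ k, Complex.imCLM (cen (dm (conv f q)) (Lh I K q h) x (y k)))) :
    eLpNorm (xiProc I K f q h y) (oR p) volume ≤ oR ((n : ℝ)⁻¹) *
      (oR (Zf volume p (fun x : I → ℝ => ∑ k, Complex.reCLM (cen (dm (conv f q)) (Lh I K q h) x (y k)))) +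
       oR (Zf volume p (fun x : I → ℝ => ∑ k, Complex.imCLM (cen (dm (conv f q)) (Lh I K q h) x (y k))))) := by
  rw [← Zf_eq hp h1, ← Zf_eq hp h2]
  have e : xiProc I K f q h y = ((n : ℝ)⁻¹) • ((fun x : I → ℝ => ((∑ k, Complex.reCLM (cen (dm (conv f q)) (Lh I K q h) x (y k)) : ℝ) : ℂ)) +
      (fun x : I → ℝ => ((∑ k, Complex.imCLM (cen (dm (conv f q)) (Lh I K q h) x (y k)) : ℝ) : ℂ) * Complex.I)) := by
    funext x
    rw [xi_eq f q h hn, Pi.smul_apply, Pi.add_apply, Complex.real_smul, ← map_sum, ← map_sum]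
    rw [Complex.reCLM_apply, Complex.imCLM_apply, Complex.re_add_im]
    push_cast; rfl
  rw [e, eLpNorm_const_smul, ← ofReal_norm, Real.norm_of_nonneg pP]
  gcongr
  refine (eLpNorm_add_le ?_ ?_ (by simpa using hp.le)).trans (add_le_add ?_ ?_)
  · exact (Complex.measurable_ofReal.comp h1.1).aestronglyMeasurable
  · exact ((Complex.measurable_ofReal.comp h2.1).mul_const _).aestronglyMeasurable
  · exact eLpNorm_mono fun x => by rw [Complex.norm_real]
  · exact eLpNorm_mono fun x => by rw [norm_mul, Complex.norm_real, Complex.norm_I, mul_one]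
end

end
section

section
variable {d : ℕ} {I : Finset (Fin d)} {K : ℝ → ℝ}

theorem zf_sum_meas {X 𝒴 : Type} [MeasurableSpace X] [MeasurableSpace 𝒴] {ν : Measure X} [SFinite ν] (p : ℝ) {ℓ : X → 𝒴 → ℝ} (hℓ : Measurable (fun z : X × 𝒴 => ℓ z.1 z.2)) (n : ℕ) :
    Measurable (fun y : Fin n → 𝒴 => Zf ν p (fun x => ∑ i, ℓ x (y i))) := by
  unfold Zf
  refine Measurable.pow_const ?_ _
  refine meas_Nf (g := fun (y : Fin n → 𝒴) x => ∑ i, ℓ x (y i)) ?_ 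
  refine Finset.measurable_sum _ fun i _ => ?_
  exact hℓ.comp (measurable_snd.prodMk ((measurable_pi_apply i).comp measurable_fst))

theorem step {f q : Vd d → ℝ} (hf : IsDensity f) (hq : IsDensity q) {p : ℝ} (hp : 1 < p) {n : ℕ} (hn : 3 ≤ n) {h : Vd d}
    (hLm : Measurable (Lh I K q h)) {C : ℝ} (hC : ∀ x, ‖Lh I K q h x‖ ≤ C) {M : ℝ} (hM0 : 0 < M)
    (hM : eLpNorm (Lh I K q h) (oR p) volume ≤ oR M)
    {j : ℕ} {B a1 a2 b1 b2 : ℝ} (hB : 0 < B)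
    (H1 : ∀ ρ, RF ρ → ∀ T : (I → ℝ) → ℝ, LpOK volume p T → ∫ y, |Df volume p (fun x => T x + ρ (cen (dm (conv f q)) (Lh I K q h) x y)) (fun x => ρ (cen (dm (conv f q)) (Lh I K q h) x y)) -
        Df volume p T (fun x => ρ (cen (dm (conv f q)) (Lh I K q h) x y))| ∂(dm (conv f q)) ≤ a1 * (Zf volume p T + 2 * M) ^ (p - 2) + a2)
    (H2 : ∀ ρ, RF ρ → ∀ T : (I → ℝ) → ℝ, LpOK volume p T → ∫ y, |Nf volume p (fun x => T x + ρ (cen (dm (conv f q)) (Lh I K q h) x y)) - Nf volume p T| *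
        |Df volume p T (fun x => ρ (cen (dm (conv f q)) (Lh I K q h) x y))| ∂(dm (conv f q)) ≤ b1 * (Zf volume p T + 2 * M) ^ (2 * p - 2) + b2)
    (h1 : 24 * n * a1 ≤ B ^ 2) (h2 : 24 * n * a2 ≤ B ^ p) (h3 : 24 * n * (j + 2) * b1 ≤ B ^ 2) (h4 : 24 * n * (j + 2) * b2 ≤ (B ^ p) ^ 2)
    (h5 : 2 * (p * (j + 2)) * (2 * M) ≤ B) :
    ∃ g : (Fin n → Vd d) → ℝ≥0∞, Measurable g ∧ (∀ y, eLpNorm (xiProc I K f q h y) (oR p) volume ≤ g y) ∧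
      ∫⁻ y, g y ^ (p * (j + 2)) ∂obsMeasure d n f q ≤ oR (2 * (n : ℝ)⁻¹ * B) ^ (p * (j + 2)) := by
  have := law_prob hf hq
  set P := dm (conv f q) with hP
  set L := Lh I K q h with hLd
  have key : ∀ ρ, RF ρ → ∫⁻ y, oR (Zf volume p (fun x => ∑ i, ρ (cen P L x (y i))) ^ (p * (j + 2))) ∂(Measure.pi fun _ : Fin n => P) ≤ oR (B ^ (p * (j + 2))) := fun ρ hρ =>
    thmC P hp (ℓ := fun x y => ρ (cen P L x y)) (rcen_meas hLm) (M := 2 * M) pP (fun y => (rcen_ok hρ hLm hp hM y).1)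
      (fun y => (rcen_ok hρ hLm hp hM y).2 hM0.le) (fun x => rcen_mean hLm hC x) (by omega) hB (H1 ρ hρ) (H2 ρ hρ) h1 h2 h3 h4 h5
  have zm : ∀ ρ : ℂ →L[ℝ] ℝ, Measurable (fun y : Fin n → Vd d => Zf volume p (fun x : I → ℝ => ∑ i, ρ (cen P L x (y i)))) := fun ρ =>
    zf_sum_meas p (ℓ := fun x y => ρ (cen P L x y)) (rcen_meas hLm) n
  have lok : ∀ ρ, RF ρ → ∀ y : Fin n → Vd d, LpOK volume p (fun x : I → ℝ => ∑ i, ρ (cen P L x (y i))) := fun ρ hρ y =>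
    LpOK.sum hp _ fun i _ => (rcen_ok hρ hLm hp hM (y i)).1
  have R1 : 1 ≤ p * ((j : ℝ) + 2) := by nlinarith [Nat.cast_nonneg (α := ℝ) j]
  refine ⟨fun y => oR ((n : ℝ)⁻¹) * (oR (Zf volume p (fun x => ∑ i, Complex.reCLM (cen P L x (y i)))) + oR (Zf volume p (fun x => ∑ i, Complex.imCLM (cen P L x (y i))))), ?_, ?_, ?_⟩
  · exact ((zm _).ennreal_ofReal.add (zm _).ennreal_ofReal).const_mul _
  · intro y
    exact xi_split f q h hn y hp (lok _ RF_re y) (lok _ RF_im y)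
  · exact combine (zm _) (zm _) (fun y => Zf_nonneg _) (fun y => Zf_nonneg _) R1 hB.le pP (key _ RF_re) (key _ RF_im)
end

end
section

theorem Jp_neg (p a : ℝ) : Jp p (-a) = - Jp p a := by unfold Jp; rw [abs_neg]; ring
theorem Jp_of_nonneg {p : ℝ} (hp : 1 < p) {a : ℝ} (ha : 0 ≤ a) : Jp p a = a ^ (p - 1) := by
  rw [← abs_of_nonneg (show 0 ≤ Jp p a by unfold Jp; positivity), Jp_abs hp, abs_of_nonneg ha]

theorem rpow_holder {e : ℝ} (h0 : 0 < e) (h1 : e ≤ 1) {x y : ℝ} (hy : 0 ≤ y) (hxy : y ≤ x) : x ^ e - y ^ e ≤ (x - y) ^ e := by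
  have := Real.rpow_add_le_add_rpow (a := x - y) (b := y) pL hy h0.le h1
  rw [sub_add_cancel] at this
  linarith

theorem Jp_holder {p : ℝ} (hp : 1 < p) (hp2 : p ≤ 2) (x y : ℝ) : |Jp p x - Jp p y| ≤ 2 * |x - y| ^ (p - 1) := by
  have he0 : 0 < p - 1 := by linarith
  have he1 : p - 1 ≤ 1 := by linarith
  have A : ∀ x y : ℝ, 0 ≤ y → y ≤ x → |Jp p x - Jp p y| ≤ 2 * |x - y| ^ (p - 1) := by
    intro x y hy hxy
    rw [Jp_of_nonneg hp hy, Jp_of_nonneg hp (hy.trans hxy), abs_of_nonneg (sub_nonneg.2 (Real.rpow_le_rpow hy hxy he0.le)), abs_of_nonneg (sub_nonneg.2 hxy)]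
    have := rpow_holder he0 he1 hy hxy
    have := Real.rpow_nonneg (sub_nonneg.2 hxy) (p - 1)
    linarith
  have B : ∀ x y : ℝ, 0 ≤ y → 0 ≤ x → |Jp p x - Jp p y| ≤ 2 * |x - y| ^ (p - 1) := by
    intro x y hy hx
    rcases le_total y x with h | h
    · exact A x y hy h
    · rw [abs_sub_comm, abs_sub_comm x]; exact A y x hx h
  have Cc : ∀ x y : ℝ, y ≤ 0 → 0 ≤ x → |Jp p x - Jp p y| ≤ 2 * |x - y| ^ (p - 1) := by
    intro x y hy hx
    refine (abs_sub _ _).trans ?_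
    rw [Jp_abs hp, Jp_abs hp, abs_of_nonneg (by linarith : 0 ≤ x - y), abs_of_nonneg hx, abs_of_nonpos hy, two_mul]
    exact add_le_add (Real.rpow_le_rpow hx pL he0.le) (Real.rpow_le_rpow pL pL he0.le)
  rcases le_total 0 x with hx | hx <;> rcases le_total 0 y with hy | hy
  · exact B x y hy hx
  · exact Cc x y hy hx
  · rw [abs_sub_comm, abs_sub_comm x]; exact Cc y x hx hy
  · have := B (-x) (-y) pL pL
    rw [Jp_neg, Jp_neg] at this
    rwa [show -Jp p x - -Jp p y = -(Jp p x - Jp p y) by ring, abs_neg, show -x - -y = -(x - y) by ring, abs_neg] at this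

theorem pow_diff {p a b c m : ℝ} (hp : 1 < p) (ha : 0 ≤ a) (hb : 0 ≤ b) (hac : a ≤ c) (hbc : b ≤ c) (hm : |a - b| ≤ m) :
    |a ^ p - b ^ p| ≤ p * c ^ (p - 1) * m := by
  have key : ∀ a b : ℝ, 0 ≤ a → 0 ≤ b → a ≤ c → a ^ p - b ^ p ≤ p * c ^ (p - 1) * |a - b| := by
    intro a b ha hb hac
    rcases le_or_gt a b with h | h
    · have := Real.rpow_le_rpow ha h (by linarith : (0 : ℝ) ≤ p)
      have : 0 ≤ p * c ^ (p - 1) * |a - b| := by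
        have : 0 ≤ c := ha.trans hac
        positivity
      linarith
    · have h0 : -1 ≤ b / a - 1 := by
        have : 0 ≤ b / a := by positivity
        linarith
      have h1 := one_add_mul_self_le_rpow_one_add (s := b / a - 1) h0 hp.le
      have ha' : 0 < a := by linarith
      rw [show 1 + (b / a - 1) = b / a by ring, Real.div_rpow hb ha] at h1
      have hap : 0 < a ^ p := by positivity
      rw [le_div_iff₀ hap] at h1
      have e : a ^ p = a ^ (p - 1) * a := by rw [← Real.rpow_add_one ha'.ne']; congr 1; ring
      have h2 : a ^ p - b ^ p ≤ p * a ^ (p - 1) * (a - b) := by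
        have : p * (b / a - 1) * a ^ p = p * a ^ (p - 1) * (b - a) := by rw [e]; field_simp
        nlinarith
      rw [abs_of_pos (by linarith : 0 < a - b)]
      refine h2.trans ?_
      have := Real.rpow_le_rpow ha hac (by linarith : 0 ≤ p - 1)
      exact mul_le_mul_of_nonneg_right (mul_le_mul_of_nonneg_left this pL) pL
  have hcn : 0 ≤ p * c ^ (p - 1) := by
    have : 0 ≤ c := ha.trans hac
    positivity
  rw [abs_le]
  constructor
  · have := key b a hb ha hbc
    rw [abs_sub_comm] at this
    nlinarith
  · have := key a b ha hb hac
    nlinarith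

theorem int_le_const {Ω : Type} [MeasurableSpace Ω] {P : Measure Ω} [IsProbabilityMeasure P] {F : Ω → ℝ} {c : ℝ} (hc : 0 ≤ c) (h : ∀ y, F y ≤ c) : ∫ y, F y ∂P ≤ c := by
  by_cases hF : Integrable F P
  · calc ∫ y, F y ∂P ≤ ∫ _y, c ∂P := integral_mono hF (integrable_const _) h
      _ = c := by simp
  · rw [integral_undef hF]; exact hc

section
variable {X : Type} [MeasurableSpace X] {ν : Measure X} {p : ℝ}
theorem Zf_diff (hp : 1 < p) {T S : X → ℝ} (hT : LpOK ν p T) (hS : LpOK ν p S) :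
    |Zf ν p (fun x => T x + S x) - Zf ν p T| ≤ Zf ν p S := by
  have h1 := Zf_add hp hT hS
  have hSn : LpOK ν p (fun x => - S x) := ⟨hS.1.neg, by simpa using hS.2⟩
  have e : Zf ν p (fun x => - S x) = Zf ν p S := by simp [Zf, Nf]
  have h2 := Zf_add hp (LpOK.add hp hT hS) hSn
  simp only [add_neg_cancel_right, e] at h2
  rw [abs_le]; constructor <;> linarith

theorem Nf_diff (hp : 1 < p) {T S : X → ℝ} (hT : LpOK ν p T) (hS : LpOK ν p S) {M : ℝ} (hM : Zf ν p S ≤ M) :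
    |Nf ν p (fun x => T x + S x) - Nf ν p T| ≤ p * (Zf ν p T + M) ^ (p - 1) * M := by
  rw [← Zf_pow hp, ← Zf_pow hp]
  have h1 := Zf_add hp hT hS
  have h2 := Zf_nonneg (ν := ν) (p := p) S
  exact pow_diff hp (Zf_nonneg _) (Zf_nonneg _) pL pL ((Zf_diff hp hT hS).trans hM)

theorem H2lt (hp : 1 < p) {T S : X → ℝ} (hT : LpOK ν p T) (hS : LpOK ν p S) {M : ℝ} (hM : Zf ν p S ≤ M) :
    |Nf ν p (fun x => T x + S x) - Nf ν p T| * |Df ν p T S| ≤ p * M ^ 2 * (Zf ν p T + M) ^ (2 * p - 2) := by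
  have h2 := Zf_nonneg (ν := ν) (p := p) S
  have h3 := Zf_nonneg (ν := ν) (p := p) T
  have hM0 := h2.trans hM
  have hD : |Df ν p T S| ≤ (Zf ν p T + M) ^ (p - 1) * M :=
    (Df_le hp hT hS).trans (mul_le_mul (Real.rpow_le_rpow h3 pL pL) hM h2 pP)
  calc _ ≤ (p * (Zf ν p T + M) ^ (p - 1) * M) * ((Zf ν p T + M) ^ (p - 1) * M) :=
        mul_le_mul (Nf_diff hp hT hS hM) hD (abs_nonneg _) pP
    _ = _ := by
        rw [show 2 * p - 2 = (p - 1) + (p - 1) by ring, Real.rpow_add_of_nonneg pL pL pL]; ring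

theorem H1lt (hp : 1 < p) (hp2 : p ≤ 2) {T S : X → ℝ} (hT : LpOK ν p T) (hS : LpOK ν p S) {M : ℝ} (hM : Zf ν p S ≤ M) :
    |Df ν p (fun x => T x + S x) S - Df ν p T S| ≤ 2 * M ^ p := by
  unfold Df
  rw [← integral_sub (Df_integrable hp (LpOK.add hp hT hS) hS) (Df_integrable hp hT hS)]
  refine (abs_integral_le_integral_abs).trans ?_
  calc _ ≤ ∫ x, 2 * |S x| ^ p ∂ν := by
        refine integral_mono_of_nonneg (ae_of_all _ fun _ => abs_nonneg _) (hS.2.const_mul _) (ae_of_all _ fun x => ?_)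
        dsimp only
        rw [← sub_mul, abs_mul]
        have := Jp_holder hp hp2 (T x + S x) (T x)
        rw [add_sub_cancel_left] at this
        rcases eq_or_ne (S x) 0 with h | h
        · simp [h, Real.zero_rpow (by linarith : p ≠ 0)]
        calc _ ≤ 2 * |S x| ^ (p - 1) * |S x| := by gcongr
          _ = _ := by rw [mul_assoc, ← Real.rpow_add_one (abs_ne_zero.2 h)]; congr 2; ring
    _ = 2 * Zf ν p S ^ p := by rw [integral_const_mul, Zf_pow hp]; rfl
    _ ≤ _ := by
        have := Real.rpow_le_rpow (Zf_nonneg _) hM (by linarith : 0 ≤ p)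
        linarith
end

theorem jch {n : ℕ} (hn : 3 ≤ n) {r : ℝ} (hr : 1 ≤ r) : 1 ≤ Real.log n ∧ ∃ j : ℕ, r + Real.log n ≤ j ∧ (j : ℝ) + 2 ≤ (r + 4) * Real.log n := by
  have h1 : 1 ≤ Real.log n := by
    rw [Real.le_log_iff_exp_le pP]
    have := Real.exp_one_lt_d9
    have : (3 : ℝ) ≤ n := by exact_mod_cast hn
    linarith
  refine ⟨h1, ⌈r + Real.log n⌉₊, Nat.le_ceil _, ?_⟩
  have := Nat.ceil_lt_add_one (by linarith : 0 ≤ r + Real.log n)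
  nlinarith

end
section

section
variable {d : ℕ} {I : Finset (Fin d)} {K : ℝ → ℝ} {q : Vd d → ℝ} {lam : Vd d}

theorem grid_HU {p : ℝ≥0∞} {n : ℕ} {h : Vd d} (hg : memGrid lam p n I h) : HU I h := by
  intro j hj
  obtain ⟨k, _, hk⟩ := hg.1 j hj
  rw [hk]
  exact ⟨by positivity, Real.rpow_le_one_of_one_le_of_nonpos pN pS⟩

theorem grid_low {p : ℝ≥0∞} {n : ℕ} (hn : 3 ≤ n) {h : Vd d} (hg : memGrid lam p n I h) {j} (hj : j ∈ I) :
    (n : ℝ) ^ (-(1 + p.toReal)) ≤ h j := by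
  refine le_trans ?_ (hg.2.1 j hj).1
  have hn1 : (1 : ℝ) ≤ n := by exact_mod_cast (by omega : 1 ≤ n)
  unfold hminG
  split_ifs with hp
  · rw [hp, ← Real.rpow_neg_one]; simp
  · refine Real.rpow_le_rpow_of_exponent_le hn1 (neg_le_neg (max_le ?_ ?_))
    · simp
    · have : (1 : ℝ) ≤ I.card := by exact_mod_cast Finset.card_pos.2 ⟨j, hj⟩
      have := div_le_self (a := p.toReal) pS this
      linarith

theorem grid_PW {p : ℝ≥0∞} {n : ℕ} (hn : 3 ≤ n) {h : Vd d} (hg : memGrid lam p n I h) {e : Vd d} (he : ∀ j, e j ≤ 0) :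
    PW I h e ≤ (n : ℝ) ^ ((1 + p.toReal) * ∑ j : I, - e j) := by
  have hn0 : (0 : ℝ) < n := by positivity
  rw [Finset.mul_sum, Real.rpow_sum_of_pos hn0]
  refine Finset.prod_le_prod (fun j _ => (Real.rpow_pos_of_pos (grid_HU hg j j.2).1 _).le) fun j _ => ?_
  rw [show (1 + p.toReal) * -e j = -(1 + p.toReal) * e j by ring, Real.rpow_mul hn0.le]
  exact Real.rpow_le_rpow_of_nonpos pP (grid_low hn hg j.2) (he _)

def PB (I : Finset (Fin d)) (K : ℝ → ℝ) (q : Vd d → ℝ) (s : ℝ) : Prop :=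
  ∃ C : ℝ, 0 < C ∧ ∃ e : Vd d, (∀ j, e j ≤ 0) ∧ ∀ h, HU I h → eLpNorm (Lh I K q h) (oR s) volume ≤ oR (C * PW I h e)

theorem core_lt {p : ℝ} (hp : 1 < p) (hp2 : p < 2) (κ : SchwartzMap ℝ ℂ)
    (hκ : eFT κ K)
    (hq : IsDensity q) {A : ℝ} (hG : GB I q A lam) (hPB : PB I K q p) {r : ℝ} (hr : 1 ≤ r) :
    Core I K q lam (oR p) r := by
  obtain ⟨CL, hCL, hLB⟩ := LBds κ hκ hq hG
  obtain ⟨C, hC, e, he, hB⟩ := hPB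
  have hpr : (oR p).toReal = p := ENNReal.toReal_ofReal pL
  have hUp : ∀ n h, Up K q lam (oR p) n I h = oR ((n : ℝ) ^ (1 / p - 1)) * eLpNorm (Lh I K q h) (oR p) volume := by
    intro n h
    unfold Up
    rw [if_neg ENNReal.ofReal_ne_top, if_neg, hpr, if_pos hp2]
    intro h2
    have := congrArg ENNReal.toReal h2
    rw [hpr] at this
    simp at this; linarith
  set ε := 2 / p - 1 with hε
  have hε0 : 0 < ε := by rw [hε, sub_pos, lt_div_iff₀ pL]; linarith
  set c := 192 + 16 * (r + 4) + 192 * (r + 4) / ε with hc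
  have hc1 : 192 ≤ c := by
    have : 0 ≤ 192 * (r + 4) / ε := by positivity
    linarith
  refine ⟨C, (1 + p) * ∑ j : I, - e j, 2 * c, hC, mul_nonneg pL (Finset.sum_nonneg fun j _ => by have := he j; linarith), by linarith, ?_⟩
  intro n hn f hf h hg
  right
  have hn0 : (0 : ℝ) < n := by positivity
  have hn1 : (1 : ℝ) ≤ n := by exact_mod_cast (by omega : 1 ≤ n)
  have H := grid_HU hg
  obtain ⟨Lc, Lb, -, -⟩ := hLB h H
  have hU0 := hB h H
  constructor
  · rw [hUp, ← one_mul (oR (C * _))]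
    refine mul_le_mul' ?_ (hU0.trans (ENNReal.ofReal_le_ofReal ?_))
    · rw [ENNReal.ofReal_le_one]
      exact Real.rpow_le_one_of_one_le_of_nonpos hn1 (by rw [sub_nonpos, div_le_one pL]; exact hp.le)
    · have := grid_PW hn hg he
      rw [hpr] at this
      gcongr
  obtain ⟨hl1, j, hj1, hj2⟩ := jch hn hr
  have hfin : eLpNorm (Lh I K q h) (oR p) volume ≠ ⊤ := ne_top_of_le_ne_top ENNReal.ofReal_ne_top hU0
  set N := (eLpNorm (Lh I K q h) (oR p) volume).toReal with hN
  have hN0 : 0 ≤ N := ENNReal.toReal_nonneg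
  have hNe : eLpNorm (Lh I K q h) (oR p) volume = oR N := (ENNReal.ofReal_toReal hfin).symm
  set M := N + (n : ℝ)⁻¹ with hM
  have hM0 : 0 < M := by positivity
  set B := c * (n : ℝ) ^ (1 / p) * M with hBd
  have hB0 : 0 < B := by positivity
  have hlog : Real.log n ≤ (n : ℝ) ^ ε / ε := Real.log_le_rpow_div hn0.le hε0
  have hlog2 : Real.log n ≤ 2 * (n : ℝ) ^ (1 / p) := by
    refine (Real.log_le_rpow_div hn0.le (ε := 1 / p) pP).trans ?_
    rw [div_div_eq_mul_div, div_one, mul_comm]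
    gcongr
  have hnp : ((n : ℝ) ^ (1 / p)) ^ p = n := by rw [← Real.rpow_mul hn0.le, one_div_mul_cancel pL, Real.rpow_one]
  have hnp2 : ((n : ℝ) ^ (1 / p)) ^ 2 = n * (n : ℝ) ^ ε := by
    rw [← Real.rpow_natCast, ← Real.rpow_mul hn0.le, hε, ← Real.rpow_one_add' hn0.le (by rw [add_sub_cancel]; positivity)]
    congr 1; push_cast; ring
  have hMp := Real.rpow_nonneg hM0.le p
  have := law_prob hf hq
  refine Exists.elim (step (K := K) (I := I) hf hq hp hn (h := h) Lc.measurable Lb hM0 (by rw [hNe]; exact ENNReal.ofReal_le_ofReal (by rw [hM]; linarith [inv_pos.2 hn0]))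
    (j := j) (B := B) (a1 := 0) (a2 := 2 * (2 * M) ^ p) (b1 := p * (2 * M) ^ 2) (b2 := 0) hB0 ?_ ?_ ?_ ?_ ?_ ?_ ?_) ?_
  · intro ρ hρ T hT
    rw [zero_mul, zero_add]
    refine int_le_const pP fun y => ?_
    have hh := rcen_ok (P := dm (conv f q)) hρ Lc.measurable hp (M := M) (by rw [hNe]; exact ENNReal.ofReal_le_ofReal (by rw [hM]; linarith [inv_pos.2 hn0])) y
    exact H1lt hp hp2.le hT hh.1 (hh.2 hM0.le)
  · intro ρ hρ T hT
    rw [add_zero]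
    refine int_le_const (mul_nonneg pP (Real.rpow_nonneg (add_nonneg (Zf_nonneg _) pP) _)) fun y => ?_
    have hh := rcen_ok (P := dm (conv f q)) hρ Lc.measurable hp (M := M) (by rw [hNe]; exact ENNReal.ofReal_le_ofReal (by rw [hM]; linarith [inv_pos.2 hn0])) y
    exact H2lt hp hT hh.1 (hh.2 hM0.le)
  · simp; positivity
  · have eB : B ^ p = c ^ p * n * M ^ p := by
      rw [hBd, Real.mul_rpow pP hM0.le, Real.mul_rpow pP pP, hnp]
    rw [eB, Real.mul_rpow pN hM0.le]
    have h2p : (2 : ℝ) ^ p ≤ 4 := by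
      calc (2 : ℝ) ^ p ≤ 2 ^ (2 : ℝ) := Real.rpow_le_rpow_of_exponent_le pN hp2.le
        _ = 4 := by norm_num
    have hcp : 192 ≤ c ^ p := hc1.trans (by
      nth_rw 1 [← Real.rpow_one c]
      exact Real.rpow_le_rpow_of_exponent_le pL hp.le)
    calc 24 * (n : ℝ) * (2 * (2 ^ p * M ^ p)) = 48 * 2 ^ p * (n * M ^ p) := by ring
      _ ≤ 192 * (n * M ^ p) := by gcongr; linarith
      _ ≤ c ^ p * (n * M ^ p) := by gcongr
      _ = _ := by ring
  · have eB : B ^ 2 = c ^ 2 * (n * (n : ℝ) ^ ε) * M ^ 2 := by rw [hBd, mul_pow, mul_pow, hnp2]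
    rw [eB]
    have hcc : 192 * (r + 4) / ε ≤ c ^ 2 := by
      have : c ≤ c ^ 2 := by nlinarith
      linarith
    calc 24 * (n : ℝ) * (j + 2) * (p * (2 * M) ^ 2) ≤ 24 * (n : ℝ) * ((r + 4) * ((n : ℝ) ^ ε / ε)) * (2 * (2 * M) ^ 2) := by
          gcongr
          exact hj2.trans (by gcongr)
      _ = 192 * (r + 4) / ε * (n * (n : ℝ) ^ ε) * M ^ 2 := by ring
      _ ≤ _ := by gcongr
  · simp; positivity
  · calc 2 * (p * ((j : ℝ) + 2)) * (2 * M) ≤ 2 * (2 * ((r + 4) * (2 * (n : ℝ) ^ (1 / p)))) * (2 * M) := by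
          gcongr
          exact hj2.trans (by gcongr)
      _ = (16 * (r + 4)) * (n : ℝ) ^ (1 / p) * M := by ring
      _ ≤ _ := by
          rw [hBd]
          gcongr
          have : 0 ≤ 192 * (r + 4) / ε := by positivity
          linarith
  · rintro g ⟨gm, g1, g2⟩
    refine ⟨p * (j + 2), ?_, g, gm, g1, g2.trans (ENNReal.rpow_le_rpow ?_ pP)⟩
    · nlinarith [Nat.cast_nonneg (α := ℝ) j]
    · rw [hUp, hNe, ← ENNReal.ofReal_mul pP, ← ENNReal.ofReal_add pP pP, ← ENNReal.ofReal_mul pP]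
      refine ENNReal.ofReal_le_ofReal ?_
      have e1 : (n : ℝ)⁻¹ * (n : ℝ) ^ (1 / p) = (n : ℝ) ^ (1 / p - 1) := by rw [Real.rpow_sub_one hn0.ne']; ring
      have e2 : (n : ℝ) ^ (1 / p - 1) * (n : ℝ)⁻¹ ≤ (n : ℝ) ^ (-(1 : ℝ) / 2) := by
        rw [← Real.rpow_neg_one, ← Real.rpow_add hn0]
        refine Real.rpow_le_rpow_of_exponent_le hn1 ?_
        have : 1 / p ≤ 1 := by rw [div_le_one pL]; exact hp.le
        linarith
      calc 2 * (n : ℝ)⁻¹ * B = 2 * c * ((n : ℝ) ^ (1 / p - 1) * N + (n : ℝ) ^ (1 / p - 1) * (n : ℝ)⁻¹) := by rw [← e1, hBd, hM]; ring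
        _ ≤ _ := by gcongr
end

end
section

section
variable {d : ℕ} {I : Finset (Fin d)}

def fa (P : Measure Vd d) (m : (I → ℝ) → ℂ) (t : I → ℝ) (y : Vd d) : ℂ :=
  m t * (ech t (rI I y) - ∫ y', ech t (rI I y') ∂P)

variable {P : Measure Vd d} [IsProbabilityMeasure P] {m : (I → ℝ) → ℂ}

theorem echr_meas : Measurable (fun z : (I → ℝ) × Vd d => ech z.1 (rI I z.2)) :=
  ech_cont.measurable.comp (measurable_fst.prodMk (rI_meas.comp measurable_snd))
theorem echr_meas2 (t : I → ℝ) : Measurable (fun y : Vd d => ech t (rI I y)) :=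
  echr_meas.comp (measurable_const.prodMk measurable_id)
theorem echr_meas1 (y : Vd d) : Measurable (fun t : I → ℝ => ech t (rI I y)) :=
  (ech_cont.comp (continuous_id.prodMk (continuous_const (y := rI I y)))).measurable
theorem phi_meas : Measurable (fun t : I → ℝ => ∫ y', ech t (rI I y') ∂P) :=
  (StronglyMeasurable.integral_prod_right' (f := fun z : (I → ℝ) × Vd d => ech z.1 (rI I z.2)) echr_meas.stronglyMeasurable).measurable
theorem phi_le (t : I → ℝ) : ‖∫ y', ech t (rI I y') ∂P‖ ≤ 1 := by
  have := norm_integral_le_of_norm_le_const (μ := P) (f := fun y' : Vd d => ech t (rI I y')) (C := 1) (ae_of_all _ fun y => (ech_norm _ _).le)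
  simpa using this
theorem echr_int (t : I → ℝ) : Integrable (fun y : Vd d => ech t (rI I y)) P :=
  Integrable.of_bound (echr_meas2 t).aestronglyMeasurable 1 (ae_of_all _ fun y => (ech_norm _ _).le)
theorem fa_meas (hm : Measurable m) : Measurable (fun z : (I → ℝ) × Vd d => fa P m z.1 z.2) :=
  (hm.comp measurable_fst).mul (echr_meas.sub (phi_meas.comp measurable_fst))
theorem fa_le (t : I → ℝ) (y : Vd d) : ‖fa P m t y‖ ≤ 2 * ‖m t‖ := by
  unfold fa
  rw [norm_mul, mul_comm]
  refine mul_le_mul_of_nonneg_right ((norm_sub_le _ _).trans ?_) (norm_nonneg _)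
  rw [ech_norm]
  have := phi_le (P := P) t
  linarith
theorem fa_inty (t : I → ℝ) : Integrable (fa P m t) P := ((echr_int t).sub (integrable_const _)).const_mul _
theorem fa_mean (t : I → ℝ) : ∫ y, fa P m t y ∂P = 0 := by
  unfold fa
  rw [integral_const_mul, integral_sub (echr_int t) (integrable_const _)]
  simp
theorem fa_meas1 (hm : Measurable m) (y : Vd d) : Measurable (fun t => fa P m t y) :=
  (fa_meas (P := P) hm).comp (measurable_id.prodMk measurable_const)
theorem fa_int (hm : Measurable m) (hi : Integrable m) (y : Vd d) : Integrable (fun t => fa P m t y) :=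
  (hi.norm.const_mul 2).mono' (fa_meas1 hm y).aestronglyMeasurable (ae_of_all _ fun t => fa_le t y)

theorem expn_norm (t x : I → ℝ) : ‖cE t x‖ = 1 := by
  rw [ech_neg, RCLike.norm_conj, ech_norm]
theorem expn_meas (x : I → ℝ) : Measurable (fun t : I → ℝ => cE t x) := by
  have : Continuous (fun t : I → ℝ => cE t x) := by unfold dotp; fun_prop
  exact this.measurable
theorem expn_sub (t x u : I → ℝ) : Complex.exp (-(Complex.I * (dotp t (x - u) : ℝ))) = cE t x * ech t u := by
  unfold ech dotp
  rw [← Complex.exp_add]; congr 1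
  simp only [Pi.sub_apply, mul_sub, Finset.sum_sub_distrib]
  push_cast; ring

theorem cen_fa (hm : Measurable m) (hi : Integrable m) {L : (I → ℝ) → ℂ} {c : ℂ}
    (hL : ∀ x, L x = c * ∫ t : I → ℝ, cE t x * m t) (x : I → ℝ) (y : Vd d) :
    cen P L x y = c * ∫ t : I → ℝ, cE t x * fa P m t y := by
  have e1 : ∀ y : Vd d, L (x - rI I y) = c * ∫ t : I → ℝ, cE t x * m t * ech t (rI I y) := by
    intro y
    rw [hL]; congr 1; refine integral_congr_ae (ae_of_all _ fun t => ?_)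
    dsimp only
    rw [expn_sub]; ring
  have hprod : Integrable (fun z : Vd d × (I → ℝ) => Complex.exp (-(Complex.I * (dotp z.2 x : ℝ))) * m z.2 * ech z.2 (rI I z.1)) (P.prod volume) := by
    have h0 : Integrable (fun z : Vd d × (I → ℝ) => ‖m z.2‖) (P.prod volume) := hi.norm.comp_snd P
    refine h0.mono' ?_ (ae_of_all _ fun z => ?_)
    · exact ((((expn_meas x).comp measurable_snd).mul (hm.comp measurable_snd)).mul (echr_meas.comp measurable_swap)).aestronglyMeasurable
    · rw [norm_mul, norm_mul, expn_norm, ech_norm, one_mul, mul_one]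
  have e2 : ∫ y', L (x - rI I y') ∂P = c * ∫ t : I → ℝ, cE t x * m t * ∫ y', ech t (rI I y') ∂P := by
    simp_rw [e1]
    rw [integral_const_mul, integral_integral_swap hprod]
    congr 1; refine integral_congr_ae (ae_of_all _ fun t => ?_)
    dsimp only
    rw [integral_const_mul]
  have hb : ∀ g : (I → ℝ) → ℂ, Measurable g → (∀ t, ‖g t‖ ≤ 1) → Integrable (fun t => cE t x * m t * g t) := by
    intro g hg h1
    refine hi.norm.mono' ((((expn_meas x).mul hm).mul hg).aestronglyMeasurable) (ae_of_all _ fun t => ?_)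
    rw [norm_mul, norm_mul, expn_norm, one_mul]
    exact mul_le_of_le_one_right (norm_nonneg _) (h1 t)
  unfold cen
  rw [e1, e2, ← mul_sub, ← integral_sub]
  · congr 1; refine integral_congr_ae (ae_of_all _ fun t => ?_)
    unfold fa
    ring
  · exact hb _ (echr_meas1 y) fun t => (ech_norm _ _).le
  · exact hb _ phi_meas fun t => phi_le t

theorem int_ech_meas {a : (I → ℝ) → ℂ} (ham : Measurable a) : Measurable (fun x : I → ℝ => ∫ t, a t * ech t x) := by
  have h1 : Measurable (fun z : (I → ℝ) × (I → ℝ) => ech z.2 z.1) := (ech_cont.comp continuous_swap).measurable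
  have : Measurable (fun z : (I → ℝ) × (I → ℝ) => a z.2 * ech z.2 z.1) := (ham.comp measurable_snd).mul h1
  exact (StronglyMeasurable.integral_prod_right' this.stronglyMeasurable).measurable

theorem fa_var {f q : Vd d → ℝ} (hf : IsDensity f) (hq : IsDensity q) (hm : Measurable m) {T : (I → ℝ) → ℝ} (hT : Measurable T)
    (hTm : Integrable (fun t => (T t : ℂ) * m t)) :
    ∫⁻ y, ‖∫ t, (T t : ℂ) * fa (dm (conv f q)) m t y‖ₑ ^ 2 ∂(dm (conv f q)) ≤ 8 * ((∫⁻ t, ‖(T t : ℂ) * m t‖ₑ ^ 2) * ∫⁻ u, ‖ftI (marginal I q) u‖ₑ) := by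
  have := law_prob hf hq
  set P := dm (conv f q) with hP
  set a : (I → ℝ) → ℂ := fun t => (T t : ℂ) * m t with ha
  have ham : Measurable a := (Complex.measurable_ofReal.comp hT).mul hm
  set G : Vd d → ℂ := fun y => ∫ t, a t * ech t (rI I y) with hG
  have hGm : Measurable G := (int_ech_meas ham).comp rI_meas
  have hprod : Integrable (fun z : Vd d × (I → ℝ) => a z.2 * ech z.2 (rI I z.1)) (P.prod volume) := by
    have h0 : Integrable (fun z : Vd d × (I → ℝ) => ‖a z.2‖) (P.prod volume) := hTm.norm.comp_snd P
    refine h0.mono' ((ham.comp measurable_snd).mul (echr_meas.comp measurable_swap)).aestronglyMeasurable (ae_of_all _ fun z => ?_)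
    rw [norm_mul, ech_norm, mul_one]
  have hb : ∀ g : (I → ℝ) → ℂ, Measurable g → (∀ t, ‖g t‖ ≤ 1) → Integrable (fun t => a t * g t) := by
    intro g hg h1
    refine hTm.norm.mono' ((ham.mul hg).aestronglyMeasurable) (ae_of_all _ fun t => ?_)
    rw [norm_mul]
    exact mul_le_of_le_one_right (norm_nonneg _) (h1 t)
  have e : ∀ y, ∫ t, (T t : ℂ) * fa P m t y = G y - ∫ y', G y' ∂P := by
    intro y
    have e2 : ∫ y', G y' ∂P = ∫ t, a t * ∫ y', ech t (rI I y') ∂P := by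
      rw [hG, integral_integral_swap hprod]
      refine integral_congr_ae (ae_of_all _ fun t => ?_)
      dsimp only
      rw [integral_const_mul]
    have i1 : Integrable (fun t => a t * ech t (rI I y)) := hb (fun t => ech t (rI I y)) (echr_meas1 y) fun t => (ech_norm _ _).le
    have i2 : Integrable (fun t => a t * ∫ y', ech t (rI I y') ∂P) := hb (fun t => ∫ y', ech t (rI I y') ∂P) (phi_meas (P := P)) fun t => phi_le (P := P) t
    have e3 : ∀ t, (T t : ℂ) * fa P m t y = a t * ech t (rI I y) - a t * ∫ y', ech t (rI I y') ∂P := fun t => by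
      unfold fa; rw [ha]; ring
    rw [e2, integral_congr_ae (ae_of_all _ e3), integral_sub i1 i2]
  have hG2 : ∫⁻ y, ‖G y‖ₑ ^ 2 ∂P ≤ 2 * ((∫⁻ t, ‖a t‖ₑ ^ 2) * ∫⁻ u, ‖ftI (marginal I q) u‖ₑ) := by
    have hmap : IsFiniteMeasure (P.map (rI I)) := inferInstance
    have h1 := quadQ (P.map (rI I)) ham hTm
    rw [lintegral_map] at h1
    · refine h1.trans ?_
      gcongr with u
      rw [integral_map rI_meas.aemeasurable]
      · rw [← ofReal_norm, ← ofReal_norm]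
        exact ENNReal.ofReal_le_ofReal (law_char hf hq u)
      · exact (ech_cont.comp ((continuous_const (y := u)).prodMk continuous_id)).aestronglyMeasurable
    · exact (int_ech_meas ham).enorm.pow_const 2
    · exact rI_meas
  have hmean : ‖∫ y', G y' ∂P‖ₑ ^ 2 ≤ ∫⁻ y, ‖G y‖ₑ ^ 2 ∂P := by
    have := jensenE (P := P) hGm.enorm (s := 2) pN
    have h2 := ENNReal.rpow_le_rpow (enorm_integral_le_lintegral_enorm (μ := P) G) (by norm_num : (0 : ℝ) ≤ 2)
    simp only [ENNReal.rpow_ofNat] at this h2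
    exact h2.trans this
  calc _ ≤ ∫⁻ y, (2 * ‖G y‖ₑ ^ 2 + 2 * ‖∫ y', G y' ∂P‖ₑ ^ 2) ∂P := by
        refine lintegral_mono fun y => ?_
        dsimp only
        rw [e, ← mul_add]
        refine (pow_le_pow_left' (enorm_sub_le) 2).trans ?_
        have := ENNReal.rpow_add_le_mul_rpow_add_rpow (‖G y‖ₑ) (‖∫ y', G y' ∂P‖ₑ) (p := 2) pN
        norm_num at this
        exact this
    _ = 2 * ∫⁻ y, ‖G y‖ₑ ^ 2 ∂P + 2 * ‖∫ y', G y' ∂P‖ₑ ^ 2 := by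
        rw [lintegral_add_right _ measurable_const, lintegral_const_mul' _ _ pS, lintegral_const, measure_univ, mul_one]
    _ ≤ 2 * ∫⁻ y, ‖G y‖ₑ ^ 2 ∂P + 2 * ∫⁻ y, ‖G y‖ₑ ^ 2 ∂P := by gcongr
    _ = 4 * ∫⁻ y, ‖G y‖ₑ ^ 2 ∂P := by ring
    _ ≤ 4 * (2 * ((∫⁻ t, ‖a t‖ₑ ^ 2) * ∫⁻ u, ‖ftI (marginal I q) u‖ₑ)) := by gcongr
    _ = _ := by ring
end

end
section

theorem split_eLp {X : Type} [MeasurableSpace X] {ν : Measure X} {p : ℝ} (hp : 1 < p) {a : X → ℂ}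
    (h1 : LpOK ν p (fun x => Complex.reCLM (a x))) (h2 : LpOK ν p (fun x => Complex.imCLM (a x))) :
    eLpNorm a (oR p) ν ≤ oR (Zf ν p (fun x => Complex.reCLM (a x))) + oR (Zf ν p (fun x => Complex.imCLM (a x))) := by
  rw [← Zf_eq hp h1, ← Zf_eq hp h2]
  have e : a = (fun x => ((Complex.reCLM (a x) : ℝ) : ℂ)) + (fun x => ((Complex.imCLM (a x) : ℝ) : ℂ) * Complex.I) := by
    funext x
    rw [Pi.add_apply, Complex.reCLM_apply, Complex.imCLM_apply, Complex.re_add_im]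
  nth_rw 1 [e]
  refine (eLpNorm_add_le ?_ ?_ (by simpa using hp.le)).trans (add_le_add ?_ ?_)
  · exact (Complex.measurable_ofReal.comp h1.1).aestronglyMeasurable
  · exact ((Complex.measurable_ofReal.comp h2.1).mul_const _).aestronglyMeasurable
  · exact eLpNorm_mono fun x => by rw [Complex.norm_real]
  · exact eLpNorm_mono fun x => by rw [norm_mul, Complex.norm_real, Complex.norm_I, mul_one]

theorem planchN {ι : Type} [Fintype ι] {a : (ι → ℝ) → ℂ} (ham : Measurable a) (ha : Integrable a) :
    eLpNorm (fun x : ι → ℝ => ∫ t, cE t x * a t) (oR 2) volume ≤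
      oR (2 * (2 * Real.pi) ^ Fintype.card ι) * eLpNorm a (oR 2) volume := by
  have h := planch ham ha
  rw [eLp_eq _ pN, eLp_eq _ pN]
  simp only [ENNReal.rpow_ofNat]
  refine (ENNReal.rpow_le_rpow h pN).trans ?_
  rw [ENNReal.mul_rpow_of_nonneg _ _ pN, ENNReal.ofReal_mul pN, ENNReal.ofReal_ofNat]
  gcongr
  have h1 : (1 : ℝ≥0∞) ≤ 2 * oR ((2 * Real.pi) ^ Fintype.card ι) := by
    have : (1 : ℝ≥0∞) ≤ oR ((2 * Real.pi) ^ Fintype.card ι) := by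
      rw [ENNReal.one_le_ofReal]; exact one_le_pow₀ (by linarith [Real.pi_gt_three])
    calc (1 : ℝ≥0∞) = 1 * 1 := by simp
      _ ≤ _ := mul_le_mul' pN this
  calc _ ≤ (2 * oR ((2 * Real.pi) ^ Fintype.card ι)) ^ (1 : ℝ) := ENNReal.rpow_le_rpow_of_exponent_le h1 pN
    _ = _ := ENNReal.rpow_one _

section
variable {d : ℕ} {I : Finset (Fin d)} {K : ℝ → ℝ}

theorem xi_fourier (κ : SchwartzMap ℝ ℂ)
    (hκ : eFT κ K)
    {f q : Vd d → ℝ} (hf : IsDensity f) (hq : IsDensity q) {h : Vd d} (H : HU I h) {n : ℕ} (hn : 3 ≤ n)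
    (hi : Integrable (mul I κ q h)) (y : Fin n → Vd d) :
    eLpNorm (xiProc I K f q h y) (oR 2) volume ≤
      oR (2 * (n : ℝ)⁻¹) * eLpNorm (fun t => ∑ k, fa (dm (conv f q)) (mul I κ q h) t (y k)) (oR 2) volume := by
  have := law_prob hf hq
  have hm := mul_meas (I := I) (h := h) κ hq
  set P := dm (conv f q) with hP
  set a : (I → ℝ) → ℂ := fun t => ∑ k, fa P (mul I κ q h) t (y k) with ha
  set c : ℝ := (2 * Real.pi) ^ (-(I.card : ℝ)) with hc
  have hc0 : 0 < c := two_pi_nn _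
  have e : xiProc I K f q h y = ((n : ℝ)⁻¹ * c) • (fun x : I → ℝ => ∫ t, cE t x * a t) := by
    funext x
    rw [xi_eq f q h hn, Pi.smul_apply, Complex.real_smul, ← hP]
    simp_rw [cen_fa (P := P) hm hi (c := (c : ℂ)) (fun x => Lh_eq κ hκ q H x)]
    rw [← Finset.mul_sum, ← integral_finsetSum]
    · push_cast
      rw [mul_assoc]; congr 3
      funext t
      rw [ha, Finset.mul_sum]
    · intro k _
      refine (fa_int (P := P) hm hi (y k)).norm.mono' ((expn_meas x).mul (fa_meas1 hm (y k))).aestronglyMeasurable (ae_of_all _ fun t => ?_)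
      rw [norm_mul, expn_norm, one_mul]
  have ham : Measurable a := Finset.measurable_sum _ fun k _ => fa_meas1 hm (y k)
  have hai : Integrable a := integrable_finsetSum _ fun k _ => fa_int hm hi (y k)
  rw [e, eLpNorm_const_smul, ← ofReal_norm, Real.norm_of_nonneg pP]
  calc _ ≤ oR ((n : ℝ)⁻¹ * c) * (oR (2 * (2 * Real.pi) ^ Fintype.card I) * eLpNorm a (oR 2) volume) := by
        gcongr; exact planchN ham hai
    _ = _ := by
        rw [← mul_assoc, ← ENNReal.ofReal_mul pP]
        congr 2
        have : c * (2 * Real.pi) ^ Fintype.card I = 1 := by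
          rw [hc, Fintype.card_coe, ← Real.rpow_natCast, ← Real.rpow_add pP]; simp
        calc (n : ℝ)⁻¹ * c * (2 * (2 * Real.pi) ^ Fintype.card I) = 2 * (n : ℝ)⁻¹ * (c * (2 * Real.pi) ^ Fintype.card I) := by ring
          _ = _ := by rw [this, mul_one]

theorem grid_V {lam : Vd d} (hI : I.Nonempty) {p : ℝ} (hp : 0 < p) {n : ℕ} (hn : 3 ≤ n) {h : Vd d} (hg : memGrid lam (oR p) n I h) :
    PW I h (fun _ => 1) ≤ Real.log n ^ (-p) := by
  have hl : 0 ≤ Real.log n := Real.log_nonneg (by exact_mod_cast (by omega : 1 ≤ n))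
  have hm : (0 : ℝ) < I.card := by exact_mod_cast Finset.card_pos.2 hI
  calc PW I h (fun _ => 1) ≤ ∏ _j : I, Real.log n ^ (-(p / I.card)) := by
        refine Finset.prod_le_prod (fun j _ => (Real.rpow_pos_of_pos (grid_HU hg j j.2).1 _).le) fun j _ => ?_
        have := (hg.2.1 j j.2).2
        unfold hmaxG at this
        rw [if_neg ENNReal.ofReal_ne_top, ENNReal.toReal_ofReal hp.le] at this
        rwa [Real.rpow_one]
    _ = _ := by
        rw [Finset.prod_const, Finset.card_univ, Fintype.card_coe, ← Real.rpow_natCast, ← Real.rpow_mul hl]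
        congr 1; field_simp
end

end
section

theorem int_le_of_lint {Ω : Type} [MeasurableSpace Ω] {P : Measure Ω} {F : Ω → ℝ} (hF : ∀ y, 0 ≤ F y) {c : ℝ} (hc : 0 ≤ c)
    (h : ∫⁻ y, oR (F y) ∂P ≤ oR c) : ∫ y, F y ∂P ≤ c := by
  by_cases hi : Integrable F P
  · rw [← ENNReal.ofReal_le_ofReal_iff hc, ofReal_integral_eq_lintegral_ofReal hi (ae_of_all _ hF)]
    exact h
  · rw [integral_undef hi]; exact hc

theorem lint_Nf {X : Type} [MeasurableSpace X] {ν : Measure X} {p : ℝ} (hp : 0 ≤ p) {T : X → ℝ} (hT : LpOK ν p T) :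
    ∫⁻ x, ‖T x‖ₑ ^ p ∂ν = oR (Nf ν p T) := by
  unfold Nf
  rw [ofReal_integral_eq_lintegral_ofReal hT.2 (ae_of_all _ fun x => by positivity)]
  refine lintegral_congr fun x => ?_
  rw [← ENNReal.ofReal_rpow_of_nonneg (abs_nonneg _) hp, ← Real.norm_eq_abs, ofReal_norm]

theorem Jp_two (a : ℝ) : Jp 2 a = a := by simp [Jp]

section
variable {X : Type} [MeasurableSpace X] {ν : Measure X}
theorem H1two {T S : X → ℝ} (hT : LpOK ν 2 T) (hS : LpOK ν 2 S) {M : ℝ} (hM : Zf ν 2 S ≤ M) :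
    |Df ν 2 (fun x => T x + S x) S - Df ν 2 T S| ≤ M ^ 2 ∧ |Nf ν 2 (fun x => T x + S x) - Nf ν 2 T| * |Df ν 2 T S| ≤ 3 * Df ν 2 T S ^ 2 + M ^ 4 := by
  have i1 := Df_integrable pN hT hS
  have i2 := Df_integrable pN hS hS
  have hN : Df ν 2 S S = Nf ν 2 S := by
    unfold Df Nf
    exact integral_congr_ae (ae_of_all _ fun x => by simp only [Jp_mul (by norm_num : (1 : ℝ) < 2)])
  have e1 : Df ν 2 (fun x => T x + S x) S = Df ν 2 T S + Nf ν 2 S := by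
    rw [← hN]; unfold Df
    rw [← integral_add i1 i2]
    exact integral_congr_ae (ae_of_all _ fun x => by simp only [Jp_two]; ring)
  have e2 : Nf ν 2 (fun x => T x + S x) = Nf ν 2 T + 2 * Df ν 2 T S + Nf ν 2 S := by
    unfold Nf Df
    have i3 := i1.const_mul 2
    have i4 : Integrable (fun x => |T x| ^ (2 : ℝ) + 2 * (Jp 2 (T x) * S x)) ν := hT.2.add i3
    rw [← integral_const_mul, ← integral_add hT.2 i3, ← integral_add i4 hS.2]
    refine integral_congr_ae (ae_of_all _ fun x => ?_)
    simp only [Jp_two, Real.rpow_ofNat, sq_abs]; ring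
  have hle : Nf ν 2 S ≤ M ^ 2 := by
    rw [← Zf_pow pN, Real.rpow_ofNat]
    exact pow_le_pow_left₀ (Zf_nonneg _) hM 2
  have h0 := Nf_nonneg (ν := ν) (p := 2) S
  constructor
  · rw [e1, add_sub_cancel_left, abs_of_nonneg h0]; exact hle
  · rw [e2, show Nf ν 2 T + 2 * Df ν 2 T S + Nf ν 2 S - Nf ν 2 T = 2 * Df ν 2 T S + Nf ν 2 S by ring]
    set D := Df ν 2 T S
    have : |2 * D + Nf ν 2 S| ≤ 2 * |D| + Nf ν 2 S := by
      refine (abs_add_le _ _).trans ?_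
      rw [abs_mul, abs_of_nonneg h0]; simp
    have h1 : |D| ^ 2 = D ^ 2 := sq_abs D
    have h2 : Nf ν 2 S ^ 2 ≤ M ^ 4 := by
      calc Nf ν 2 S ^ 2 ≤ (M ^ 2) ^ 2 := pow_le_pow_left₀ h0 hle 2
        _ = _ := by ring
    have h3 := abs_nonneg D
    nlinarith [mul_le_mul_of_nonneg_right this h3, sq_nonneg (|D| - Nf ν 2 S)]
end

section
variable {d : ℕ} {I : Finset (Fin d)} {m : (I → ℝ) → ℂ} {ρ : ℂ →L[ℝ] ℝ}

theorem rfa_ok {P : Measure Vd d} [IsProbabilityMeasure P] (hρ : RF ρ) (hm : Measurable m) {S : ℝ} (hS : 0 ≤ S) (h2 : ∫⁻ t, ‖m t‖ₑ ^ 2 ≤ oR (S ^ 2)) (y : Vd d) :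
    LpOK volume 2 (fun t => ρ (fa P m t y)) ∧ Zf volume 2 (fun t => ρ (fa P m t y)) ≤ 2 * S := by
  have hmm : Measurable (fun t => ρ (fa P m t y)) := ρ.continuous.measurable.comp (fa_meas1 hm y)
  have hle : eLpNorm (fun t => ρ (fa P m t y)) (oR 2) volume ≤ oR (2 * S) := by
    have h1 : eLpNorm (fun t => ρ (fa P m t y)) (oR 2) volume ≤ eLpNorm ((2 : ℝ) • m) (oR 2) volume :=
      eLpNorm_mono fun t => by
        rw [Pi.smul_apply, norm_smul, Real.norm_ofNat]
        exact (hρ _).trans (fa_le t y)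
    refine h1.trans ?_
    rw [eLpNorm_const_smul, ENNReal.ofReal_mul pN, ← ofReal_norm, Real.norm_ofNat]
    gcongr
    rw [eLp_eq _ pN]
    simp only [ENNReal.rpow_ofNat]
    refine (ENNReal.rpow_le_rpow h2 pN).trans ?_
    rw [ENNReal.ofReal_rpow_of_nonneg pP pN, ← Real.sqrt_eq_rpow, Real.sqrt_sq hS]
  have hok : LpOK volume 2 (fun t => ρ (fa P m t y)) := LpOK.of_memLp pN hmm ⟨hmm.aestronglyMeasurable, hle.trans_lt ENNReal.ofReal_lt_top⟩
  refine ⟨hok, ?_⟩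
  rw [Zf_eq pN hok] at hle
  exact (ENNReal.ofReal_le_ofReal_iff pP).1 hle

theorem rfa_var {f q : Vd d → ℝ} (hf : IsDensity f) (hq : IsDensity q) (hQ : Integrable (ftI (marginal I q))) (hρ : RF ρ) (hm : Measurable m)
    (hi : Integrable m) {s : ℝ} (hs : 0 ≤ s) (hsup : ∀ t, ‖m t‖ ≤ s) {M : ℝ}
    {T : (I → ℝ) → ℝ} (hT : LpOK volume 2 T) :
    ∫⁻ y, oR (3 * Df volume 2 T (fun t => ρ (fa (dm (conv f q)) m t y)) ^ 2 + M ^ 4) ∂(dm (conv f q)) ≤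
      oR (24 * s ^ 2 * (∫ u, ‖ftI (marginal I q) u‖) * Zf volume 2 T ^ 2 + M ^ 4) := by
  have := law_prob hf hq
  have hTm : Integrable (fun t => (T t : ℂ) * m t) := by
    have h1 : Integrable (fun t => |T t| ^ (2 : ℝ) + s * ‖m t‖) := hT.2.add (hi.norm.const_mul s)
    refine h1.mono' ((Complex.measurable_ofReal.comp hT.1).mul hm).aestronglyMeasurable (ae_of_all _ fun t => ?_)
    rw [norm_mul, Complex.norm_real, Real.norm_eq_abs, Real.rpow_ofNat]
    nlinarith [hsup t, norm_nonneg (m t), sq_nonneg (|T t| - ‖m t‖), abs_nonneg (T t)]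
  have hD : ∀ y, Df volume 2 T (fun t => ρ (fa (dm (conv f q)) m t y)) ^ 2 ≤ ‖∫ t, (T t : ℂ) * fa (dm (conv f q)) m t y‖ ^ 2 := by
    intro y
    have hint : Integrable (fun t => (T t : ℂ) * fa (dm (conv f q)) m t y) := by
      refine (hTm.norm.const_mul 2).mono' ((Complex.measurable_ofReal.comp hT.1).mul (fa_meas1 hm y)).aestronglyMeasurable (ae_of_all _ fun t => ?_)
      rw [norm_mul, norm_mul]
      calc _ ≤ ‖(T t : ℂ)‖ * (2 * ‖m t‖) := by gcongr; exact fa_le t y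
        _ = _ := by ring
    have : Df volume 2 T (fun t => ρ (fa (dm (conv f q)) m t y)) = ρ (∫ t, (T t : ℂ) * fa (dm (conv f q)) m t y) := by
      rw [← ρ.integral_comp_comm hint]
      refine integral_congr_ae (ae_of_all _ fun t => ?_)
      dsimp only
      rw [Jp_two, ← Complex.real_smul, map_smul, smul_eq_mul]
    rw [this, ← sq_abs]
    exact pow_le_pow_left₀ (abs_nonneg _) (hρ _) 2
  have hv := fa_var hf hq hm hT.1 hTm
  have hT2 : ∫⁻ t, ‖(T t : ℂ) * m t‖ₑ ^ 2 ≤ oR (s ^ 2 * Zf volume 2 T ^ 2) := by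
    have e := lint_Nf pN hT
    rw [← Zf_pow pN] at e
    simp only [ENNReal.rpow_ofNat, Real.rpow_ofNat] at e
    rw [ENNReal.ofReal_mul pP, ← e, ← lintegral_const_mul' _ _ pS]
    refine lintegral_mono fun t => ?_
    dsimp only
    rw [enorm_mul, mul_pow, mul_comm, ENNReal.ofReal_pow hs]
    gcongr
    · rw [← ofReal_norm]; exact ENNReal.ofReal_le_ofReal (hsup t)
    · rw [← ofReal_norm, Complex.norm_real, ofReal_norm]
  have hQ2 : ∫⁻ u, ‖ftI (marginal I q) u‖ₑ = oR (∫ u, ‖ftI (marginal I q) u‖) := by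
    rw [ofReal_integral_norm_eq_lintegral_enorm hQ]
  have hQn : 0 ≤ ∫ u, ‖ftI (marginal I q) u‖ := integral_nonneg fun _ => norm_nonneg _
  have hM4 : 0 ≤ M ^ 4 := by positivity
  calc _ ≤ ∫⁻ y, (3 * ‖∫ t, (T t : ℂ) * fa (dm (conv f q)) m t y‖ₑ ^ 2 + oR (M ^ 4)) ∂(dm (conv f q)) := by
        refine lintegral_mono fun y => ?_
        dsimp only
        rw [ENNReal.ofReal_add pP hM4, ENNReal.ofReal_mul pN, ENNReal.ofReal_ofNat, ← ofReal_norm, ← ENNReal.ofReal_pow (norm_nonneg _)]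
        exact add_le_add (mul_le_mul' le_rfl (ENNReal.ofReal_le_ofReal (hD y))) le_rfl
    _ = 3 * ∫⁻ y, ‖∫ t, (T t : ℂ) * fa (dm (conv f q)) m t y‖ₑ ^ 2 ∂(dm (conv f q)) + oR (M ^ 4) := by
        rw [lintegral_add_right _ measurable_const, lintegral_const_mul' _ _ pS, lintegral_const, measure_univ, mul_one]
    _ ≤ 3 * (8 * (oR (s ^ 2 * Zf volume 2 T ^ 2) * oR (∫ u, ‖ftI (marginal I q) u‖))) + oR (M ^ 4) := by
        rw [← hQ2]
        gcongr
        exact hv.trans (by gcongr)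
    _ = _ := by
        rw [ENNReal.ofReal_add pP hM4, ← ENNReal.ofReal_mul pP]
        congr 1
        rw [show (3 : ℝ≥0∞) = oR 3 by simp, show (8 : ℝ≥0∞) = oR 8 by simp, ← ENNReal.ofReal_mul pN, ← ENNReal.ofReal_mul pN]
        congr 1; ring
end

end
section

section
variable {d : ℕ} {I : Finset (Fin d)} {K : ℝ → ℝ} {q : Vd d → ℝ} {lam : Vd d}
attribute [local irreducible] fa mul Zf Nf Df
theorem sqrtn {n : ℕ} (hn : 3 ≤ n) : 0 < (n : ℝ) ∧ 0 < (n : ℝ) ^ ((1 : ℝ) / 2) ∧ ((n : ℝ) ^ ((1 : ℝ) / 2)) ^ 2 = n ∧ (n : ℝ)⁻¹ * (n : ℝ) ^ ((1 : ℝ) / 2) = (n : ℝ) ^ (-(1 : ℝ) / 2) ∧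
    Real.log n ≤ 2 * (n : ℝ) ^ ((1 : ℝ) / 2) ∧ Real.log n ≤ n := by
  have h0 : (0 : ℝ) < n := by positivity
  refine ⟨h0, by positivity, ?_, ?_, ?_, ?_⟩
  · rw [← Real.rpow_natCast, ← Real.rpow_mul h0.le]; norm_num
  · rw [← Real.rpow_neg_one, ← Real.rpow_add h0]; norm_num
  · refine (Real.log_le_rpow_div h0.le (ε := 1 / 2) pP).trans (le_of_eq (by ring))
  · exact (Real.log_le_sub_one_of_pos h0).trans pL

set_option maxHeartbeats 1000000 in
theorem core_two (hI : I.Nonempty) (κ : SchwartzMap ℝ ℂ)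
    (hκ : eFT κ K)
    (hq : IsDensity q) {A : ℝ} (hG : GB I q A lam) (hQ : Integrable (ftI (marginal I q))) {r : ℝ} (hr : 1 ≤ r) :
    Core I K q lam (oR 2) r := by
  obtain ⟨C, hC, hMB⟩ := mulBds κ hq hG
  have hlam := hG.2.1
  have hpr : (oR 2).toReal = 2 := ENNReal.toReal_ofReal pN
  have hUp : ∀ n h, Up K q lam (oR 2) n I h = oR ((n : ℝ) ^ (-(1 : ℝ) / 2) * PW I h (fun j => -lam j - 1 / 2)) := by
    intro n h
    unfold Up
    rw [if_neg ENNReal.ofReal_ne_top, if_pos pS, PW_eq (fun j => -lam j - 1 / 2)]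
  set Q := ∫ u, ‖ftI (marginal I q) u‖ with hQd
  have hQ0 : 0 ≤ Q := integral_nonneg fun _ => norm_nonneg _
  set c := 600 * (r + 4) * (1 + Q) with hc
  have hc2 : 600 * (r + 4) ≤ c := by rw [hc]; nlinarith
  have hc1 : 3000 ≤ c := by linarith
  have hcc : c ≤ c ^ 2 := by nlinarith
  have hCC : C ≤ (1 + C) ^ 2 := by nlinarith
  have hcQ : 576 * ((r + 4) * Q) ≤ c ^ 2 := by refine le_trans ?_ hcc; rw [hc]; nlinarith
  have hccc : c ≤ (c ^ 2) ^ 2 := by nlinarith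
  refine ⟨1, (1 + 2) * ∑ j : I, -(-lam j - 1 / 2), 4 * c * (1 + C), one_pos, mul_nonneg pN (Finset.sum_nonneg fun j _ => by have := hlam j; linarith), by nlinarith, ?_⟩
  intro n hn f hf h hg
  right
  obtain ⟨hn0, hs0, hs2, hs3, hl2, hln⟩ := sqrtn hn
  have H := grid_HU hg
  obtain ⟨mi, -, m2, msup, -, -⟩ := hMB h H
  set PH := PW I h (fun j => -lam j - 1 / 2) with hPH
  have hPH0 : 0 < PH := PW_pos (fun j hj => (H j hj).1) _
  have hle : (n : ℝ) ^ (-(1 : ℝ) / 2) ≤ 1 := Real.rpow_le_one_of_one_le_of_nonpos (by exact_mod_cast (by omega : 1 ≤ n)) pN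
  constructor
  · rw [hUp, one_mul]
    refine ENNReal.ofReal_le_ofReal ?_
    have := grid_PW hn hg (e := fun j => -lam j - 1 / 2) (fun j => by have := hlam j; linarith)
    rw [hpr] at this
    exact (mul_le_of_le_one_left hPH0.le hle).trans this
  obtain ⟨hl1, j, hj1, hj2⟩ := jch hn hr
  have hV := grid_V hI pN hn hg
  set V := PW I h (fun _ => 1) with hVd
  have hV0 : 0 < V := PW_pos (fun j hj => (H j hj).1) _
  have hPH2 : PH ^ 2 = PW I h (fun j => -2 * lam j - 1) := by
    rw [← Real.rpow_natCast, hPH, PW_rpow (fun j hj => (H j hj).1)]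
    congr 1; funext j; push_cast; ring
  have hPl : PW I h (fun j => -lam j) ^ 2 = PH ^ 2 * V := by
    rw [hPH2, hVd, ← Real.rpow_natCast, PW_rpow (fun j hj => (H j hj).1), PW_mul (fun j hj => (H j hj).1)]
    congr 1; funext j; push_cast; ring
  have hjV : ((j : ℝ) + 2) * V ≤ r + 4 := by
    have : Real.log n * V ≤ 1 := by
      calc Real.log n * V ≤ Real.log n * Real.log n ^ (-(2 : ℝ)) := by gcongr
        _ = (Real.log n)⁻¹ := by
            rw [← Real.rpow_one_add' pL pN, ← Real.rpow_neg_one]; norm_num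
        _ ≤ 1 := inv_le_one_of_one_le₀ hl1
    calc ((j : ℝ) + 2) * V ≤ (r + 4) * Real.log n * V := by gcongr
      _ = (r + 4) * (Real.log n * V) := by ring
      _ ≤ (r + 4) * 1 := by gcongr
      _ = _ := mul_one _
  set S := (1 + C) * PH with hS
  have hS0 : 0 < S := by positivity
  set s := (1 + C) * PW I h (fun j => -lam j) with hsd
  have hPl0 : 0 < PW I h (fun j => -lam j) := PW_pos (fun j hj => (H j hj).1) _
  have hss0 : 0 ≤ s := by positivity
  have hss : s ^ 2 = S ^ 2 * V := by rw [hsd, hS, mul_pow, mul_pow, hPl]; ring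
  have hsup : ∀ t, ‖mul I κ q h t‖ ≤ s := fun t => (msup t).trans (mul_le_mul_of_nonneg_right pL hPl0.le)
  have hm2 : ∫⁻ t, ‖mul I κ q h t‖ₑ ^ 2 ≤ oR (S ^ 2) := m2.trans (ENNReal.ofReal_le_ofReal (by
    rw [← hPH2, hS, mul_pow]; exact mul_le_mul_of_nonneg_right hCC (sq_nonneg PH)))
  have hP := law_prob hf hq
  have hmm := mul_meas (I := I) (h := h) κ hq
  set B := c * (n : ℝ) ^ ((1 : ℝ) / 2) * S with hBd
  have hB0 : 0 < B := by positivity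
  have eB : B ^ 2 = c ^ 2 * n * S ^ 2 := by rw [hBd, mul_pow, mul_pow, hs2]
  have eB2 : B ^ (2 : ℝ) = c ^ 2 * n * S ^ 2 := by rw [Real.rpow_ofNat, eB]
  set P := dm (conv f q) with hPd
  set m := mul I κ q h with hmd
  have rm : ∀ ρ : ℂ →L[ℝ] ℝ, Measurable (fun z : (I → ℝ) × Vd d => ρ (fa P m z.1 z.2)) := fun ρ =>
    ρ.continuous.measurable.comp (fa_meas hmm)
  have hok : ∀ ρ, RF ρ → ∀ y, _ := fun ρ hρ y => rfa_ok (P := P) hρ hmm hS0.le hm2 y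
  have key : ∀ ρ, RF ρ → ∫⁻ y, oR (Zf volume 2 (fun x => ∑ i, ρ (fa P m x (y i))) ^ (2 * ((j : ℝ) + 2))) ∂(Measure.pi fun _ : Fin n => P) ≤ oR (B ^ (2 * ((j : ℝ) + 2))) := by
    intro ρ hρ
    refine thmC P pN (ℓ := fun x y => ρ (fa P m x y)) (rm ρ) (M := 2 * S) pP (fun y => (hok ρ hρ y).1)
      (fun y => (hok ρ hρ y).2) (fun x => ?_) (by omega) (a1 := (2 * S) ^ 2) (a2 := 0) (b1 := 24 * s ^ 2 * Q) (b2 := (2 * S) ^ 4) hB0 ?_ ?_ ?_ ?_ ?_ ?_ ?_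
    · have hi0 : Integrable (fun y => fa P m x y) P := fa_inty x
      exact (ρ.integral_comp_comm hi0).trans (by rw [fa_mean, map_zero])
    · intro T hT
      rw [sub_self, Real.rpow_zero, mul_one, add_zero]
      exact int_le_const pP fun y => (H1two hT (hok ρ hρ y).1 (hok ρ hρ y).2).1
    · intro T hT
      have hz := Zf_nonneg (ν := volume) (p := 2) T
      have e2 : (Zf volume 2 T + 2 * S) ^ ((2 : ℝ) * 2 - 2) = (Zf volume 2 T + 2 * S) ^ 2 := by
        rw [← Real.rpow_natCast]; norm_num
      rw [e2]
      refine int_le_of_lint (fun y => by positivity) pP ?_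
      refine (lintegral_mono fun y => ENNReal.ofReal_le_ofReal (H1two hT (hok ρ hρ y).1 (hok ρ hρ y).2).2).trans ?_
      refine (rfa_var hf hq hQ hρ hmm mi hss0 hsup (M := 2 * S) hT).trans (ENNReal.ofReal_le_ofReal ?_)
      gcongr
      linarith
    · rw [eB]
      calc 24 * (n : ℝ) * (2 * S) ^ 2 = 96 * n * S ^ 2 := by ring
        _ ≤ _ := by gcongr; linarith
    · rw [mul_zero]; positivity
    · rw [eB, hss]
      calc 24 * (n : ℝ) * (j + 2) * (24 * (S ^ 2 * V) * Q) = 576 * (((j + 2) * V) * Q) * n * S ^ 2 := by ring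
        _ ≤ 576 * ((r + 4) * Q) * n * S ^ 2 := by gcongr
        _ ≤ c ^ 2 * n * S ^ 2 := by exact mul_le_mul_of_nonneg_right (mul_le_mul_of_nonneg_right hcQ hn0.le) (sq_nonneg S)
    · rw [eB2]
      calc 24 * (n : ℝ) * (j + 2) * (2 * S) ^ 4 ≤ 24 * (n : ℝ) * ((r + 4) * n) * (2 * S) ^ 4 := by
            gcongr; exact hj2.trans (by gcongr)
        _ = 384 * (r + 4) * (n * S ^ 2) ^ 2 := by ring
        _ ≤ (c ^ 2) ^ 2 * (n * S ^ 2) ^ 2 := by gcongr; linarith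
        _ = _ := by ring
    · calc 2 * (2 * ((j : ℝ) + 2)) * (2 * S) ≤ 2 * (2 * ((r + 4) * (2 * (n : ℝ) ^ ((1 : ℝ) / 2)))) * (2 * S) := by
            gcongr; exact hj2.trans (by gcongr)
        _ = 16 * (r + 4) * (n : ℝ) ^ ((1 : ℝ) / 2) * S := by ring
        _ ≤ B := by rw [hBd]; gcongr; linarith
  have zm : ∀ ρ : ℂ →L[ℝ] ℝ, Measurable (fun y : Fin n → Vd d => Zf volume 2 (fun x : I → ℝ => ∑ i, ρ (fa P m x (y i)))) := fun ρ =>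
    zf_sum_meas 2 (ℓ := fun x y => ρ (fa P m x y)) (rm ρ) n
  have lok : ∀ ρ, RF ρ → ∀ y : Fin n → Vd d, LpOK volume 2 (fun x : I → ℝ => ρ (∑ i, fa P m x (y i))) := by
    intro ρ hρ y
    simp only [map_sum]
    exact LpOK.sum pN _ fun i _ => (hok ρ hρ (y i)).1
  have R1 : 1 ≤ 2 * ((j : ℝ) + 2) := by linarith [Nat.cast_nonneg (α := ℝ) j]
  refine ⟨2 * ((j : ℝ) + 2), by linarith [Nat.cast_nonneg (α := ℝ) j], fun y => oR (2 * (n : ℝ)⁻¹) * (oR (Zf volume 2 (fun x => ∑ i, Complex.reCLM (fa P m x (y i)))) + oR (Zf volume 2 (fun x => ∑ i, Complex.imCLM (fa P m x (y i))))), ?_, ?_, ?_⟩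
  · exact ((zm _).ennreal_ofReal.add (zm _).ennreal_ofReal).const_mul _
  · intro y
    refine (xi_fourier κ hκ hf hq H hn mi y).trans ?_
    refine mul_le_mul' le_rfl ((split_eLp pN (lok _ RF_re y) (lok _ RF_im y)).trans (le_of_eq ?_))
    simp only [map_sum]
  · refine (combine (zm _) (zm _) (fun y => Zf_nonneg _) (fun y => Zf_nonneg _) R1 hB0.le pP (key _ RF_re) (key _ RF_im)).trans ?_
    refine ENNReal.rpow_le_rpow ?_ pP
    rw [hUp]
    calc oR (2 * (2 * (n : ℝ)⁻¹) * B) = oR (4 * c * (1 + C) * ((n : ℝ) ^ (-(1 : ℝ) / 2) * PH)) := by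
          rw [hBd, hS, ← hs3]; congr 1; ring
      _ = oR (4 * c * (1 + C)) * oR ((n : ℝ) ^ (-(1 : ℝ) / 2) * PH) := ENNReal.ofReal_mul pP
      _ ≤ _ := mul_le_mul' le_rfl le_self_add
end

end
section

theorem addpow {e x y : ℝ} (he : 0 ≤ e) (hx : 0 ≤ x) (hy : 0 ≤ y) : (x + y) ^ e ≤ 2 ^ e * (x ^ e + y ^ e) := by
  have key : ∀ a b : ℝ, 0 ≤ a → 0 ≤ b → a ≤ b → (a + b) ^ e ≤ 2 ^ e * (a ^ e + b ^ e) := by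
    intro a b ha hb hab
    calc (a + b) ^ e ≤ (2 * b) ^ e := Real.rpow_le_rpow pL pL he
      _ = 2 ^ e * b ^ e := Real.mul_rpow pN hb
      _ ≤ _ := mul_le_mul_of_nonneg_left (by linarith [Real.rpow_nonneg ha e]) pP
  rcases le_total x y with h | h
  · exact key x y hx hy h
  · rw [add_comm x y, add_comm (x ^ e)]; exact key y x hy hx h

theorem Jp_lip {p : ℝ} (hp : 2 < p) {x y c : ℝ} (hx : |x| ≤ c) (hy : |y| ≤ c) : |Jp p x - Jp p y| ≤ p * c ^ (p - 2) * |x - y| := by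
  have hc : 0 ≤ c := (abs_nonneg x).trans hx
  have hcp := Real.rpow_nonneg hc (p - 2)
  have A : ∀ x y : ℝ, 0 ≤ x → 0 ≤ y → x ≤ c → y ≤ c → |Jp p x - Jp p y| ≤ p * c ^ (p - 2) * |x - y| := by
    intro x y hx hy hxc hyc
    rw [Jp_of_nonneg pL hx, Jp_of_nonneg pL hy]
    refine (pow_diff (p := p - 1) pL hx hy hxc hyc le_rfl).trans ?_
    rw [show p - 1 - 1 = p - 2 by ring]
    gcongr; linarith
  have sp : ∀ x : ℝ, 0 ≤ x → x ≤ c → x ^ (p - 1) ≤ c ^ (p - 2) * x := by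
    intro x hx hxc
    rw [show p - 1 = p - 2 + 1 by ring, Real.rpow_add_one' hx pL]
    gcongr
  have B : ∀ x y : ℝ, 0 ≤ x → 0 ≤ y → x ≤ c → y ≤ c → |Jp p x - Jp p (-y)| ≤ p * c ^ (p - 2) * |x - -y| := by
    intro x y hx hy hxc hyc
    rw [Jp_neg, Jp_of_nonneg pL hx, Jp_of_nonneg pL hy, sub_neg_eq_add, sub_neg_eq_add, abs_of_nonneg pP, abs_of_nonneg pP]
    calc x ^ (p - 1) + y ^ (p - 1) ≤ 1 * c ^ (p - 2) * (x + y) := by linarith [sp x hx hxc, sp y hy hyc]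
      _ ≤ _ := by gcongr; linarith
  rcases le_total 0 x with h1 | h1 <;> rcases le_total 0 y with h2 | h2
  · rw [abs_of_nonneg h1] at hx; rw [abs_of_nonneg h2] at hy
    exact A x y h1 h2 hx hy
  · rw [abs_of_nonneg h1] at hx; rw [abs_of_nonpos h2] at hy
    simpa using B x (-y) h1 pL hx hy
  · rw [abs_of_nonpos h1] at hx; rw [abs_of_nonneg h2] at hy
    rw [abs_sub_comm, abs_sub_comm x]
    simpa using B y (-x) h2 pL hy hx
  · rw [abs_of_nonpos h1] at hx; rw [abs_of_nonpos h2] at hy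
    have := A (-x) (-y) pL pL hx hy
    rwa [Jp_neg, Jp_neg, neg_sub_neg, neg_sub_neg, abs_sub_comm, abs_sub_comm y] at this

theorem pt1 {p : ℝ} (hp : 2 < p) (a b : ℝ) : |Jp p (a + b) * b - Jp p a * b| ≤ p * 2 ^ p * (|a| ^ (p - 2) * |b| ^ 2 + |b| ^ p) := by
  have h1 := Jp_lip hp (x := a + b) (y := a) (c := |a| + |b|) (abs_add_le a b) (by linarith [abs_nonneg b])
  rw [add_sub_cancel_left] at h1
  have h2 := addpow (e := p - 2) pL (abs_nonneg a) (abs_nonneg b)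
  have h3 : |b| ^ p = |b| ^ (p - 2) * |b| ^ 2 := by
    rw [← Real.rpow_natCast, ← Real.rpow_add' (abs_nonneg _) (by push_cast; linarith)]; congr 1; push_cast; ring
  have h4 : (2 : ℝ) ^ (p - 2) ≤ 2 ^ p := Real.rpow_le_rpow_of_exponent_le pN pL
  rw [← sub_mul, abs_mul, h3, ← add_mul]
  calc |Jp p (a + b) - Jp p a| * |b| ≤ p * (2 ^ p * (|a| ^ (p - 2) + |b| ^ (p - 2))) * |b| * |b| := by
        refine mul_le_mul_of_nonneg_right (h1.trans ?_) (abs_nonneg b)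
        refine mul_le_mul_of_nonneg_right (mul_le_mul_of_nonneg_left (h2.trans ?_) pL) (abs_nonneg b)
        exact mul_le_mul_of_nonneg_right h4 pP
    _ = _ := by ring

theorem pt2 {p : ℝ} (hp : 2 < p) (a b : ℝ) : |(|a + b|) ^ p - |a| ^ p| ≤ p * 2 ^ p * (|a| ^ (p - 1) * |b| + |b| ^ p) := by
  have h1 := pow_diff (p := p) pL (abs_nonneg (a + b)) (abs_nonneg a) (c := |a| + |b|) (abs_add_le a b) (by linarith [abs_nonneg b])
    (m := |b|) (by simpa using abs_abs_sub_abs_le_abs_sub (a + b) a)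
  have h2 := addpow (e := p - 1) pL (abs_nonneg a) (abs_nonneg b)
  have h3 : |b| ^ p = |b| ^ (p - 1) * |b| := by
    rw [← Real.rpow_add_one' (abs_nonneg _) pL]; congr 1; ring
  have h4 : (2 : ℝ) ^ (p - 1) ≤ 2 ^ p := Real.rpow_le_rpow_of_exponent_le pN pL
  rw [h3, ← add_mul]
  calc _ ≤ p * (2 ^ p * (|a| ^ (p - 1) + |b| ^ (p - 1))) * |b| := by
        refine h1.trans ?_
        refine mul_le_mul_of_nonneg_right (mul_le_mul_of_nonneg_left (h2.trans ?_) pL) (abs_nonneg b)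
        exact mul_le_mul_of_nonneg_right h4 pP
    _ = _ := by ring

theorem or_abs (a : ℝ) {e : ℝ} (he : 0 ≤ e) : oR (|a| ^ e) = ‖a‖ₑ ^ e := by
  rw [← ENNReal.ofReal_rpow_of_nonneg (abs_nonneg _) he, ← Real.norm_eq_abs, ofReal_norm]

section
variable {X : Type} [MeasurableSpace X] {ν : Measure X} {p : ℝ}
theorem H1gt (hp : 2 < p) {T S : X → ℝ} (hT : LpOK ν p T) (hS : LpOK ν p S) :
    oR |Df ν p (fun x => T x + S x) S - Df ν p T S| ≤ oR (p * 2 ^ p) * (∫⁻ x, ‖T x‖ₑ ^ (p - 2) * ‖S x‖ₑ ^ 2 ∂ν + ∫⁻ x, ‖S x‖ₑ ^ p ∂ν) := by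
  unfold Df
  rw [← integral_sub (Df_integrable pL (LpOK.add pL hT hS) hS) (Df_integrable pL hT hS), ← Real.norm_eq_abs, ofReal_norm]
  refine (enorm_integral_le_lintegral_enorm _).trans ?_
  rw [← lintegral_add_right _ (hS.1.enorm.pow_const p), ← lintegral_const_mul' _ _ ENNReal.ofReal_ne_top]
  refine lintegral_mono fun x => ?_
  dsimp only
  rw [← ofReal_norm, Real.norm_eq_abs, ← or_abs _ pL, ← or_abs _ pL, ← ENNReal.rpow_ofNat, ← or_abs _ pN, ← ENNReal.ofReal_mul pP, ← ENNReal.ofReal_add pP pP, ← ENNReal.ofReal_mul pP]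
  refine ENNReal.ofReal_le_ofReal ?_
  simpa using pt1 hp (T x) (S x)

theorem H2gt (hp : 2 < p) {T S : X → ℝ} (hT : LpOK ν p T) (hS : LpOK ν p S) :
    oR (|Nf ν p (fun x => T x + S x) - Nf ν p T| * |Df ν p T S|) ≤
      oR (p * 2 ^ p) * (2 * (∫⁻ x, ‖T x‖ₑ ^ (p - 1) * ‖S x‖ₑ ∂ν) ^ 2 + (∫⁻ x, ‖S x‖ₑ ^ p ∂ν) ^ 2) := by
  set D := ∫⁻ x, ‖T x‖ₑ ^ (p - 1) * ‖S x‖ₑ ∂ν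
  set W := ∫⁻ x, ‖S x‖ₑ ^ p ∂ν
  have h1 : oR |Nf ν p (fun x => T x + S x) - Nf ν p T| ≤ oR (p * 2 ^ p) * (D + W) := by
    unfold Nf
    rw [← integral_sub (LpOK.add pL hT hS).2 hT.2, ← Real.norm_eq_abs, ofReal_norm]
    refine (enorm_integral_le_lintegral_enorm _).trans ?_
    rw [← lintegral_add_right _ (hS.1.enorm.pow_const p), ← lintegral_const_mul' _ _ ENNReal.ofReal_ne_top]
    refine lintegral_mono fun x => ?_
    dsimp only
    rw [← ofReal_norm, Real.norm_eq_abs, ← or_abs _ pL, ← or_abs _ pL, ← ofReal_norm (S x), Real.norm_eq_abs, ← ENNReal.ofReal_mul pP, ← ENNReal.ofReal_add pP pP, ← ENNReal.ofReal_mul pP]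
    exact ENNReal.ofReal_le_ofReal (pt2 hp (T x) (S x))
  have h2 : oR |Df ν p T S| ≤ D := by
    unfold Df
    rw [← Real.norm_eq_abs, ofReal_norm]
    refine (enorm_integral_le_lintegral_enorm _).trans (le_of_eq ?_)
    refine lintegral_congr fun x => ?_
    rw [enorm_mul, ← ofReal_norm (Jp p (T x)), Real.norm_eq_abs, Jp_abs pL, or_abs _ pL]
  have h3 : W * D ≤ W ^ 2 + D ^ 2 := by
    rcases le_total W D with h | h
    · calc W * D ≤ D * D := by gcongr
        _ = D ^ 2 := (sq D).symm
        _ ≤ _ := le_add_self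
    · calc W * D ≤ W * W := by gcongr
        _ = W ^ 2 := (sq W).symm
        _ ≤ _ := le_self_add
  rw [ENNReal.ofReal_mul (abs_nonneg _)]
  calc _ ≤ oR (p * 2 ^ p) * (D + W) * D := mul_le_mul' h1 h2
    _ = oR (p * 2 ^ p) * (D ^ 2 + W * D) := by ring
    _ ≤ oR (p * 2 ^ p) * (D ^ 2 + (W ^ 2 + D ^ 2)) := by gcongr
    _ = _ := by ring
end

end
section

theorem sqadd (a b : ℝ≥0∞) : (a + b) ^ 2 ≤ 2 * (a ^ 2 + b ^ 2) := by
  have := ENNReal.rpow_add_le_mul_rpow_add_rpow a b (by norm_num : (1 : ℝ) ≤ 2)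
  simpa [show (2 : ℝ) - 1 = 1 by norm_num] using this

theorem young3 {ι : Type} [Fintype ι] {a l : (ι → ℝ) → ℝ≥0∞} (ha : Measurable a) (hl : Measurable l) {p : ℝ} (hp : 2 < p) :
    ∫⁻ u, (∫⁻ x, a x ^ (p - 1) * l (x - u)) ^ 2 ≤
      (∫⁻ x, a x ^ p) ^ ((2 * p - 2) / p) * (∫⁻ x, l x ^ (2 * p / (p + 2))) ^ (2 / (2 * p / (p + 2))) := by
  set s := 2 * p / (p + 2) with hs
  have hs0 : 0 < s := by positivity
  set A := ∫⁻ x, a x ^ p with hA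
  set Λ := ∫⁻ x, l x ^ s with hΛ
  have hinv : 0 < 1 / p ∧ 1 / p < 1 / 2 := ⟨by positivity, one_div_lt_one_div_of_lt pN hp⟩
  have hlm : Measurable (fun z : (ι → ℝ) × (ι → ℝ) => l (z.2 - z.1)) := hl.comp (measurable_snd.sub measurable_fst)
  have hlu : ∀ u, Measurable (fun x => l (x - u)) := fun u => hlm.comp (measurable_const.prodMk measurable_id)
  have hΛu : ∀ u, ∫⁻ x, l (x - u) ^ s = Λ := fun u => lintegral_sub_right_eq_self (fun x => l x ^ s) u
  have pt : ∀ u, (∫⁻ x, a x ^ (p - 1) * l (x - u)) ^ 2 ≤ (∫⁻ x, a x ^ p * l (x - u) ^ s) * (A ^ (1 - 2 / p) * Λ ^ (2 / p)) := by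
    intro u
    have h := ENNReal.lintegral_prod_norm_pow_le (μ := (volume : Measure (ι → ℝ))) (univ : Finset (Fin 3))
      (f := ![fun x => a x ^ p * l (x - u) ^ s, fun x => a x ^ p, fun x => l (x - u) ^ s]) (p := ![1 / 2, 1 / 2 - 1 / p, 1 / p])
      (by
        intro i _
        fin_cases i
        · exact ((ha.pow_const _).mul ((hlu u).pow_const _)).aemeasurable
        · exact (ha.pow_const _).aemeasurable
        · exact ((hlu u).pow_const _).aemeasurable)
      (by simp [Fin.sum_univ_three]; ring) (by
        intro i _
        fin_cases i
        · simp
        · simpa using hinv.2.le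
        · simpa using hinv.1.le)
    simp only [Fin.prod_univ_three, Matrix.cons_val_zero, Matrix.cons_val_one, Matrix.cons_val_two, Matrix.cons_val, Matrix.head_cons, Matrix.tail_cons] at h
    rw [hΛu u] at h
    have e : ∀ x, (a x ^ p * l (x - u) ^ s) ^ (1 / 2 : ℝ) * (a x ^ p) ^ (1 / 2 - 1 / p) * (l (x - u) ^ s) ^ (1 / p) = a x ^ (p - 1) * l (x - u) := by
      intro x
      have e1 : p - 1 = p * (1 / 2) + p * (1 / 2 - 1 / p) := by field_simp; ring
      have e2 : s * (1 / 2) + s * (1 / p) = 1 := by rw [hs]; field_simp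
      rw [ENNReal.mul_rpow_of_nonneg _ _ pN, ← ENNReal.rpow_mul, ← ENNReal.rpow_mul, ← ENNReal.rpow_mul, ← ENNReal.rpow_mul]
      calc _ = (a x ^ (p * (1 / 2)) * a x ^ (p * (1 / 2 - 1 / p))) * (l (x - u) ^ (s * (1 / 2)) * l (x - u) ^ (s * (1 / p))) := by ring
        _ = _ := by
          rw [← ENNReal.rpow_add_of_nonneg _ _ pP (mul_nonneg pL pL), ← ENNReal.rpow_add_of_nonneg _ _ pP pP, ← e1, e2, ENNReal.rpow_one]
    simp only [e] at h
    calc _ ≤ _ := pow_le_pow_left' h 2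
      _ = _ := by
        rw [mul_pow, mul_pow, ← ENNReal.rpow_natCast, ← ENNReal.rpow_natCast, ← ENNReal.rpow_natCast, ← ENNReal.rpow_mul, ← ENNReal.rpow_mul, ← ENNReal.rpow_mul,
          mul_assoc]
        congr 1
        · norm_num
        · congr 1
          · congr 1; push_cast; ring
          · congr 1; push_cast; ring
  refine (lintegral_mono pt).trans ?_
  have m1 : Measurable (fun z : (ι → ℝ) × (ι → ℝ) => a z.2 ^ p * l (z.2 - z.1) ^ s) := ((ha.comp measurable_snd).pow_const _).mul (hlm.pow_const _)
  rw [lintegral_mul_const _ m1.lintegral_prod_right', lintegral_lintegral_swap m1.aemeasurable]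
  have e3 : ∀ x, ∫⁻ u, a x ^ p * l (x - u) ^ s = a x ^ p * Λ := by
    intro x
    have hm' : Measurable (fun u => l (x - u) ^ s) := (hl.comp (measurable_const.sub measurable_id)).pow_const _
    rw [lintegral_const_mul _ hm', lintegral_sub_left_eq_self (fun x => l x ^ s) x]
  simp only [e3]
  rw [lintegral_mul_const _ (ha.pow_const _)]
  have e4 : (2 * p - 2) / p = 1 + (1 - 2 / p) := by field_simp; ring
  have e5 : 2 / s = 1 + 2 / p := by rw [hs]; field_simp
  have h2p : 2 / p < 1 := by rw [div_lt_one pL]; exact hp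
  rw [e4, e5, ENNReal.rpow_add_of_nonneg _ _ pN pL, ENNReal.rpow_add_of_nonneg _ _ pN pP, ENNReal.rpow_one, ENNReal.rpow_one]
  exact le_of_eq (by ring)

section
variable {d : ℕ} {I : Finset (Fin d)} {L : (I → ℝ) → ℂ} {f q : Vd d → ℝ} {ρ : ℂ →L[ℝ] ℝ}

theorem rcen_le {P : Measure Vd d} (hρ : RF ρ) (x : I → ℝ) (y : Vd d) :
    ‖ρ (cen P L x y)‖ₑ ≤ ‖L (x - rI I y)‖ₑ + ∫⁻ y', ‖L (x - rI I y')‖ₑ ∂P := by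
  have h1 : ‖ρ (cen P L x y)‖ₑ ≤ ‖cen P L x y‖ₑ := by
    rw [← ofReal_norm, ← ofReal_norm]; exact ENNReal.ofReal_le_ofReal (hρ _)
  refine h1.trans ?_
  unfold cen
  refine (enorm_sub_le).trans ?_
  gcongr
  exact enorm_integral_le_lintegral_enorm _

theorem rcen_var {P : Measure Vd d} [IsProbabilityMeasure P] (hρ : RF ρ) (hL : Measurable L) (x : I → ℝ) :
    ∫⁻ y, ‖ρ (cen P L x y)‖ₑ ^ 2 ∂P ≤ 4 * ∫⁻ y, ‖L (x - rI I y)‖ₑ ^ 2 ∂P := by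
  have hm : Measurable (fun y : Vd d => ‖L (x - rI I y)‖ₑ) := (Lsub_meas2 hL x).enorm
  have hj := jensenE (P := P) hm (s := 2) pN
  simp only [ENNReal.rpow_ofNat] at hj
  calc _ ≤ ∫⁻ y, 2 * (‖L (x - rI I y)‖ₑ ^ 2 + (∫⁻ y', ‖L (x - rI I y')‖ₑ ∂P) ^ 2) ∂P :=
        lintegral_mono fun y => (pow_le_pow_left' (rcen_le hρ x y) 2).trans (sqadd _ _)
    _ = 2 * ((∫⁻ y, ‖L (x - rI I y)‖ₑ ^ 2 ∂P) + (∫⁻ y', ‖L (x - rI I y')‖ₑ ∂P) ^ 2) := by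
        rw [lintegral_const_mul' _ _ pS, lintegral_add_right _ measurable_const, lintegral_const, measure_univ, mul_one]
    _ ≤ 2 * ((∫⁻ y, ‖L (x - rI I y)‖ₑ ^ 2 ∂P) + (∫⁻ y, ‖L (x - rI I y)‖ₑ ^ 2 ∂P)) := by gcongr
    _ = _ := by ring

theorem G_sup (hf : IsDensity f) (hq : IsDensity q) (hL : Measurable L) (x : I → ℝ) :
    ∫⁻ y, ‖L (x - rI I y)‖ₑ ^ 2 ∂(dm (conv f q)) ≤ eLpNorm (marginal I q) ⊤ volume * ∫⁻ u, ‖L u‖ₑ ^ 2 := by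
  have hm : Measurable (fun u : I → ℝ => ‖L (x - u)‖ₑ ^ 2) := (hL.comp (measurable_const.sub measurable_id)).enorm.pow_const 2
  refine (law_lint_le hf hq hm).trans (le_of_eq ?_)
  rw [lintegral_sub_left_eq_self (fun u => ‖L u‖ₑ ^ 2) x]

theorem G_meas {P : Measure Vd d} [IsProbabilityMeasure P] (hL : Measurable L) : Measurable (fun x : I → ℝ => ∫⁻ y, ‖L (x - rI I y)‖ₑ ^ 2 ∂P) :=
  Measurable.lintegral_prod_right' (f := fun z : (I → ℝ) × Vd d => ‖L (z.1 - rI I z.2)‖ₑ ^ 2) ((Lsub_meas hL).enorm.pow_const 2)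

theorem G_int {P : Measure Vd d} [IsProbabilityMeasure P] (hL : Measurable L) :
    ∫⁻ x : I → ℝ, (∫⁻ y, ‖L (x - rI I y)‖ₑ ^ 2 ∂P) = ∫⁻ u, ‖L u‖ₑ ^ 2 := by
  have hm : Measurable (fun z : (I → ℝ) × Vd d => ‖L (z.1 - rI I z.2)‖ₑ ^ 2) := (Lsub_meas hL).enorm.pow_const 2
  rw [lintegral_lintegral_swap hm.aemeasurable]
  have e : ∀ y : Vd d, ∫⁻ x : I → ℝ, ‖L (x - rI I y)‖ₑ ^ 2 = ∫⁻ u, ‖L u‖ₑ ^ 2 := fun y => lintegral_sub_right_eq_self (fun x => ‖L x‖ₑ ^ 2) (rI I y)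
  simp only [e]
  simp

theorem varT (hf : IsDensity f) (hq : IsDensity q) (hρ : RF ρ) (hL : Measurable L) {p : ℝ} (hp : 2 < p) {T : (I → ℝ) → ℝ} (hT : Measurable T) :
    ∫⁻ y, (∫⁻ x, ‖T x‖ₑ ^ (p - 2) * ‖ρ (cen (dm (conv f q)) L x y)‖ₑ ^ 2) ∂(dm (conv f q)) ≤
      4 * ((1 + eLpNorm (marginal I q) ⊤ volume) * (∫⁻ u, ‖L u‖ₑ ^ 2)) * (∫⁻ x, ‖T x‖ₑ ^ p) ^ ((p - 2) / p) := by
  have := law_prob hf hq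
  set P := dm (conv f q)
  set N := ∫⁻ u, ‖L u‖ₑ ^ 2
  set Q := eLpNorm (marginal I q) ⊤ volume
  have hm : Measurable (fun z : Vd d × (I → ℝ) => ‖T z.2‖ₑ ^ (p - 2) * ‖ρ (cen P L z.2 z.1)‖ₑ ^ 2) :=
    ((hT.comp measurable_snd).enorm.pow_const _).mul (((rcen_meas (P := P) (ρ := ρ) hL).comp measurable_swap).enorm.pow_const 2)
  rw [lintegral_lintegral_swap hm.aemeasurable]
  set G : (I → ℝ) → ℝ≥0∞ := fun x => ∫⁻ y, ‖L (x - rI I y)‖ₑ ^ 2 ∂P with hG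
  have hGm : Measurable G := G_meas hL
  have hp2 : 0 < p / 2 - 1 := by linarith
  have hGp : ∫⁻ x, G x ^ (p / 2) ≤ ((1 + Q) * N) ^ (p / 2) := by
    calc ∫⁻ x, G x ^ (p / 2) ≤ ∫⁻ x, ((1 + Q) * N) ^ (p / 2 - 1) * G x := by
          refine lintegral_mono fun x => ?_
          dsimp only
          rw [show p / 2 = (p / 2 - 1) + 1 by ring, ENNReal.rpow_add_of_nonneg _ _ hp2.le pN, ENNReal.rpow_one, show p / 2 - 1 + 1 - 1 = p / 2 - 1 by ring]
          refine mul_le_mul' (ENNReal.rpow_le_rpow ((G_sup hf hq hL x).trans ?_) hp2.le) le_rfl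
          exact mul_le_mul' le_add_self le_rfl
      _ = ((1 + Q) * N) ^ (p / 2 - 1) * N := by rw [lintegral_const_mul _ hGm, hG, G_int hL]
      _ ≤ ((1 + Q) * N) ^ (p / 2 - 1) * ((1 + Q) * N) := by
          gcongr
          nth_rw 1 [← one_mul N]
          exact mul_le_mul' le_self_add le_rfl
      _ = _ := by
          nth_rw 2 [← ENNReal.rpow_one ((1 + Q) * N)]
          rw [← ENNReal.rpow_add_of_nonneg _ _ hp2.le pN, sub_add_cancel]
  calc _ ≤ ∫⁻ x, 4 * (‖T x‖ₑ ^ (p - 2) * G x) := by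
        refine lintegral_mono fun x => ?_
        dsimp only
        have hm' : Measurable (fun y => ‖ρ (cen P L x y)‖ₑ ^ 2) := (((rcen_meas (P := P) (ρ := ρ) hL).comp (measurable_const.prodMk measurable_id)).enorm.pow_const 2)
        rw [lintegral_const_mul _ hm']
        calc _ ≤ ‖T x‖ₑ ^ (p - 2) * (4 * G x) := by gcongr; exact rcen_var hρ hL x
          _ = _ := by ring
    _ = 4 * ∫⁻ x, (‖T x‖ₑ ^ p) ^ ((p - 2) / p) * (G x ^ (p / 2)) ^ (2 / p) := by
        rw [lintegral_const_mul' _ _ pS]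
        congr 1
        refine lintegral_congr fun x => ?_
        rw [← ENNReal.rpow_mul, ← ENNReal.rpow_mul, show p * ((p - 2) / p) = p - 2 by field_simp, show p / 2 * (2 / p) = 1 by field_simp, ENNReal.rpow_one]
    _ ≤ 4 * ((∫⁻ x, ‖T x‖ₑ ^ p) ^ ((p - 2) / p) * (∫⁻ x, G x ^ (p / 2)) ^ (2 / p)) := by
        gcongr
        exact ENNReal.lintegral_mul_norm_pow_le (hT.enorm.pow_const _).aemeasurable (hGm.pow_const _).aemeasurable (div_nonneg pL pL) pP (by field_simp; ring)
    _ ≤ 4 * ((∫⁻ x, ‖T x‖ₑ ^ p) ^ ((p - 2) / p) * ((1 + Q) * N)) := by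
        gcongr
        refine (ENNReal.rpow_le_rpow hGp pP).trans (le_of_eq ?_)
        rw [← ENNReal.rpow_mul, show p / 2 * (2 / p) = 1 by field_simp, ENNReal.rpow_one]
    _ = _ := by ring

theorem devT (hf : IsDensity f) (hq : IsDensity q) (hρ : RF ρ) (hL : Measurable L) {p : ℝ} (hp : 2 < p) {T : (I → ℝ) → ℝ} (hT : Measurable T) :
    ∫⁻ y, (∫⁻ x, ‖T x‖ₑ ^ (p - 1) * ‖ρ (cen (dm (conv f q)) L x y)‖ₑ) ^ 2 ∂(dm (conv f q)) ≤
      4 * (eLpNorm (marginal I q) ⊤ volume * ((∫⁻ x, ‖T x‖ₑ ^ p) ^ ((2 * p - 2) / p) * (∫⁻ x, ‖L x‖ₑ ^ (2 * p / (p + 2))) ^ (2 / (2 * p / (p + 2))))) := by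
  have := law_prob hf hq
  set P := dm (conv f q)
  set D : (I → ℝ) → ℝ≥0∞ := fun u => ∫⁻ x, ‖T x‖ₑ ^ (p - 1) * ‖L (x - u)‖ₑ with hD
  have hTp : Measurable (fun x => ‖T x‖ₑ ^ (p - 1)) := hT.enorm.pow_const _
  have hDm : Measurable D := Measurable.lintegral_prod_right' (f := fun z : (I → ℝ) × (I → ℝ) => ‖T z.2‖ₑ ^ (p - 1) * ‖L (z.2 - z.1)‖ₑ)
    ((hTp.comp measurable_snd).mul (hL.comp (measurable_snd.sub measurable_fst)).enorm)
  have hDr : Measurable (fun y => D (rI I y)) := hDm.comp rI_meas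
  have hDr2 : Measurable (fun y => D (rI I y) ^ 2) := hDr.pow_const 2
  have hmz : Measurable (fun z : (I → ℝ) × Vd d => ‖T z.1‖ₑ ^ (p - 1) * ‖L (z.1 - rI I z.2)‖ₑ) := (hTp.comp measurable_fst).mul (Lsub_meas hL).enorm
  have h1 : ∀ y, ∫⁻ x, ‖T x‖ₑ ^ (p - 1) * ‖ρ (cen P L x y)‖ₑ ≤ D (rI I y) + ∫⁻ y', D (rI I y') ∂P := by
    intro y
    have e : ∫⁻ y', D (rI I y') ∂P = ∫⁻ x, ‖T x‖ₑ ^ (p - 1) * ∫⁻ y', ‖L (x - rI I y')‖ₑ ∂P := by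
      rw [hD, ← lintegral_lintegral_swap hmz.aemeasurable]
      refine lintegral_congr fun x => ?_
      rw [lintegral_const_mul _ (Lsub_meas2 hL x).enorm]
    rw [e, hD]
    dsimp only
    have hm' : Measurable (fun x => ‖T x‖ₑ ^ (p - 1) * ‖L (x - rI I y)‖ₑ) := hTp.mul (hL.comp (measurable_id.sub measurable_const)).enorm
    rw [← lintegral_add_left hm']
    refine lintegral_mono fun x => ?_
    dsimp only
    rw [← mul_add]
    exact mul_le_mul' le_rfl (rcen_le hρ x y)
  have hj := jensenE (P := P) hDr (s := 2) pN
  simp only [ENNReal.rpow_ofNat] at hj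
  calc _ ≤ ∫⁻ y, 2 * (D (rI I y) ^ 2 + (∫⁻ y', D (rI I y') ∂P) ^ 2) ∂P :=
        lintegral_mono fun y => (pow_le_pow_left' (h1 y) 2).trans (sqadd _ _)
    _ = 2 * ((∫⁻ y, D (rI I y) ^ 2 ∂P) + (∫⁻ y', D (rI I y') ∂P) ^ 2) := by
        rw [lintegral_const_mul' _ _ pS, lintegral_add_right _ measurable_const, lintegral_const, measure_univ, mul_one]
    _ ≤ 2 * ((∫⁻ y, D (rI I y) ^ 2 ∂P) + (∫⁻ y, D (rI I y) ^ 2 ∂P)) := by gcongr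
    _ = 4 * ∫⁻ y, D (rI I y) ^ 2 ∂P := by ring
    _ ≤ _ := by
        gcongr
        refine (law_lint_le hf hq (G := fun u => D u ^ 2) (hDm.pow_const 2)).trans ?_
        gcongr
        exact young3 hT.enorm hL.enorm hp
end

end
section

section
variable {d : ℕ} {I : Finset (Fin d)} {L : (I → ℝ) → ℂ} {f q : Vd d → ℝ} {ρ : ℂ →L[ℝ] ℝ}

theorem lintS {P : Measure Vd d} [IsProbabilityMeasure P] (hρ : RF ρ) (hL : Measurable L) {p M : ℝ} (hp : 2 < p) (hM0 : 0 ≤ M)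
    (hM : eLpNorm L (oR p) volume ≤ oR M) (y : Vd d) :
    ∫⁻ x, ‖ρ (cen P L x y)‖ₑ ^ p ≤ oR ((2 * M) ^ p) := by
  have h := rcen_ok (P := P) hρ hL pL hM y
  rw [lint_Nf pL h.1, ← Zf_pow pL]
  exact ENNReal.ofReal_le_ofReal (Real.rpow_le_rpow (Zf_nonneg _) (h.2 hM0) pL)

theorem lintT {T : (I → ℝ) → ℝ} {p : ℝ} (hp : 2 < p) (hT : LpOK volume p T) {e e' M : ℝ} (he : p * e = e') (he0 : 0 ≤ e) (hM0 : 0 ≤ M) :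
    (∫⁻ x, ‖T x‖ₑ ^ p) ^ e ≤ oR ((Zf volume p T + 2 * M) ^ e') := by
  have hz := Zf_nonneg (ν := (volume : Measure (I → ℝ))) (p := p) T
  rw [lint_Nf pL hT, ← Zf_pow pL, ENNReal.ofReal_rpow_of_nonneg (Real.rpow_nonneg hz _) he0, ← Real.rpow_mul hz, he]
  refine ENNReal.ofReal_le_ofReal (Real.rpow_le_rpow hz pL ?_)
  rw [← he]; exact mul_nonneg pL he0

theorem H1gtI (hf : IsDensity f) (hq : IsDensity q) (hρ : RF ρ) (hL : Measurable L) {p M Q N : ℝ} (hp : 2 < p) (hM0 : 0 ≤ M) (hQ0 : 0 ≤ Q) (hN0 : 0 ≤ N)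
    (hM : eLpNorm L (oR p) volume ≤ oR M) (hQ : eLpNorm (marginal I q) ⊤ volume ≤ oR Q)
    (hN : ∫⁻ u, ‖L u‖ₑ ^ 2 ≤ oR N) {T : (I → ℝ) → ℝ} (hT : LpOK volume p T) :
    ∫ y, |Df volume p (fun x => T x + ρ (cen (dm (conv f q)) L x y)) (fun x => ρ (cen (dm (conv f q)) L x y)) -
        Df volume p T (fun x => ρ (cen (dm (conv f q)) L x y))| ∂(dm (conv f q)) ≤
      (p * 2 ^ p * (4 * ((1 + Q) * N))) * (Zf volume p T + 2 * M) ^ (p - 2) + p * 2 ^ p * (2 * M) ^ p := by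
  have := law_prob hf hq
  set P := dm (conv f q)
  have hz := Zf_nonneg (ν := (volume : Measure (I → ℝ))) (p := p) T
  have hzM : 0 ≤ Zf volume p T + 2 * M := by linarith
  have hc : 0 ≤ p * 2 ^ p := by positivity
  refine int_le_of_lint (fun y => abs_nonneg _) pP ?_
  have hm : Measurable (fun z : Vd d × (I → ℝ) => ‖T z.2‖ₑ ^ (p - 2) * ‖ρ (cen P L z.2 z.1)‖ₑ ^ 2) :=
    ((hT.1.comp measurable_snd).enorm.pow_const _).mul (((rcen_meas (P := P) (ρ := ρ) hL).comp measurable_swap).enorm.pow_const 2)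
  have hm1 := hm.lintegral_prod_right' (ν := (volume : Measure (I → ℝ)))
  calc _ ≤ ∫⁻ y, oR (p * 2 ^ p) * ((∫⁻ x, ‖T x‖ₑ ^ (p - 2) * ‖ρ (cen P L x y)‖ₑ ^ 2) + oR ((2 * M) ^ p)) ∂P := by
        refine lintegral_mono fun y => (H1gt hp hT (rcen_ok (P := P) hρ hL pL hM y).1).trans ?_
        gcongr
        exact lintS hρ hL hp hM0 hM y
    _ = oR (p * 2 ^ p) * ((∫⁻ y, (∫⁻ x, ‖T x‖ₑ ^ (p - 2) * ‖ρ (cen P L x y)‖ₑ ^ 2) ∂P) + oR ((2 * M) ^ p)) := by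
        rw [lintegral_const_mul' _ _ pS, lintegral_add_right _ measurable_const, lintegral_const, measure_univ, mul_one]
    _ ≤ oR (p * 2 ^ p) * (4 * ((1 + oR Q) * oR N) * oR ((Zf volume p T + 2 * M) ^ (p - 2)) + oR ((2 * M) ^ p)) := by
        gcongr
        refine (varT hf hq hρ hL hp hT.1).trans ?_
        gcongr
        exact lintT hp hT (by field_simp) (div_nonneg pL pL) hM0
    _ = _ := by
        rw [← ENNReal.ofReal_one, ← ENNReal.ofReal_add pN hQ0, ← ENNReal.ofReal_mul pP, ← ENNReal.ofReal_ofNat 4, ← ENNReal.ofReal_mul pP,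
          ← ENNReal.ofReal_mul pP, ← ENNReal.ofReal_add pP pP, ← ENNReal.ofReal_mul hc]
        congr 1; ring

theorem H2gtI (hf : IsDensity f) (hq : IsDensity q) (hρ : RF ρ) (hL : Measurable L) {p M Q σ : ℝ} (hp : 2 < p) (hM0 : 0 ≤ M) (hQ0 : 0 ≤ Q)
    (hM : eLpNorm L (oR p) volume ≤ oR M) (hQ : eLpNorm (marginal I q) ⊤ volume ≤ oR Q)
    (hN : (∫⁻ x, ‖L x‖ₑ ^ (2 * p / (p + 2))) ^ (2 / (2 * p / (p + 2))) ≤ oR (σ ^ 2)) {T : (I → ℝ) → ℝ} (hT : LpOK volume p T) :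
    ∫ y, |Nf volume p (fun x => T x + ρ (cen (dm (conv f q)) L x y)) - Nf volume p T| *
        |Df volume p T (fun x => ρ (cen (dm (conv f q)) L x y))| ∂(dm (conv f q)) ≤
      (p * 2 ^ p * (8 * (Q * σ ^ 2))) * (Zf volume p T + 2 * M) ^ (2 * p - 2) + p * 2 ^ p * ((2 * M) ^ p) ^ 2 := by
  have := law_prob hf hq
  set P := dm (conv f q)
  have hz := Zf_nonneg (ν := (volume : Measure (I → ℝ))) (p := p) T
  have hzM : 0 ≤ Zf volume p T + 2 * M := by linarith
  have hc : 0 ≤ p * 2 ^ p := by positivity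
  refine int_le_of_lint (fun y => by positivity) pP ?_
  calc _ ≤ ∫⁻ y, oR (p * 2 ^ p) * (2 * (∫⁻ x, ‖T x‖ₑ ^ (p - 1) * ‖ρ (cen P L x y)‖ₑ) ^ 2 + (oR ((2 * M) ^ p)) ^ 2) ∂P := by
        refine lintegral_mono fun y => (H2gt hp hT (rcen_ok (P := P) hρ hL pL hM y).1).trans ?_
        gcongr
        exact lintS hρ hL hp hM0 hM y
    _ = oR (p * 2 ^ p) * (2 * (∫⁻ y, (∫⁻ x, ‖T x‖ₑ ^ (p - 1) * ‖ρ (cen P L x y)‖ₑ) ^ 2 ∂P) + (oR ((2 * M) ^ p)) ^ 2) := by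
        rw [lintegral_const_mul' _ _ pS, lintegral_add_right _ measurable_const, lintegral_const, measure_univ, mul_one, lintegral_const_mul' _ _ pS]
    _ ≤ oR (p * 2 ^ p) * (2 * (4 * (oR Q * (oR ((Zf volume p T + 2 * M) ^ (2 * p - 2)) * oR (σ ^ 2)))) + (oR ((2 * M) ^ p)) ^ 2) := by
        gcongr
        refine (devT hf hq hρ hL hp hT.1).trans ?_
        gcongr
        exact lintT hp hT (by field_simp) (div_nonneg pL pL) hM0
    _ = _ := by
        rw [← ENNReal.ofReal_pow pP, ← ENNReal.ofReal_mul pP, ← ENNReal.ofReal_mul pP, ← ENNReal.ofReal_ofNat 4, ← ENNReal.ofReal_mul pP, ← ENNReal.ofReal_ofNat 2,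
          ← ENNReal.ofReal_mul pP, ← ENNReal.ofReal_add pP pP, ← ENNReal.ofReal_mul hc]
        congr 1; ring

theorem Lp_norm {C1 p : ℝ} {h lam : Vd d} (H : HU I h) (hp : 2 < p) (hC : 1 ≤ C1) (hb : ∀ x, ‖L x‖ ≤ C1 * PW I h (fun j => -lam j - 1))
    (h2 : ∫⁻ x, ‖L x‖ₑ ^ 2 ≤ oR (C1 * PW I h (fun j => -2 * lam j - 1))) (hL : Measurable L) :
    eLpNorm L (oR p) volume ≤ oR (C1 * PW I h (fun j => -lam j - 1 + 1 / p)) := by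
  have hh : ∀ j ∈ I, 0 < h j := fun j hj => (H j hj).1
  have p1 := PW_pos hh (fun j => -lam j - 1)
  have p2 := PW_pos hh (fun j => -lam j - 1 + 1 / p)
  have p3 := PW_pos hh (fun j => -2 * lam j - 1)
  have hC0 : 0 < C1 := by linarith
  rw [eLp_eq L pL]
  rw [one_div p, ENNReal.rpow_inv_le_iff pL, ← one_div]
  calc ∫⁻ x, ‖L x‖ₑ ^ p ≤ ∫⁻ x, oR ((C1 * PW I h (fun j => -lam j - 1)) ^ (p - 2)) * ‖L x‖ₑ ^ 2 := by
        refine lintegral_mono fun x => ?_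
        dsimp only
        rw [show p = (p - 2) + (2 : ℕ) by push_cast; ring, ENNReal.rpow_add_of_nonneg _ _ pL pN, ENNReal.rpow_natCast, show p - 2 + ((2 : ℕ) : ℝ) - 2 = p - 2 by push_cast; ring,
          ← ENNReal.ofReal_rpow_of_nonneg pP pL]
        refine mul_le_mul' (ENNReal.rpow_le_rpow ?_ pL) le_rfl
        rw [← ofReal_norm]; exact ENNReal.ofReal_le_ofReal (hb x)
    _ ≤ oR ((C1 * PW I h (fun j => -lam j - 1)) ^ (p - 2)) * oR (C1 * PW I h (fun j => -2 * lam j - 1)) := by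
        rw [lintegral_const_mul' _ _ pS]
        gcongr
    _ ≤ _ := by
        rw [← ENNReal.ofReal_mul pP, ENNReal.ofReal_rpow_of_nonneg pP pL]
        refine ENNReal.ofReal_le_ofReal ?_
        rw [Real.mul_rpow hC0.le p1.le, Real.mul_rpow hC0.le p2.le, PW_rpow hh, PW_rpow hh]
        have e : PW I h (fun j => (-lam j - 1) * (p - 2)) * PW I h (fun j => -2 * lam j - 1) = PW I h (fun j => (-lam j - 1 + 1 / p) * p) := by
          rw [PW_mul hh]; congr 1; ext j; field_simp; ring
        rw [← e]
        have e2 : C1 ^ (p - 2) * C1 ≤ C1 ^ p := by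
          rw [← Real.rpow_add_one hC0.ne']; exact Real.rpow_le_rpow_of_exponent_le hC pL
        have p4 := PW_pos hh (fun j => (-lam j - 1) * (p - 2))
        calc _ = (C1 ^ (p - 2) * C1) * (PW I h (fun j => (-lam j - 1) * (p - 2)) * PW I h (fun j => -2 * lam j - 1)) := by ring
          _ ≤ _ := by gcongr

theorem cp_pos {lam : Vd d} (hl : ∀ j, 0 < lam j) {p : ℝ} (hp : 0 < p) : 0 < cpGrid lam (oR p) := by
  unfold cpGrid
  have : 0 ≤ lamMax lam := Real.sSup_nonneg (by rintro _ ⟨j, rfl⟩; exact (hl j).le)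
  rw [ENNReal.toReal_ofReal hp.le]
  refine lt_min one_pos (Real.rpow_pos_of_pos (mul_pos pP ?_) _)
  have : 0 ≤ lamMax lam * max 2 (p / (p - 1)) := mul_nonneg this (le_max_of_le_left pN)
  linarith

theorem grid_gt {lam : Vd d} (hl : ∀ j, 0 < lam j) (hI : I.Nonempty) {p : ℝ} (hp : 2 < p) {n : ℕ} (hn : 3 ≤ n) {h : Vd d} (hg : memGrid lam (oR p) n I h) :
    (n : ℝ) ^ (1 / p) * PW I h (fun j => -lam j - 1 + 1 / p) ≤ (cpGrid lam (oR p))⁻¹ * ((n : ℝ) ^ (1 / 2 : ℝ) * PW I h (fun j => -lam j - 1 / 2)) ∧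
    Real.log n * PW I h (fun j => -lam j - 1 + 1 / p) ≤ (cpGrid lam (oR p))⁻¹ * ((n : ℝ) ^ (1 / 2 : ℝ) * PW I h (fun j => -lam j - 1 / 2)) := by
  have hc := cp_pos hl (p := p) pL
  have hc1 : cpGrid lam (oR p) ≤ 1 := min_le_left _ _
  have hV := grid_V hI pL hn hg
  have H := grid_HU hg
  have hh : ∀ j ∈ I, 0 < h j := fun j hj => (H j hj).1
  have hb := hg.2.2
  rw [if_neg ENNReal.ofReal_ne_top] at hb
  have ebp : bp (oR p) = 1 / 2 := by
    unfold bp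
    rw [ENNReal.toReal_ofReal pL]
    refine min_eq_left ?_
    have : 1 / p < 1 / 2 := one_div_lt_one_div_of_lt pN hp
    linarith
  have eV : ∏ j ∈ I, h j = PW I h (fun _ => 1) := by rw [← PW_eq]; simp
  rw [ebp, PW_eq, eV] at hb
  set c := cpGrid lam (oR p)
  set V := PW I h (fun _ => 1) with hVd
  have V0 : 0 < V := PW_pos hh _
  have PH0 := PW_pos hh (fun j => -lam j - 1 / 2)
  have hn0 : (0 : ℝ) < n := by positivity
  have hnV : c ≤ (n * V) ^ (1 / 2 : ℝ) := by
    refine hb.trans (mul_le_of_le_one_right pP ?_)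
    refine (PW_anti H (e := fun _ => 0) (e' := lam) fun j => (hl j).le).trans (le_of_eq (by simp [PW]))
  have hp0 : 0 < 1 / p := by positivity
  have hp1 : 1 / p < 1 / 2 := one_div_lt_one_div_of_lt pN hp
  have hl1 : 1 ≤ Real.log n := (jch hn (le_refl (1 : ℝ))).1
  have eM : PW I h (fun j => -lam j - 1 + 1 / p) = PW I h (fun j => -lam j - 1 / 2) * V ^ (1 / p - 1 / 2) := by
    rw [hVd, PW_rpow hh, PW_mul hh]; congr 1; ext j; ring
  rw [eM]
  constructor
  · have e : (n : ℝ) ^ (1 / p) * V ^ (1 / p - 1 / 2) = (n : ℝ) ^ (1 / 2 : ℝ) * ((n * V) ^ (1 / 2 : ℝ)) ^ (2 / p - 1) := by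
      rw [← Real.rpow_mul pP, show (1 / 2 : ℝ) * (2 / p - 1) = 1 / p - 1 / 2 by ring, Real.mul_rpow hn0.le V0.le, ← mul_assoc, ← Real.rpow_add hn0]
      congr 2; ring
    have e2 : ((n * V) ^ (1 / 2 : ℝ)) ^ (2 / p - 1) ≤ c⁻¹ := by
      have h2p : 2 / p < 1 := by rw [div_lt_one pL]; exact hp
      have h2p' : 0 < 2 / p := by positivity
      calc _ ≤ c ^ (2 / p - 1) := Real.rpow_le_rpow_of_nonpos hc hnV pL
        _ ≤ c ^ (-1 : ℝ) := Real.rpow_le_rpow_of_exponent_ge hc hc1 pL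
        _ = c⁻¹ := Real.rpow_neg_one c
    calc _ = ((n : ℝ) ^ (1 / p) * V ^ (1 / p - 1 / 2)) * PW I h (fun j => -lam j - 1 / 2) := by ring
      _ = (n : ℝ) ^ (1 / 2 : ℝ) * ((n * V) ^ (1 / 2 : ℝ)) ^ (2 / p - 1) * PW I h (fun j => -lam j - 1 / 2) := by rw [e]
      _ ≤ (n : ℝ) ^ (1 / 2 : ℝ) * c⁻¹ * PW I h (fun j => -lam j - 1 / 2) := by gcongr
      _ = _ := by ring
  · have e1 : Real.log n * V ^ (1 / p) ≤ 1 := by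
      calc _ ≤ Real.log n * (Real.log n ^ (-p)) ^ (1 / p) := by gcongr
        _ = 1 := by
          rw [← Real.rpow_mul pL, show -p * (1 / p) = -1 by field_simp, Real.rpow_neg_one, mul_inv_cancel₀ pL]
    have e2 : V ^ (1 / p - 1 / 2) = V ^ (1 / p) * V ^ (-(1 / 2) : ℝ) := by rw [← Real.rpow_add V0]; congr 1
    have e3 : V ^ (-(1 / 2) : ℝ) ≤ c⁻¹ * (n : ℝ) ^ (1 / 2 : ℝ) := by
      rw [Real.rpow_neg V0.le, inv_le_iff_one_le_mul₀ pP, mul_assoc, ← Real.mul_rpow hn0.le V0.le, inv_mul_eq_div, le_div_iff₀ hc, one_mul]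
      exact hnV
    calc _ = (Real.log n * V ^ (1 / p)) * V ^ (-(1 / 2) : ℝ) * PW I h (fun j => -lam j - 1 / 2) := by rw [e2]; ring
      _ ≤ 1 * (c⁻¹ * (n : ℝ) ^ (1 / 2 : ℝ)) * PW I h (fun j => -lam j - 1 / 2) := by gcongr
      _ = _ := by ring
end

end
section

section
variable {d : ℕ} {I : Finset (Fin d)} {K : ℝ → ℝ} {q : Vd d → ℝ} {lam : Vd d}

set_option maxHeartbeats 1000000 in
theorem core_gt (hI : I.Nonempty) {p : ℝ} (hp : 2 < p) (κ : SchwartzMap ℝ ℂ)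
    (hκ : eFT κ K)
    (hq : IsDensity q) {A : ℝ} (hG : GB I q A lam) (hQt : eLpNorm (marginal I q) ⊤ volume < ⊤)
    (hPB : PB I K q (2 * p / (p + 2))) {r : ℝ} (hr : 1 ≤ r) :
    Core I K q lam (oR p) r := by
  obtain ⟨CL, hCL, hLB⟩ := LBds κ hκ hq hG
  obtain ⟨C, hC, e, he, hB⟩ := hPB
  have hlam := hG.2.1
  have hpr : (oR p).toReal = p := ENNReal.toReal_ofReal pL
  set s := 2 * p / (p + 2) with hs
  have hs1 : 1 < s := by rw [hs, lt_div_iff₀ pL]; linarith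
  have hUp : ∀ n h, Up K q lam (oR p) n I h = oR ((n : ℝ) ^ (-(1 : ℝ) / 2)) * (oR (PW I h (fun j => -lam j - 1 / 2)) + oR (Real.sqrt (Real.log n)) * eLpNorm (Lh I K q h) (oR s) volume) := by
    intro n h
    unfold Up
    rw [if_neg ENNReal.ofReal_ne_top, if_neg, hpr, if_neg pL, PW_eq]
    intro h2
    have := congrArg ENNReal.toReal h2
    rw [hpr] at this
    simp at this; linarith
  set Q := (eLpNorm (marginal I q) ⊤ volume).toReal with hQd
  have hQ0 : 0 ≤ Q := ENNReal.toReal_nonneg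
  have hQ : eLpNorm (marginal I q) ⊤ volume ≤ oR Q := (ENNReal.ofReal_toReal hQt.ne).ge
  set cg := (cpGrid lam (oR p))⁻¹ with hcg
  have hcg1 : 1 ≤ cg := (one_le_inv₀ (cp_pos hlam pL)).2 (min_le_left _ _)
  set C1 := CL + 1 with hC1
  have hC11 : 1 ≤ C1 := by linarith
  set D := 2 * C1 * cg with hD
  have hDC : 2 * C1 ≤ D := le_mul_of_one_le_right pL hcg1
  set w := p * 2 ^ p with hw
  have h2p : (1 : ℝ) ≤ 2 ^ p := Real.one_le_rpow pN pL
  have hw1 : p ≤ w := le_mul_of_one_le_right pL h2p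
  set k := 96 * w * (1 + Q) * (r + 4) with hk
  have hk1 : 96 * w * (1 + Q) ≤ k := le_mul_of_one_le_right pP pL
  have hk2 : 96 * w * (r + 4) ≤ k := by
    have : 96 * w * (r + 4) * 1 ≤ 96 * w * (r + 4) * (1 + Q) := mul_le_mul_of_nonneg_left pL pP
    calc _ = 96 * w * (r + 4) * 1 := by ring
      _ ≤ _ := this
      _ = k := by rw [hk]; ring
  have hk3 : 96 * w * Q * (r + 4) ≤ k := by rw [hk]; gcongr; linarith
  have hk0 : 96 * w ≤ k := le_trans (le_mul_of_one_le_right pP pL) hk1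
  have hk4 : 24 * w * (r + 4) ≤ k := by
    refine le_trans ?_ hk2
    gcongr; norm_num
  have hk5 : 2 * p * (r + 4) ≤ k := by
    refine le_trans ?_ hk2
    gcongr; norm_num
  have hkone : 1 ≤ k := by linarith
  set c := k * D with hc
  have hDk : k * 2 ≤ c := mul_le_mul_of_nonneg_left pL pL
  have hc1 : 1 ≤ c := by linarith
  have hcc : c ≤ c ^ 2 := by
    calc c = c * 1 := (mul_one c).symm
      _ ≤ c * c := mul_le_mul_of_nonneg_left hc1 pL
      _ = c ^ 2 := (sq c).symm
  have hkC : k * C1 ≤ c := mul_le_mul_of_nonneg_left pL pL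
  set b0 := (1 + p) * (∑ j : I, - (-lam j - 1 / 2)) with hb0
  set b1 := (1 + p) * (∑ j : I, - e j) with hb1
  have hb00 : 0 ≤ b0 := mul_nonneg pL (Finset.sum_nonneg fun j _ => by have := hlam j; linarith)
  have hb10 : 0 ≤ b1 := mul_nonneg pL (Finset.sum_nonneg fun j _ => by have := he j; linarith)
  refine ⟨1 + C, b0 + b1, 2 * c, by linarith, by linarith, by linarith, ?_⟩
  intro n hn f hf h hg
  right
  obtain ⟨hn0, hsn0, hsn2, hsn3, hln1, hln2⟩ := sqrtn hn
  have hn1 : (1 : ℝ) ≤ n := by exact_mod_cast (by omega : 1 ≤ n)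
  have H := grid_HU hg
  have hh : ∀ j ∈ I, 0 < h j := fun j hj => (H j hj).1
  obtain ⟨Lc, Lb, L2, -⟩ := hLB h H
  have hU0 := hB h H
  obtain ⟨hl1, j, hj1, hj2⟩ := jch hn hr
  obtain ⟨gr1, gr2⟩ := grid_gt hlam hI hp hn hg
  rw [← hcg] at gr1 gr2
  set PH := PW I h (fun j => -lam j - 1 / 2) with hPH
  have PH0 : 0 < PH := PW_pos hh _
  set sl := Real.sqrt (Real.log n) with hsl
  have hsl0 : 0 ≤ sl := Real.sqrt_nonneg _
  have hsl2 : sl ^ 2 = Real.log n := Real.sq_sqrt pL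
  constructor
  · rw [hUp]
    have a1 := grid_PW hn hg (e := fun j => -lam j - 1 / 2) (fun j => by have := hlam j; linarith)
    have a2 := grid_PW hn hg he
    rw [hpr, ← hb1] at a2
    rw [hpr, ← hb0, ← hPH] at a1
    have a3 : (n : ℝ) ^ (-(1 : ℝ) / 2) * sl ≤ 1 := by
      rw [show -(1 : ℝ) / 2 = -(1 / 2) by ring, Real.rpow_neg hn0.le, inv_mul_le_iff₀ hsn0, mul_one, hsl, Real.sqrt_eq_rpow]
      exact Real.rpow_le_rpow pL hln2 pN
    have a4 : (n : ℝ) ^ (-(1 : ℝ) / 2) ≤ 1 := Real.rpow_le_one_of_one_le_of_nonpos hn1 pN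
    have a5 := PW_pos hh e
    have nb0 : (1 : ℝ) ≤ (n : ℝ) ^ b0 := Real.one_le_rpow hn1 hb00
    have nb1 : (1 : ℝ) ≤ (n : ℝ) ^ b1 := Real.one_le_rpow hn1 hb10
    calc _ ≤ oR ((n : ℝ) ^ (-(1 : ℝ) / 2)) * (oR PH + oR sl * oR (C * PW I h e)) := by gcongr
      _ = oR ((n : ℝ) ^ (-(1 : ℝ) / 2) * PH + ((n : ℝ) ^ (-(1 : ℝ) / 2) * sl) * (C * PW I h e)) := by
          rw [← ENNReal.ofReal_mul hsl0, ← ENNReal.ofReal_add PH0.le pP, ← ENNReal.ofReal_mul pP]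
          congr 1; ring
      _ ≤ _ := by
          refine ENNReal.ofReal_le_ofReal ?_
          rw [Real.rpow_add hn0]
          calc _ ≤ 1 * (n : ℝ) ^ b0 + 1 * (C * (n : ℝ) ^ b1) := by gcongr
            _ ≤ (n : ℝ) ^ b0 * (n : ℝ) ^ b1 + C * ((n : ℝ) ^ b0 * (n : ℝ) ^ b1) := by
                rw [one_mul, one_mul]
                gcongr
                · exact le_mul_of_one_le_right pP nb1
                · exact le_mul_of_one_le_left pP nb0
            _ = _ := by ring
  have hfin : eLpNorm (Lh I K q h) (oR s) volume ≠ ⊤ := ne_top_of_le_ne_top ENNReal.ofReal_ne_top hU0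
  set σ := (eLpNorm (Lh I K q h) (oR s) volume).toReal with hσ
  have hσ0 : 0 ≤ σ := ENNReal.toReal_nonneg
  have hσe : eLpNorm (Lh I K q h) (oR s) volume = oR σ := (ENNReal.ofReal_toReal hfin).symm
  have hσ2 : (∫⁻ x, ‖Lh I K q h x‖ₑ ^ s) ^ (2 / s) ≤ oR (σ ^ 2) := by
    rw [ENNReal.ofReal_pow hσ0, ← hσe, eLp_eq _ hs1.le, ← ENNReal.rpow_natCast, ← ENNReal.rpow_mul]
    exact le_of_eq (by congr 1; push_cast; ring)
  set Mp := PW I h (fun j => -lam j - 1 + 1 / p) with hMp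
  have Mp0 : 0 < Mp := PW_pos hh _
  set M := C1 * Mp with hM
  have hM0 : 0 < M := by positivity
  have PW1 := PW_pos hh (fun j => -lam j - 1)
  have PW2 := PW_pos hh (fun j => -2 * lam j - 1)
  have hN : ∫⁻ x, ‖Lh I K q h x‖ₑ ^ 2 ≤ oR (C1 * PW I h (fun j => -2 * lam j - 1)) := L2.trans (ENNReal.ofReal_le_ofReal (by gcongr; linarith))
  have hMn : eLpNorm (Lh I K q h) (oR p) volume ≤ oR M :=
    Lp_norm H hp hC11 (fun x => (Lb x).trans (by gcongr; linarith)) hN Lc.measurable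
  have ePH : PW I h (fun j => -2 * lam j - 1) = PH ^ 2 := by
    rw [hPH, ← Real.rpow_natCast, PW_rpow hh]; congr 1; ext j; push_cast; ring
  rw [ePH] at hN
  set S := (n : ℝ) ^ (1 / 2 : ℝ) * PH with hS
  have hS0 : 0 < S := by positivity
  set W := (n : ℝ) ^ (1 / 2 : ℝ) * sl * σ with hW
  have hW0 : 0 ≤ W := by positivity
  have hS2 : S ^ 2 = n * PH ^ 2 := by rw [hS, mul_pow, hsn2]
  have hW2 : W ^ 2 = n * Real.log n * σ ^ 2 := by rw [hW, mul_pow, mul_pow, hsn2, hsl2]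
  have m1 : (n : ℝ) ^ (1 / p) * (2 * M) ≤ D * S := by
    calc _ = 2 * C1 * ((n : ℝ) ^ (1 / p) * Mp) := by rw [hM]; ring
      _ ≤ 2 * C1 * (cg * S) := by gcongr
      _ = _ := by rw [hD]; ring
  have m2 : Real.log n * (2 * M) ≤ D * S := by
    calc _ = 2 * C1 * (Real.log n * Mp) := by rw [hM]; ring
      _ ≤ 2 * C1 * (cg * S) := by gcongr
      _ = _ := by rw [hD]; ring
  have m3 : n * (2 * M) ^ p ≤ (D * S) ^ p := by
    have e0 : ((n : ℝ) ^ (1 / p)) ^ p = n := by rw [← Real.rpow_mul hn0.le, one_div_mul_cancel pL, Real.rpow_one]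
    calc (n : ℝ) * (2 * M) ^ p = ((n : ℝ) ^ (1 / p) * (2 * M)) ^ p := by rw [Real.mul_rpow (x := (n : ℝ) ^ (1 / p)) pP pP, e0]
      _ ≤ _ := Real.rpow_le_rpow pP m1 pL
  set B := c * (S + W) with hBd
  have hB0 : 0 < B := by positivity
  have hBS : c * S ≤ B := mul_le_mul_of_nonneg_left pL pL
  have hBW : c * W ≤ B := mul_le_mul_of_nonneg_left pL pL
  have kp : k ≤ k ^ p := by
    nth_rw 1 [← Real.rpow_one k]
    exact Real.rpow_le_rpow_of_exponent_le hkone pL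
  have hDS0 : 0 ≤ D * S := by positivity
  have DSp := Real.rpow_nonneg hDS0 p
  have hBp : k * (D * S) ^ p ≤ B ^ p := by
    calc k * (D * S) ^ p ≤ k ^ p * (D * S) ^ p := mul_le_mul_of_nonneg_right kp DSp
      _ = (c * S) ^ p := by rw [← Real.mul_rpow pL hDS0, hc]; congr 1; ring
      _ ≤ B ^ p := Real.rpow_le_rpow pP hBS pL
  have := law_prob hf hq
  refine Exists.elim (step (K := K) (I := I) hf hq (by linarith : 1 < p) hn (h := h) Lc.measurable Lb hM0 hMn
    (j := j) (B := B) (a1 := w * (4 * ((1 + Q) * (C1 * PH ^ 2)))) (a2 := w * (2 * M) ^ p) (b1 := w * (8 * (Q * σ ^ 2))) (b2 := w * ((2 * M) ^ p) ^ 2) hB0 ?_ ?_ ?_ ?_ ?_ ?_ ?_) ?_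
  · intro ρ hρ T hT
    exact H1gtI hf hq hρ Lc.measurable hp hM0.le hQ0 pP hMn hQ hN hT
  · intro ρ hρ T hT
    exact H2gtI hf hq hρ Lc.measurable hp hM0.le hQ0 hMn hQ hσ2 hT
  · calc 24 * (n : ℝ) * (w * (4 * ((1 + Q) * (C1 * PH ^ 2)))) = (96 * w * (1 + Q)) * C1 * S ^ 2 := by rw [hS2]; ring
      _ ≤ k * C1 * S ^ 2 := by gcongr
      _ ≤ c ^ 2 * S ^ 2 := mul_le_mul_of_nonneg_right (hkC.trans hcc) (sq_nonneg _)
      _ = (c * S) ^ 2 := by ring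
      _ ≤ B ^ 2 := pow_le_pow_left₀ pP hBS 2
  · calc 24 * (n : ℝ) * (w * (2 * M) ^ p) = 24 * w * (n * (2 * M) ^ p) := by ring
      _ ≤ 24 * w * (D * S) ^ p := by gcongr
      _ ≤ k * (D * S) ^ p := mul_le_mul_of_nonneg_right pL DSp
      _ ≤ _ := hBp
  · calc 24 * (n : ℝ) * (j + 2) * (w * (8 * (Q * σ ^ 2))) ≤ 24 * (n : ℝ) * ((r + 4) * Real.log n) * (w * (8 * (Q * σ ^ 2))) := by gcongr
      _ = (96 * w * Q * (r + 4)) * 2 * W ^ 2 := by rw [hW2]; ring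
      _ ≤ k * 2 * W ^ 2 := by gcongr
      _ ≤ c ^ 2 * W ^ 2 := mul_le_mul_of_nonneg_right (hDk.trans hcc) (sq_nonneg _)
      _ = (c * W) ^ 2 := by ring
      _ ≤ B ^ 2 := pow_le_pow_left₀ pP hBW 2
  · have kk : k ≤ k ^ 2 := by
      calc k = k * 1 := (mul_one k).symm
        _ ≤ k * k := mul_le_mul_of_nonneg_left hkone pL
        _ = k ^ 2 := (sq k).symm
    calc 24 * (n : ℝ) * (j + 2) * (w * ((2 * M) ^ p) ^ 2) ≤ 24 * (n : ℝ) * ((r + 4) * n) * (w * ((2 * M) ^ p) ^ 2) := by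
          gcongr
          exact hj2.trans (by gcongr)
      _ = 24 * w * (r + 4) * (n * (2 * M) ^ p) ^ 2 := by ring
      _ ≤ 24 * w * (r + 4) * ((D * S) ^ p) ^ 2 := by gcongr
      _ ≤ k * ((D * S) ^ p) ^ 2 := mul_le_mul_of_nonneg_right hk4 (sq_nonneg _)
      _ ≤ k ^ 2 * ((D * S) ^ p) ^ 2 := mul_le_mul_of_nonneg_right kk (sq_nonneg _)
      _ = (k * (D * S) ^ p) ^ 2 := by ring
      _ ≤ _ := pow_le_pow_left₀ pP hBp 2
  · calc 2 * (p * ((j : ℝ) + 2)) * (2 * M) ≤ 2 * (p * ((r + 4) * Real.log n)) * (2 * M) := by gcongr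
      _ = 2 * p * (r + 4) * (Real.log n * (2 * M)) := by ring
      _ ≤ 2 * p * (r + 4) * (D * S) := by gcongr
      _ ≤ k * (D * S) := mul_le_mul_of_nonneg_right hk5 hDS0
      _ = c * S := by rw [hc]; ring
      _ ≤ B := hBS
  · rintro g ⟨gm, g1, g2⟩
    refine ⟨p * (j + 2), ?_, g, gm, g1, g2.trans (ENNReal.rpow_le_rpow ?_ pP)⟩
    · exact hj1.trans ((le_add_of_nonneg_right pN).trans (le_mul_of_one_le_left pP pL))
    · rw [hUp, hσe, ← ENNReal.ofReal_mul hsl0, ← ENNReal.ofReal_add PH0.le pP, ← ENNReal.ofReal_mul pP, ← ENNReal.ofReal_add pP pP, ← ENNReal.ofReal_mul pP]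
      refine ENNReal.ofReal_le_ofReal ?_
      calc 2 * (n : ℝ)⁻¹ * B = 2 * c * ((n : ℝ)⁻¹ * (n : ℝ) ^ (1 / 2 : ℝ) * (PH + sl * σ)) := by rw [hBd, hS, hW]; ring
        _ = 2 * c * ((n : ℝ) ^ (-(1 : ℝ) / 2) * (PH + sl * σ)) := by rw [hsn3]
        _ ≤ _ := by gcongr; exact le_add_of_nonneg_right pP
end

end
section

theorem v1_shift (s τ : ℝ) (hτ : |τ| ≤ Real.pi) : (1 + (s + τ) ^ 2)⁻¹ ≤ 22 * (1 + s ^ 2)⁻¹ := by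
  have h1 : τ ^ 2 ≤ 10 := by
    have := Real.pi_lt_d2
    have h0 := Real.pi_pos
    rw [← sq_abs]
    nlinarith [abs_nonneg τ]
  rw [← div_eq_mul_inv, le_div_iff₀ pP, inv_mul_le_iff₀ pP]
  nlinarith [sq_nonneg (s + 2 * τ), sq_nonneg (s + τ), mul_nonneg (sq_nonneg (s+τ)) (sq_nonneg τ)]

theorem fd1 {w w' : ℝ → ℂ} {B x : ℝ} (hw : ∀ s, HasDerivAt w (w' s) s)
    (h0 : ∀ s, ‖w s‖ ≤ B * ((1 + s ^ 2)⁻¹) ^ 2) (h1 : ∀ s, ‖w' s‖ * |s| ≤ B * ((1 + s ^ 2)⁻¹) ^ 2) (s : ℝ) :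
    ‖w (s + (if |x| ≤ 1 then 0 else Real.pi / x)) - (if |x| ≤ 1 then 0 else 1) * w s‖
      ≤ B * (1000 * (1 + s ^ 2)⁻¹ / (1 + |x| * |s|)) := by
  have hB : 0 ≤ B := by
    have := (norm_nonneg _).trans (h0 0)
    norm_num at this
    exact this
  have v0 : 0 < (1 + s ^ 2)⁻¹ := by positivity
  have v1 : ∀ s : ℝ, (1 + s ^ 2)⁻¹ ≤ 1 := fun s => inv_le_one_of_one_le₀ (by nlinarith [sq_nonneg s])
  have v2 : ∀ s : ℝ, ((1 + s ^ 2)⁻¹) ^ 2 ≤ (1 + s ^ 2)⁻¹ := fun s => by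
    have : 0 < (1 + s ^ 2)⁻¹ := by positivity
    nlinarith [v1 s]
  have hd : 0 < 1 + |x| * |s| := by positivity
  split_ifs with hx
  · rw [add_zero, zero_mul, sub_zero]
    refine (h0 s).trans (mul_le_mul_of_nonneg_left ?_ hB)
    rw [le_div_iff₀ hd, sq, mul_assoc, mul_comm (1000 : ℝ)]
    refine mul_le_mul_of_nonneg_left ?_ v0.le
    rw [inv_mul_le_iff₀ pP]
    have : |x| * |s| ≤ 1 * |s| := mul_le_mul_of_nonneg_right hx (abs_nonneg s)
    nlinarith [sq_abs s, sq_nonneg (|s| - 1)]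
  · push Not at hx
    have hx0 : x ≠ 0 := fun h => by simp [h] at hx; linarith
    have hpi := Real.pi_pos
    have hpi2 := Real.pi_lt_d2
    have hpi3 := Real.pi_gt_three
    set δ := Real.pi / x with hδ
    have hδa : |δ| * |x| = Real.pi := by rw [hδ, abs_div, abs_of_pos hpi]; field_simp
    have hδp : |δ| ≤ Real.pi := by nlinarith [abs_nonneg δ]
    rw [one_mul]
    by_cases hs : |s| < 2 * |δ|
    · have e1 : |x| * |s| ≤ 7 := by nlinarith [abs_nonneg x]
      calc ‖w (s + δ) - w s‖ ≤ ‖w (s + δ)‖ + ‖w s‖ := norm_sub_le _ _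
        _ ≤ B * (22 * (1 + s ^ 2)⁻¹) + B * (1 + s ^ 2)⁻¹ :=
            add_le_add ((h0 _).trans (mul_le_mul_of_nonneg_left ((v2 _).trans (v1_shift s δ hδp)) hB))
              ((h0 _).trans (mul_le_mul_of_nonneg_left (v2 _) hB))
        _ = B * (23 * (1 + s ^ 2)⁻¹) := by ring
        _ ≤ _ := by
            refine mul_le_mul_of_nonneg_left ?_ hB
            rw [le_div_iff₀ hd]
            nlinarith
    · push Not at hs
      have hδ0 : 0 < |δ| := by
        rw [abs_pos, hδ]; positivity
      have hs0 : 0 < |s| := by linarith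
      have key : ∀ ξ ∈ Set.uIcc s (s + δ), ‖w' ξ‖ ≤ B * (44 * (1 + s ^ 2)⁻¹ / |s|) := by
        intro ξ hξ
        have hτ : |ξ - s| ≤ |δ| := by
          have := Set.abs_sub_left_of_mem_uIcc hξ
          simpa using this
        have e1 : (1 + ξ ^ 2)⁻¹ ≤ 22 * (1 + s ^ 2)⁻¹ := by
          have := v1_shift s (ξ - s) (hτ.trans hδp)
          simpa using this
        have e2 : |s| / 2 ≤ |ξ| := by
          have : |s| - |ξ| ≤ |s - ξ| := abs_sub_abs_le_abs_sub _ _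
          rw [abs_sub_comm] at this
          linarith
        have e3 : ‖w' ξ‖ * (|s| / 2) ≤ B * (22 * (1 + s ^ 2)⁻¹) :=
          (mul_le_mul_of_nonneg_left e2 (norm_nonneg _)).trans
            ((h1 ξ).trans (mul_le_mul_of_nonneg_left ((v2 _).trans e1) hB))
        rw [← mul_div_assoc, le_div_iff₀ hs0]
        linarith
      have := (convex_uIcc s (s + δ)).norm_image_sub_le_of_norm_hasDerivWithin_le (f := w) (f' := w')
        (fun ξ _ => (hw ξ).hasDerivWithinAt) key Set.left_mem_uIcc Set.right_mem_uIcc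
      refine this.trans ?_
      rw [add_sub_cancel_left, Real.norm_eq_abs, mul_assoc]
      refine mul_le_mul_of_nonneg_left ?_ hB
      rw [le_div_iff₀ hd, div_mul_eq_mul_div, div_mul_eq_mul_div, div_le_iff₀ hs0]
      have e4 : |δ| * (1 + |x| * |s|) ≤ 8 * |s| := by
        have : |δ| * (|x| * |s|) = Real.pi * |s| := by rw [← mul_assoc, hδa]
        nlinarith
      calc 44 * (1 + s ^ 2)⁻¹ * |δ| * (1 + |x| * |s|) = 44 * (1 + s ^ 2)⁻¹ * (|δ| * (1 + |x| * |s|)) := by ring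
        _ ≤ 44 * (1 + s ^ 2)⁻¹ * (8 * |s|) := mul_le_mul_of_nonneg_left e4 pP
        _ ≤ 1000 * (1 + s ^ 2)⁻¹ * |s| := by nlinarith [mul_pos v0 hs0]

section
variable {ι : Type} [Fintype ι] [DecidableEq ι]

def Dl (δ : ι → ℝ) (χ : ι → ℂ) : List ι → ((ι → ℝ) → ℂ) → (ι → ℝ) → ℂ
  | [], G => G
  | j :: r, G => fun t => Dl δ χ r G (t + Pi.single j (δ j)) - χ j * Dl δ χ r G t

theorem Dl_int (δ : ι → ℝ) (χ : ι → ℂ) {G : (ι → ℝ) → ℂ} (hG : Integrable G) (r : List ι) :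
    Integrable (Dl δ χ r G) := by
  induction r with
  | nil => exact hG
  | cons j r ih => exact (ih.comp_add_right _).sub (ih.const_mul _)

theorem ei_int {G : (ι → ℝ) → ℂ} (hG : Integrable G) (x : ι → ℝ) :
    Integrable (fun t => cE t x * G t) := by
  refine hG.bdd_mul (c := 1) ?_ ?_
  · have : Continuous fun t : ι → ℝ => dotp t x := by unfold dotp; fun_prop
    exact (by fun_prop : Continuous fun t : ι → ℝ => cE t x).aestronglyMeasurable
  · refine ae_of_all _ fun t => ?_
    rw [← mul_neg, mul_comm, ← Complex.ofReal_neg, Complex.norm_exp_ofReal_mul_I]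

theorem Dl_ft (δ : ι → ℝ) (χ : ι → ℂ) {G : (ι → ℝ) → ℂ} (hG : Integrable G) (x : ι → ℝ) (r : List ι) :
    ∫ t, cE t x * Dl δ χ r G t =
      (r.map fun j => Complex.exp (Complex.I * (δ j * x j : ℝ)) - χ j).prod *
        ∫ t, cE t x * G t := by
  induction r with
  | nil => simp [Dl]
  | cons j r ih =>
    have hD := Dl_int δ χ hG r
    have e : ∀ t : ι → ℝ, cE t x * Dl δ χ (j :: r) G t =
        Complex.exp (Complex.I * (δ j * x j : ℝ)) *
          (Complex.exp (-(Complex.I * (dotp (t + Pi.single j (δ j)) x : ℝ))) * Dl δ χ r G (t + Pi.single j (δ j)))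
          - χ j * (cE t x * Dl δ χ r G t) := by
      intro t
      have : dotp (t + Pi.single j (δ j)) x = dotp t x + δ j * x j := by
        simp [dotp, add_mul, Finset.sum_add_distrib, Pi.single_apply]
      rw [this, ← mul_assoc, ← Complex.exp_add]
      have e2 : Complex.I * ((δ j * x j : ℝ) : ℂ) + -(Complex.I * ((dotp t x + δ j * x j : ℝ) : ℂ)) = -(Complex.I * (dotp t x : ℝ)) := by
        push_cast; ring
      rw [e2]; simp only [Dl]; ring
    simp_rw [e]
    have i1 := ei_int hD x
    rw [integral_sub ((i1.comp_add_right (Pi.single j (δ j))).const_mul _) (i1.const_mul _), integral_const_mul, integral_const_mul,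
      integral_add_right_eq_self (fun t => cE t x * Dl δ χ r G t) (Pi.single j (δ j)), ih,
      List.map_cons, List.prod_cons]
    ring

theorem cpd_line {G : (ι → ℝ) → ℂ} (hG : Differentiable ℝ G) (j : ι) (t : ι → ℝ) (s : ℝ) :
    HasDerivAt (fun s : ℝ => G (t + Pi.single j s)) (cpd j G (t + Pi.single j s)) s := by
  have h1 : HasDerivAt (fun s : ℝ => t + Pi.single j s) (Pi.single j (1 : ℝ)) s := by
    rw [hasDerivAt_pi]
    intro i
    by_cases hi : i = j
    · subst hi; simpa using (hasDerivAt_id s).const_add (t i)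
    · simpa [hi] using hasDerivAt_const s (t i)
  exact (hG (t + Pi.single j s)).hasFDerivAt.comp_hasDerivAt s h1

theorem Dl_line (δ : ι → ℝ) (χ : ι → ℂ) {G : (ι → ℝ) → ℂ} (hG : Differentiable ℝ G) (j : ι) (r : List ι) :
    ∀ (t : ι → ℝ) (s : ℝ), HasDerivAt (fun s : ℝ => Dl δ χ r G (t + Pi.single j s)) (Dl δ χ r (cpd j G) (t + Pi.single j s)) s := by
  induction r with
  | nil => exact fun t s => cpd_line hG j t s
  | cons i r ih =>
    intro t s
    have := (ih (t + Pi.single i (δ i)) s).sub ((ih t s).const_mul (χ i))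
    have e : ∀ s : ℝ, t + Pi.single j s + Pi.single i (δ i) = t + Pi.single i (δ i) + Pi.single j s :=
      fun s => add_right_comm _ _ _
    simp only [Dl, e]
    exact this

def Good (v : ι → ℝ → ℝ) : List ι → ((ι → ℝ) → ℂ) → ((ι → ℝ) → ℝ) → ((ι → ℝ) → ℝ) → Prop
  | [], G, m, E => ∀ t, ‖G t‖ * m t ≤ E t
  | j :: r, G, m, E => Differentiable ℝ G ∧ Good v r G m (fun t => E t * v j (t j)) ∧
      Good v r (cpd j G) (fun t => m t * |t j|) (fun t => E t * v j (t j))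

theorem Good.bound {v : ι → ℝ → ℝ} (hv : ∀ j s, v j s = ((1 + s ^ 2)⁻¹) ^ 2) (x : ι → ℝ) :
    ∀ (r : List ι) (G : (ι → ℝ) → ℂ) (m E : (ι → ℝ) → ℝ), r.Nodup → Good v r G m E →
    (∀ t, 0 ≤ m t) → (∀ j ∈ r, ∀ t s, m (Function.update t j s) = m t) →
    (∀ j ∈ r, ∀ t s, E (Function.update t j s) = E t) → ∀ t,
    ‖Dl (fun j => if |x j| ≤ 1 then 0 else Real.pi / x j) (fun j => if |x j| ≤ 1 then 0 else 1) r G t‖ * m t ≤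
      E t * (r.map fun j => 1000 * (1 + t j ^ 2)⁻¹ / (1 + |x j| * |t j|)).prod := by
  intro r
  induction r with
  | nil => intro G m E _ hg _ _ _ t; simpa [Dl, Good] using hg t
  | cons j r ih =>
    intro G m E hn hg hm mi Ei t
    obtain ⟨hj, hn⟩ := List.nodup_cons.1 hn
    obtain ⟨g0, g1, g2⟩ := hg
    have hne : ∀ i ∈ r, j ≠ i := fun i hi h => hj (h ▸ hi)
    have b1 := ih G m _ hn g1 hm (fun i hi => mi i (List.mem_cons_of_mem _ hi))
      (fun i hi t s => by rw [Ei i (List.mem_cons_of_mem _ hi), Function.update_of_ne (hne i hi)])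
    have b2 := ih (cpd j G) _ _ hn g2 (fun t => mul_nonneg (hm t) (abs_nonneg _))
      (fun i hi t s => by rw [mi i (List.mem_cons_of_mem _ hi), Function.update_of_ne (hne i hi)])
      (fun i hi t s => by rw [Ei i (List.mem_cons_of_mem _ hi), Function.update_of_ne (hne i hi)])
    set δ : ι → ℝ := fun j => if |x j| ≤ 1 then 0 else Real.pi / x j
    set χ : ι → ℂ := fun j => if |x j| ≤ 1 then 0 else 1
    set W : ι → ℝ → ℝ := fun j s => 1000 * (1 + s ^ 2)⁻¹ / (1 + |x j| * |s|) with hW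
    set t0 := Function.update t j 0 with ht0
    have hup : ∀ s, t0 + Pi.single j s = Function.update t j s := by
      intro s; ext i
      by_cases hi : i = j
      · subst hi; simp [t0]
      · simp [t0, hi]
    have hprod : ∀ s, (r.map fun i => W i (Function.update t j s i)).prod = (r.map fun i => W i (t i)).prod := by
      intro s; congr 1; refine List.map_congr_left fun i hi => ?_
      rw [Function.update_of_ne (hne i hi).symm]
    have mj := mi j List.mem_cons_self t
    have Ej := Ei j List.mem_cons_self t
    obtain ⟨w, hw⟩ : ∃ w : ℝ → ℂ, w = fun s => (m t : ℂ) * Dl δ χ r G (t0 + Pi.single j s) := ⟨_, rfl⟩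
    obtain ⟨w', hw'⟩ : ∃ w : ℝ → ℂ, w = fun s => (m t : ℂ) * Dl δ χ r (cpd j G) (t0 + Pi.single j s) := ⟨_, rfl⟩
    obtain ⟨B, hB⟩ : ∃ B : ℝ, B = E t * (r.map fun i => W i (t i)).prod := ⟨_, rfl⟩
    have hD : ∀ s, HasDerivAt w (w' s) s := by
      intro s
      have h := Dl_line δ χ g0 j r t0 s
      rw [hw, hw']
      exact HasDerivAt.const_mul (m t : ℂ) h
    have c1 : ∀ s, ‖w s‖ ≤ B * ((1 + s ^ 2)⁻¹) ^ 2 := by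
      intro s
      have := b1 (Function.update t j s)
      simp only [mj, Ej, Function.update_self, hv] at this
      rw [hprod] at this
      rw [hw, hB]
      dsimp only
      rw [hup, norm_mul, Complex.norm_real, Real.norm_of_nonneg (hm t), mul_comm, mul_right_comm]
      exact this
    have c2 : ∀ s, ‖w' s‖ * |s| ≤ B * ((1 + s ^ 2)⁻¹) ^ 2 := by
      intro s
      have := b2 (Function.update t j s)
      simp only [mj, Ej, Function.update_self, hv] at this
      rw [hprod] at this
      rw [hw', hB]
      dsimp only
      rw [hup, norm_mul, Complex.norm_real, Real.norm_of_nonneg (hm t), mul_comm (m t), mul_assoc, mul_right_comm (E t)]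
      exact this
    have key : ‖w (t j + δ j) - χ j * w (t j)‖ ≤ B * W j (t j) := fd1 (x := x j) hD c1 c2 (t j)
    have e1 : t0 + Pi.single j (t j) = t := by rw [hup]; simp
    have e2 : t0 + Pi.single j (t j + δ j) = t + Pi.single j (δ j) := by rw [Pi.single_add, ← add_assoc, e1]
    rw [List.map_cons, List.prod_cons]
    rw [hw, hB] at key
    dsimp only at key
    rw [e1, e2] at key
    have e3 : (m t : ℂ) * Dl δ χ r G (t + Pi.single j (δ j)) - χ j * ((m t : ℂ) * Dl δ χ r G t) = (m t : ℂ) * Dl δ χ (j :: r) G t := by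
      simp only [Dl]; ring
    rw [e3, norm_mul, Complex.norm_real, Real.norm_of_nonneg (hm t)] at key
    change _ ≤ E t * (W j (t j) * _)
    linarith

end

end
section

section
variable {ι : Type} [Fintype ι] [DecidableEq ι]

theorem cpd_eq {G : (ι → ℝ) → ℂ} (hG : Differentiable ℝ G) {j : ι} {t : ι → ℝ} {c : ℂ}
    (h : HasDerivAt (fun s : ℝ => G (t + Pi.single j s)) c 0) : cpd j G t = c := by
  have := cpd_line hG j t 0
  rw [Pi.single_zero, add_zero] at this
  exact this.unique h

theorem cpd_mul {β G : (ι → ℝ) → ℂ} (hβ : Differentiable ℝ β) (hG : Differentiable ℝ G) (j : ι) (t : ι → ℝ) :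
    cpd j (fun t => β t * G t) t = cpd j β t * G t + β t * cpd j G t := by
  have h1 := cpd_line hβ j t 0
  have h2 := cpd_line hG j t 0
  refine cpd_eq (hβ.mul hG) ?_
  have := h1.mul h2
  simp only [Pi.single_zero, add_zero] at this
  exact this

theorem cpd_coord {β β' : ℝ → ℂ} (hβ : ∀ s, HasDerivAt β (β' s) s) (i j : ι) (t : ι → ℝ) :
    cpd j (fun t : ι → ℝ => β (t i)) t = if i = j then β' (t i) else 0 := by
  have hd : Differentiable ℝ β := fun s => (hβ s).differentiableAt
  refine cpd_eq pF ?_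
  split_ifs with h
  · subst h
    have h1 : HasDerivAt (fun s : ℝ => t i + s) 1 0 := (hasDerivAt_id (0:ℝ)).const_add (t i)
    have := HasDerivAt.scomp (0:ℝ) (by simpa using hβ (t i) : HasDerivAt β (β' (t i)) (t i + 0)) h1
    simpa [Function.comp_def] using this
  · simpa [h] using hasDerivAt_const (0:ℝ) (β (t i))

theorem cpd_add {G G' : (ι → ℝ) → ℂ} (h : Differentiable ℝ G) (h' : Differentiable ℝ G') (j : ι) :
    cpd j (fun t => G t + G' t) = fun t => cpd j G t + cpd j G' t := by
  ext t
  have := (cpd_line h j t 0).add (cpd_line h' j t 0)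
  simp only [Pi.single_zero, add_zero] at this
  exact cpd_eq (h.add h') this

variable {v : ι → ℝ → ℝ}

theorem Good.add {r : List ι} : ∀ {G G' : (ι → ℝ) → ℂ} {m E E' : (ι → ℝ) → ℝ}, (∀ t, 0 ≤ m t) →
    Good v r G m E → Good v r G' m E' → Good v r (fun t => G t + G' t) m (fun t => E t + E' t) := by
  induction r with
  | nil =>
    intro G G' m E E' hm h h' t
    calc ‖G t + G' t‖ * m t ≤ (‖G t‖ + ‖G' t‖) * m t := mul_le_mul_of_nonneg_right (norm_add_le _ _) (hm t)
      _ ≤ E t + E' t := by rw [add_mul]; exact add_le_add (h t) (h' t)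
  | cons j r ih =>
    intro G G' m E E' hm h h'
    have e : (fun t : ι → ℝ => (E t + E' t) * v j (t j)) = fun t => E t * v j (t j) + E' t * v j (t j) := by
      ext t; ring
    refine ⟨h.1.add h'.1, ?_, ?_⟩
    · rw [e]; exact ih hm h.2.1 h'.2.1
    · rw [e, cpd_add h.1 h'.1]; exact ih (fun t => mul_nonneg (hm t) (abs_nonneg _)) h.2.2 h'.2.2

theorem Good.mono (hv : ∀ j s, 0 ≤ v j s) {r : List ι} : ∀ {G : (ι → ℝ) → ℂ} {m E E' : (ι → ℝ) → ℝ}, (∀ t, E t ≤ E' t) →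
    Good v r G m E → Good v r G m E' := by
  induction r with
  | nil => exact fun hE h t => (h t).trans (hE t)
  | cons j r ih =>
    intro G m E E' hE h
    have e := fun t : ι → ℝ => mul_le_mul_of_nonneg_right (hE t) (hv j (t j))
    exact ⟨h.1, ih e h.2.1, ih e h.2.2⟩

theorem Good.mulm {r : List ι} {c : (ι → ℝ) → ℝ} (hc : ∀ t, 0 ≤ c t) : ∀ {G : (ι → ℝ) → ℂ} {m E : (ι → ℝ) → ℝ},
    Good v r G m E → Good v r G (fun t => m t * c t) (fun t => E t * c t) := by
  induction r with
  | nil => exact fun h t => by rw [← mul_assoc]; exact mul_le_mul_of_nonneg_right (h t) (hc t)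
  | cons j r ih =>
    intro G m E h
    have e : (fun t : ι → ℝ => E t * c t * v j (t j)) = fun t => E t * v j (t j) * c t := by ext t; ring
    have e' : (fun t : ι → ℝ => m t * c t * |t j|) = fun t => m t * |t j| * c t := by ext t; ring
    refine ⟨h.1, ?_, ?_⟩
    · rw [e]; exact ih h.2.1
    · rw [e, e']; exact ih h.2.2

theorem Good.mulc {r : List ι} {β : ℝ → ℂ} (hβ : Differentiable ℝ β) {i : ι} (hi : i ∉ r) : ∀ {G : (ι → ℝ) → ℂ} {m E : (ι → ℝ) → ℝ},
    Good v r G m E → Good v r (fun t => β (t i) * G t) m (fun t => E t * ‖β (t i)‖) := by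
  induction r with
  | nil =>
    intro G m E h t
    dsimp only
    rw [norm_mul, mul_assoc, mul_comm (E t)]
    exact mul_le_mul_of_nonneg_left (h t) (norm_nonneg _)
  | cons j r ih =>
    intro G m E h
    have hij : i ≠ j := fun h => hi (h ▸ List.mem_cons_self)
    have hr : i ∉ r := fun h => hi (List.mem_cons_of_mem _ h)
    have e : (fun t : ι → ℝ => E t * ‖β (t i)‖ * v j (t j)) = fun t => E t * v j (t j) * ‖β (t i)‖ := by ext t; ring
    have hb : Differentiable ℝ fun t : ι → ℝ => β (t i) := by fun_prop
    have e' : cpd j (fun t : ι → ℝ => β (t i) * G t) = fun t => β (t i) * cpd j G t := by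
      ext t
      rw [cpd_mul hb h.1, cpd_coord (β' := deriv β) (fun s => (hβ s).hasDerivAt), if_neg hij, zero_mul, zero_add]
    refine ⟨hb.mul h.1, ?_, ?_⟩
    · rw [e]; exact ih hr h.2.1
    · rw [e, e']; exact ih hr h.2.2

theorem lprod_diff {a : ι → ℝ → ℂ} (ha : ∀ j, Differentiable ℝ (a j)) (r : List ι) :
    Differentiable ℝ fun t : ι → ℝ => (r.map fun j => a j (t j)).prod := by
  induction r with
  | nil => simp
  | cons j r ih =>
    simp only [List.map_cons, List.prod_cons]
    have : Differentiable ℝ fun t : ι → ℝ => a j (t j) := (ha j).comp (differentiable_apply j)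
    exact this.mul ih

theorem lprod_cpd {a : ι → ℝ → ℂ} (ha : ∀ j, Differentiable ℝ (a j)) (r : List ι) {j : ι} (hj : j ∉ r) :
    cpd j (fun t : ι → ℝ => (r.map fun j => a j (t j)).prod) = fun _ => 0 := by
  ext t
  refine cpd_eq (lprod_diff ha r) ?_
  have : (fun s : ℝ => (r.map fun i => a i ((t + Pi.single j s : ι → ℝ) i)).prod) = fun _ => (r.map fun i => a i (t i)).prod := by
    ext s; congr 1; refine List.map_congr_left fun i hi => ?_
    have : i ≠ j := fun h => hj (h ▸ hi)
    simp [this]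
  rw [this]
  exact hasDerivAt_const _ _

theorem Good.prod {u : ι → ℝ → ℝ} {a a' : ι → ℝ → ℂ} {Kc : ι → ℝ} (hv : ∀ j s, 0 ≤ v j s) (hu : ∀ j s, 0 ≤ u j s)
    (hK : ∀ j, 0 ≤ Kc j)
    (ha : ∀ j s, HasDerivAt (a j) (a' j s) s) (ha' : ∀ j, Differentiable ℝ (a' j))
    (h0 : ∀ j s, u j s * ‖a j s‖ ≤ Kc j * v j s) (h1 : ∀ j s, u j s * |s| * ‖a' j s‖ ≤ Kc j * v j s) {r : List ι} :
    ∀ {ψ : (ι → ℝ) → ℂ} {m E : (ι → ℝ) → ℝ}, r.Nodup → (∀ t, 0 ≤ m t) → (∀ t, 0 ≤ E t) → Good u r ψ m E →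
    Good v r (fun t => (r.map fun j => a j (t j)).prod * ψ t) m (fun t => E t * (r.map fun j => 2 * Kc j).prod) := by
  have had : ∀ j, Differentiable ℝ (a j) := fun j s => (ha j s).differentiableAt
  induction r with
  | nil => intro ψ m E _ _ _ h; simpa [Good] using h
  | cons j r ih =>
    intro ψ m E hn hm hE h
    obtain ⟨hj, hn⟩ := List.nodup_cons.1 hn
    obtain ⟨hd, g1, g2⟩ := h
    have hE' : ∀ t : ι → ℝ, 0 ≤ E t * u j (t j) := fun t => mul_nonneg (hE t) (hu _ _)
    have i1 := ih hn hm hE' g1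
    have i2 := ih hn (fun t => mul_nonneg (hm t) (abs_nonneg _)) hE' g2
    set P := (r.map fun j => 2 * Kc j).prod with hP
    have hP0 : 0 ≤ P := List.prod_nonneg (by
      intro z hz; obtain ⟨i, _, rfl⟩ := List.mem_map.1 hz; linarith [hK i])
    set Gr : (ι → ℝ) → ℂ := fun t => (r.map fun j => a j (t j)).prod * ψ t with hGr
    have dGr : Differentiable ℝ Gr := (lprod_diff had r).mul hd
    have cGr : cpd j Gr = fun t => (r.map fun j => a j (t j)).prod * cpd j ψ t := by
      ext t
      rw [hGr, cpd_mul (lprod_diff had r) hd, lprod_cpd had r hj, zero_mul, zero_add]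
    have dj : Differentiable ℝ fun t : ι → ℝ => a j (t j) := (had j).comp (differentiable_apply j)
    have eG : (fun t : ι → ℝ => ((j :: r).map fun j => a j (t j)).prod * ψ t) = fun t => a j (t j) * Gr t := by
      ext t; simp [hGr, mul_assoc]
    have cG : cpd j (fun t => a j (t j) * Gr t) = fun t => a' j (t j) * Gr t + a j (t j) * cpd j Gr t := by
      ext t
      rw [cpd_mul dj dGr, cpd_coord (ha j), if_pos rfl]
    rw [eG]
    rw [← cGr] at i2
    have n0 : ∀ t : ι → ℝ, E t * u j (t j) * P * ‖a j (t j)‖ ≤ E t * P * Kc j * v j (t j) := fun t =>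
      calc _ = E t * P * (u j (t j) * ‖a j (t j)‖) := by ring
        _ ≤ E t * P * (Kc j * v j (t j)) := mul_le_mul_of_nonneg_left (h0 _ _) (mul_nonneg (hE t) hP0)
        _ = _ := by ring
    have n1 : ∀ t : ι → ℝ, E t * u j (t j) * P * |t j| * ‖a' j (t j)‖ ≤ E t * P * Kc j * v j (t j) := fun t =>
      calc _ = E t * P * (u j (t j) * |t j| * ‖a' j (t j)‖) := by ring
        _ ≤ E t * P * (Kc j * v j (t j)) := mul_le_mul_of_nonneg_left (h1 _ _) (mul_nonneg (hE t) hP0)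
        _ = _ := by ring
    have n2 : ∀ t : ι → ℝ, 0 ≤ E t * P * Kc j * v j (t j) := fun t =>
      mul_nonneg (mul_nonneg (mul_nonneg (hE t) hP0) (hK j)) (hv _ _)
    refine ⟨dj.mul dGr, ?_, ?_⟩
    · refine Good.mono hv (fun t => ?_) (Good.mulc (had j) hj i1)
      rw [List.map_cons, List.prod_cons, ← hP]
      linarith [n0 t, n2 t]
    · rw [cG]
      refine Good.mono hv (fun t => ?_) (Good.add (fun t => mul_nonneg (hm t) (abs_nonneg _))
        (Good.mulc (ha' j) hj (Good.mulm (c := fun t => |t j|) (fun t => abs_nonneg _) i1)) (Good.mulc (had j) hj i2))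
      dsimp only
      rw [List.map_cons, List.prod_cons, ← hP]
      linarith [n0 t, n1 t]

theorem good_of {u : ι → ℝ → ℝ} {r : List ι} : ∀ {ψ : (ι → ℝ) → ℂ} {m E : (ι → ℝ) → ℝ}, r.Nodup →
    ContDiff ℝ r.length ψ →
    (∀ α : ι → ℕ, (∀ j, α j ≤ 1) → ∀ t, ‖r.foldl (fun ψ j => (cpd j)^[α j] ψ) ψ t‖ * (m t * (r.map fun j => |t j| ^ α j).prod)
      ≤ E t * (r.map fun j => u j (t j)).prod) → Good u r ψ m E := by
  induction r with
  | nil =>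
    intro ψ m E _ _ H t
    simpa using H 0 pS t
  | cons j r ih =>
    intro ψ m E hn hc H
    obtain ⟨hj, hn⟩ := List.nodup_cons.1 hn
    rw [List.length_cons] at hc
    push_cast at hc
    have hup : ∀ (α : ι → ℕ) (z : ℕ), z ≤ 1 → (∀ i, α i ≤ 1) → ∀ t,
        ‖r.foldl (fun ψ j => (cpd j)^[α j] ψ) ((cpd j)^[z] ψ) t‖ * (m t * (|t j| ^ z * (r.map fun j => |t j| ^ α j).prod))
          ≤ E t * (u j (t j) * (r.map fun j => u j (t j)).prod) := by
      intro α z hz hα t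
      have := H (Function.update α j z) (fun i => by
        by_cases hi : i = j
        · subst hi; simpa
        · simpa [hi] using hα i) t
      rw [List.foldl_cons, List.map_cons, List.map_cons, List.prod_cons, List.prod_cons, Function.update_self] at this
      have e1 : (r.map fun i => |t i| ^ (Function.update α j z i)) = r.map fun i => |t i| ^ α i :=
        List.map_congr_left fun i hi => by rw [Function.update_of_ne (show i ≠ j from fun h => hj (h ▸ hi))]
      have e2 : r.foldl (fun ψ i => (cpd i)^[Function.update α j z i] ψ) ((cpd j)^[z] ψ) =
          r.foldl (fun ψ i => (cpd i)^[α i] ψ) ((cpd j)^[z] ψ) :=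
        List.foldl_ext _ _ _ fun a i hi => by rw [Function.update_of_ne (show i ≠ j from fun h => hj (h ▸ hi))]
      rw [e1, e2] at this
      exact this
    refine ⟨hc.differentiable pS, ?_, ?_⟩
    · refine ih hn (hc.of_le (by exact_mod_cast Nat.le_succ _)) fun α hα t => ?_
      have := hup α 0 pN hα t
      simp only [Function.iterate_zero, id, pow_zero, one_mul] at this
      rw [mul_assoc (E t)]; exact this
    · refine ih hn ?_ fun α hα t => ?_
      · exact (hc.fderiv_right le_rfl).clm_apply contDiff_const
      · have := hup α 1 le_rfl hα t
        simp only [Function.iterate_one, pow_one] at this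
        rw [mul_assoc (E t), mul_assoc (m t)]; exact this

end

end
section

theorem rp_int {θ : ℝ} (h0 : 0 < θ) (h1 : θ < 1) : Integrable (fun s : ℝ => (1 + s ^ 2)⁻¹ * (1 + |s| ^ (-θ))) := by
  have e1 : IntegrableOn (fun s : ℝ => (1 + s ^ 2)⁻¹ * |s| ^ (-θ)) (Set.Ioi 0) := by
    rw [← Set.Ioc_union_Ioi_eq_Ioi zero_le_one]
    refine IntegrableOn.union ?_ ?_
    · have := (intervalIntegral.intervalIntegrable_rpow' (a := 0) (b := 1) (by linarith : -1 < -θ)).1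
      refine this.mono' pF ?_
      filter_upwards [ae_restrict_mem measurableSet_Ioc] with s hs
      rw [abs_of_pos hs.1, Real.norm_of_nonneg (by have := hs.1; positivity)]
      exact mul_le_of_le_one_left (Real.rpow_nonneg hs.1.le _) (inv_le_one_of_one_le₀ (by nlinarith [sq_nonneg s]))
    · refine integrable_inv_one_add_sq.integrableOn.mono' pF ?_
      filter_upwards [ae_restrict_mem measurableSet_Ioi] with s hs
      have hs' : (1 : ℝ) < s := hs
      rw [abs_of_pos pL, Real.norm_of_nonneg pP]
      exact mul_le_of_le_one_right pP (Real.rpow_le_one_of_one_le_of_nonpos hs'.le pL)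
  have e2 : IntegrableOn (fun s : ℝ => (1 + s ^ 2)⁻¹ * |s| ^ (-θ)) (Set.Iio 0) := by
    have h := e1.comp_neg
    rw [Set.neg_Ioi, neg_zero] at h
    simpa using h
  have e3 : Integrable (fun s : ℝ => (1 + s ^ 2)⁻¹ * |s| ^ (-θ)) := by
    have := e2.union e1
    rw [Set.Iio_union_Ioi, IntegrableOn, restrict_compl_singleton] at this
    exact this
  simp_rw [mul_add, mul_one]
  exact integrable_inv_one_add_sq.add e3

theorem W_int (x : ℝ) : Integrable (fun s : ℝ => 1000 * (1 + s ^ 2)⁻¹ / (1 + |x| * |s|)) := by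
  refine (integrable_inv_one_add_sq.const_mul 1000).mono' (by fun_prop : Measurable fun s : ℝ => 1000 * (1 + s ^ 2)⁻¹ / (1 + |x| * |s|)).aestronglyMeasurable (ae_of_all _ fun s => ?_)
  rw [Real.norm_of_nonneg pP]
  exact div_le_self pP (by nlinarith [mul_nonneg (abs_nonneg x) (abs_nonneg s)])

theorem W_le {θ : ℝ} (h0 : 0 < θ) (h1 : θ < 1) (x : ℝ) : ∫ s : ℝ, 1000 * (1 + s ^ 2)⁻¹ / (1 + |x| * |s|) ≤
    (1000 * ∫ s : ℝ, (1 + s ^ 2)⁻¹ * (1 + |s| ^ (-θ))) * (1 + |x|) ^ (-θ) := by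
  rw [← integral_const_mul, ← integral_mul_const]
  refine integral_mono_ae (W_int x) (((rp_int h0 h1).const_mul _).mul_const _) ?_
  have hne : ∀ᵐ s : ℝ, s ≠ 0 := by simp [ae_iff]
  filter_upwards [hne] with s hs
  have hs0 : 0 < |s| := abs_pos.2 hs
  have hm : 0 < min 1 |s| := lt_min one_pos hs0
  have k1 : (1 + |x|) * min 1 |s| ≤ 1 + |x| * |s| := by
    have a1 := min_le_left 1 |s|
    have a2 := min_le_right 1 |s|
    nlinarith [abs_nonneg x]
  have k2 : (min 1 |s|) ^ (-θ) ≤ 1 + |s| ^ (-θ) := by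
    rcases min_choice 1 |s| with h | h <;> rw [h]
    · rw [Real.one_rpow]; have := Real.rpow_nonneg hs0.le (-θ); linarith
    · linarith
  have k3 : (1 + |x| * |s|)⁻¹ ≤ (1 + |x| * |s|) ^ (-θ) := by
    rw [← Real.rpow_neg_one]
    exact Real.rpow_le_rpow_of_exponent_le (by nlinarith [mul_nonneg (abs_nonneg x) (abs_nonneg s)]) pL
  have k4 : (1 + |x| * |s|) ^ (-θ) ≤ ((1 + |x|) * min 1 |s|) ^ (-θ) :=
    Real.rpow_le_rpow_of_nonpos pP k1 pL
  rw [Real.mul_rpow pP hm.le] at k4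
  have k5 := mul_le_mul_of_nonneg_left k2 (Real.rpow_nonneg (by positivity : 0 ≤ 1 + |x|) (-θ))
  calc 1000 * (1 + s ^ 2)⁻¹ / (1 + |x| * |s|) = 1000 * (1 + s ^ 2)⁻¹ * (1 + |x| * |s|)⁻¹ := div_eq_mul_inv _ _
    _ ≤ 1000 * (1 + s ^ 2)⁻¹ * ((1 + |x|) ^ (-θ) * (1 + |s| ^ (-θ))) :=
        mul_le_mul_of_nonneg_left (k3.trans (k4.trans k5)) pP
    _ = _ := by ring

theorem ab_bd (κ : SchwartzMap ℝ ℂ) {l : ℝ} (hl : 0 < l) : ∃ C : ℝ, 0 < C ∧ ∀ h : ℝ, 0 < h → h ≤ 1 → ∀ s : ℝ,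
    (1 + s ^ 2) ^ (l / 2) * ‖κ (h * s)‖ ≤ C * h ^ (-l - 4) * ((1 + s ^ 2)⁻¹) ^ 2 ∧
    (1 + s ^ 2) ^ (l / 2) * |s| * ‖h * deriv κ (h * s)‖ ≤ C * h ^ (-l - 4) * ((1 + s ^ 2)⁻¹) ^ 2 := by
  obtain ⟨C0, c0, H0⟩ := schwartz_decay κ 0 (2 + l / 2)
  obtain ⟨C1, c1, H1⟩ := schwartz_decay κ 1 (2 + l / 2 + 1 / 2)
  refine ⟨C0 + C1, by positivity, fun h h0 h1 s => ?_⟩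
  have hz : 0 < 1 + (h * s) ^ 2 := by positivity
  have key : (1 + s ^ 2) ^ (l / 2) * (1 + (h * s) ^ 2) ^ (-(2 + l / 2)) ≤ h ^ (-l - 4) * ((1 + s ^ 2)⁻¹) ^ 2 := by
    have e1 : (1 + (h * s) ^ 2) ^ (-(2 + l / 2)) ≤ (h ^ 2 * (1 + s ^ 2)) ^ (-(2 + l / 2)) :=
      Real.rpow_le_rpow_of_nonpos pP (by nlinarith [mul_pos h0 h0]) pL
    refine (mul_le_mul_of_nonneg_left e1 pP).trans (le_of_eq ?_)
    rw [Real.mul_rpow pP pP, ← Real.rpow_natCast h 2, ← Real.rpow_mul h0.le, mul_left_comm,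
      ← Real.rpow_add pP, inv_pow, ← Real.rpow_natCast (1 + s ^ 2) 2, ← Real.rpow_neg pP]
    congr 2 <;> push_cast <;> ring
  have hh : 0 ≤ h ^ (-l - 4) * ((1 + s ^ 2)⁻¹) ^ 2 := by positivity
  have q0 := H0 (h * s)
  have q1 := H1 (h * s)
  rw [iteratedDeriv_zero] at q0
  rw [iteratedDeriv_one] at q1
  constructor
  · calc _ ≤ (1 + s ^ 2) ^ (l / 2) * (C0 * (1 + (h * s) ^ 2) ^ (-(2 + l / 2))) := mul_le_mul_of_nonneg_left q0 pP
      _ = C0 * ((1 + s ^ 2) ^ (l / 2) * (1 + (h * s) ^ 2) ^ (-(2 + l / 2))) := by ring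
      _ ≤ C0 * (h ^ (-l - 4) * ((1 + s ^ 2)⁻¹) ^ 2) := mul_le_mul_of_nonneg_left key c0.le
      _ ≤ _ := by rw [mul_assoc (C0 + C1), add_mul]; linarith [mul_nonneg c1.le hh]
  · have e2 : |h * s| ≤ (1 + (h * s) ^ 2) ^ ((1 : ℝ) / 2) := by
      rw [← Real.sqrt_eq_rpow, ← Real.sqrt_sq_eq_abs]
      exact Real.sqrt_le_sqrt pL
    calc (1 + s ^ 2) ^ (l / 2) * |s| * ‖h * deriv κ (h * s)‖
        = (1 + s ^ 2) ^ (l / 2) * (|h * s| * ‖deriv κ (h * s)‖) := by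
          rw [norm_mul, Complex.norm_real, Real.norm_eq_abs, abs_mul]; ring
      _ ≤ (1 + s ^ 2) ^ (l / 2) * ((1 + (h * s) ^ 2) ^ ((1 : ℝ) / 2) * (C1 * (1 + (h * s) ^ 2) ^ (-(2 + l / 2 + 1 / 2)))) := by
          refine mul_le_mul_of_nonneg_left (mul_le_mul e2 q1 (norm_nonneg _) pP) pP
      _ = C1 * ((1 + s ^ 2) ^ (l / 2) * ((1 + (h * s) ^ 2) ^ ((1 : ℝ) / 2) * (1 + (h * s) ^ 2) ^ (-(2 + l / 2 + 1 / 2)))) := by ring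
      _ = C1 * ((1 + s ^ 2) ^ (l / 2) * (1 + (h * s) ^ 2) ^ (-(2 + l / 2))) := by
          rw [← Real.rpow_add hz]; congr 3; ring
      _ ≤ C1 * (h ^ (-l - 4) * ((1 + s ^ 2)⁻¹) ^ 2) := mul_le_mul_of_nonneg_left key c1.le
      _ ≤ _ := by rw [mul_assoc (C0 + C1), add_mul]; linarith [mul_nonneg c0.le hh]

end
section

section
variable {d : ℕ} {I : Finset (Fin d)} {K : ℝ → ℝ}

theorem L_dec (κ : SchwartzMap ℝ ℂ)
    (hκ : eFT κ K)
    {q : Vd d → ℝ} (hq : IsDensity q) {A : ℝ} {lam : Vd d} {A' : ℝ} (hG : GB I q A' lam) (hA : 0 < A)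
    (hN : N2mid I q A lam) {θ : ℝ} (t0 : 0 < θ) (t1 : θ < 1) :
    ∃ C : ℝ, 0 < C ∧ ∀ h, HU I h → ∀ x, ‖Lh I K q h x‖ ≤ C * PW I h (fun j => -lam j - 4) * ∏ j : I, (1 + |x j|) ^ (-θ) := by
  have hl := hG.2.1
  choose c hc0 hc using fun j : I => ab_bd κ (hl j)
  set Cθ := 1000 * ∫ s : ℝ, (1 + s ^ 2)⁻¹ * (1 + |s| ^ (-θ)) with hCθ
  have hCθ0 : 0 ≤ Cθ := mul_nonneg pN (integral_nonneg fun s => by positivity)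
  refine ⟨A * (∏ j, 2 * c j) * (Cθ + 1) ^ I.card, by
    have : 0 < ∏ j, 2 * c j := Finset.prod_pos fun j _ => by linarith [hc0 j]
    positivity, fun h H x => ?_⟩
  obtain ⟨_, _, hb⟩ := mulBds κ hq hG
  have hi := (hb h H).1
  obtain ⟨-, hcd, hN⟩ := hN
  set ψ : (I → ℝ) → ℂ := fun t => (ftI (marginal I q) t)⁻¹ with hψ
  set r : List I := (Finset.univ (α := I)).toList.reverse with hr
  have hnd : r.Nodup := List.nodup_reverse.2 (Finset.nodup_toList _)
  have hprodR : ∀ f : I → ℝ, (r.map f).prod = ∏ j, f j := fun f => by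
    rw [hr, List.map_reverse, List.prod_reverse, Finset.prod_map_toList]
  have hprodC : ∀ f : I → ℂ, (r.map f).prod = ∏ j, f j := fun f => by
    rw [hr, List.map_reverse, List.prod_reverse, Finset.prod_map_toList]
  have hlen : r.length = I.card := by simp [hr]
  have g1 : Good (fun (j : I) s => (1 + s ^ 2) ^ (lam j / 2)) r ψ (fun _ => 1) (fun _ => A) := by
    refine good_of hnd (by rw [hlen]; exact hcd) fun α hα t => ?_
    have := hN α (by
      calc ∑ j, α j ≤ ∑ _j : I, 1 := Finset.sum_le_sum fun j _ => hα j
        _ = I.card := by simp) t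
    rw [norm_mul, norm_prod] at this
    rw [hprodR, hprodR, hr, List.foldl_reverse, one_mul]
    refine le_trans (le_of_eq ?_) this
    congr 1
    exact Finset.prod_congr rfl fun j _ => by rw [norm_pow, Complex.norm_real, Real.norm_eq_abs]
  have hka : ∀ (j : I) (s : ℝ), HasDerivAt (fun s : ℝ => κ (h j * s)) ((h j : ℂ) * deriv κ (h j * s)) s := by
    intro j s
    have h1 : HasDerivAt (fun s : ℝ => h j * s) (h j) s := by simpa using (hasDerivAt_id s).const_mul (h j)
    have h2 := (κ.differentiable (h j * s)).hasDerivAt.scomp s h1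
    rw [Complex.real_smul] at h2
    exact h2
  have hkd : Differentiable ℝ (deriv κ) := by
    have : ContDiff ℝ 2 κ := κ.smooth 2
    exact ((contDiff_succ_iff_deriv (n := 1)).1 this).2.2.differentiable pN
  have g2 := Good.prod (v := fun (_ : I) s => ((1 + s ^ 2)⁻¹) ^ 2) (a := fun (j : I) s => κ (h j * s))
    (a' := fun (j : I) s => (h j : ℂ) * deriv κ (h j * s)) (Kc := fun j => c j * (h j) ^ (-lam j - 4))
    (fun j s => by positivity) (fun j s => by positivity)
    (fun j => mul_nonneg (hc0 j).le (Real.rpow_nonneg (H j j.2).1.le _)) hka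
    (fun j => (hkd.comp (by fun_prop : Differentiable ℝ fun s : ℝ => h j * s)).const_mul _)
    (fun j s => (hc j (h j) (H j j.2).1 (H j j.2).2 s).1)
    (fun j s => (hc j (h j) (H j j.2).1 (H j j.2).2 s).2) hnd (fun _ => zero_le_one) (fun _ => hA.le) g1
  have eG : (fun t : I → ℝ => (r.map fun j : I => κ (h j * t j)).prod * ψ t) = mul I κ q h := by
    ext t; rw [hprodC]; rfl
  rw [eG] at g2
  have b := Good.bound (fun _ _ => rfl) x r _ _ _ hnd g2 (fun _ => zero_le_one) (fun _ _ _ _ => rfl) (fun _ _ _ _ => rfl)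
  have hft := Dl_ft (fun j => if |x j| ≤ 1 then 0 else Real.pi / x j) (fun j => if |x j| ≤ 1 then 0 else 1) hi x r
  set δ : I → ℝ := fun j => if |x j| ≤ 1 then 0 else Real.pi / x j with hδ
  set χ : I → ℂ := fun j => if |x j| ≤ 1 then 0 else 1 with hχ
  have hγ : 1 ≤ ‖(r.map fun j => Complex.exp (Complex.I * (δ j * x j : ℝ)) - χ j).prod‖ := by
    rw [hprodC, norm_prod]
    refine Finset.one_le_prod fun j => ?_
    simp only [hδ, hχ]
    split_ifs with hx
    · simp
    · have hx0 : x j ≠ 0 := fun h => hx (by simp [h])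
      rw [div_mul_cancel₀ _ hx0, mul_comm, Complex.exp_pi_mul_I]; norm_num
  rw [Lh_eq κ hκ q H x, norm_mul, Complex.norm_real, Real.norm_of_nonneg (two_pi_nn _).le]
  set J := ∫ t, cE t x * mul I κ q h t with hJ
  have s1 : ‖J‖ ≤ ∫ t, ‖Dl δ χ r (mul I κ q h) t‖ := by
    calc ‖J‖ ≤ ‖(r.map fun j => Complex.exp (Complex.I * (δ j * x j : ℝ)) - χ j).prod * J‖ := by
          rw [norm_mul]; exact le_mul_of_one_le_left (norm_nonneg _) hγ
      _ = ‖∫ t, cE t x * Dl δ χ r (mul I κ q h) t‖ := by rw [hft]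
      _ ≤ ∫ t, ‖cE t x * Dl δ χ r (mul I κ q h) t‖ := norm_integral_le_integral_norm _
      _ = _ := by
          congr 1; ext t
          rw [norm_mul, ← mul_neg, mul_comm Complex.I, ← Complex.ofReal_neg, Complex.norm_exp_ofReal_mul_I, one_mul]
  set P := A * (r.map fun j : I => 2 * (c j * (h j) ^ (-lam j - 4))).prod with hP
  have hPe : P = A * (∏ j, 2 * c j) * PW I h (fun j => -lam j - 4) := by
    rw [hP, hprodR, PW, mul_assoc, ← Finset.prod_mul_distrib]
    congr 1; exact Finset.prod_congr rfl fun j _ => by ring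
  have hPW := PW_pos H.pos (fun j => -lam j - 4)
  have hP0 : 0 ≤ P := by
    rw [hPe]
    have : 0 < ∏ j, 2 * c j := Finset.prod_pos fun j _ => by linarith [hc0 j]
    positivity
  have s2 : ∫ t, ‖Dl δ χ r (mul I κ q h) t‖ ≤ P * ∏ j : I, ∫ s : ℝ, 1000 * (1 + s ^ 2)⁻¹ / (1 + |x j| * |s|) := by
    rw [← integral_fintype_prod_volume_eq_prod (f := fun (j : I) (s : ℝ) => 1000 * (1 + s ^ 2)⁻¹ / (1 + |x j| * |s|)),
      ← integral_const_mul]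
    refine integral_mono (Dl_int δ χ hi r).norm
      ((Integrable.fintype_prod (f := fun (j : I) (s : ℝ) => 1000 * (1 + s ^ 2)⁻¹ / (1 + |x j| * |s|)) fun j => W_int (x j)).const_mul _) fun t => ?_
    have := b t
    rw [mul_one, hprodR] at this
    exact this
  have s3 : ∏ j : I, ∫ s : ℝ, 1000 * (1 + s ^ 2)⁻¹ / (1 + |x j| * |s|) ≤ ∏ j : I, (Cθ + 1) * (1 + |x j|) ^ (-θ) := by
    refine Finset.prod_le_prod (fun j _ => integral_nonneg fun s => by positivity) fun j _ => ?_
    refine (W_le t0 t1 (x j)).trans ?_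
    exact mul_le_mul_of_nonneg_right pL pP
  calc (2 * Real.pi) ^ (-(I.card : ℝ)) * ‖J‖ ≤ 1 * ‖J‖ := mul_le_mul_of_nonneg_right (two_pi_le _) (norm_nonneg _)
    _ = ‖J‖ := one_mul _
    _ ≤ P * ∏ j : I, (Cθ + 1) * (1 + |x j|) ^ (-θ) := s1.trans (s2.trans (mul_le_mul_of_nonneg_left s3 hP0))
    _ = _ := by
      rw [Finset.prod_mul_distrib, Finset.prod_const, hPe, Finset.card_univ, Fintype.card_coe]; ring

theorem PB_of (κ : SchwartzMap ℝ ℂ)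
    (hκ : eFT κ K)
    {q : Vd d → ℝ} (hq : IsDensity q) {A : ℝ} {lam : Vd d} (hG : GB I q A lam) {A' : ℝ} (hA : 0 < A')
    (hN : N2mid I q A' lam) {s : ℝ} (s1 : 1 < s) : PB I K q s := by
  set θ := (1 + 1 / s) / 2 with hθ
  have hs0 : 0 < s := by linarith
  have i1 : 1 / s < 1 := by rw [div_lt_one hs0]; exact s1
  have i2 : 0 < 1 / s := by positivity
  obtain ⟨C, hC, hL⟩ := L_dec κ hκ hq hG hA hN (θ := θ) pL pL
  set g : (I → ℝ) → ℝ := fun x => ∏ j : I, (1 + |x j|) ^ (-θ) with hg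
  have hg0 : ∀ x, 0 ≤ g x := fun x => Finset.prod_nonneg fun j _ => by positivity
  have hgm : Measurable g := by
    rw [hg]; exact Finset.measurable_prod _ fun j _ => by fun_prop
  have hgs : MemLp g (oR s) volume := by
    have hne : oR s ≠ 0 := by simpa using hs0
    rw [← integrable_norm_rpow_iff hgm.aestronglyMeasurable hne ENNReal.ofReal_ne_top, ENNReal.toReal_ofReal hs0.le]
    have e : (fun x : I → ℝ => ‖g x‖ ^ s) = fun x => ∏ j : I, (1 + ‖x j‖) ^ (-(θ * s)) := by
      ext x
      rw [Real.norm_of_nonneg (hg0 x), hg, ← Real.finset_prod_rpow _ _ (fun j _ => by positivity)]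
      refine Finset.prod_congr rfl fun j _ => ?_
      rw [← Real.rpow_mul pP, Real.norm_eq_abs, neg_mul]
    rw [e]
    refine Integrable.fintype_prod (f := fun (_ : I) (z : ℝ) => (1 + ‖z‖) ^ (-(θ * s))) fun j => ?_
    refine integrable_one_add_norm ?_
    rw [Module.finrank_self, hθ]
    have : (1 + 1 / s) / 2 * s = (s + 1) / 2 := by field_simp
    rw [this]; push_cast; linarith
  refine ⟨C * (eLpNorm g (oR s) volume).toReal + 1, by positivity, fun j => -|lam j| - 4,
    fun j => by linarith [abs_nonneg (lam j)], fun h H => ?_⟩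
  have hPW := PW_pos H.pos (fun j => -lam j - 4)
  have k1 : eLpNorm (Lh I K q h) (oR s) volume ≤
      oR (C * PW I h (fun j => -lam j - 4)) * eLpNorm g (oR s) volume := by
    refine eLpNorm_le_mul_eLpNorm_of_ae_le_mul (ae_of_all _ fun x => ?_) _
    rw [Real.norm_of_nonneg (hg0 x)]
    exact hL h H x
  refine k1.trans ?_
  rw [← ENNReal.ofReal_toReal hgs.2.ne, ← ENNReal.ofReal_mul pP]
  refine ENNReal.ofReal_le_ofReal ?_
  have k2 : PW I h (fun j => -lam j - 4) ≤ PW I h (fun j => -|lam j| - 4) :=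
    PW_anti H fun j => by linarith [le_abs_self (lam j)]
  have k3 : 0 ≤ C * (eLpNorm g (oR s) volume).toReal := by positivity
  rw [ENNReal.toReal_ofReal ENNReal.toReal_nonneg]
  nlinarith
end

end
section

theorem add_pow_split {N : ℕ} {t x : ℝ} (ht : 0 ≤ t) (hx : 0 ≤ x) : (t + x) ^ N ≤ 3 * t ^ N + ((N + 1 : ℝ) * x) ^ N := by
  rcases Nat.eq_zero_or_pos N with rfl | hN
  · norm_num
  have hN' : (0 : ℝ) < N := by exact_mod_cast hN
  rcases le_or_gt ((N : ℝ) * x) t with h | h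
  · have h1 : t + x ≤ t * (1 + 1 / N) := by
      have : x ≤ t / N := by rw [le_div_iff₀ hN']; linarith
      calc t + x ≤ t + t / N := by linarith
        _ = _ := by ring
    have h2 : (1 + 1 / (N : ℝ)) ^ N ≤ 3 := by
      have e1 : 1 + 1 / (N : ℝ) ≤ Real.exp (1 / N) := by rw [add_comm]; exact Real.add_one_le_exp _
      calc (1 + 1 / (N : ℝ)) ^ N ≤ Real.exp (1 / N) ^ N := pow_le_pow_left₀ pP e1 N
        _ = Real.exp 1 := by rw [← Real.exp_nat_mul]; congr 1; field_simp
        _ ≤ 3 := by linarith [Real.exp_one_lt_d9]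
    calc (t + x) ^ N ≤ (t * (1 + 1 / N)) ^ N := pow_le_pow_left₀ pP h1 N
      _ = t ^ N * (1 + 1 / N) ^ N := mul_pow _ _ _
      _ ≤ t ^ N * 3 := mul_le_mul_of_nonneg_left h2 pP
      _ ≤ _ := by have : 0 ≤ ((N + 1 : ℝ) * x) ^ N := by positivity
                  linarith
  · have : (t + x) ^ N ≤ ((N + 1 : ℝ) * x) ^ N := pow_le_pow_left₀ pP pL N
    have : 0 ≤ t ^ N := by positivity
    linarith

theorem delta_bd (l : ℕ) (T X : ℝ) : |(T + X) ^ (2 * l + 1) * X - T ^ (2 * l + 1) * X| ≤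
    (2 * l + 2) * X ^ 2 * (3 * |T| ^ (2 * l) + ((2 * l + 1 : ℝ) * |X|) ^ (2 * l)) := by
  have h1 : |(T + X) ^ (2 * l + 1) - T ^ (2 * l + 1)| ≤ (2 * l + 2) * |X| * (|T| + |X|) ^ (2 * l) := by
    have := abs_pow_sub_pow_le (T + X) T (2 * l + 1)
    refine this.trans ?_
    rw [add_sub_cancel_left]
    have e : max |T + X| |T| ≤ |T| + |X| := max_le (abs_add_le _ _) (by linarith [abs_nonneg X])
    have e2 : max |T + X| |T| ^ (2 * l + 1 - 1) ≤ (|T| + |X|) ^ (2 * l) := by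
      rw [Nat.add_sub_cancel]
      exact pow_le_pow_left₀ (le_max_of_le_right (abs_nonneg _)) e _
    push_cast
    calc _ ≤ |X| * (2 * l + 1) * (|T| + |X|) ^ (2 * l) := mul_le_mul_of_nonneg_left e2 pP
      _ ≤ (2 * l + 2) * |X| * (|T| + |X|) ^ (2 * l) := by
        refine mul_le_mul_of_nonneg_right ?_ pP
        nlinarith [abs_nonneg X]
  have h2 := add_pow_split (N := 2 * l) (abs_nonneg T) (abs_nonneg X)
  push_cast at h2
  rw [← sub_mul, abs_mul]
  calc _ ≤ (2 * l + 2) * |X| * (|T| + |X|) ^ (2 * l) * |X| := mul_le_mul_of_nonneg_right h1 (abs_nonneg X)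
    _ = (2 * l + 2) * X ^ 2 * (|T| + |X|) ^ (2 * l) := by rw [← sq_abs X]; ring
    _ ≤ _ := mul_le_mul_of_nonneg_left h2 pP

theorem young_l (l : ℕ) {a t : ℝ} (ha : 0 ≤ a) (ht : 0 ≤ t) : a * t ^ l ≤ t ^ (l + 1) + a ^ (l + 1) := by
  rcases le_total a t with h | h
  · calc a * t ^ l ≤ t * t ^ l := mul_le_mul_of_nonneg_right h pP
      _ = t ^ (l + 1) := by ring
      _ ≤ _ := by have : 0 ≤ a ^ (l + 1) := by positivity
                  linarith
  · calc a * t ^ l ≤ a * a ^ l := mul_le_mul_of_nonneg_left (pow_le_pow_left₀ ht h l) ha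
      _ = a ^ (l + 1) := by ring
      _ ≤ _ := by have : 0 ≤ t ^ (l + 1) := by positivity
                  linarith

theorem scalNum (l : ℕ) {n T M v s C : ℝ} (hn' : 0 < n) (hs : 0 < s) (hM0 : 0 ≤ M)
    (hv0 : 0 ≤ v) (hvs : v ≤ s) (hC : 1 ≤ C) (hk : (l + 1 : ℝ) * M ^ 2 ≤ C * n * s) :
    2 * n * ((2 * l + 2) * v * (3 * |T| ^ (2 * l) + ((2 * l + 1 : ℝ) * M) ^ (2 * l))) ≤
      v / s * (16 * C * (n * (l + 1) * s)) ^ (l + 1) + T ^ (2 * l + 2) := by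
  have hw0 : 0 ≤ v / s := by positivity
  have hw1 : v / s ≤ 1 := by rw [div_le_one hs]; exact hvs
  obtain ⟨w, hw⟩ : ∃ w, w = v / s := ⟨_, rfl⟩
  have hvw : v = w * s := by rw [hw]; field_simp
  rw [← hw] at hw0 hw1 ⊢
  obtain ⟨a, ha⟩ : ∃ a, a = n * (l + 1) * s := ⟨_, rfl⟩
  have ha0 : 0 ≤ a := by rw [ha]; positivity
  have hTT : |T| ^ (2 * l) = (T ^ 2) ^ l := by rw [pow_mul, sq_abs]
  have hTT2 : T ^ (2 * l + 2) = (T ^ 2) ^ (l + 1) := by rw [← pow_mul]; congr 1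
  have y1 := young_l l (a := 12 * (w * a)) (t := T ^ 2) pP pP
  have y2 : (12 * (w * a)) ^ (l + 1) ≤ w * (12 * C * a) ^ (l + 1) := by
    have : (12 * (w * a)) ^ (l + 1) = w ^ (l + 1) * (12 * a) ^ (l + 1) := by rw [← mul_pow]; ring
    rw [this]
    refine mul_le_mul ?_ ?_ pP hw0
    · rw [pow_succ]
      exact mul_le_of_le_one_left hw0 (pow_le_one₀ hw0 hw1)
    · refine pow_le_pow_left₀ pP ?_ _
      nlinarith
  have y3 : ((2 * l + 1 : ℝ) * M) ^ (2 * l) ≤ (4 * C * a) ^ l := by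
    rw [pow_mul]
    refine pow_le_pow_left₀ pP ?_ _
    have hl : (0 : ℝ) ≤ l := by positivity
    have e1 : ((2 * l + 1 : ℝ) * M) ^ 2 ≤ 4 * (l + 1) * ((l + 1) * M ^ 2) := by
      have : (0:ℝ) ≤ M ^ 2 * (4 * l + 3) := by positivity
      nlinarith
    have e2 : 4 * (l + 1 : ℝ) * ((l + 1) * M ^ 2) ≤ 4 * (l + 1) * (C * n * s) :=
      mul_le_mul_of_nonneg_left hk pP
    have e3 : 4 * (l + 1 : ℝ) * (C * n * s) = 4 * C * a := by rw [ha]; ring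
    linarith
  have y4 : 4 * (w * a) * ((2 * l + 1 : ℝ) * M) ^ (2 * l) ≤ w * (4 * C * a) ^ (l + 1) := by
    calc _ ≤ 4 * (w * a) * (4 * C * a) ^ l := mul_le_mul_of_nonneg_left y3 pP
      _ = w * (4 * a) * (4 * C * a) ^ l := by ring
      _ ≤ w * (4 * C * a) * (4 * C * a) ^ l := by
        refine mul_le_mul_of_nonneg_right (mul_le_mul_of_nonneg_left ?_ hw0) pP
        nlinarith
      _ = _ := by ring
  have y5 : (12 * C * a) ^ (l + 1) + (4 * C * a) ^ (l + 1) ≤ (16 * C * a) ^ (l + 1) := by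
    have := pow_add_pow_le (x := 12 * C * a) (y := 4 * C * a) (n := l + 1) pP pP (by omega)
    refine this.trans (le_of_eq ?_)
    congr 1; ring
  have y6 := mul_le_mul_of_nonneg_left y5 hw0
  have key : 2 * n * ((2 * l + 2) * v * (3 * |T| ^ (2 * l) + ((2 * l + 1 : ℝ) * M) ^ (2 * l))) =
      12 * (w * a) * (T ^ 2) ^ l + 4 * (w * a) * ((2 * l + 1 : ℝ) * M) ^ (2 * l) := by
    rw [hTT, hvw, ha]; ring
  rw [key, ← ha, hTT2]
  linarith

theorem scalRos {𝒴 : Type} [MeasurableSpace 𝒴] (P : Measure 𝒴) [IsProbabilityMeasure P] {n : ℕ} (hn : 0 < n) (l : ℕ)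
    {ℓ : 𝒴 → ℝ} (hm : Measurable ℓ) {M v s C : ℝ} (hs : 0 < s) (hM0 : 0 ≤ M) (hM : ∀ y, |ℓ y| ≤ M) (h0 : ∫ y, ℓ y ∂P = 0)
    (hv : ∫ y, ℓ y ^ 2 ∂P ≤ v) (hv0 : 0 ≤ v) (hvs : v ≤ s) (hC : 1 ≤ C) (hk : (l + 1 : ℝ) * M ^ 2 ≤ C * n * s) :
    ∫ y : Fin n → 𝒴, (∑ i, ℓ (y i)) ^ (2 * l + 2) ∂(Measure.pi fun _ => P) ≤ v / s * (16 * C * (n * (l + 1) * s)) ^ (l + 1) := by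
  have hn' : (0 : ℝ) < n := by exact_mod_cast hn
  have hSm : ∀ m, Measurable (fun y : Fin m → 𝒴 => ∑ i, ℓ (y i)) := fun m =>
    Finset.measurable_sum _ fun i _ => hm.comp (measurable_pi_apply i)
  have hSb : ∀ m, ∀ y : Fin m → 𝒴, |∑ i, ℓ (y i)| ≤ m * M := fun m y => by
    refine (Finset.abs_sum_le_sum_abs _ _).trans ?_
    refine (Finset.sum_le_sum fun i _ => hM (y i)).trans ?_
    simp
  have hi2 : Integrable (fun y => ℓ y ^ 2) P :=
    Integrable.of_bound (hm.pow_const 2).aestronglyMeasurable (M ^ 2) (ae_of_all _ fun y => by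
      rw [Real.norm_eq_abs, abs_pow]; exact pow_le_pow_left₀ (abs_nonneg _) (hM y) 2)
  refine lemA P n _ pP (fun m y => (∑ i, ℓ (y i)) ^ (2 * l + 2))
    (fun m y y0 => (∑ i, ℓ (y i)) ^ (2 * l + 1) * ℓ y0) ?_ ?_ ?_ ?_ ?_ n le_rfl
  · intro m
    exact (((hSm m).comp measurable_fst).pow_const _).mul (hm.comp measurable_snd)
  · intro m
    refine ⟨(m * M) ^ (2 * l + 1) * M, fun y y0 => ?_⟩
    rw [abs_mul, abs_pow]
    exact mul_le_mul (pow_le_pow_left₀ (abs_nonneg _) (hSb m y) _) (hM y0) (abs_nonneg _) pP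
  · intro m y

    rw [← Finset.mul_sum]; ring
  · intro m y

    rw [integral_const_mul, h0, mul_zero]
  · intro m _ y i

    have e : ∀ y0, ∑ j, ℓ ((i.insertNth y0 y : Fin (m + 1) → 𝒴) j) = (∑ j, ℓ (y j)) + ℓ y0 := by
      intro y0
      rw [Fin.sum_univ_succAbove _ i]
      simp [add_comm]
    simp only [e]
    obtain ⟨T, hT⟩ : ∃ T, T = ∑ j, ℓ (y j) := ⟨_, rfl⟩
    rw [← hT]
    have b1 : ∀ y0, |(T + ℓ y0) ^ (2 * l + 1) * ℓ y0 - T ^ (2 * l + 1) * ℓ y0| ≤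
        ((2 * l + 2) * (3 * |T| ^ (2 * l) + ((2 * l + 1 : ℝ) * M) ^ (2 * l))) * ℓ y0 ^ 2 := by
      intro y0
      refine (delta_bd l T (ℓ y0)).trans ?_
      have : ((2 * l + 1 : ℝ) * |ℓ y0|) ^ (2 * l) ≤ ((2 * l + 1 : ℝ) * M) ^ (2 * l) :=
        pow_le_pow_left₀ pP (mul_le_mul_of_nonneg_left (hM y0) pP) _
      calc _ ≤ (2 * l + 2) * ℓ y0 ^ 2 * (3 * |T| ^ (2 * l) + ((2 * l + 1 : ℝ) * M) ^ (2 * l)) :=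
            mul_le_mul_of_nonneg_left pL pP
        _ = _ := by ring
    have b2 := integral_mono_of_nonneg (μ := P) (ae_of_all _ fun y0 => abs_nonneg _) (hi2.const_mul _) (ae_of_all _ b1)
    rw [integral_const_mul] at b2
    refine b2.trans ?_
    rw [le_div_iff₀ pP]
    have b3 := scalNum l (T := T) hn' hs hM0 hv0 hvs hC hk
    refine le_trans ?_ b3
    have b4 : (2 * l + 2) * (3 * |T| ^ (2 * l) + ((2 * l + 1 : ℝ) * M) ^ (2 * l)) * ∫ y, ℓ y ^ 2 ∂P ≤
      (2 * l + 2) * (3 * |T| ^ (2 * l) + ((2 * l + 1 : ℝ) * M) ^ (2 * l)) * v :=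
        mul_le_mul_of_nonneg_left hv pP
    calc _ ≤ (2 * l + 2) * (3 * |T| ^ (2 * l) + ((2 * l + 1 : ℝ) * M) ^ (2 * l)) * v * (2 * n) :=
          mul_le_mul_of_nonneg_right b4 pP
      _ = _ := by ring

end
section

theorem supBall {ι : Type} [Fintype ι] {T : (ι → ℝ) → ℝ} {Λ : ℝ} (hΛ : 0 < Λ) (hT : ∀ x x', |T x - T x'| ≤ Λ * ‖x - x'‖) (N : ℕ) (x : ι → ℝ) :
    ‖T x‖ₑ ^ (N + Fintype.card ι) ≤ 2 ^ N * oR Λ ^ Fintype.card ι * ∫⁻ u, ‖T u‖ₑ ^ N := by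
  obtain ⟨z, hz⟩ : ∃ z, z = |T x| := ⟨_, rfl⟩
  have hz0 : 0 ≤ z := hz ▸ abs_nonneg _
  have hr0 : 0 ≤ z / (2 * Λ) := by positivity
  have h1 : ∀ u ∈ Metric.closedBall x (z / (2 * Λ)), oR (z / 2) ^ N ≤ ‖T u‖ₑ ^ N := by
    intro u hu
    refine pow_le_pow_left' ?_ N
    rw [← ofReal_norm, Real.norm_eq_abs]
    refine ENNReal.ofReal_le_ofReal ?_
    rw [mem_closedBall_iff_norm] at hu
    have a1 := hT u x
    have a2 : Λ * ‖u - x‖ ≤ z / 2 := by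
      calc Λ * ‖u - x‖ ≤ Λ * (z / (2 * Λ)) := mul_le_mul_of_nonneg_left hu hΛ.le
        _ = z / 2 := by field_simp
    have a3 := abs_sub_abs_le_abs_sub (T x) (T u)
    rw [abs_sub_comm] at a3
    linarith
  have h2 : oR (z / 2) ^ N * oR ((z / Λ) ^ Fintype.card ι) ≤ ∫⁻ u, ‖T u‖ₑ ^ N := by
    calc _ = ∫⁻ u in Metric.closedBall x (z / (2 * Λ)), oR (z / 2) ^ N := by
          rw [setLIntegral_const, Real.volume_pi_closedBall _ hr0]
          congr 3; congr 1; field_simp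
      _ ≤ ∫⁻ u in Metric.closedBall x (z / (2 * Λ)), ‖T u‖ₑ ^ N := setLIntegral_mono' Metric.isClosed_closedBall.measurableSet h1
      _ ≤ _ := setLIntegral_le_lintegral _ _
  calc ‖T x‖ₑ ^ (N + Fintype.card ι) = 2 ^ N * oR Λ ^ Fintype.card ι * (oR (z / 2) ^ N * oR ((z / Λ) ^ Fintype.card ι)) := by
        rw [← ofReal_norm, Real.norm_eq_abs, ← hz, ← ENNReal.ofReal_pow hz0, ← ENNReal.ofReal_pow hΛ.le, ← ENNReal.ofReal_pow pP,
          show (2 : ℝ≥0∞) ^ N = oR (2 ^ N) by rw [ENNReal.ofReal_pow pN]; simp,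
          ← ENNReal.ofReal_mul pP, ← ENNReal.ofReal_mul pP, ← ENNReal.ofReal_mul pP]
        congr 1
        rw [div_pow, div_pow, pow_add]; field_simp
    _ ≤ _ := by gcongr

theorem topNum {n c1 B L Λ D w a : ℝ} {k m R : ℕ} (hn : 0 < n) (hc : 1 ≤ c1) (hB : 0 ≤ B) (hD : 1 ≤ D) (hw : 1 ≤ w) (hR : R = 2 * k + m)
    (hLR : L ≤ R) (hΛ0 : 0 ≤ Λ) (hΛ : Λ ≤ c1 * Real.exp (B * L)) (ha0 : 0 ≤ a) (ha : a ≤ D * w ^ 2) :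
    (2 / n) ^ R * (2 ^ (2 * k) * Λ ^ m * a ^ k) ≤ (4 * c1 * Real.exp (B * m) * D * (w / n)) ^ R := by
  have e1 : (2 : ℝ) ^ (2 * k) ≤ 2 ^ R := pow_le_pow_right₀ pN (by omega)
  have e2 : Λ ^ m ≤ c1 ^ R * Real.exp (B * m) ^ R := by
    calc Λ ^ m ≤ (c1 * Real.exp (B * L)) ^ m := pow_le_pow_left₀ hΛ0 hΛ m
      _ = c1 ^ m * Real.exp (B * L) ^ m := mul_pow _ _ _
      _ ≤ c1 ^ R * Real.exp (B * m) ^ R := by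
        refine mul_le_mul (pow_le_pow_right₀ hc (by omega)) ?_ pP pP
        rw [← Real.exp_nat_mul, ← Real.exp_nat_mul]
        refine Real.exp_le_exp.2 ?_
        have : (m : ℝ) * B * L ≤ m * B * R := mul_le_mul_of_nonneg_left hLR pP
        linarith
  have e3 : a ^ k ≤ D ^ R * w ^ R := by
    calc a ^ k ≤ (D * w ^ 2) ^ k := pow_le_pow_left₀ ha0 ha k
      _ = D ^ k * w ^ (2 * k) := by rw [mul_pow, ← pow_mul]
      _ ≤ D ^ R * w ^ R := mul_le_mul (pow_le_pow_right₀ hD (by omega)) (pow_le_pow_right₀ hw (by omega)) pP pP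
  calc _ ≤ (2 / n) ^ R * (2 ^ R * (c1 ^ R * Real.exp (B * m) ^ R) * (D ^ R * w ^ R)) := by
        refine mul_le_mul_of_nonneg_left ?_ pP
        refine mul_le_mul (mul_le_mul e1 e2 pP pP) e3 pP pP
    _ = _ := by simp only [← mul_pow]; congr 1; field_simp; ring

variable {d : ℕ} {I : Finset (Fin d)} {K : ℝ → ℝ} {q f : Vd d → ℝ} {L : (I → ℝ) → ℂ} {ρ : ℂ →L[ℝ] ℝ} {lam : Vd d}

theorem Sx_meas {P : Measure Vd d} [IsProbabilityMeasure P] (hL : Measurable L) (n : ℕ) :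
    Measurable (fun z : (I → ℝ) × (Fin n → Vd d) => ∑ i, ρ (cen P L z.1 (z.2 i))) :=
  Finset.measurable_sum _ fun i _ => (rcen_meas (P := P) (ρ := ρ) hL).comp (measurable_fst.prodMk ((measurable_pi_apply i).comp measurable_snd))

theorem rcen_bd {P : Measure Vd d} [IsProbabilityMeasure P] (hρ : RF ρ) {M : ℝ} (hM : ∀ x, ‖L x‖ ≤ M) (x : I → ℝ) (y : Vd d) :
    |ρ (cen P L x y)| ≤ 2 * M := by
  refine (hρ _).trans ?_
  unfold cen
  refine (norm_sub_le _ _).trans ?_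
  have := norm_integral_le_of_norm_le_const (μ := P) (ae_of_all _ fun y' => hM (x - rI I y'))
  simp at this
  linarith [hM (x - rI I y)]

theorem S_lip {P : Measure Vd d} [IsProbabilityMeasure P] (hρ : RF ρ) (hL : Measurable L) {M Λ : ℝ} (hM : ∀ x, ‖L x‖ ≤ M)
    (hΛ : ∀ x x', ‖L x - L x'‖ ≤ Λ * ‖x - x'‖) {n : ℕ} (y : Fin n → Vd d) (x x' : I → ℝ) :
    |(∑ i, ρ (cen P L x (y i))) - ∑ i, ρ (cen P L x' (y i))| ≤ (2 * n * Λ) * ‖x - x'‖ := by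
  rw [← Finset.sum_sub_distrib]
  refine (Finset.abs_sum_le_sum_abs _ _).trans ?_
  have : ∀ i ∈ (Finset.univ : Finset (Fin n)), |ρ (cen P L x (y i)) - ρ (cen P L x' (y i))| ≤ 2 * Λ * ‖x - x'‖ := by
    intro i _
    rw [← map_sub]
    refine (hρ _).trans ?_
    have hh : ∀ y', ‖L (x - rI I y') - L (x' - rI I y')‖ ≤ Λ * ‖x - x'‖ := fun y' => by
      have := hΛ (x - rI I y') (x' - rI I y')
      rwa [sub_sub_sub_cancel_right] at this
    have e : cen P L x (y i) - cen P L x' (y i) = (L (x - rI I (y i)) - L (x' - rI I (y i))) - ∫ y', (L (x - rI I y') - L (x' - rI I y')) ∂P := by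
      unfold cen
      rw [integral_sub (Lsub_int hL hM x) (Lsub_int hL hM x')]; ring
    rw [e]
    refine (norm_sub_le _ _).trans ?_
    have := norm_integral_le_of_norm_le_const (μ := P) (ae_of_all _ hh)
    simp at this
    linarith [hh (y i)]
  refine (Finset.sum_le_sum this).trans (le_of_eq ?_)
  simp; ring

theorem JBound (hf : IsDensity f) (hq : IsDensity q) (hρ : RF ρ) (hL : Measurable L) {M N2 Q Cc : ℝ} (hM : ∀ x, ‖L x‖ ≤ M)
    (hN : 0 < N2) (hL2 : ∫⁻ u, ‖L u‖ₑ ^ 2 ≤ oR N2) (hQ1 : 1 ≤ Q) (hQ : eLpNorm (marginal I q) ⊤ volume ≤ oR Q)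
    {n : ℕ} (hn : 0 < n) (l : ℕ) (hC : 1 ≤ Cc) (hk : (l + 1 : ℝ) * (2 * M) ^ 2 ≤ Cc * n * (4 * Q * N2)) :
    ∫⁻ y : Fin n → Vd d, (∫⁻ x : I → ℝ, ‖∑ i, ρ (cen (dm (conv f q)) L x (y i))‖ₑ ^ (2 * l + 2)) ∂(Measure.pi fun _ => dm (conv f q)) ≤
      oR ((16 * Cc * (n * (l + 1) * (4 * Q * N2))) ^ (l + 1)) := by
  have := law_prob hf hq
  obtain ⟨P, hP⟩ : ∃ P, P = dm (conv f q) := ⟨_, rfl⟩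
  have G1 : ∀ x : I → ℝ, 4 * ∫⁻ y, ‖L (x - rI I y)‖ₑ ^ 2 ∂P ≤ oR (4 * Q * N2) := by
    intro x
    rw [hP, mul_assoc, ENNReal.ofReal_mul pN, ENNReal.ofReal_mul pL]
    refine mul_le_mul' pS ((G_sup hf hq hL x).trans (mul_le_mul' hQ hL2))
  rw [← hP] at this ⊢
  have hM0 : 0 ≤ M := (norm_nonneg _).trans (hM 0)
  obtain ⟨s, hs⟩ : ∃ s, s = 4 * Q * N2 := ⟨_, rfl⟩
  have hs0 : 0 < s := by rw [hs]; positivity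
  rw [← hs] at G1 hk ⊢
  obtain ⟨B, hB⟩ : ∃ B, B = (16 * Cc * (n * (l + 1) * s)) ^ (l + 1) := ⟨_, rfl⟩
  have hB0 : 0 ≤ B := by rw [hB]; positivity
  have key : ∀ x : I → ℝ, ∫⁻ y : Fin n → Vd d, ‖∑ i, ρ (cen P L x (y i))‖ₑ ^ (2 * l + 2) ∂(Measure.pi fun _ => P) ≤
      oR (B / s) * (4 * ∫⁻ y, ‖L (x - rI I y)‖ₑ ^ 2 ∂P) := by
    intro x
    have hfin : 4 * ∫⁻ y, ‖L (x - rI I y)‖ₑ ^ 2 ∂P ≠ ⊤ := ne_top_of_le_ne_top ENNReal.ofReal_ne_top (G1 x)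
    obtain ⟨v, hv⟩ : ∃ v, v = (4 * ∫⁻ y, ‖L (x - rI I y)‖ₑ ^ 2 ∂P).toReal := ⟨_, rfl⟩
    have hv0 : 0 ≤ v := hv ▸ ENNReal.toReal_nonneg
    have hvE : oR v = 4 * ∫⁻ y, ‖L (x - rI I y)‖ₑ ^ 2 ∂P := by rw [hv, ENNReal.ofReal_toReal hfin]
    have hvs : v ≤ s := by rw [← ENNReal.ofReal_le_ofReal_iff hs0.le, hvE]; exact G1 x
    have hm : Measurable (fun y => ρ (cen P L x y)) := (rcen_meas (P := P) (ρ := ρ) hL).comp (measurable_const.prodMk measurable_id)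
    have hvar : ∫ y, ρ (cen P L x y) ^ 2 ∂P ≤ v := by
      refine int_le_of_lint (fun y => sq_nonneg _) hv0 ?_
      rw [hvE]
      refine le_trans (le_of_eq ?_) (rcen_var (P := P) hρ hL x)
      refine lintegral_congr fun y => ?_
      rw [← ofReal_norm, ← ENNReal.ofReal_pow (norm_nonneg _), Real.norm_eq_abs, sq_abs]
    have R := scalRos P hn l hm hs0 (by positivity : 0 ≤ 2 * M) (rcen_bd hρ hM x) (rcen_mean hL hM x) hvar hv0 hvs hC hk
    rw [← hB] at R
    have hSm : Measurable (fun y : Fin n → Vd d => ∑ i, ρ (cen P L x (y i))) :=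
      (Sx_meas (P := P) (ρ := ρ) hL n).comp (measurable_const.prodMk measurable_id)
    have hint : Integrable (fun y : Fin n → Vd d => (∑ i, ρ (cen P L x (y i))) ^ (2 * l + 2)) (Measure.pi fun _ => P) := by
      refine Integrable.of_bound (hSm.pow_const _).aestronglyMeasurable ((n * (2 * M)) ^ (2 * l + 2)) (ae_of_all _ fun y => ?_)
      rw [Real.norm_eq_abs, abs_pow]
      refine pow_le_pow_left₀ (abs_nonneg _) ?_ _
      refine (Finset.abs_sum_le_sum_abs _ _).trans ((Finset.sum_le_sum fun i _ => rcen_bd hρ hM x (y i)).trans ?_)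
      simp
    have ev : ∀ t : ℝ, ‖t‖ₑ ^ (2 * l + 2) = oR (t ^ (2 * l + 2)) := fun t => by
      rw [← ofReal_norm, ← ENNReal.ofReal_pow (norm_nonneg _), Real.norm_eq_abs, Even.pow_abs (by exact ⟨l + 1, by ring⟩)]
    simp only [ev]
    rw [← ofReal_integral_eq_lintegral_ofReal hint (ae_of_all _ fun y => Even.pow_nonneg (by exact ⟨l + 1, by ring⟩) _), ← hvE, ← ENNReal.ofReal_mul pP]
    refine ENNReal.ofReal_le_ofReal (R.trans (le_of_eq ?_))
    ring
  have hSm2 : Measurable (fun z : (Fin n → Vd d) × (I → ℝ) => ‖∑ i, ρ (cen P L z.2 (z.1 i))‖ₑ ^ (2 * l + 2)) :=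
    ((Sx_meas (P := P) (ρ := ρ) hL n).comp measurable_swap).enorm.pow_const _
  rw [lintegral_lintegral_swap hSm2.aemeasurable, ← hB]
  refine (lintegral_mono key).trans ?_
  rw [lintegral_const_mul' _ _ ENNReal.ofReal_ne_top, lintegral_const_mul' _ _ pS, G_int hL]
  calc oR (B / s) * (4 * ∫⁻ u, ‖L u‖ₑ ^ 2) ≤ oR (B / s) * (oR 4 * oR N2) := by
        refine mul_le_mul' le_rfl (mul_le_mul' pS hL2)
    _ = oR (B / Q) := by
        rw [← ENNReal.ofReal_mul pN, ← ENNReal.ofReal_mul pP, hs]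
        congr 1; field_simp
    _ ≤ _ := ENNReal.ofReal_le_ofReal (div_le_self hB0 hQ1)

end
section

variable {d : ℕ} {I : Finset (Fin d)} {K : ℝ → ℝ} {q f : Vd d → ℝ} {L : (I → ℝ) → ℂ} {ρ : ℂ →L[ℝ] ℝ} {lam : Vd d}

theorem grid_top {n : ℕ} (hn : 3 ≤ n) (hl : ∀ j, 0 < lam j) {h : Vd d} (hg : memGrid lam ⊤ n I h) :
    Real.log n ≤ n * PW I h (fun _ => 1) := by
  have H := grid_HU hg
  have h3 := hg.2.2
  have hb : bp ⊤ = 1 / 2 := by unfold bp; norm_num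
  rw [if_pos rfl, hb, PW_eq lam] at h3
  have hV : ∏ j ∈ I, h j = PW I h (fun _ => 1) := by rw [← PW_eq]; simp
  rw [hV] at h3
  have hV0 := PW_pos H.pos (fun _ => (1 : ℝ))
  have h1 : PW I h lam ≤ 1 := by
    refine (PW_anti H (e := fun _ => 0) (fun j => (hl j).le)).trans (le_of_eq ?_)
    simp [PW]
  have hn1 : (1 : ℝ) ≤ n := by exact_mod_cast (by omega : 1 ≤ n)
  have h4 : Real.sqrt (Real.log n) ≤ Real.sqrt (n * PW I h (fun _ => 1)) := by
    rw [Real.sqrt_eq_rpow (n * _)]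
    exact h3.trans (mul_le_of_le_one_right pP h1)
  exact (Real.sqrt_le_sqrt_iff pP).1 h4

theorem xi_top (hf : IsDensity f) (hq : IsDensity q) {h : Vd d} (hL : Measurable (Lh I K q h)) {M Λ : ℝ} (hΛ0 : 0 < Λ) (hM : ∀ x, ‖Lh I K q h x‖ ≤ M)
    (hΛ : ∀ x x', ‖Lh I K q h x - Lh I K q h x'‖ ≤ Λ * ‖x - x'‖) {n : ℕ} (hn : 3 ≤ n) (k R : ℕ) (hR : R = 2 * k + I.card) (hk : 0 < k) {B : ℝ} (hB0 : 0 ≤ B)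
    (hB : ∀ ρ, RF ρ → ∫⁻ y : Fin n → Vd d, (∫⁻ x : I → ℝ, ‖∑ i, ρ (cen (dm (conv f q)) (Lh I K q h) x (y i))‖ₑ ^ (2 * k)) ∂(Measure.pi fun _ => dm (conv f q)) ≤ oR B) :
    ∃ g : (Fin n → Vd d) → ℝ≥0∞, Measurable g ∧ (∀ y, eLpNorm (xiProc I K f q h y) ⊤ volume ≤ g y) ∧
      ∫⁻ y, g y ^ (R : ℝ) ∂obsMeasure d n f q ≤ oR ((2 / n) ^ R * (2 ^ (2 * k) * (2 * n * Λ) ^ I.card * B)) := by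
  have := law_prob hf hq
  have hn0 : (0 : ℝ) < n := by exact_mod_cast (by omega : 0 < n)
  have hR0 : (0 : ℝ) < R := by exact_mod_cast (by omega : 0 < R)
  have hR1 : (1 : ℝ) ≤ R := by exact_mod_cast (by omega : 1 ≤ R)
  obtain ⟨P, hP⟩ : ∃ P, P = dm (conv f q) := ⟨_, rfl⟩
  have hobs : obsMeasure d n f q = Measure.pi fun _ => P := by rw [hP]; rfl
  have hxi : ∀ y x, xiProc I K f q h y x = (n : ℂ)⁻¹ * ∑ k, cen P (Lh I K q h) x (y k) := fun y x => by rw [hP]; exact xi_eq f q h hn y x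
  rw [hobs]
  rw [← hP] at this hB
  obtain ⟨L, hLd⟩ : ∃ L, L = Lh I K q h := ⟨_, rfl⟩
  rw [← hLd] at hL hM hΛ hB hxi
  have hm : ∀ ρ : ℂ →L[ℝ] ℝ, Measurable (fun y : Fin n → Vd d => ∫⁻ x : I → ℝ, ‖∑ i, ρ (cen P L x (y i))‖ₑ ^ (2 * k)) := fun ρ =>
    Measurable.lintegral_prod_right' (f := fun z : (Fin n → Vd d) × (I → ℝ) => ‖∑ i, ρ (cen P L z.2 (z.1 i))‖ₑ ^ (2 * k))
      (((Sx_meas (P := P) (ρ := ρ) hL n).comp measurable_swap).enorm.pow_const _)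
  obtain ⟨J, hJ⟩ : ∃ J : (ℂ →L[ℝ] ℝ) → (Fin n → Vd d) → ℝ≥0∞, J = fun ρ y => ∫⁻ x : I → ℝ, ‖∑ i, ρ (cen P L x (y i))‖ₑ ^ (2 * k) := ⟨_, rfl⟩
  obtain ⟨c, hc⟩ : ∃ c : ℝ, c = 2 ^ (2 * k) * (2 * n * Λ) ^ I.card := ⟨_, rfl⟩
  have hc0 : 0 ≤ c := by rw [hc]; positivity
  have hcE : oR c = 2 ^ (2 * k) * oR (2 * n * Λ) ^ I.card := by
    rw [hc, ENNReal.ofReal_mul pP, ENNReal.ofReal_pow (by norm_num : (0 : ℝ) ≤ 2), ENNReal.ofReal_pow (by positivity : 0 ≤ 2 * n * Λ)]; simp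
  have hJm : ∀ ρ, Measurable (J ρ) := fun ρ => by rw [hJ]; exact hm ρ
  have hJB : ∀ ρ, RF ρ → ∫⁻ y, J ρ y ∂(Measure.pi fun _ => P) ≤ oR B := fun ρ hρ => by rw [hJ]; exact hB ρ hρ
  have hsup : ∀ ρ, RF ρ → ∀ y x, ‖∑ i, ρ (cen P L x (y i))‖ₑ ≤ (oR c * J ρ y) ^ ((R : ℝ)⁻¹) := by
    intro ρ hρ y x
    have := supBall (T := fun x => ∑ i, ρ (cen P L x (y i))) (by positivity : 0 < 2 * n * Λ) (S_lip hρ hL hM hΛ y) (2 * k) x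
    rw [Fintype.card_coe, ← hR, ← hcE] at this
    rw [ENNReal.le_rpow_inv_iff hR0, ENNReal.rpow_natCast, hJ]
    exact this
  refine ⟨fun y => oR (n : ℝ)⁻¹ * ((oR c * J Complex.reCLM y) ^ ((R : ℝ)⁻¹) + (oR c * J Complex.imCLM y) ^ ((R : ℝ)⁻¹)), ?_, ?_, ?_⟩
  · exact ((((hJm _).const_mul _).pow_const _).add (((hJm _).const_mul _).pow_const _)).const_mul _
  · intro y
    rw [eLpNorm_exponent_top]
    refine eLpNormEssSup_le_of_ae_enorm_bound (ae_of_all _ fun x => ?_)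
    rw [hxi, enorm_mul]
    refine mul_le_mul' (le_of_eq ?_) ?_
    · rw [← ofReal_norm, norm_inv]; simp
    refine le_trans ?_ (add_le_add (hsup _ RF_re y x) (hsup _ RF_im y x))
    rw [← map_sum, ← map_sum, ← ofReal_norm, ← ofReal_norm, ← ofReal_norm, ← ENNReal.ofReal_add (norm_nonneg _) (norm_nonneg _)]
    exact ENNReal.ofReal_le_ofReal (Complex.norm_le_abs_re_add_abs_im _)
  · have pt : ∀ y, (oR (n : ℝ)⁻¹ * ((oR c * J Complex.reCLM y) ^ ((R : ℝ)⁻¹) + (oR c * J Complex.imCLM y) ^ ((R : ℝ)⁻¹))) ^ (R : ℝ) ≤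
        oR ((n : ℝ)⁻¹) ^ (R : ℝ) * (2 ^ ((R : ℝ) - 1) * (oR c * J Complex.reCLM y + oR c * J Complex.imCLM y)) := by
      intro y
      rw [ENNReal.mul_rpow_of_nonneg _ _ hR0.le]
      refine mul_le_mul' le_rfl ?_
      refine (ENNReal.rpow_add_le_mul_rpow_add_rpow _ _ hR1).trans (le_of_eq ?_)
      rw [ENNReal.rpow_inv_rpow hR0.ne', ENNReal.rpow_inv_rpow hR0.ne']
    have e2 : (2 : ℝ≥0∞) ^ ((R : ℝ) - 1) * 2 = 2 ^ R := by
      have := ENNReal.rpow_add ((R : ℝ) - 1) 1 (by norm_num : (2 : ℝ≥0∞) ≠ 0) pN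
      rw [sub_add_cancel, ENNReal.rpow_one, ENNReal.rpow_natCast] at this
      exact this.symm
    refine (lintegral_mono pt).trans ?_
    rw [lintegral_const_mul' _ _ pS, lintegral_const_mul' _ _ pS,
      lintegral_add_left ((hJm _).const_mul _), lintegral_const_mul' _ _ pS, lintegral_const_mul' _ _ pS]
    calc _ ≤ oR ((n : ℝ)⁻¹) ^ (R : ℝ) * (2 ^ ((R : ℝ) - 1) * (oR c * oR B + oR c * oR B)) := by
          refine mul_le_mul' le_rfl (mul_le_mul' le_rfl (add_le_add (mul_le_mul' le_rfl (hJB _ RF_re)) (mul_le_mul' le_rfl (hJB _ RF_im))))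
      _ = oR ((2 / n) ^ R * (c * B)) := by
          rw [← two_mul, ← mul_assoc (2 ^ _ : ℝ≥0∞) 2, e2, ENNReal.rpow_natCast,
            ← mul_assoc, ← mul_pow, ← ENNReal.ofReal_mul hc0, ENNReal.ofReal_mul (by positivity : 0 ≤ (2 / (n : ℝ)) ^ R), ENNReal.ofReal_pow pP, div_eq_mul_inv,
            ENNReal.ofReal_mul (by norm_num : (0 : ℝ) ≤ 2), mul_comm (oR 2)]
          simp
      _ = _ := by rw [hc]

end
section

variable {d : ℕ} {I : Finset (Fin d)} {K : ℝ → ℝ} {q : Vd d → ℝ} {lam : Vd d}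

set_option maxHeartbeats 600000 in
theorem core_top (κ : SchwartzMap ℝ ℂ)
    (hκ : eFT κ K)
    (hq : IsDensity q) {A : ℝ} (hG : GB I q A lam) (hQt : eLpNorm (marginal I q) ⊤ volume < ⊤) {r : ℝ} (hr : 1 ≤ r) :
    Core I K q lam ⊤ r := by
  obtain ⟨C0, hC0, hLB⟩ := LBds κ hκ hq hG
  have hlam := hG.2.1
  obtain ⟨C, hC⟩ : ∃ C, C = C0 + 1 := ⟨_, rfl⟩
  have hC1 : 1 ≤ C := by linarith
  have hC01 : C0 ≤ C := by linarith
  obtain ⟨Q, hQd⟩ : ∃ Q, Q = (eLpNorm (marginal I q) ⊤ volume).toReal + 1 := ⟨_, rfl⟩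
  have hQ1 : 1 ≤ Q := by rw [hQd]; linarith [ENNReal.toReal_nonneg (a := eLpNorm (marginal I q) ⊤ volume)]
  have hQ : eLpNorm (marginal I q) ⊤ volume ≤ oR Q := by
    rw [← ENNReal.ofReal_toReal hQt.ne]
    exact ENNReal.ofReal_le_ofReal pL
  obtain ⟨Cc, hCc⟩ : ∃ Cc, Cc = C * (r + 4) := ⟨_, rfl⟩
  have hCc1 : 1 ≤ Cc := by rw [hCc]; nlinarith
  obtain ⟨b1, hb1⟩ : ∃ b1, b1 = ∑ j : I, -(-lam j - 1 / 2) := ⟨_, rfl⟩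
  obtain ⟨b2, hb2⟩ : ∃ b2, b2 = 1 + ∑ j : I, -(-lam j - 2) := ⟨_, rfl⟩
  have hb10 : 0 ≤ b1 := by rw [hb1]; exact Finset.sum_nonneg fun j _ => by have := hlam j; linarith
  have hb20 : 0 ≤ b2 := by
    have : 0 ≤ ∑ j : I, -(-lam j - 2) := Finset.sum_nonneg fun j _ => by have := hlam j; linarith
    rw [hb2]; linarith
  obtain ⟨D, hD⟩ : ∃ D, D = 64 * Cc * (r + 4) * Q * C := ⟨_, rfl⟩
  have hD1 : 1 ≤ D := by
    rw [hD]
    have a1 : 1 ≤ Cc * (r + 4) := by nlinarith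
    have a2 : 1 ≤ Q * C := by nlinarith
    have a3 : 1 ≤ (Cc * (r + 4)) * (Q * C) := by nlinarith
    nlinarith
  obtain ⟨E, hE⟩ : ∃ E, E = 4 * (2 * C) * Real.exp (b2 * I.card) * D := ⟨_, rfl⟩
  have hE1 : 1 ≤ E := by
    rw [hE]
    have a1 : 1 ≤ Real.exp (b2 * I.card) := Real.one_le_exp pP
    have a2 : 1 ≤ 4 * (2 * C) := by linarith
    have a3 : 1 ≤ 4 * (2 * C) * Real.exp (b2 * I.card) := by nlinarith
    nlinarith
  refine ⟨1, b1, E, one_pos, hb10, hE1, ?_⟩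
  intro n hn f hf h hg
  right
  have H := grid_HU hg
  have hh := H.pos
  have hn0 : (0 : ℝ) < n := by exact_mod_cast (by omega : 0 < n)
  have hn1 : (1 : ℝ) ≤ n := by exact_mod_cast (by omega : 1 ≤ n)
  obtain ⟨hl1, l, hj1, hj2⟩ := jch hn hr
  have hl0 : 0 < Real.log n := by linarith
  obtain ⟨Lc, Lb, L2, Llip⟩ := hLB h H
  obtain ⟨PH, hPH⟩ : ∃ PH, PH = PW I h (fun j => -lam j - 1 / 2) := ⟨_, rfl⟩
  have hPH0 : 0 < PH := by rw [hPH]; exact PW_pos hh _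
  have hPH1 : 1 ≤ PH := by
    rw [hPH]
    refine le_trans (le_of_eq ?_) (PW_anti H (e' := fun _ => 0) (fun j => by have := hlam j; linarith))
    simp [PW]
  have hPH2 : PH ^ 2 = PW I h (fun j => -2 * lam j - 1) := by
    rw [← Real.rpow_natCast, hPH, PW_rpow hh]
    congr 1; funext j; push_cast; ring
  obtain ⟨V, hV⟩ : ∃ V, V = PW I h (fun _ => 1) := ⟨_, rfl⟩
  have hV0 : 0 < V := by rw [hV]; exact PW_pos hh _
  have hlogV : Real.log n ≤ n * V := by rw [hV]; exact grid_top hn hlam hg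
  have hPM : PW I h (fun j => -lam j - 1) ^ 2 * V = PH ^ 2 := by
    rw [hPH2, hV, ← Real.rpow_natCast, PW_rpow hh, PW_mul hh]
    congr 1; funext j; push_cast; ring
  have hPM0 : 0 < PW I h (fun j => -lam j - 1) := PW_pos hh _
  obtain ⟨pm, hpm⟩ : ∃ pm, pm = PW I h (fun j => -lam j - 1) := ⟨_, rfl⟩
  rw [← hpm] at hPM hPM0 Lb
  have hPΛ0 : 0 < PW I h (fun j => -lam j - 2) := PW_pos hh _
  have hgΛ := grid_PW hn hg (e := fun j => -lam j - 2) (fun j => by have := hlam j; linarith)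
  have hgU := grid_PW hn hg (e := fun j => -lam j - 1 / 2) (fun j => by have := hlam j; linarith)
  simp only [ENNReal.toReal_top, add_zero, one_mul] at hgΛ hgU
  rw [← hb1, ← hPH] at hgU
  obtain ⟨pl, hpl⟩ : ∃ pl, pl = PW I h (fun j => -lam j - 2) := ⟨_, rfl⟩
  rw [← hpl] at hPΛ0 hgΛ Llip
  obtain ⟨u, hu⟩ : ∃ u, u = (n : ℝ) ^ (-(1 : ℝ) / 2) * Real.sqrt (Real.log n) * PH := ⟨_, rfl⟩
  have hU : Up K q lam ⊤ n I h = oR u := by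
    unfold Up
    rw [if_pos rfl, PW_eq (fun j => -lam j - 1 / 2), hu, hPH]
  have hn2 : ((n : ℝ) ^ (-(1 : ℝ) / 2)) ^ 2 = (n : ℝ)⁻¹ := by
    rw [← Real.rpow_natCast, ← Real.rpow_mul hn0.le, ← Real.rpow_neg_one]; norm_num
  have hu2 : u ^ 2 = (n : ℝ)⁻¹ * Real.log n * PH ^ 2 := by
    rw [hu, mul_pow, mul_pow, hn2, Real.sq_sqrt hl0.le]
  have hu0 : 0 < u := by rw [hu]; have := Real.sqrt_pos.2 hl0; positivity
  have hlogn : Real.log n ≤ n := (Real.log_le_sub_one_of_pos hn0).trans pL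
  have huPH : u ≤ PH := by
    rw [← pow_le_pow_iff_left₀ hu0.le hPH0.le two_ne_zero, hu2]
    refine mul_le_of_le_one_left pP ?_
    rw [inv_mul_le_iff₀ hn0]; linarith
  have hw2 : (n * u) ^ 2 = n * Real.log n * PH ^ 2 := by rw [mul_pow, hu2]; field_simp
  have hw1 : 1 ≤ n * u := by
    rw [← pow_le_pow_iff_left₀ pN pP two_ne_zero, hw2, one_pow]
    exact one_le_mul_of_one_le_of_one_le (one_le_mul_of_one_le_of_one_le hn1 hl1) (one_le_pow₀ hPH1)
  rw [hU]
  constructor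
  · rw [one_mul]
    exact ENNReal.ofReal_le_ofReal (huPH.trans hgU)
  have hlk : (l : ℝ) + 1 ≤ (r + 4) * Real.log n := by linarith
  have hkk : (l + 1 : ℝ) * (2 * (C * pm)) ^ 2 ≤ Cc * n * (4 * Q * (C * PH ^ 2)) := by
    have a1 : (l + 1 : ℝ) ≤ (r + 4) * (n * V) := hlk.trans (mul_le_mul_of_nonneg_left hlogV pL)
    calc (l + 1 : ℝ) * (2 * (C * pm)) ^ 2 ≤ (r + 4) * (n * V) * (2 * (C * pm)) ^ 2 := mul_le_mul_of_nonneg_right a1 pP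
      _ = 4 * C ^ 2 * (r + 4) * n * (pm ^ 2 * V) := by ring
      _ = 4 * C ^ 2 * (r + 4) * n * PH ^ 2 * 1 := by rw [hPM]; ring
      _ ≤ 4 * C ^ 2 * (r + 4) * n * PH ^ 2 * Q := mul_le_mul_of_nonneg_left hQ1 pP
      _ = _ := by rw [hCc]; ring
  have hLb : ∀ x, ‖Lh I K q h x‖ ≤ C * pm := fun x => (Lb x).trans (mul_le_mul_of_nonneg_right hC01 hPM0.le)
  have hL2 : ∫⁻ x, ‖Lh I K q h x‖ₑ ^ 2 ≤ oR (C * PH ^ 2) := by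
    refine L2.trans (ENNReal.ofReal_le_ofReal ?_)
    rw [hPH2]
    exact mul_le_mul_of_nonneg_right hC01 (PW_pos hh _).le
  have hLl : ∀ x x', ‖Lh I K q h x - Lh I K q h x'‖ ≤ C * pl * ‖x - x'‖ := fun x x' =>
    (Llip x x').trans (mul_le_mul_of_nonneg_right (mul_le_mul_of_nonneg_right hC01 hPΛ0.le) (norm_nonneg _))
  obtain ⟨a, ha⟩ : ∃ a, a = 16 * Cc * (n * (l + 1) * (4 * Q * (C * PH ^ 2))) := ⟨_, rfl⟩
  have ha0 : 0 ≤ a := by rw [ha]; positivity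
  have haw : a ≤ D * (n * u) ^ 2 := by
    rw [ha, hw2, hD]
    calc 16 * Cc * (n * (l + 1) * (4 * Q * (C * PH ^ 2))) = (64 * Cc * Q * C * n * PH ^ 2) * (l + 1) := by ring
      _ ≤ (64 * Cc * Q * C * n * PH ^ 2) * ((r + 4) * Real.log n) := mul_le_mul_of_nonneg_left hlk pP
      _ = _ := by ring
  have hJ : ∀ ρ, RF ρ → ∫⁻ y : Fin n → Vd d, (∫⁻ x : I → ℝ, ‖∑ i, ρ (cen (dm (conv f q)) (Lh I K q h) x (y i))‖ₑ ^ (2 * (l + 1))) ∂(Measure.pi fun _ => dm (conv f q)) ≤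
      oR (a ^ (l + 1)) := by
    intro ρ hρ
    rw [ha]
    exact JBound hf hq hρ Lc.measurable hLb pP hL2 hQ1 hQ (by omega) l hCc1 hkk
  obtain ⟨g, gm, gle, gint⟩ := xi_top hf hq Lc.measurable (by positivity : 0 < C * pl) hLb hLl hn (l + 1) (2 * (l + 1) + I.card) rfl (by omega) (pow_nonneg ha0 (l + 1)) hJ
  have hRl : r + Real.log n ≤ ((2 * (l + 1) + I.card : ℕ) : ℝ) := by
    push_cast
    have : (0 : ℝ) ≤ I.card := by positivity
    have : (0 : ℝ) ≤ l := by positivity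
    linarith
  refine ⟨((2 * (l + 1) + I.card : ℕ) : ℝ), hRl, g, gm, gle, gint.trans ?_⟩
  have hΛb : 2 * n * (C * pl) ≤ 2 * C * Real.exp (b2 * Real.log n) := by
    have e : Real.exp (b2 * Real.log n) = n * (n : ℝ) ^ (∑ j : I, -(-lam j - 2)) := by
      rw [mul_comm, ← Real.rpow_def_of_pos hn0, hb2, Real.rpow_add hn0, Real.rpow_one]
    rw [e]
    calc 2 * n * (C * pl) = 2 * C * n * pl := by ring
      _ ≤ 2 * C * n * (n : ℝ) ^ (∑ j : I, -(-lam j - 2)) := mul_le_mul_of_nonneg_left hgΛ pP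
      _ = _ := by ring
  have fin := topNum (m := I.card) (k := l + 1) hn0 (by linarith : 1 ≤ 2 * C) hb20 hD1 hw1 rfl (by linarith : Real.log n ≤ ((2 * (l + 1) + I.card : ℕ) : ℝ)) pP hΛb ha0 haw
  rw [ENNReal.rpow_natCast]
  refine le_trans (ENNReal.ofReal_le_ofReal fin) ?_
  rw [← hE, mul_div_cancel_left₀ _ hn0.ne', ENNReal.ofReal_pow pP, ENNReal.ofReal_mul pP]
  exact pow_le_pow_left' (mul_le_mul' le_rfl le_self_add) _

end

/-- **Proposition 2**: for `p ∈ (1,∞]`, under Assumptions (N1)-(N2), for each `r ≥ 1`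
there are constants `γ_{p,I}(r) > 0` and `c_p(r) > 0`, not depending on `n`, such that
for every `n ≥ 3`,
`{E sup_{h_I ∈ H_{p,I}} [‖ξ_{h_I}‖_p - γ_{p,I}(r) U_p(h_I)]_+^r}^{1/r} ≤ c_p(r) n^{-1/2}`
(the positive part is realized by truncated subtraction in `ℝ≥0∞`). -/
theorem statement5 (d : ℕ) (I : Finset (Fin d)) (hI : I.Nonempty)
    (K : ℝ → ℝ) (hK : IsKernel K) (q : (Fin d → ℝ) → ℝ) (hq : IsDensity q)
    (A : ℝ) (lam : Fin d → ℝ) (p : ℝ≥0∞) (hp : 1 < p)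
    (hN : N1N2 p I q A lam) (r : ℝ) (hr : 1 ≤ r) :
    ∃ γ c : ℝ≥0∞, 0 < γ ∧ γ ≠ ⊤ ∧ 0 < c ∧ c ≠ ⊤ ∧
      ∀ n : ℕ, 3 ≤ n → ∀ f : (Fin d → ℝ) → ℝ, IsDensity f →
        (∫⁻ y, (⨆ h ∈ {h : Fin d → ℝ | memGrid lam p n I h},
            (eLpNorm (xiProc I K f q h y) p volume - γ * Up K q lam p n I h)) ^ r
          ∂obsMeasure d n f q) ^ (1 / r) ≤
        c * ENNReal.ofReal ((n : ℝ) ^ (-(1 : ℝ) / 2)) := by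
  refine assemble hq hr ?_
  obtain ⟨κ, hκ⟩ := kap_exists hK
  have hG := hN.gb hI
  obtain ⟨hA, hl, h2, hgt, hmid, hinf⟩ := hN
  by_cases hT : p = ⊤
  · subst hT
    exact core_top κ hκ hq hG (hgt (by simp)) hr
  obtain ⟨s, rfl⟩ : ∃ s : ℝ, p = ENNReal.ofReal s := ⟨p.toReal, (ENNReal.ofReal_toReal hT).symm⟩
  have hs : 1 < s := by
    rw [← ENNReal.ofReal_one] at hp
    exact (ENNReal.ofReal_lt_ofReal_iff_of_nonneg zero_le_one).1 hp
  have e2 : (2 : ℝ≥0∞) = ENNReal.ofReal 2 := by simp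
  rcases lt_trichotomy s 2 with h | h | h
  · have hne : ENNReal.ofReal s ≠ 2 := by
      rw [e2]; exact ((ENNReal.ofReal_lt_ofReal_iff (by norm_num)).2 h).ne
    exact core_lt hs h κ hκ hq hG (PB_of κ hκ hq hG hA (hmid hne hT) hs) hr
  · subst h
    exact core_two hI κ hκ hq hG (h2 e2.symm).1 hr
  · have hlt : 2 < ENNReal.ofReal s := by
      rw [e2]; exact (ENNReal.ofReal_lt_ofReal_iff (by linarith)).2 h
    refine core_gt hI h κ hκ hq hG (hgt hlt) (PB_of κ hκ hq hG hA (hmid hlt.ne' hT) ?_) hr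
    rw [lt_div_iff₀ (by linarith)]; linarith

end Deconv
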